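/- Let p ≥ 2 be an integer and T > 0. Let a_p : [0,T] × ℝ → ℝ be continuous in t, smooth in ξ, with |∂_ξ^α a_p(t,ξ)| ≤ C_α·⟨ξ⟩^{p−α} for all t, ξ, α, and suppose there exist C_p > 0 and R > 1 such that |∂_ξ a_p(t,ξ)| ≥ C_p·|ξ|^{p−1} for all t ∈ [0,T] and |ξ| ≥ R, with sgn(∂_ξ a_p(t,ξ)) independent of t for |ξ| ≥ R. For 0 ≤ j ≤ p−1 let a_j : [0,T] × ℝ × ℝ → ℂ be continuous in t, smooth in (x,ξ), with |∂_ξ^α ∂_x^β a_j(t,x,ξ)| ≤ C_{αβ}·⟨ξ⟩^{j−α}·⟨x⟩^{−j/(p−1)−β} for all t, x, ξ, α, β. Then there exist h ≥ 1, positive constants M_{p−1}, …, M_1, and real-valued smooth functions λ_{p−1}, …, λ_1 on ℝ² — given by λ_{p−1}(x,ξ) = M_{p−1}·ω(ξ/h)·∫₀ˣ ⟨y⟩^{−1} dy and, for 2 ≤ k ≤ p−1, λ_{p−k}(x,ξ) = M_{p−k}·ω(ξ/h)·⟨ξ⟩_h^{−k+1}·∫₀ˣ ⟨y⟩^{−(p−k)/(p−1)}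 ψ(⟨y⟩/⟨ξ⟩_h^{p−1}) dy, where ω ∈ C^∞(ℝ) with |ω| ≤ 1, ω = 0 on {|ξ| ≤ 1}, ω(ξ) = sgn(∂_ξ a_p(t,ξ)) for |ξ| ≥ R, and ψ ∈ C₀^∞(ℝ), 0 ≤ ψ ≤ 1, ψ = 1 on {|y| ≤ 1/2}, ψ = 0 on {|y| ≥ 1} — such that each operator e^{λ_{p−k}}(x,D) (1 ≤ k ≤ p−1) is a bijection of 𝒮(ℝ) onto itself and, writing A(t) := i·a_p(t,D_x) + Σ_{j=0}^{p−1} i·a_j(t,x,D_x), the conjugated operator A_λ(t) := (e^{λ_1}(x,D))^{−1} ⋯ (e^{λ_{p−1}}(x,D))^{−1} ∘ A(t) ∘ e^{λ_{p−1}}(x,D) ⋯ e^{λ_1}(x,D) on 𝒮(ℝ) decomposes as A_λ(t) = i·a_p(t,D_x) + Σ_{ℓ=1}^{p−1} Q_{p−ℓ}(t,x,D_x) + r₀(t,x,D_x), where for each ℓ the symbol Q_{p−ℓ}(t,·,·) belongs to SG^{p−ℓ,0}(ℝ²) with seminorm bounds uniform in t and satisfies Re⟨Q_{p−ℓ}(t,x,D_x)v,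 v⟩_{L²(ℝ)} ≥ 0 for every v ∈ 𝒮(ℝ) and t ∈ [0,T], and r₀(t,·,·) belongs to S⁰(ℝ²) with bounds uniform in t. -/

import Mathlib

open MeasureTheory Real

noncomputable section

/-- The Japanese bracket `⟨x⟩ = (1 + x²)^(1/2)`. -/
def jb (x : ℝ) : ℝ := Real.sqrt (1 + x ^ 2)

/-- `⟨ξ⟩ₕ = (h² + ξ²)^(1/2)`. -/
def jbh (h ξ : ℝ) : ℝ := Real.sqrt (h ^ 2 + ξ ^ 2)

/-- The pseudo-differential operator
`a(x,D)u(x) = (2π)⁻¹ ∫ e^{ixξ} a(x,ξ) û(ξ) dξ`, with `û(ξ) = ∫ e^{-iyξ} u(y) dy`. -/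
def psdo1 (a : ℝ → ℝ → ℂ) (u : ℝ → ℂ) (x : ℝ) : ℂ :=
  (((2 * Real.pi)⁻¹ : ℝ) : ℂ) *
    ∫ ξ : ℝ, Complex.exp (Complex.I * (x:ℂ) * (ξ:ℂ)) * a x ξ *
      ∫ y : ℝ, Complex.exp (-Complex.I * (y:ℂ) * (ξ:ℂ)) * u y

/-- The symbol `λ_{p-k}(x,ξ)`, `k = 1, …, p-1`:
`λ_{p-1}(x,ξ) = M_{p-1}·ω(ξ/h)·∫₀ˣ ⟨y⟩⁻¹ dy` (case `k = 1`) and, for `2 ≤ k ≤ p-1`,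
`λ_{p-k}(x,ξ) = M_{p-k}·ω(ξ/h)·⟨ξ⟩ₕ^{-k+1}·∫₀ˣ ⟨y⟩^{-(p-k)/(p-1)} ψ(⟨y⟩/⟨ξ⟩ₕ^{p-1}) dy`.
Here `Mc k` stands for the constant `M_{p-k}`. -/
def lamSym (p : ℕ) (Mc : ℕ → ℝ) (ω ψ : ℝ → ℝ) (h : ℝ) (k : ℕ) (x ξ : ℝ) : ℝ :=
  if k = 1 then Mc 1 * ω (ξ / h) * ∫ y in (0:ℝ)..x, (jb y)⁻¹
  else Mc k * ω (ξ / h) * jbh h ξ ^ (-(k : ℝ) + 1) *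
    ∫ y in (0:ℝ)..x,
      jb y ^ (-(((p : ℝ) - k) / ((p : ℝ) - 1))) * ψ (jb y / jbh h ξ ^ ((p : ℝ) - 1))

/-- `compFwd E n = E 1 ∘ E 2 ∘ ⋯ ∘ E n` (identity when `n = 0`). -/
def compFwd (E : ℕ → SchwartzMap ℝ ℂ → SchwartzMap ℝ ℂ) :
    ℕ → SchwartzMap ℝ ℂ → SchwartzMap ℝ ℂ
  | 0 => id
  | n + 1 => compFwd E n ∘ E (n + 1)

/-- `compBwd E n = E n ∘ E (n-1) ∘ ⋯ ∘ E 1` (identity when `n = 0`). -/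
def compBwd (E : ℕ → SchwartzMap ℝ ℂ → SchwartzMap ℝ ℂ) :
    ℕ → SchwartzMap ℝ ℂ → SchwartzMap ℝ ℂ
  | 0 => id
  | n + 1 => E (n + 1) ∘ compBwd E n

variable {ι : Type}

/-! ### The Japanese bracket -/

lemma jb_pos (x : ℝ) : 0 < jb x := Real.sqrt_pos.2 (by positivity)

lemma one_le_jb (x : ℝ) : 1 ≤ jb x := Real.one_le_sqrt.2 (by nlinarith [sq_nonneg x])

lemma jb_sq (x : ℝ) : jb x ^ 2 = 1 + x ^ 2 := Real.sq_sqrt (by positivity)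

lemma abs_le_jb (x : ℝ) : |x| ≤ jb x := Real.abs_le_sqrt (by linarith)

lemma jb_le (x : ℝ) : jb x ≤ 1 + |x| := by
  have h1 := jb_sq x
  have h2 := jb_pos x
  nlinarith [abs_nonneg x, sq_abs x]

lemma continuous_jb : Continuous jb := by
  unfold jb; fun_prop

lemma jb_neg (x : ℝ) : jb (-x) = jb x := by simp [jb]

lemma continuous_jb_rpow (s : ℝ) : Continuous fun x => jb x ^ s :=
  continuous_jb.rpow_const fun x => Or.inl (jb_pos x).ne'

lemma jb_rpow_pos (x s : ℝ) : 0 < jb x ^ s := Real.rpow_pos_of_pos (jb_pos x) s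

lemma jb_rpow_mono (x : ℝ) {s t : ℝ} (h : s ≤ t) : jb x ^ s ≤ jb x ^ t :=
  Real.rpow_le_rpow_of_exponent_le (one_le_jb x) h

lemma jb_rpow_add (x s t : ℝ) : jb x ^ (s + t) = jb x ^ s * jb x ^ t :=
  Real.rpow_add (jb_pos x) s t

lemma jb_rpow_le_one (x : ℝ) {s : ℝ} (h : s ≤ 0) : jb x ^ s ≤ 1 :=
  Real.rpow_le_one_of_one_le_of_nonpos (one_le_jb x) h

lemma jb_add_le (x y : ℝ) : jb (x + y) ≤ 2 * jb x * jb y := by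
  have h1 := jb_sq (x + y)
  have h2 := jb_sq x
  have h3 := jb_sq y
  have : jb (x + y) ^ 2 ≤ (2 * jb x * jb y) ^ 2 := by
    rw [mul_pow, mul_pow, h1, h2, h3]
    nlinarith [sq_nonneg (x - y), mul_nonneg (sq_nonneg x) (sq_nonneg y), sq_nonneg x, sq_nonneg y]
  exact le_of_sq_le_sq this (by have := jb_pos x; have := jb_pos y; positivity)
where
  le_of_sq_le_sq {a b : ℝ} (h : a ^ 2 ≤ b ^ 2) (hb : 0 ≤ b) : a ≤ b :=
    (le_abs_self a).trans ((sq_le_sq.1 h).trans_eq (abs_of_nonneg hb))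

/-- Peetre's inequality. -/
lemma peetre (s x y : ℝ) : jb (x + y) ^ s ≤ 2 ^ |s| * jb x ^ s * jb y ^ |s| := by
  have hx := jb_pos x
  have hy := jb_pos y
  have hxy := jb_pos (x + y)
  rcases le_or_gt 0 s with hs | hs
  · rw [abs_of_nonneg hs, ← Real.mul_rpow (by norm_num) hx.le,
      ← Real.mul_rpow (by positivity) hy.le]
    exact Real.rpow_le_rpow hxy.le (jb_add_le x y) hs
  · rw [abs_of_neg hs]
    have h : jb x ≤ 2 * jb (x + y) * jb y := by
      have := jb_add_le (x + y) (-y)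
      rwa [add_neg_cancel_right, jb_neg] at this
    have h2 : (2 * jb (x + y) * jb y) ^ s ≤ jb x ^ s :=
      Real.rpow_le_rpow_of_nonpos hx h hs.le
    rw [Real.mul_rpow (by positivity) hy.le, Real.mul_rpow (by norm_num) hxy.le] at h2
    have e1 : (2:ℝ) ^ (-s) * 2 ^ s = 1 := by
      rw [← Real.rpow_add (by norm_num)]; simp
    have e2 : jb y ^ (-s) * jb y ^ s = 1 := by
      rw [← jb_rpow_add]; simp
    calc jb (x + y) ^ s = 2 ^ (-s) * (2 ^ s * jb (x + y) ^ s * jb y ^ s) * jb y ^ (-s) := by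
          linear_combination (-(jb (x + y) ^ s) * (jb y ^ (-s) * jb y ^ s)) * e1 -
            jb (x + y) ^ s * e2
      _ ≤ _ := by gcongr

/-! ### Symbols and their seminorm classes -/

/-- Partial derivative of a symbol in `x`. -/
def dX (a : ℝ → ℝ → ℂ) : ℝ → ℝ → ℂ := fun x ξ => deriv (fun x' => a x' ξ) x

/-- Partial derivative of a symbol in `ξ`. -/
def dXi (a : ℝ → ℝ → ℂ) : ℝ → ℝ → ℂ := fun x ξ => deriv (fun ξ' => a x ξ') ξ

/-- Joint smoothness of a symbol. -/
def SmoothSym (a : ℝ → ℝ → ℂ) : Prop := ContDiff ℝ (⊤ : ℕ∞) (fun q : ℝ × ℝ => a q.1 q.2)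


/-- Uniform weighted sup bound for a family of symbols. -/
def BddW (m₁ m₂ : ℝ) (a : ι → ℝ → ℝ → ℂ) : Prop :=
  ∃ C, 0 ≤ C ∧ ∀ i x ξ, ‖a i x ξ‖ ≤ C * jb ξ ^ m₁ * jb x ^ m₂

/-- Weighted bounds for all derivatives up to order `n`; every derivative gains `γ`. -/
def SGn (γ : ℝ) : ℕ → ℝ → ℝ → (ι → ℝ → ℝ → ℂ) → Prop
  | 0, m₁, m₂, a => BddW m₁ m₂ a
  | n + 1, m₁, m₂, a => BddW m₁ m₂ a ∧ SGn γ n (m₁ - γ) m₂ (fun i => dXi (a i)) ∧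
      SGn γ n m₁ (m₂ - γ) (fun i => dX (a i))

/-- Families of symbols of order `(m₁, m₂)` uniformly in the index; `γ = 1` is the `SG` class,
`γ = 0` the class without gain. -/
def SG (γ m₁ m₂ : ℝ) (a : ι → ℝ → ℝ → ℂ) : Prop :=
  (∀ i, SmoothSym (a i)) ∧ ∀ n, SGn γ n m₁ m₂ a

lemma SmoothSym.hasDerivAt_x {a : ℝ → ℝ → ℂ} (h : SmoothSym a) (x ξ : ℝ) :
    HasDerivAt (fun x' => a x' ξ) (dX a x ξ) x := by
  have : ContDiff ℝ (⊤ : ℕ∞) (fun x' => a x' ξ) :=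
    ContDiff.comp (g := fun q : ℝ × ℝ => a q.1 q.2) h (contDiff_id.prodMk contDiff_const)
  exact ((this.differentiable (by simp)) x).hasDerivAt

lemma SmoothSym.hasDerivAt_xi {a : ℝ → ℝ → ℂ} (h : SmoothSym a) (x ξ : ℝ) :
    HasDerivAt (fun ξ' => a x ξ') (dXi a x ξ) ξ := by
  have : ContDiff ℝ (⊤ : ℕ∞) (fun ξ' => a x ξ') :=
    ContDiff.comp (g := fun q : ℝ × ℝ => a q.1 q.2) h (contDiff_const.prodMk contDiff_id)
  exact ((this.differentiable (by simp)) ξ).hasDerivAt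

lemma SmoothSym.dX_eq {a : ℝ → ℝ → ℂ} (h : SmoothSym a) (x ξ : ℝ) :
    dX a x ξ = fderiv ℝ (fun q : ℝ × ℝ => a q.1 q.2) (x, ξ) (1, 0) := by
  have h1 : HasFDerivAt (fun q : ℝ × ℝ => a q.1 q.2)
    (fderiv ℝ (fun q : ℝ × ℝ => a q.1 q.2) (x, ξ)) (x, ξ) :=
    (ContDiff.differentiable h (by simp) _).hasFDerivAt
  have h2 : HasDerivAt (fun x' : ℝ => (x', ξ)) ((1 : ℝ), (0 : ℝ)) x :=
    (hasDerivAt_id x).prodMk (hasDerivAt_const x ξ)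
  exact (h1.comp_hasDerivAt x h2).deriv

lemma SmoothSym.dXi_eq {a : ℝ → ℝ → ℂ} (h : SmoothSym a) (x ξ : ℝ) :
    dXi a x ξ = fderiv ℝ (fun q : ℝ × ℝ => a q.1 q.2) (x, ξ) (0, 1) := by
  have h1 : HasFDerivAt (fun q : ℝ × ℝ => a q.1 q.2)
    (fderiv ℝ (fun q : ℝ × ℝ => a q.1 q.2) (x, ξ)) (x, ξ) :=
    (ContDiff.differentiable h (by simp) _).hasFDerivAt
  have h2 : HasDerivAt (fun ξ' : ℝ => (x, ξ')) ((0 : ℝ), (1 : ℝ)) ξ :=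
    (hasDerivAt_const ξ x).prodMk (hasDerivAt_id ξ)
  exact (h1.comp_hasDerivAt ξ h2).deriv

lemma SmoothSym.dX {a : ℝ → ℝ → ℂ} (h : SmoothSym a) : SmoothSym (dX a) := by
  have h1 : (fun q : ℝ × ℝ => _root_.dX a q.1 q.2) =
      fun q => fderiv ℝ (fun q : ℝ × ℝ => a q.1 q.2) q (1, 0) := by
    ext q; exact h.dX_eq q.1 q.2
  unfold SmoothSym; rw [h1]
  exact (ContDiff.fderiv_right (m := (⊤ : ℕ∞)) h (by simp)).clm_apply contDiff_const

lemma SmoothSym.dXi {a : ℝ → ℝ → ℂ} (h : SmoothSym a) : SmoothSym (dXi a) := by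
  have h1 : (fun q : ℝ × ℝ => _root_.dXi a q.1 q.2) =
      fun q => fderiv ℝ (fun q : ℝ × ℝ => a q.1 q.2) q (0, 1) := by
    ext q; exact h.dXi_eq q.1 q.2
  unfold SmoothSym; rw [h1]
  exact (ContDiff.fderiv_right (m := (⊤ : ℕ∞)) h (by simp)).clm_apply contDiff_const

lemma SmoothSym.dX_dXi {a : ℝ → ℝ → ℂ} (h : SmoothSym a) :
    _root_.dX (_root_.dXi a) = _root_.dXi (_root_.dX a) := by
  ext x ξ
  set f := fun q : ℝ × ℝ => a q.1 q.2
  have hf2 : ContDiff ℝ (⊤ : ℕ∞) (fderiv ℝ f) := ContDiff.fderiv_right (m := (⊤ : ℕ∞)) h (by simp)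
  have key : ∀ v w : ℝ × ℝ, fderiv ℝ (fun q => fderiv ℝ f q v) (x, ξ) w =
      fderiv ℝ (fderiv ℝ f) (x, ξ) w v := by
    intro v w
    have := ((hf2.differentiable (by simp) (x, ξ)).hasFDerivAt.clm_apply
      (hasFDerivAt_const v (x, ξ))).fderiv
    rw [this]; simp
  have e1 : (fun q : ℝ × ℝ => _root_.dXi a q.1 q.2) = fun q => fderiv ℝ f q (0, 1) := by
    ext q; exact h.dXi_eq q.1 q.2
  have e2 : (fun q : ℝ × ℝ => _root_.dX a q.1 q.2) = fun q => fderiv ℝ f q (1, 0) := by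
    ext q; exact h.dX_eq q.1 q.2
  rw [h.dXi.dX_eq, h.dX.dXi_eq, e1, e2, key, key]
  exact (ContDiff.contDiffAt h).isSymmSndFDerivAt
    (by simp only [minSmoothness_of_isRCLikeNormedField]; exact WithTop.coe_le_coe.2 (le_top : (2 : ℕ∞) ≤ ⊤)) _ _

lemma SmoothSym.continuous {a : ℝ → ℝ → ℂ} (h : SmoothSym a) :
    Continuous (fun q : ℝ × ℝ => a q.1 q.2) := ContDiff.continuous h

lemma SmoothSym.continuous_xi {a : ℝ → ℝ → ℂ} (h : SmoothSym a) (x : ℝ) :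
    Continuous (fun ξ => a x ξ) := h.continuous.comp (by fun_prop : Continuous fun ξ : ℝ => (x, ξ))

lemma SmoothSym.continuous_x {a : ℝ → ℝ → ℂ} (h : SmoothSym a) (ξ : ℝ) :
    Continuous (fun x => a x ξ) := h.continuous.comp (by fun_prop : Continuous fun x : ℝ => (x, ξ))

lemma BddW.mono {m₁ m₂ m₁' m₂' : ℝ} {a : ι → ℝ → ℝ → ℂ} (h : BddW m₁ m₂ a)
    (h₁ : m₁ ≤ m₁') (h₂ : m₂ ≤ m₂') : BddW m₁' m₂' a := by
  obtain ⟨C, hC, h⟩ := h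
  refine ⟨C, hC, fun i x ξ => (h i x ξ).trans ?_⟩
  have := jb_rpow_pos x m₂
  have := jb_rpow_pos ξ m₁
  exact mul_le_mul (mul_le_mul_of_nonneg_left (jb_rpow_mono ξ h₁) hC) (jb_rpow_mono x h₂)
    (by positivity) (mul_nonneg hC (jb_rpow_pos _ _).le)

lemma BddW.add {m₁ m₂ : ℝ} {a b : ι → ℝ → ℝ → ℂ} (ha : BddW m₁ m₂ a) (hb : BddW m₁ m₂ b) :
    BddW m₁ m₂ (fun i x ξ => a i x ξ + b i x ξ) := by
  obtain ⟨C, hC, ha⟩ := ha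
  obtain ⟨D, hD, hb⟩ := hb
  refine ⟨C + D, by positivity, fun i x ξ => (norm_add_le _ _).trans ?_⟩
  have := ha i x ξ
  have := hb i x ξ
  nlinarith

lemma BddW.mul {m₁ m₂ n₁ n₂ : ℝ} {a b : ι → ℝ → ℝ → ℂ} (ha : BddW m₁ m₂ a) (hb : BddW n₁ n₂ b) :
    BddW (m₁ + n₁) (m₂ + n₂) (fun i x ξ => a i x ξ * b i x ξ) := by
  obtain ⟨C, hC, ha⟩ := ha
  obtain ⟨D, hD, hb⟩ := hb
  refine ⟨C * D, by positivity, fun i x ξ => ?_⟩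
  rw [norm_mul, jb_rpow_add, jb_rpow_add]
  calc ‖a i x ξ‖ * ‖b i x ξ‖ ≤ (C * jb ξ ^ m₁ * jb x ^ m₂) * (D * jb ξ ^ n₁ * jb x ^ n₂) :=
        mul_le_mul (ha i x ξ) (hb i x ξ) (norm_nonneg _) ((norm_nonneg _).trans (ha i x ξ))
    _ = _ := by ring

lemma continuous_of_hasDerivAt_of_bddW {m₁ m₂ : ℝ} {a b c : ℝ → ℝ → ℂ}
    (hx : ∀ x ξ, HasDerivAt (fun x' => a x' ξ) (b x ξ) x)
    (hξ : ∀ x ξ, HasDerivAt (fun ξ' => a x ξ') (c x ξ) ξ)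
    {C : ℝ} (hb : ∀ x ξ, ‖b x ξ‖ ≤ C * jb ξ ^ m₁ * jb x ^ m₂) :
    Continuous (fun q : ℝ × ℝ => a q.1 q.2) := by
  have hcont : Continuous fun q : ℝ × ℝ => C * jb q.2 ^ m₁ * jb q.1 ^ m₂ :=
    (continuous_const.mul ((continuous_jb_rpow m₁).comp continuous_snd)).mul
      ((continuous_jb_rpow m₂).comp continuous_fst)
  rw [continuous_iff_continuousAt]
  rintro ⟨x₀, ξ₀⟩
  obtain ⟨M, hM⟩ := ((isCompact_closedBall x₀ 1).prod
    (isCompact_closedBall ξ₀ 1)).exists_bound_of_continuousOn hcont.continuousOn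
  have hlip : ∀ x ∈ Metric.closedBall x₀ 1, ∀ ξ ∈ Metric.closedBall ξ₀ 1,
      ‖a x ξ - a x₀ ξ‖ ≤ M * ‖x - x₀‖ := by
    intro x hx' ξ hξ'
    refine Convex.norm_image_sub_le_of_norm_hasDerivWithin_le (f' := fun x => b x ξ)
      (s := Metric.closedBall x₀ 1) (fun y _ => (hx y ξ).hasDerivWithinAt) (fun y hy => ?_)
      (convex_closedBall x₀ 1) (Metric.mem_closedBall_self zero_le_one) hx'
    exact (hb y ξ).trans ((le_abs_self _).trans (hM (y, ξ) ⟨hy, hξ'⟩))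
  have hlim : Filter.Tendsto (fun q : ℝ × ℝ => M * ‖q.1 - x₀‖ + ‖a x₀ q.2 - a x₀ ξ₀‖)
      (nhds (x₀, ξ₀)) (nhds 0) := by
    have hc : ContinuousAt (fun q : ℝ × ℝ => a x₀ q.2) (x₀, ξ₀) :=
      ContinuousAt.comp (f := Prod.snd) (g := fun ξ => a x₀ ξ) (hξ x₀ ξ₀).continuousAt
        continuousAt_snd
    have : ContinuousAt (fun q : ℝ × ℝ => M * ‖q.1 - x₀‖ + ‖a x₀ q.2 - a x₀ ξ₀‖) (x₀, ξ₀) := by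
      exact ((continuous_const.mul
        (continuous_fst.sub continuous_const).norm).continuousAt).add
        (hc.sub continuousAt_const).norm
    simpa [ContinuousAt] using this
  rw [ContinuousAt, tendsto_iff_norm_sub_tendsto_zero]
  refine squeeze_zero' (Filter.Eventually.of_forall fun _ => norm_nonneg _) ?_ hlim
  have : Metric.closedBall x₀ 1 ×ˢ Metric.closedBall ξ₀ 1 ∈ nhds (x₀, ξ₀) :=
    prod_mem_nhds (Metric.closedBall_mem_nhds _ one_pos) (Metric.closedBall_mem_nhds _ one_pos)
  filter_upwards [this] with q hq
  calc ‖a q.1 q.2 - a x₀ ξ₀‖ = ‖(a q.1 q.2 - a x₀ q.2) + (a x₀ q.2 - a x₀ ξ₀)‖ := by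
        congr 1; ring
    _ ≤ _ := (norm_add_le _ _).trans (add_le_add (hlip _ hq.1 _ hq.2) le_rfl)

lemma hasFDerivAt_of_partials {a b c : ℝ → ℝ → ℂ}
    (hx : ∀ x ξ, HasDerivAt (fun x' => a x' ξ) (b x ξ) x)
    (hξ : ∀ x ξ, HasDerivAt (fun ξ' => a x ξ') (c x ξ) ξ)
    (hb : Continuous (fun q : ℝ × ℝ => b q.1 q.2)) (hc : Continuous (fun q : ℝ × ℝ => c q.1 q.2))
    (q : ℝ × ℝ) :
    HasFDerivAt (fun q : ℝ × ℝ => a q.1 q.2)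
      ((ContinuousLinearMap.fst ℝ ℝ ℝ).smulRight (b q.1 q.2) +
        (ContinuousLinearMap.snd ℝ ℝ ℝ).smulRight (c q.1 q.2)) q := by
  have := hasStrictFDerivAt_uncurry_coprod (𝕜 := ℝ) (u := q) (f := a)
    (f₁ := fun x ξ => ContinuousLinearMap.toSpanSingleton ℝ (b x ξ))
    (f₂ := fun x ξ => ContinuousLinearMap.toSpanSingleton ℝ (c x ξ))
    (Filter.Eventually.of_forall fun v => (hx v.1 v.2).hasFDerivAt)
    (Filter.Eventually.of_forall fun v => (hξ v.1 v.2).hasFDerivAt)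
    (((ContinuousLinearMap.toSpanSingletonCLE (𝕜 := ℝ) (E := ℂ)).continuous.comp hb).continuousAt)
    (((ContinuousLinearMap.toSpanSingletonCLE (𝕜 := ℝ) (E := ℂ)).continuous.comp hc).continuousAt)
  refine this.hasFDerivAt.congr_fderiv ?_
  ext <;> simp [Function.HasUncurry.uncurry]

lemma hasDerivAt_dX {a b : ℝ → ℝ → ℂ}
    (hx : ∀ x ξ, HasDerivAt (fun x' => a x' ξ) (b x ξ) x) : dX a = b := by
  ext x ξ; exact (hx x ξ).deriv

lemma hasDerivAt_dXi {a b : ℝ → ℝ → ℂ}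
    (hx : ∀ x ξ, HasDerivAt (fun ξ' => a x ξ') (b x ξ) ξ) : dXi a = b := by
  ext x ξ; exact (hx x ξ).deriv

/-- A class of weighted-bounded families closed under partial derivatives consists of symbols. -/
theorem SG.of_closed_class {γ : ℝ} (P : ℝ → ℝ → (ι → ℝ → ℝ → ℂ) → Prop)
    (hb : ∀ m₁ m₂ a, P m₁ m₂ a → BddW m₁ m₂ a)
    (hξ : ∀ m₁ m₂ a, P m₁ m₂ a → ∃ b, P (m₁ - γ) m₂ b ∧
      ∀ i x ξ, HasDerivAt (fun ξ' => a i x ξ') (b i x ξ) ξ)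
    (hx : ∀ m₁ m₂ a, P m₁ m₂ a → ∃ b, P m₁ (m₂ - γ) b ∧
      ∀ i x ξ, HasDerivAt (fun x' => a i x' ξ) (b i x ξ) x)
    {m₁ m₂ : ℝ} {a : ι → ℝ → ℝ → ℂ} (ha : P m₁ m₂ a) : SG γ m₁ m₂ a := by
  have hcont : ∀ m₁ m₂ a, P m₁ m₂ a → ∀ i, Continuous (fun q : ℝ × ℝ => a i q.1 q.2) := by
    intro m₁ m₂ a ha i
    obtain ⟨b, hb1, hb2⟩ := hξ _ _ _ ha
    obtain ⟨c, hc1, hc2⟩ := hx _ _ _ ha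
    obtain ⟨C, -, hC⟩ := hb _ _ _ hc1
    exact continuous_of_hasDerivAt_of_bddW (hc2 i) (hb2 i) (hC i)
  have hsm : ∀ n : ℕ, ∀ m₁ m₂ a, P m₁ m₂ a → ∀ i,
      ContDiff ℝ n (fun q : ℝ × ℝ => a i q.1 q.2) := by
    intro n
    induction n with
    | zero => intro m₁ m₂ a ha i; exact contDiff_zero.2 (hcont _ _ _ ha i)
    | succ n ih =>
      intro m₁ m₂ a ha i
      obtain ⟨b, hb1, hb2⟩ := hξ _ _ _ ha
      obtain ⟨c, hc1, hc2⟩ := hx _ _ _ ha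
      push_cast
      rw [contDiff_succ_iff_hasFDerivAt]
      refine ⟨_, ?_, hasFDerivAt_of_partials (hc2 i) (hb2 i) (hcont _ _ _ hc1 i)
        (hcont _ _ _ hb1 i)⟩
      exact ContDiff.add
        (ContDiff.smulRight (f := fun _ : ℝ × ℝ => ContinuousLinearMap.fst ℝ ℝ ℝ)
          contDiff_const (ih _ _ _ hc1 i))
        (ContDiff.smulRight (f := fun _ : ℝ × ℝ => ContinuousLinearMap.snd ℝ ℝ ℝ)
          contDiff_const (ih _ _ _ hb1 i))
  refine ⟨fun i => contDiff_infty.2 fun n => hsm n _ _ _ ha i, fun n => ?_⟩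
  induction n generalizing m₁ m₂ a with
  | zero => exact hb _ _ _ ha
  | succ n ih =>
    obtain ⟨b, hb1, hb2⟩ := hξ _ _ _ ha
    obtain ⟨c, hc1, hc2⟩ := hx _ _ _ ha
    refine ⟨hb _ _ _ ha, ?_, ?_⟩
    · rw [show (fun i => dXi (a i)) = b from funext fun i => hasDerivAt_dXi (hb2 i)]
      exact ih hb1
    · rw [show (fun i => dX (a i)) = c from funext fun i => hasDerivAt_dX (hc2 i)]
      exact ih hc1

/-- Closure of a class of families under addition. -/
inductive AddClosure (P : ℝ → ℝ → (ι → ℝ → ℝ → ℂ) → Prop) :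
    ℝ → ℝ → (ι → ℝ → ℝ → ℂ) → Prop
  | base {m₁ m₂ : ℝ} {a : ι → ℝ → ℝ → ℂ} : P m₁ m₂ a → AddClosure P m₁ m₂ a
  | add {m₁ m₂ : ℝ} {a b : ι → ℝ → ℝ → ℂ} : AddClosure P m₁ m₂ a → AddClosure P m₁ m₂ b →
      AddClosure P m₁ m₂ (fun i x ξ => a i x ξ + b i x ξ)

/-- Variant of `SG.of_closed_class` in which partial derivatives are sums of two members. -/
theorem SG.of_class {γ : ℝ} (P : ℝ → ℝ → (ι → ℝ → ℝ → ℂ) → Prop)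
    (hb : ∀ m₁ m₂ a, P m₁ m₂ a → BddW m₁ m₂ a)
    (hξ : ∀ m₁ m₂ a, P m₁ m₂ a → ∃ b c, P (m₁ - γ) m₂ b ∧ P (m₁ - γ) m₂ c ∧
      ∀ i x ξ, HasDerivAt (fun ξ' => a i x ξ') (b i x ξ + c i x ξ) ξ)
    (hx : ∀ m₁ m₂ a, P m₁ m₂ a → ∃ b c, P m₁ (m₂ - γ) b ∧ P m₁ (m₂ - γ) c ∧
      ∀ i x ξ, HasDerivAt (fun x' => a i x' ξ) (b i x ξ + c i x ξ) x)
    {m₁ m₂ : ℝ} {a : ι → ℝ → ℝ → ℂ} (ha : P m₁ m₂ a) : SG γ m₁ m₂ a := by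
  refine SG.of_closed_class (AddClosure P) ?_ ?_ ?_ (AddClosure.base ha)
  · intro m₁ m₂ a ha
    induction ha with
    | base h => exact hb _ _ _ h
    | add _ _ h1 h2 => exact h1.add h2
  · intro m₁ m₂ a ha
    induction ha with
    | base h =>
      obtain ⟨b, c, h1, h2, h3⟩ := hξ _ _ _ h
      exact ⟨_, (AddClosure.base h1).add (AddClosure.base h2), h3⟩
    | add _ _ h1 h2 =>
      obtain ⟨b, hb1, hb2⟩ := h1
      obtain ⟨c, hc1, hc2⟩ := h2
      exact ⟨_, hb1.add hc1, fun i x ξ => (hb2 i x ξ).add (hc2 i x ξ)⟩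
  · intro m₁ m₂ a ha
    induction ha with
    | base h =>
      obtain ⟨b, c, h1, h2, h3⟩ := hx _ _ _ h
      exact ⟨_, (AddClosure.base h1).add (AddClosure.base h2), h3⟩
    | add _ _ h1 h2 =>
      obtain ⟨b, hb1, hb2⟩ := h1
      obtain ⟨c, hc1, hc2⟩ := h2
      exact ⟨_, hb1.add hc1, fun i x ξ => (hb2 i x ξ).add (hc2 i x ξ)⟩

/-! ### Algebra of symbol families -/

lemma SG.smooth {γ m₁ m₂ : ℝ} {a : ι → ℝ → ℝ → ℂ} (h : SG γ m₁ m₂ a) (i : ι) : SmoothSym (a i) :=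
  h.1 i

lemma SG.bdd {γ m₁ m₂ : ℝ} {a : ι → ℝ → ℝ → ℂ} (h : SG γ m₁ m₂ a) : BddW m₁ m₂ a := h.2 0

lemma SG.dXi {γ m₁ m₂ : ℝ} {a : ι → ℝ → ℝ → ℂ} (h : SG γ m₁ m₂ a) :
    SG γ (m₁ - γ) m₂ (fun i => dXi (a i)) := ⟨fun i => (h.1 i).dXi, fun n => (h.2 (n + 1)).2.1⟩

lemma SG.dX {γ m₁ m₂ : ℝ} {a : ι → ℝ → ℝ → ℂ} (h : SG γ m₁ m₂ a) :
    SG γ m₁ (m₂ - γ) (fun i => dX (a i)) := ⟨fun i => (h.1 i).dX, fun n => (h.2 (n + 1)).2.2⟩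

lemma SG.hasDerivAt_xi {γ m₁ m₂ : ℝ} {a : ι → ℝ → ℝ → ℂ} (h : SG γ m₁ m₂ a) (i : ι) (x ξ : ℝ) :
    HasDerivAt (fun ξ' => a i x ξ') (_root_.dXi (a i) x ξ) ξ := (h.1 i).hasDerivAt_xi x ξ

lemma SG.hasDerivAt_x {γ m₁ m₂ : ℝ} {a : ι → ℝ → ℝ → ℂ} (h : SG γ m₁ m₂ a) (i : ι) (x ξ : ℝ) :
    HasDerivAt (fun x' => a i x' ξ) (_root_.dX (a i) x ξ) x := (h.1 i).hasDerivAt_x x ξ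

lemma SG.mono {γ γ' m₁ m₂ m₁' m₂' : ℝ} {a : ι → ℝ → ℝ → ℂ} (h : SG γ m₁ m₂ a)
    (hγ : γ' ≤ γ) (h₁ : m₁ ≤ m₁') (h₂ : m₂ ≤ m₂') : SG γ' m₁' m₂' a := by
  refine SG.of_closed_class
    (fun p q b => ∃ p' q', p' ≤ p ∧ q' ≤ q ∧ SG γ p' q' b) ?_ ?_ ?_ ⟨_, _, h₁, h₂, h⟩
  · rintro m n b ⟨p', q', h1, h2, h3⟩
    exact h3.bdd.mono h1 h2
  · rintro m n b ⟨p', q', h1, h2, h3⟩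
    exact ⟨_, ⟨_, _, by linarith, by linarith, h3.dXi⟩, h3.hasDerivAt_xi⟩
  · rintro m n b ⟨p', q', h1, h2, h3⟩
    exact ⟨_, ⟨_, _, by linarith, by linarith, h3.dX⟩, h3.hasDerivAt_x⟩

lemma SG.le {γ m₁ m₂ m₁' m₂' : ℝ} {a : ι → ℝ → ℝ → ℂ} (h : SG γ m₁ m₂ a)
    (h₁ : m₁ ≤ m₁') (h₂ : m₂ ≤ m₂') : SG γ m₁' m₂' a := h.mono le_rfl h₁ h₂

lemma SG.congr {γ m₁ m₂ : ℝ} {a b : ι → ℝ → ℝ → ℂ} (h : SG γ m₁ m₂ a)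
    (hab : ∀ i x ξ, b i x ξ = a i x ξ) : SG γ m₁ m₂ b := by
  rwa [show b = a from by funext i x ξ; exact hab i x ξ]

lemma SG.reindex {κ : Type} {γ m₁ m₂ : ℝ} {a : ι → ℝ → ℝ → ℂ} (h : SG γ m₁ m₂ a) (f : κ → ι) :
    SG γ m₁ m₂ (fun j => a (f j)) := by
  refine SG.of_closed_class
    (fun p q b => ∃ a : ι → ℝ → ℝ → ℂ, SG γ p q a ∧ b = fun j => a (f j)) ?_ ?_ ?_ ⟨_, h, rfl⟩
  · rintro m n _ ⟨a, ha, rfl⟩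
    obtain ⟨C, hC, h⟩ := ha.bdd
    exact ⟨C, hC, fun i => h (f i)⟩
  · rintro m n _ ⟨a, ha, rfl⟩
    exact ⟨_, ⟨_, ha.dXi, rfl⟩, fun j => ha.hasDerivAt_xi (f j)⟩
  · rintro m n _ ⟨a, ha, rfl⟩
    exact ⟨_, ⟨_, ha.dX, rfl⟩, fun j => ha.hasDerivAt_x (f j)⟩

lemma SG.of_partials {γ m₁ m₂ : ℝ} {a b c : ι → ℝ → ℝ → ℂ} (ha : BddW m₁ m₂ a)
    (hb : SG γ (m₁ - γ) m₂ b) (hab : ∀ i x ξ, HasDerivAt (fun ξ' => a i x ξ') (b i x ξ) ξ)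
    (hc : SG γ m₁ (m₂ - γ) c) (hac : ∀ i x ξ, HasDerivAt (fun x' => a i x' ξ) (c i x ξ) x) :
    SG γ m₁ m₂ a := by
  refine SG.of_closed_class
    (fun p q d => SG γ p q d ∨ (d = a ∧ p = m₁ ∧ q = m₂)) ?_ ?_ ?_ (Or.inr ⟨rfl, rfl, rfl⟩)
  · rintro p q d (h | ⟨rfl, rfl, rfl⟩)
    exacts [h.bdd, ha]
  · rintro p q d (h | ⟨rfl, rfl, rfl⟩)
    exacts [⟨_, Or.inl h.dXi, h.hasDerivAt_xi⟩, ⟨_, Or.inl hb, hab⟩]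
  · rintro p q d (h | ⟨rfl, rfl, rfl⟩)
    exacts [⟨_, Or.inl h.dX, h.hasDerivAt_x⟩, ⟨_, Or.inl hc, hac⟩]

lemma SG.zero {γ m₁ m₂ : ℝ} : SG γ m₁ m₂ (fun (_ : ι) _ _ => (0 : ℂ)) := by
  refine SG.of_closed_class (fun _ _ d => d = fun _ _ _ => 0) ?_ ?_ ?_ rfl
  · rintro p q _ rfl
    exact ⟨0, le_rfl, fun _ _ _ => by simp⟩
  · rintro p q _ rfl
    exact ⟨_, rfl, fun _ _ _ => hasDerivAt_const _ _⟩
  · rintro p q _ rfl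
    exact ⟨_, rfl, fun _ _ _ => hasDerivAt_const _ _⟩

lemma SG.const {γ : ℝ} (c : ℂ) : SG γ 0 0 (fun (_ : ι) _ _ => c) :=
  SG.of_partials ⟨‖c‖, norm_nonneg _, fun _ _ _ => by simp⟩ SG.zero
    (fun _ _ _ => hasDerivAt_const _ _) SG.zero (fun _ _ _ => hasDerivAt_const _ _)

lemma SG.bddConst {γ : ℝ} {c : ι → ℂ} {C : ℝ} (hC : ∀ i, ‖c i‖ ≤ C) :
    SG γ 0 0 (fun (i : ι) _ _ => c i) :=
  SG.of_partials ⟨|C|, abs_nonneg _, fun i _ _ => by simpa using (hC i).trans (le_abs_self _)⟩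
    SG.zero (fun _ _ _ => hasDerivAt_const _ _) SG.zero (fun _ _ _ => hasDerivAt_const _ _)

lemma SG.add {γ m₁ m₂ : ℝ} {a b : ι → ℝ → ℝ → ℂ} (ha : SG γ m₁ m₂ a) (hb : SG γ m₁ m₂ b) :
    SG γ m₁ m₂ (fun i x ξ => a i x ξ + b i x ξ) := by
  refine SG.of_closed_class (fun p q d => ∃ a b, SG γ p q a ∧ SG γ p q b ∧
    d = fun i x ξ => a i x ξ + b i x ξ) ?_ ?_ ?_ ⟨a, b, ha, hb, rfl⟩
  · rintro p q _ ⟨a, b, ha, hb, rfl⟩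
    exact ha.bdd.add hb.bdd
  · rintro p q _ ⟨a, b, ha, hb, rfl⟩
    exact ⟨_, ⟨_, _, ha.dXi, hb.dXi, rfl⟩,
      fun i x ξ => (ha.hasDerivAt_xi i x ξ).add (hb.hasDerivAt_xi i x ξ)⟩
  · rintro p q _ ⟨a, b, ha, hb, rfl⟩
    exact ⟨_, ⟨_, _, ha.dX, hb.dX, rfl⟩,
      fun i x ξ => (ha.hasDerivAt_x i x ξ).add (hb.hasDerivAt_x i x ξ)⟩

lemma SG.mul {γ m₁ m₂ n₁ n₂ : ℝ} {a b : ι → ℝ → ℝ → ℂ} (ha : SG γ m₁ m₂ a) (hb : SG γ n₁ n₂ b) :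
    SG γ (m₁ + n₁) (m₂ + n₂) (fun i x ξ => a i x ξ * b i x ξ) := by
  refine SG.of_class (fun p q d => ∃ p₁ q₁ p₂ q₂ a b, SG γ p₁ q₁ a ∧ SG γ p₂ q₂ b ∧
    p = p₁ + p₂ ∧ q = q₁ + q₂ ∧
    d = fun i x ξ => a i x ξ * b i x ξ) ?_ ?_ ?_ ⟨_, _, _, _, a, b, ha, hb, rfl, rfl, rfl⟩
  · rintro _ _ _ ⟨p₁, q₁, p₂, q₂, a, b, ha, hb, rfl, rfl, rfl⟩
    exact ha.bdd.mul hb.bdd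
  · rintro _ _ _ ⟨p₁, q₁, p₂, q₂, a, b, ha, hb, rfl, rfl, rfl⟩
    exact ⟨_, _, ⟨_, _, _, _, _, _, ha.dXi, hb, by ring, by ring, rfl⟩,
      ⟨_, _, _, _, _, _, ha, hb.dXi, by ring, by ring, rfl⟩,
      fun i x ξ => (ha.hasDerivAt_xi i x ξ).mul (hb.hasDerivAt_xi i x ξ)⟩
  · rintro _ _ _ ⟨p₁, q₁, p₂, q₂, a, b, ha, hb, rfl, rfl, rfl⟩
    exact ⟨_, _, ⟨_, _, _, _, _, _, ha.dX, hb, by ring, by ring, rfl⟩,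
      ⟨_, _, _, _, _, _, ha, hb.dX, by ring, by ring, rfl⟩,
      fun i x ξ => (ha.hasDerivAt_x i x ξ).mul (hb.hasDerivAt_x i x ξ)⟩

lemma SG.const_mul {γ m₁ m₂ : ℝ} {a : ι → ℝ → ℝ → ℂ} (ha : SG γ m₁ m₂ a) (c : ℂ) :
    SG γ m₁ m₂ (fun i x ξ => c * a i x ξ) := by
  simpa using (SG.const (ι := ι) (γ := γ) c).mul ha

lemma SG.neg {γ m₁ m₂ : ℝ} {a : ι → ℝ → ℝ → ℂ} (ha : SG γ m₁ m₂ a) :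
    SG γ m₁ m₂ (fun i x ξ => - a i x ξ) := (ha.const_mul (-1)).congr (by simp)

lemma SG.sub {γ m₁ m₂ : ℝ} {a b : ι → ℝ → ℝ → ℂ} (ha : SG γ m₁ m₂ a) (hb : SG γ m₁ m₂ b) :
    SG γ m₁ m₂ (fun i x ξ => a i x ξ - b i x ξ) := (ha.add hb.neg).congr (by simp [sub_eq_add_neg])

lemma SG.sum {γ m₁ m₂ : ℝ} {κ : Type} (s : Finset κ) {a : κ → ι → ℝ → ℝ → ℂ}
    (ha : ∀ j ∈ s, SG γ m₁ m₂ (a j)) : SG γ m₁ m₂ (fun i x ξ => ∑ j ∈ s, a j i x ξ) := by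
  classical
  induction s using Finset.induction_on with
  | empty => simpa using SG.zero
  | insert j s hj ih =>
    refine ((ha j (Finset.mem_insert_self _ _)).add
      (ih fun k hk => ha k (Finset.mem_insert_of_mem hk))).congr fun i x ξ => ?_
    rw [Finset.sum_insert hj]

lemma SG.swap {γ m₁ m₂ : ℝ} {a : ι → ℝ → ℝ → ℂ} (ha : SG γ m₁ m₂ a) :
    SG γ m₂ m₁ (fun i x ξ => a i ξ x) := by
  refine SG.of_closed_class (fun p q d => ∃ a, SG γ q p a ∧
    d = fun i x ξ => a i ξ x) ?_ ?_ ?_ ⟨a, ha, rfl⟩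
  · rintro p q _ ⟨a, ha, rfl⟩
    obtain ⟨C, hC, h⟩ := ha.bdd
    exact ⟨C, hC, fun i x ξ => (h i ξ x).trans_eq (by ring)⟩
  · rintro p q _ ⟨a, ha, rfl⟩
    exact ⟨_, ⟨_, ha.dX, rfl⟩, fun i x ξ => ha.hasDerivAt_x i ξ x⟩
  · rintro p q _ ⟨a, ha, rfl⟩
    exact ⟨_, ⟨_, ha.dXi, rfl⟩, fun i x ξ => ha.hasDerivAt_xi i ξ x⟩

/-! ### Model symbols -/

lemma jbh_pos {h : ℝ} (hh : 1 ≤ h) (ξ : ℝ) : 0 < jbh h ξ := Real.sqrt_pos.2 (by nlinarith [sq_nonneg ξ])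

lemma jbh_one (ξ : ℝ) : jbh 1 ξ = jb ξ := by simp [jbh, jb]

lemma jb_le_jbh {h : ℝ} (hh : 1 ≤ h) (ξ : ℝ) : jb ξ ≤ jbh h ξ :=
  Real.sqrt_le_sqrt (by nlinarith)

lemma le_jbh (h ξ : ℝ) : h ≤ jbh h ξ :=
  Real.le_sqrt_of_sq_le (by nlinarith [sq_nonneg ξ])

lemma jbh_le {h : ℝ} (hh : 1 ≤ h) (ξ : ℝ) : jbh h ξ ≤ h * jb ξ := by
  rw [jbh, jb, ← Real.sqrt_sq (by linarith : 0 ≤ h), ← Real.sqrt_mul (by positivity)]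
  refine Real.sqrt_le_sqrt ?_
  rw [Real.sqrt_sq (by linarith : 0 ≤ h)]
  nlinarith [sq_nonneg ξ, mul_nonneg (sub_nonneg.2 hh) (sq_nonneg ξ),
    mul_nonneg (sub_nonneg.2 hh) (mul_nonneg (by linarith : 0 ≤ h) (sq_nonneg ξ))]

lemma abs_le_jbh (h ξ : ℝ) : |ξ| ≤ jbh h ξ := Real.abs_le_sqrt (by nlinarith [sq_nonneg h])

lemma hasDerivAt_jbh {h : ℝ} (hh : 1 ≤ h) (ξ : ℝ) : HasDerivAt (jbh h) (ξ * (jbh h ξ)⁻¹) ξ := by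
  have h1 : HasDerivAt (fun ξ : ℝ => h ^ 2 + ξ ^ 2) (2 * ξ) ξ := by
    simpa using ((hasDerivAt_id ξ).pow 2).const_add (h ^ 2)
  have h2 := h1.sqrt (by positivity)
  change HasDerivAt (fun y => √(h ^ 2 + y ^ 2)) _ ξ
  convert h2 using 1
  have := (jbh_pos hh ξ).ne'
  rw [show √(h ^ 2 + ξ ^ 2) = jbh h ξ from rfl]
  field_simp

lemma hasDerivAt_jbh_rpow {h : ℝ} (hh : 1 ≤ h) (s ξ : ℝ) :
    HasDerivAt (fun ξ => jbh h ξ ^ s) (s * ξ * jbh h ξ ^ (s - 2)) ξ := by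
  have h2 := (hasDerivAt_jbh hh ξ).rpow_const (p := s) (Or.inl (jbh_pos hh ξ).ne')
  convert h2 using 1
  rw [show s - 2 = s - 1 + (-1) by ring, Real.rpow_add (jbh_pos hh ξ), Real.rpow_neg_one]
  ring

lemma jbh_bound {h : ℝ} (hh : 1 ≤ h) (k : ℕ) (s ξ : ℝ) :
    |ξ ^ k * jbh h ξ ^ s| ≤ jbh h ξ ^ (k + s) := by
  have := jbh_pos hh ξ
  rw [abs_mul, abs_pow, abs_of_pos (Real.rpow_pos_of_pos this s), Real.rpow_add this,
    Real.rpow_natCast]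
  exact mul_le_mul_of_nonneg_right (pow_le_pow_left₀ (abs_nonneg _) (abs_le_jbh h ξ) k)
    (Real.rpow_pos_of_pos this s).le

/-- Polynomials times powers of `⟨ξ⟩ₕ`, either of nonpositive order or with `h` bounded. -/
lemma SG.pow_mul_jbh_rpow {H : ι → ℝ} (hH : ∀ i, 1 ≤ H i) (k : ℕ) (s : ℝ)
    (hs : k + s ≤ 0 ∨ ∃ B, ∀ i, H i ≤ B) :
    SG 1 (k + s) 0 (fun i _ ξ => ((ξ ^ k * jbh (H i) ξ ^ s : ℝ) : ℂ)) := by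
  refine SG.of_class (fun p q d => d = (fun _ _ _ => 0) ∨ ((p ≤ 0 ∨ ∃ B, ∀ i, H i ≤ B) ∧
    ∃ (c : ℝ) (k : ℕ) (s : ℝ), k + s ≤ p ∧ q = 0 ∧
    d = fun i _ ξ => ((c * (ξ ^ k * jbh (H i) ξ ^ s) : ℝ) : ℂ)))
    ?_ ?_ ?_ (Or.inr ⟨hs, 1, k, s, le_rfl, rfl, by simp⟩)
  · rintro p q _ (rfl | ⟨hs, c, k, s, hp, rfl, rfl⟩)
    · exact SG.zero (γ := 1).bdd
    have key : ∃ D, 0 ≤ D ∧ ∀ i ξ, jbh (H i) ξ ^ (k + s) ≤ D * jb ξ ^ p := by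
      rcases hs with hs | ⟨B, hB⟩
      · refine ⟨1, zero_le_one, fun i ξ => ?_⟩
        rw [one_mul]
        calc jbh (H i) ξ ^ (k + s) ≤ jbh (H i) ξ ^ p :=
              Real.rpow_le_rpow_of_exponent_le ((hH i).trans (le_jbh _ ξ)) hp
          _ ≤ _ := Real.rpow_le_rpow_of_nonpos (jb_pos ξ) (jb_le_jbh (hH i) ξ) hs
      · refine ⟨|B| ^ |p|, by positivity, fun i ξ => ?_⟩
        have hB1 : 1 ≤ |B| := (hH i).trans ((hB i).trans (le_abs_self B))
        refine (Real.rpow_le_rpow_of_exponent_le ((hH i).trans (le_jbh _ ξ)) hp).trans ?_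
        rcases le_total 0 p with h0 | h0
        · rw [abs_of_nonneg h0, ← Real.mul_rpow (abs_nonneg _) (jb_pos ξ).le]
          exact Real.rpow_le_rpow (jbh_pos (hH i) ξ).le ((jbh_le (hH i) ξ).trans
            (mul_le_mul_of_nonneg_right ((hB i).trans (le_abs_self B)) (jb_pos ξ).le)) h0
        · refine (Real.rpow_le_rpow_of_nonpos (jb_pos ξ) (jb_le_jbh (hH i) ξ) h0).trans ?_
          exact le_mul_of_one_le_left (jb_rpow_pos _ _).le
            (Real.one_le_rpow hB1 (abs_nonneg _))
    obtain ⟨D, hD, h⟩ := key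
    refine ⟨|c| * D, by positivity, fun i x ξ => ?_⟩
    rw [Complex.norm_real, Real.norm_eq_abs, abs_mul, Real.rpow_zero, mul_one, mul_assoc]
    exact mul_le_mul_of_nonneg_left ((jbh_bound (hH i) k s ξ).trans (h i ξ)) (abs_nonneg _)
  · rintro p q _ (rfl | ⟨hs, c, k, s, hp, rfl, rfl⟩)
    · exact ⟨_, _, Or.inl rfl, Or.inl rfl, fun i x ξ => by simpa using hasDerivAt_const ξ (0:ℂ)⟩
    refine ⟨fun i _ ξ => ((c * k * (ξ ^ (k - 1) * jbh (H i) ξ ^ s) : ℝ) : ℂ),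
      fun i _ ξ => ((c * s * (ξ ^ (k + 1) * jbh (H i) ξ ^ (s - 2)) : ℝ) : ℂ), ?_,
      Or.inr ⟨hs.imp (fun h => by linarith) id, c * s, k + 1, s - 2, by push_cast; linarith,
        rfl, rfl⟩, fun i x ξ => ?_⟩
    · rcases k with _ | k
      · left; simp
      · exact Or.inr ⟨hs.imp (fun h => by linarith) id, c * (k + 1 : ℕ), k, s,
          by push_cast at hp; linarith, rfl, by simp⟩
    · have h := (((hasDerivAt_pow k ξ).mul (hasDerivAt_jbh_rpow (hH i) s ξ)).const_mul c).ofReal_comp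
      refine h.congr_deriv ?_
      push_cast; ring
  · rintro p q _ (rfl | ⟨hs, c, k, s, hp, rfl, rfl⟩)
    · exact ⟨_, _, Or.inl rfl, Or.inl rfl, fun i x ξ => by simpa using hasDerivAt_const x (0:ℂ)⟩
    · exact ⟨_, _, Or.inl rfl, Or.inl rfl, fun i x ξ => by simpa using hasDerivAt_const x _⟩

lemma SG.jb_xi (s : ℝ) : SG 1 s 0 (fun (_ : ι) _ ξ => ((jb ξ ^ s : ℝ) : ℂ)) := by
  have := SG.pow_mul_jbh_rpow (ι := ι) (H := fun _ => 1) (fun _ => le_rfl) 0 s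
    (Or.inr ⟨1, fun _ => le_rfl⟩)
  simpa [jbh_one] using this

lemma SG.xi : SG 1 1 0 (fun (_ : ι) _ ξ => (ξ : ℂ)) := by
  have := SG.pow_mul_jbh_rpow (ι := ι) (H := fun _ => 1) (fun _ => le_rfl) 1 0
    (Or.inr ⟨1, fun _ => le_rfl⟩)
  simpa [jbh_one] using this

lemma SG.jb_x (s : ℝ) : SG 1 0 s (fun (_ : ι) x _ => ((jb x ^ s : ℝ) : ℂ)) := (SG.jb_xi s).swap

lemma SG.id_x : SG 1 0 1 (fun (_ : ι) x _ => (x : ℂ)) := SG.xi.swap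

/-! ### Comparison with iterated derivatives -/

lemma SmoothSym.iterate_dX {a : ℝ → ℝ → ℂ} (h : SmoothSym a) (n : ℕ) :
    SmoothSym (_root_.dX^[n] a) := by
  induction n generalizing a with
  | zero => exact h
  | succ n ih => exact ih h.dX

lemma SmoothSym.iterate_dXi {a : ℝ → ℝ → ℂ} (h : SmoothSym a) (n : ℕ) :
    SmoothSym (_root_.dXi^[n] a) := by
  induction n generalizing a with
  | zero => exact h
  | succ n ih => exact ih h.dXi

lemma iteratedDeriv_x_eq (a : ℝ → ℝ → ℂ) (n : ℕ) (x ξ : ℝ) :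
    iteratedDeriv n (fun x' => a x' ξ) x = dX^[n] a x ξ := by
  induction n generalizing a x with
  | zero => simp
  | succ n ih => rw [iteratedDeriv_succ', Function.iterate_succ_apply, ← ih]; rfl

lemma iteratedDeriv_xi_eq (a : ℝ → ℝ → ℂ) (n : ℕ) (x ξ : ℝ) :
    iteratedDeriv n (fun ξ' => a x ξ') ξ = dXi^[n] a x ξ := by
  induction n generalizing a ξ with
  | zero => simp
  | succ n ih => rw [iteratedDeriv_succ', Function.iterate_succ_apply, ← ih]; rfl

lemma iteratedDeriv_mixed_eq (a : ℝ → ℝ → ℂ) (α β : ℕ) (x ξ : ℝ) :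
    iteratedDeriv α (fun ξ' => iteratedDeriv β (fun x' => a x' ξ') x) ξ =
      dXi^[α] (dX^[β] a) x ξ := by
  simp_rw [iteratedDeriv_x_eq]
  exact iteratedDeriv_xi_eq _ α x ξ

lemma SG.iterate_dX {γ m₁ m₂ : ℝ} {a : ι → ℝ → ℝ → ℂ} (h : SG γ m₁ m₂ a) (n : ℕ) :
    SG γ m₁ (m₂ - n * γ) (fun i => _root_.dX^[n] (a i)) := by
  induction n generalizing m₂ a with
  | zero => simpa using h
  | succ n ih =>
    have := ih h.dX
    simp only [Function.iterate_succ_apply]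
    convert this using 1; push_cast; ring

lemma SG.iterate_dXi {γ m₁ m₂ : ℝ} {a : ι → ℝ → ℝ → ℂ} (h : SG γ m₁ m₂ a) (n : ℕ) :
    SG γ (m₁ - n * γ) m₂ (fun i => _root_.dXi^[n] (a i)) := by
  induction n generalizing m₁ a with
  | zero => simpa using h
  | succ n ih =>
    have := ih h.dXi
    simp only [Function.iterate_succ_apply]
    convert this using 1; push_cast; ring

lemma SG.iteratedDeriv_bound {γ m₁ m₂ : ℝ} {a : ι → ℝ → ℝ → ℂ} (h : SG γ m₁ m₂ a) (α β : ℕ) :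
    ∃ C > 0, ∀ i x ξ,
      ‖iteratedDeriv α (fun ξ' => iteratedDeriv β (fun x' => a i x' ξ') x) ξ‖ ≤
        C * jb ξ ^ (m₁ - α * γ) * jb x ^ (m₂ - β * γ) := by
  obtain ⟨C, hC, hb⟩ := ((h.iterate_dX β).iterate_dXi α).bdd
  refine ⟨C + 1, by positivity, fun i x ξ => ?_⟩
  rw [iteratedDeriv_mixed_eq]
  refine (hb i x ξ).trans ?_
  have := jb_rpow_pos ξ (m₁ - α * γ)
  have := jb_rpow_pos x (m₂ - β * γ)
  gcongr
  linarith

lemma SmoothSym.dX_iterate_dXi {a : ℝ → ℝ → ℂ} (h : SmoothSym a) (n : ℕ) :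
    _root_.dX (_root_.dXi^[n] a) = _root_.dXi^[n] (_root_.dX a) := by
  induction n generalizing a with
  | zero => rfl
  | succ n ih => rw [Function.iterate_succ_apply, ih h.dXi, h.dX_dXi, Function.iterate_succ_apply]

lemma SG.of_iteratedDeriv {γ m₁ m₂ : ℝ} {a : ι → ℝ → ℝ → ℂ} (hs : ∀ i, SmoothSym (a i))
    (h : ∀ α β : ℕ, ∃ C > 0, ∀ i x ξ,
      ‖iteratedDeriv α (fun ξ' => iteratedDeriv β (fun x' => a i x' ξ') x) ξ‖ ≤
        C * jb ξ ^ (m₁ - α * γ) * jb x ^ (m₂ - β * γ)) : SG γ m₁ m₂ a := by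
  refine SG.of_closed_class (fun p q d => ∃ α β : ℕ, p = m₁ - α * γ ∧ q = m₂ - β * γ ∧
    d = fun i => _root_.dXi^[α] (_root_.dX^[β] (a i))) ?_ ?_ ?_
    ⟨0, 0, by simp, by simp, rfl⟩
  · rintro _ _ _ ⟨α, β, rfl, rfl, rfl⟩
    obtain ⟨C, hC, hb⟩ := h α β
    exact ⟨C, hC.le, fun i x ξ => by
      simpa only [← iteratedDeriv_mixed_eq] using hb i x ξ⟩
  · rintro _ _ _ ⟨α, β, rfl, rfl, rfl⟩
    refine ⟨_, ⟨α + 1, β, by push_cast; ring, rfl, rfl⟩, fun i x ξ => ?_⟩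
    rw [Function.iterate_succ_apply']
    exact (((hs i).iterate_dX β).iterate_dXi α).hasDerivAt_xi x ξ
  · rintro _ _ _ ⟨α, β, rfl, rfl, rfl⟩
    refine ⟨_, ⟨α, β + 1, rfl, by push_cast; ring, rfl⟩, fun i x ξ => ?_⟩
    rw [Function.iterate_succ_apply', ← ((hs i).iterate_dX β).dX_iterate_dXi]
    exact (((hs i).iterate_dX β).iterate_dXi α).hasDerivAt_x x ξ

/-! ### Oscillatory integrals -/

/-- The character `e^{it}`. -/
def ep (t : ℝ) : ℂ := Complex.exp (t * Complex.I)

lemma norm_ep (t : ℝ) : ‖ep t‖ = 1 := Complex.norm_exp_ofReal_mul_I t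

lemma ep_add (s t : ℝ) : ep (s + t) = ep s * ep t := by
  simp [ep, add_mul, Complex.exp_add]

lemma ep_zero : ep 0 = 1 := by simp [ep]

lemma hasDerivAt_ep (t : ℝ) : HasDerivAt ep (Complex.I * ep t) t := by
  have h : HasDerivAt (fun s : ℝ => (s : ℂ) * Complex.I) Complex.I t := by
    simpa using (hasDerivAt_id t).ofReal_comp.mul_const Complex.I
  exact h.cexp.congr_deriv (by rw [ep]; ring)

lemma hasDerivAt_ep_mul (c t : ℝ) :
    HasDerivAt (fun s => ep (c * s)) (Complex.I * c * ep (c * t)) t := by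
  have h1 : HasDerivAt (fun s : ℝ => c * s) c t := by simpa using (hasDerivAt_id t).const_mul c
  have := (hasDerivAt_ep (c * t)).scomp t h1
  refine this.congr_deriv ?_
  rw [Complex.real_smul]; ring

@[fun_prop]
lemma continuous_ep : Continuous ep := by unfold ep; fun_prop

lemma integrable_jb_rpow {s : ℝ} (hs : s < -1) : Integrable (fun x => jb x ^ s) := by
  have := integrable_rpow_neg_one_add_norm_sq (E := ℝ) (μ := volume) (r := -s) (by simp; linarith)
  refine this.congr (Filter.Eventually.of_forall fun x => ?_)
  simp only [jb, Real.norm_eq_abs, sq_abs, neg_neg, Real.sqrt_eq_rpow]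
  rw [← Real.rpow_mul (by positivity)]
  congr 1; ring

lemma integrable_jb_neg_two : Integrable (fun x => jb x ^ (-2 : ℝ)) :=
  integrable_jb_rpow (by norm_num)

lemma integrable_of_jb_bound {f : ℝ → ℂ} (hf : Continuous f) {C : ℝ}
    (h : ∀ x, ‖f x‖ ≤ C * jb x ^ (-2 : ℝ)) : Integrable f :=
  (integrable_jb_neg_two.const_mul C).mono' hf.aestronglyMeasurable (Filter.Eventually.of_forall h)

lemma norm_integral_le_of_jb_bound {f : ℝ → ℂ} {C : ℝ}
    (h : ∀ x, ‖f x‖ ≤ C * jb x ^ (-2 : ℝ)) : ‖∫ x, f x‖ ≤ C * ∫ x, jb x ^ (-2 : ℝ) := by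
  rw [← integral_const_mul]
  exact norm_integral_le_of_norm_le (integrable_jb_neg_two.const_mul C)
    (Filter.Eventually.of_forall h)

lemma jb_int_nonneg : 0 ≤ ∫ x, jb x ^ (-2 : ℝ) := integral_nonneg fun x => (jb_rpow_pos x _).le

lemma hasDerivAt_integral_of_jb_bound {F F' : ℝ → ℝ → ℂ} {x₀ : ℝ}
    (hF : ∀ x, Continuous (F x)) (hF' : Continuous (F' x₀)) {C₀ C : ℝ}
    (h₀ : ∀ z, ‖F x₀ z‖ ≤ C₀ * jb z ^ (-2 : ℝ))
    (hb : ∀ x, |x - x₀| ≤ 1 → ∀ z, ‖F' x z‖ ≤ C * jb z ^ (-2 : ℝ))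
    (hd : ∀ x z, HasDerivAt (fun x => F x z) (F' x z) x) :
    HasDerivAt (fun x => ∫ z, F x z) (∫ z, F' x₀ z) x₀ :=
  (hasDerivAt_integral_of_dominated_loc_of_deriv_le (Metric.closedBall_mem_nhds x₀ one_pos)
    (Filter.Eventually.of_forall fun x => (hF x).aestronglyMeasurable)
    (integrable_of_jb_bound (hF x₀) h₀) hF'.aestronglyMeasurable
    (Filter.Eventually.of_forall fun z x hx => hb x (by simpa [Real.dist_eq] using hx) z)
    (integrable_jb_neg_two.const_mul C)
    (Filter.Eventually.of_forall fun z x _ => hd x z)).2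

lemma jb_local {x x₀ : ℝ} (h : |x - x₀| ≤ 1) (s : ℝ) : jb x ^ s ≤ 4 ^ |s| * jb x₀ ^ s := by
  have h1 := peetre s x₀ (x - x₀)
  rw [add_sub_cancel] at h1
  have h2 : jb (x - x₀) ^ |s| ≤ 2 ^ |s| :=
    Real.rpow_le_rpow (jb_pos _).le ((jb_le _).trans (by linarith)) (abs_nonneg s)
  have h3 : (4 : ℝ) ^ |s| = 2 ^ |s| * 2 ^ |s| := by
    rw [← Real.mul_rpow (by norm_num) (by norm_num)]; norm_num
  have := jb_rpow_pos x₀ s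
  calc jb x ^ s ≤ 2 ^ |s| * jb x₀ ^ s * 2 ^ |s| := h1.trans (by gcongr)
    _ = _ := by rw [h3]; ring

lemma jb_sub_mul_le {θ : ℝ} (hθ : |θ| ≤ 2) (s x z : ℝ) :
    jb (x - θ * z) ^ s ≤ 4 ^ |s| * jb x ^ s * jb z ^ |s| := by
  have h := peetre s x (-(θ * z))
  rw [← sub_eq_add_neg, jb_neg] at h
  refine h.trans ?_
  have h2 : jb (θ * z) ≤ 2 * jb z := by
    refine Real.sqrt_le_iff.2 ⟨by have := jb_pos z; positivity, ?_⟩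
    have : θ ^ 2 ≤ 4 := by rw [← sq_abs]; nlinarith [abs_nonneg θ]
    rw [mul_pow 2 (jb z), jb_sq]
    rw [mul_pow]
    nlinarith [sq_nonneg z]
  have h3 := jb_rpow_pos x s
  have h4 := Real.rpow_le_rpow (jb_pos _).le h2 (abs_nonneg s)
  rw [Real.mul_rpow (by norm_num) (jb_pos z).le] at h4
  have h5 : (4 : ℝ) ^ |s| = 2 ^ |s| * 2 ^ |s| := by
    rw [← Real.mul_rpow (by norm_num) (by norm_num)]; norm_num
  calc _ ≤ 2 ^ |s| * jb x ^ s * (2 ^ |s| * jb z ^ |s|) := by gcongr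
    _ = _ := by rw [h5]; ring

/-! ### The convolution kernel of a symbol -/

/-- The kernel `K(x,z) = (2π)⁻¹ ∫ e^{izξ} a(x,ξ) dξ`. -/
def kern (a : ℝ → ℝ → ℂ) (x z : ℝ) : ℂ := ((2 * π)⁻¹ : ℝ) * ∫ ξ, ep (z * ξ) * a x ξ

section kern

variable {γ m₁ m₂ : ℝ} {a : ι → ℝ → ℝ → ℂ}

lemma SG.xi_bound (h : SG γ m₁ m₂ a) (hm : m₁ ≤ -2) :
    ∃ C, 0 ≤ C ∧ ∀ i x ξ, ‖a i x ξ‖ ≤ C * jb x ^ m₂ * jb ξ ^ (-2 : ℝ) := by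
  obtain ⟨C, hC, hb⟩ := h.bdd.mono hm le_rfl
  exact ⟨C, hC, fun i x ξ => (hb i x ξ).trans_eq (by ring)⟩

lemma norm_ep_mul (t : ℝ) (c : ℂ) : ‖ep t * c‖ = ‖c‖ := by rw [norm_mul, norm_ep, one_mul]

lemma SG.continuous_xi (h : SG γ m₁ m₂ a) (i : ι) (x : ℝ) : Continuous (a i x) :=
  (h.smooth i).continuous_xi x

lemma SG.continuous_x (h : SG γ m₁ m₂ a) (i : ι) (ξ : ℝ) : Continuous (fun x => a i x ξ) :=
  (h.smooth i).continuous_x ξ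

lemma SG.integrable_xi (h : SG γ m₁ m₂ a) (hm : m₁ ≤ -2) (i : ι) (x : ℝ) :
    Integrable (a i x) := by
  obtain ⟨C, -, hC⟩ := h.xi_bound hm
  exact integrable_of_jb_bound (h.continuous_xi i x) (hC i x)

lemma SG.integrable_ep_mul (h : SG γ m₁ m₂ a) (hm : m₁ ≤ -2) (i : ι) (x z : ℝ) :
    Integrable (fun ξ => ep (z * ξ) * a i x ξ) := by
  obtain ⟨C, -, hC⟩ := h.xi_bound hm
  exact integrable_of_jb_bound ((by fun_prop : Continuous fun ξ => ep (z * ξ)).mul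
    (h.continuous_xi i x)) (fun ξ => by rw [norm_ep_mul]; exact hC i x ξ)

lemma SG.kern_bdd (h : SG γ m₁ m₂ a) (hm : m₁ ≤ -2) :
    ∃ C, 0 ≤ C ∧ ∀ i x z, ‖kern (a i) x z‖ ≤ C * jb x ^ m₂ := by
  obtain ⟨C, hC0, hC⟩ := h.xi_bound hm
  refine ⟨(2 * π)⁻¹ * (C * ∫ x, jb x ^ (-2 : ℝ)), by have := jb_int_nonneg; positivity,
    fun i x z => ?_⟩
  rw [kern, norm_mul, Complex.norm_real, Real.norm_of_nonneg (by positivity)]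
  have := norm_integral_le_of_jb_bound (f := fun ξ => ep (z * ξ) * a i x ξ)
    (fun ξ => by rw [norm_ep_mul]; exact hC i x ξ)
  calc _ ≤ (2 * π)⁻¹ * (C * jb x ^ m₂ * ∫ x, jb x ^ (-2 : ℝ)) := by gcongr
    _ = _ := by ring

lemma SG.mul_kern (h : SG γ m₁ m₂ a) (hγ : 0 ≤ γ) (hm : m₁ ≤ -2) (i : ι) (x z : ℝ) :
    z * kern (a i) x z = Complex.I * kern (_root_.dXi (a i)) x z := by
  have hm' : m₁ - γ ≤ -2 := by linarith
  have hI := integral_mul_deriv_eq_deriv_mul_of_integrable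
    (u := fun ξ => ep (z * ξ)) (v := a i x) (u' := fun ξ => Complex.I * z * ep (z * ξ))
    (v' := _root_.dXi (a i) x) (fun ξ _ => hasDerivAt_ep_mul z ξ)
    (fun ξ _ => h.hasDerivAt_xi i x ξ)
    (h.dXi.integrable_ep_mul hm' i x z)
    (((h.integrable_ep_mul hm i x z).const_mul (Complex.I * z)).congr
      (Filter.Eventually.of_forall fun ξ => by simp [mul_assoc]))
    (h.integrable_ep_mul hm i x z)
  simp_rw [mul_assoc, integral_const_mul] at hI
  rw [kern, kern, hI]
  linear_combination ((((2 * π)⁻¹ : ℝ) : ℂ) * z * ∫ ξ, ep (z * ξ) * a i x ξ) * Complex.I_sq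

lemma SG.kern_decay (h : SG γ m₁ m₂ a) (hγ : 0 ≤ γ) (hm : m₁ ≤ -2) (N : ℕ) :
    ∃ C, 0 ≤ C ∧ ∀ i x z, ‖kern (a i) x z‖ ≤ C * jb x ^ m₂ * jb z ^ (-(N : ℝ)) := by
  induction N generalizing a m₁ with
  | zero => simpa using h.kern_bdd hm
  | succ N ih =>
    obtain ⟨C, hC0, hC⟩ := ih h hm
    obtain ⟨D, hD0, hD⟩ := ih h.dXi (by linarith)
    refine ⟨C + D, by positivity, fun i x z => ?_⟩
    have h1 : |z| * ‖kern (a i) x z‖ = ‖kern (_root_.dXi (a i)) x z‖ := by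
      have := congrArg norm (h.mul_kern hγ hm i x z)
      simpa using this
    have h2 : jb z * ‖kern (a i) x z‖ ≤ (C + D) * jb x ^ m₂ * jb z ^ (-(N : ℝ)) := by
      have := mul_le_mul_of_nonneg_right (jb_le z) (norm_nonneg (kern (a i) x z))
      have := hC i x z
      have := hD i x z
      nlinarith
    rw [show (-((N + 1 : ℕ) : ℝ)) = -(N : ℝ) + -1 by push_cast; ring, jb_rpow_add,
      Real.rpow_neg_one, ← mul_assoc, ← div_eq_mul_inv, le_div_iff₀ (jb_pos z)]
    linarith

lemma SG.kern_decay_rpow (h : SG γ m₁ m₂ a) (hγ : 0 ≤ γ) (hm : m₁ ≤ -2) (s : ℝ) :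
    ∃ C, 0 ≤ C ∧ ∀ i x z, ‖kern (a i) x z‖ ≤ C * jb x ^ m₂ * jb z ^ s := by
  obtain ⟨N, hN⟩ := exists_nat_ge (-s)
  obtain ⟨C, hC0, hC⟩ := h.kern_decay hγ hm N
  refine ⟨C, hC0, fun i x z => (hC i x z).trans ?_⟩
  exact mul_le_mul_of_nonneg_left (jb_rpow_mono z (by linarith))
    (mul_nonneg hC0 (jb_rpow_pos _ _).le)

lemma SG.continuous_kern (h : SG γ m₁ m₂ a) (hm : m₁ ≤ -2) (i : ι) (x : ℝ) :
    Continuous (kern (a i) x) := by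
  obtain ⟨C, -, hC⟩ := h.xi_bound hm
  refine continuous_const.mul (continuous_of_dominated
    (bound := fun ξ => C * jb x ^ m₂ * jb ξ ^ (-2 : ℝ)) (fun z => ?_) (fun z => ?_) ?_ ?_)
  · exact ((by fun_prop : Continuous fun ξ => ep (z * ξ)).mul
      (h.continuous_xi i x)).aestronglyMeasurable
  · exact Filter.Eventually.of_forall fun ξ => by rw [norm_ep_mul]; exact hC i x ξ
  · exact integrable_jb_neg_two.const_mul _
  · exact Filter.Eventually.of_forall fun ξ => by fun_prop

lemma SG.hasDerivAt_kern (h : SG γ m₁ m₂ a) (hm : m₁ ≤ -2) (i : ι) (x z : ℝ) :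
    HasDerivAt (fun x => kern (a i) x z) (kern (_root_.dX (a i)) x z) x := by
  obtain ⟨C, hC0, hC⟩ := h.xi_bound hm
  obtain ⟨D, hD0, hD⟩ := h.dX.xi_bound hm
  refine HasDerivAt.const_mul _ (hasDerivAt_integral_of_jb_bound
    (F := fun x ξ => ep (z * ξ) * a i x ξ) (F' := fun x ξ => ep (z * ξ) * _root_.dX (a i) x ξ)
    (C₀ := C * jb x ^ m₂) (C := D * (4 ^ |m₂ - γ| * jb x ^ (m₂ - γ)))
    (fun x => (by fun_prop : Continuous fun ξ => ep (z * ξ)).mul (h.continuous_xi i x))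
    ((by fun_prop : Continuous fun ξ => ep (z * ξ)).mul (h.dX.continuous_xi i x))
    (fun ξ => ?_) (fun x' hx' ξ => ?_) fun x ξ => ?_)
  · rw [norm_ep_mul]; exact hC i x ξ
  · rw [norm_ep_mul]
    refine (hD i x' ξ).trans ?_
    have := jb_rpow_pos ξ (-2)
    have := jb_local hx' (m₂ - γ)
    gcongr
  · exact (h.hasDerivAt_x i x ξ).const_mul _

/-- Fourier inversion for the kernel. -/
lemma SG.integral_kern (h : SG γ m₁ m₂ a) (hγ : 0 ≤ γ) (hm : m₁ ≤ -2) (i : ι) (x ξ : ℝ) :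
    ∫ z, kern (a i) x z * ep (-(z * ξ)) = a i x ξ := by
  have hK : Integrable (kern (a i) x) := by
    obtain ⟨C, -, hC⟩ := h.kern_decay_rpow hγ hm (-2)
    exact integrable_of_jb_bound (h.continuous_kern hm i x) (hC i x)
  have e1 : ∀ w, FourierTransformInv.fourierInv (a i x) w = 2 * π * kern (a i) x (2 * π * w) := by
    intro w
    rw [Real.fourierInv_eq', kern]
    have : (2 * π : ℂ) * (((2 * π)⁻¹ : ℝ) * ∫ ξ, ep (2 * π * w * ξ) * a i x ξ) =
        ∫ ξ, ep (2 * π * w * ξ) * a i x ξ := by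
      push_cast
      rw [← mul_assoc, mul_inv_cancel₀ (by simp [Real.pi_ne_zero]), one_mul]
    rw [this]
    refine integral_congr_ae (Filter.Eventually.of_forall fun v => ?_)
    simp only [smul_eq_mul, ep]
    congr 2
    simp; ring
  have e3 : Integrable (FourierTransformInv.fourierInv (a i x)) := by
    rw [show FourierTransformInv.fourierInv (a i x) =
      fun w => 2 * π * kern (a i) x (2 * π * w) from funext e1]
    exact (hK.comp_mul_left' (by positivity)).const_mul _
  have e4 : Integrable (FourierTransform.fourier (a i x)) := by
    have := e3.comp_neg
    refine this.congr (Filter.Eventually.of_forall fun v => ?_)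
    simp [Real.fourierInv_eq_fourier_neg]
  have e2 := congrFun ((h.continuous_xi i x).fourier_fourierInv_eq
    (h.integrable_xi hm i x) e4) ξ
  rw [Real.fourier_eq'] at e2
  rw [← e2]
  simp_rw [e1]
  have := Measure.integral_comp_mul_left (fun z => kern (a i) x z * ep (-(z * ξ))) (2 * π)
  rw [abs_of_pos (by positivity), Complex.real_smul] at this
  have h3 : ∫ z, kern (a i) x z * ep (-(z * ξ)) =
      2 * π * ∫ z, kern (a i) x (2 * π * z) * ep (-(2 * π * z * ξ)) := by
    simp only [mul_assoc] at this ⊢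
    rw [this]; push_cast
    rw [← mul_assoc, ← mul_assoc, mul_inv_cancel₀ (by simp [Real.pi_ne_zero]), one_mul]
  rw [h3, ← integral_const_mul]
  refine integral_congr_ae (Filter.Eventually.of_forall fun v => ?_)
  simp only [smul_eq_mul, ep]
  rw [mul_comm (Complex.exp _), ← mul_assoc]
  congr 2
  simp; ring

end kern

/-! ### Composition of symbols of negative order -/

/-- The symbol `∫ K_a(x,z) e^{-izξ} b(x - θz, ξ) dz`, which for `θ = 1` is the symbol of
`a(x,D) ∘ b(x,D)` and for `θ = 0` is the product `ab`. -/
def cps (θ : ℝ) (a b : ℝ → ℝ → ℂ) : ℝ → ℝ → ℂ :=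
  fun x ξ => ∫ z, kern a x z * ep (-(z * ξ)) * b (x - θ * z) ξ

section cps

variable {γ m₁ m₂ n₁ n₂ : ℝ} {a b : ι → ℝ → ℝ → ℂ}

lemma SG.cmp_integrand_bdd (ha : SG γ m₁ m₂ a) (hγ : 0 ≤ γ) (hm : m₁ ≤ -2) (hb : SG γ n₁ n₂ b) :
    ∃ C, 0 ≤ C ∧ ∀ i θ, |θ| ≤ 2 → ∀ x ξ z,
      ‖kern (a i) x z * ep (-(z * ξ)) * b i (x - θ * z) ξ‖ ≤
        C * jb ξ ^ n₁ * jb x ^ (m₂ + n₂) * jb z ^ (-2 : ℝ) := by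
  obtain ⟨C, hC0, hC⟩ := ha.kern_decay_rpow hγ hm (-2 - |n₂|)
  obtain ⟨D, hD0, hD⟩ := hb.bdd
  refine ⟨C * D * 4 ^ |n₂|, by positivity, fun i θ hθ x ξ z => ?_⟩
  rw [norm_mul, norm_mul, norm_ep, mul_one]
  have h1 := hC i x z
  have h2 := hD i (x - θ * z) ξ
  have h3 := jb_sub_mul_le hθ n₂ x z
  have p1 := jb_rpow_pos ξ n₁
  have p2 := jb_rpow_pos x m₂
  have p3 := jb_rpow_pos z (-2 - |n₂|)
  calc _ ≤ (C * jb x ^ m₂ * jb z ^ (-2 - |n₂|)) *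
        (D * jb ξ ^ n₁ * (4 ^ |n₂| * jb x ^ n₂ * jb z ^ |n₂|)) :=
        mul_le_mul h1 (h2.trans (by gcongr)) (norm_nonneg _) (by positivity)
    _ = C * D * 4 ^ |n₂| * jb ξ ^ n₁ * (jb x ^ m₂ * jb x ^ n₂) *
        (jb z ^ (-2 - |n₂|) * jb z ^ |n₂|) := by ring
    _ = _ := by rw [← jb_rpow_add, ← jb_rpow_add]; congr 2; ring

lemma SG.continuous_cmp_integrand (ha : SG γ m₁ m₂ a) (hm : m₁ ≤ -2) (hb : SG γ n₁ n₂ b)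
    (i : ι) (θ x ξ : ℝ) :
    Continuous (fun z => kern (a i) x z * ep (-(z * ξ)) * b i (x - θ * z) ξ) :=
  ((ha.continuous_kern hm i x).mul (by fun_prop)).mul
    ((hb.continuous_x i ξ).comp (by fun_prop : Continuous fun z : ℝ => x - θ * z))

lemma SG.integrable_cmp_integrand (ha : SG γ m₁ m₂ a) (hγ : 0 ≤ γ) (hm : m₁ ≤ -2)
    (hb : SG γ n₁ n₂ b) (i : ι) {θ : ℝ} (hθ : |θ| ≤ 2) (x ξ : ℝ) :
    Integrable (fun z => kern (a i) x z * ep (-(z * ξ)) * b i (x - θ * z) ξ) := by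
  obtain ⟨C, -, hC⟩ := ha.cmp_integrand_bdd hγ hm hb
  exact integrable_of_jb_bound (ha.continuous_cmp_integrand hm hb i θ x ξ) (hC i θ hθ x ξ)

lemma SG.cmp_bdd (ha : SG γ m₁ m₂ a) (hγ : 0 ≤ γ) (hm : m₁ ≤ -2) (hb : SG γ n₁ n₂ b) :
    ∃ C, 0 ≤ C ∧ ∀ i θ, |θ| ≤ 2 → ∀ x ξ,
      ‖cps θ (a i) (b i) x ξ‖ ≤ C * jb ξ ^ n₁ * jb x ^ (m₂ + n₂) := by
  obtain ⟨C, hC0, hC⟩ := ha.cmp_integrand_bdd hγ hm hb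
  refine ⟨C * ∫ x, jb x ^ (-2 : ℝ), mul_nonneg hC0 jb_int_nonneg, fun i θ hθ x ξ => ?_⟩
  exact (norm_integral_le_of_jb_bound (hC i θ hθ x ξ)).trans_eq (by ring)

lemma SG.cmp_add_integral (ha : SG γ m₁ m₂ a) (hγ : 0 ≤ γ) (hm : m₁ ≤ -2) (hb : SG γ n₁ n₂ b)
    {m₁' m₂' n₁' n₂' : ℝ} {a' b' : ι → ℝ → ℝ → ℂ}
    (ha' : SG γ m₁' m₂' a') (hm' : m₁' ≤ -2) (hb' : SG γ n₁' n₂' b')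
    (i : ι) {θ : ℝ} (hθ : |θ| ≤ 2) (x ξ : ℝ) :
    ∫ z, (kern (a i) x z * ep (-(z * ξ)) * b i (x - θ * z) ξ +
      kern (a' i) x z * ep (-(z * ξ)) * b' i (x - θ * z) ξ) =
      cps θ (a i) (b i) x ξ + cps θ (a' i) (b' i) x ξ :=
  integral_add (ha.integrable_cmp_integrand hγ hm hb i hθ x ξ)
    (ha'.integrable_cmp_integrand hγ hm' hb' i hθ x ξ)

lemma SG.hasDerivAt_cmp_x (ha : SG γ m₁ m₂ a) (hγ : 0 ≤ γ) (hm : m₁ ≤ -2) (hb : SG γ n₁ n₂ b)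
    (i : ι) {θ : ℝ} (hθ : |θ| ≤ 2) (x ξ : ℝ) :
    HasDerivAt (fun x => cps θ (a i) (b i) x ξ)
      (cps θ (_root_.dX (a i)) (b i) x ξ + cps θ (a i) (_root_.dX (b i)) x ξ) x := by
  obtain ⟨C, hC0, hC⟩ := ha.cmp_integrand_bdd hγ hm hb
  obtain ⟨C₁, hC10, hC1⟩ := ha.dX.cmp_integrand_bdd hγ hm hb
  obtain ⟨C₂, hC20, hC2⟩ := ha.cmp_integrand_bdd hγ hm hb.dX
  rw [← ha.dX.cmp_add_integral hγ hm hb ha hm hb.dX i hθ x ξ]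
  refine hasDerivAt_integral_of_jb_bound
    (F := fun x z => kern (a i) x z * ep (-(z * ξ)) * b i (x - θ * z) ξ)
    (F' := fun x z => kern (_root_.dX (a i)) x z * ep (-(z * ξ)) * b i (x - θ * z) ξ +
      kern (a i) x z * ep (-(z * ξ)) * _root_.dX (b i) (x - θ * z) ξ)
    (C := C₁ * jb ξ ^ n₁ * (4 ^ |m₂ - γ + n₂| * jb x ^ (m₂ - γ + n₂)) +
      C₂ * jb ξ ^ n₁ * (4 ^ |m₂ + (n₂ - γ)| * jb x ^ (m₂ + (n₂ - γ))))
    (fun x => ha.continuous_cmp_integrand hm hb i θ x ξ)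
    ((ha.dX.continuous_cmp_integrand hm hb i θ x ξ).add
      (ha.continuous_cmp_integrand hm hb.dX i θ x ξ)) (hC i θ hθ x ξ) (fun x' hx' z => ?_)
    (fun x z => ?_)
  · refine (norm_add_le _ _).trans ?_
    rw [add_mul]
    have := jb_rpow_pos z (-2)
    have := jb_rpow_pos ξ n₁
    refine add_le_add ((hC1 i θ hθ x' ξ z).trans ?_) ((hC2 i θ hθ x' ξ z).trans ?_)
    · have := jb_local hx' (m₂ - γ + n₂)
      gcongr
    · have := jb_local hx' (m₂ + (n₂ - γ))
      gcongr
  · have h1 := (ha.hasDerivAt_kern hm i x z).mul_const (ep (-(z * ξ)))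
    have h2 := (hb.hasDerivAt_x i (x - θ * z) ξ).comp_sub_const x (θ * z)
    exact h1.mul h2

lemma SG.hasDerivAt_cmp_xi (ha : SG γ m₁ m₂ a) (hγ : 0 ≤ γ) (hm : m₁ ≤ -2) (hb : SG γ n₁ n₂ b)
    (i : ι) {θ : ℝ} (hθ : |θ| ≤ 2) (x ξ : ℝ) :
    HasDerivAt (fun ξ => cps θ (a i) (b i) x ξ)
      (cps θ (_root_.dXi (a i)) (b i) x ξ + cps θ (a i) (_root_.dXi (b i)) x ξ) ξ := by
  have hm' : m₁ - γ ≤ -2 := by linarith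
  obtain ⟨C, hC0, hC⟩ := ha.cmp_integrand_bdd hγ hm hb
  obtain ⟨C₁, hC10, hC1⟩ := ha.dXi.cmp_integrand_bdd hγ hm' hb
  obtain ⟨C₂, hC20, hC2⟩ := ha.cmp_integrand_bdd hγ hm hb.dXi
  rw [← ha.dXi.cmp_add_integral hγ hm' hb ha hm hb.dXi i hθ x ξ]
  refine hasDerivAt_integral_of_jb_bound
    (F := fun ξ z => kern (a i) x z * ep (-(z * ξ)) * b i (x - θ * z) ξ)
    (F' := fun ξ z => kern (_root_.dXi (a i)) x z * ep (-(z * ξ)) * b i (x - θ * z) ξ +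
      kern (a i) x z * ep (-(z * ξ)) * _root_.dXi (b i) (x - θ * z) ξ)
    (C := C₁ * (4 ^ |n₁| * jb ξ ^ n₁) * jb x ^ (m₂ + n₂) +
      C₂ * (4 ^ |n₁ - γ| * jb ξ ^ (n₁ - γ)) * jb x ^ (m₂ + n₂))
    (fun ξ => ha.continuous_cmp_integrand hm hb i θ x ξ)
    ((ha.dXi.continuous_cmp_integrand hm' hb i θ x ξ).add
      (ha.continuous_cmp_integrand hm hb.dXi i θ x ξ)) (hC i θ hθ x ξ) (fun ξ' hξ' z => ?_)
    (fun ξ z => ?_)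
  · refine (norm_add_le _ _).trans ?_
    rw [add_mul]
    have := jb_rpow_pos z (-2)
    have := jb_rpow_pos x (m₂ + n₂)
    refine add_le_add ((hC1 i θ hθ x ξ' z).trans ?_) ((hC2 i θ hθ x ξ' z).trans ?_)
    · have := jb_local hξ' n₁
      gcongr
    · have := jb_local hξ' (n₁ - γ)
      gcongr
  · have h1 := hasDerivAt_ep_mul (-z) ξ
    simp only [neg_mul] at h1
    refine ((h1.const_mul (kern (a i) x z)).mul (hb.hasDerivAt_xi i (x - θ * z) ξ)).congr_deriv ?_
    have h3 := ha.mul_kern hγ hm i x z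
    push_cast
    linear_combination (-Complex.I * ep (-(z * ξ)) * b i (x - θ * z) ξ) * h3 +
      (-kern (_root_.dXi (a i)) x z * ep (-(z * ξ)) * b i (x - θ * z) ξ) * Complex.I_sq

lemma SG.hasDerivAt_cmp_theta (ha : SG γ m₁ m₂ a) (hγ : 0 ≤ γ) (hm : m₁ ≤ -2)
    (hb : SG γ n₁ n₂ b) (i : ι) {θ : ℝ} (hθ : |θ| ≤ 1) (x ξ : ℝ) :
    HasDerivAt (fun θ => cps θ (a i) (b i) x ξ)
      (-Complex.I * cps θ (_root_.dXi (a i)) (_root_.dX (b i)) x ξ) θ := by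
  have hm' : m₁ - γ ≤ -2 := by linarith
  obtain ⟨C, hC0, hC⟩ := ha.cmp_integrand_bdd hγ hm hb
  obtain ⟨C₁, hC10, hC1⟩ := ha.dXi.cmp_integrand_bdd hγ hm' hb.dX
  unfold cps
  rw [← integral_const_mul]
  refine hasDerivAt_integral_of_jb_bound
    (F := fun θ z => kern (a i) x z * ep (-(z * ξ)) * b i (x - θ * z) ξ)
    (F' := fun θ z => -Complex.I *
      (kern (_root_.dXi (a i)) x z * ep (-(z * ξ)) * _root_.dX (b i) (x - θ * z) ξ))
    (C := C₁ * jb ξ ^ n₁ * jb x ^ (m₂ + (n₂ - γ)))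
    (fun θ => ha.continuous_cmp_integrand hm hb i θ x ξ)
    (continuous_const.mul (ha.dXi.continuous_cmp_integrand hm' hb.dX i θ x ξ))
    (hC i θ (by linarith) x ξ) (fun θ' hθ' z => ?_) (fun θ z => ?_)
  · rw [norm_mul, norm_neg, Complex.norm_I, one_mul]
    exact hC1 i θ' (by have := abs_add_le (θ' - θ) θ; rw [sub_add_cancel] at this; linarith) x ξ z
  · have h1 : HasDerivAt (fun θ : ℝ => x - θ * z) (-z) θ := by
      simpa using ((hasDerivAt_id θ).mul_const z).const_sub x
    have h2 := (hb.hasDerivAt_x i (x - θ * z) ξ).scomp θ h1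
    refine (h2.const_mul (kern (a i) x z * ep (-(z * ξ)))).congr_deriv ?_
    have h3 := ha.mul_kern hγ hm i x z
    rw [Complex.real_smul]
    push_cast
    linear_combination (-ep (-(z * ξ)) * _root_.dX (b i) (x - θ * z) ξ) * h3

lemma SG.cmp_zero (ha : SG γ m₁ m₂ a) (hγ : 0 ≤ γ) (hm : m₁ ≤ -2) (b : ℝ → ℝ → ℂ)
    (i : ι) (x ξ : ℝ) : cps 0 (a i) b x ξ = a i x ξ * b x ξ := by
  simp only [cps, zero_mul, sub_zero]
  rw [integral_mul_const, ha.integral_kern hγ hm]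

lemma SG.hasDerivAt_kern_z (ha : SG γ m₁ m₂ a) (hm : m₁ ≤ -3) (i : ι) (x z : ℝ) :
    HasDerivAt (kern (a i) x) (kern (fun x ξ => Complex.I * ξ * a i x ξ) x z) z := by
  obtain ⟨C, hC0, hC⟩ := ha.bdd.mono hm le_rfl
  have hc := ha.continuous_xi i x
  have key : ∀ z ξ, ‖Complex.I * ξ * ep (z * ξ) * a i x ξ‖ ≤ C * jb x ^ m₂ * jb ξ ^ (-2 : ℝ) := by
    intro z ξ
    rw [norm_mul, norm_mul, norm_mul, Complex.norm_I, norm_ep, Complex.norm_real, one_mul, mul_one,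
      Real.norm_eq_abs]
    have := abs_le_jb ξ
    have h2 := hC i x ξ
    have p := jb_pos ξ
    calc |ξ| * ‖a i x ξ‖ ≤ jb ξ * (C * jb ξ ^ (-3 : ℝ) * jb x ^ m₂) := by gcongr
      _ = C * jb x ^ m₂ * (jb ξ ^ (1 : ℝ) * jb ξ ^ (-3 : ℝ)) := by rw [Real.rpow_one]; ring
      _ = _ := by rw [← jb_rpow_add]; norm_num
  have := hasDerivAt_integral_of_jb_bound (x₀ := z) (F := fun z ξ => ep (z * ξ) * a i x ξ)
    (F' := fun z ξ => Complex.I * ξ * ep (z * ξ) * a i x ξ) (C₀ := C * jb x ^ m₂)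
    (C := C * jb x ^ m₂)
    (fun z => by fun_prop) (by fun_prop) (fun ξ => ?_) (fun z _ ξ => key z ξ) (fun z ξ => ?_)
  · refine (this.const_mul (((2 * π)⁻¹ : ℝ) : ℂ)).congr_deriv ?_
    unfold kern
    congr 2
    ext ξ
    ring
  · rw [norm_ep_mul]
    refine (hC i x ξ).trans ?_
    have := jb_rpow_mono ξ (by norm_num : (-3 : ℝ) ≤ -2)
    have := jb_rpow_pos x m₂
    calc _ ≤ C * jb ξ ^ (-2 : ℝ) * jb x ^ m₂ := by gcongr
      _ = _ := by ring
  · have h := hasDerivAt_ep_mul ξ z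
    simp only [mul_comm ξ] at h
    exact h.mul_const _

lemma SG.mul_one_add_xi (ha : SG γ m₁ m₂ a) (hγ : γ ≤ 1) :
    SG γ (m₁ + 1) m₂ (fun i x ξ => (1 + Complex.I * ξ) * a i x ξ) := by
  have h : SG 1 1 0 (fun (_ : ι) (_ : ℝ) (ξ : ℝ) => 1 + Complex.I * (ξ : ℂ)) :=
    ((SG.const 1).le (by norm_num) le_rfl).add (SG.xi.const_mul _)
  have := (h.mono hγ le_rfl le_rfl).mul ha
  rwa [zero_add, add_comm 1] at this

end cps

section cps

variable {γ m₁ m₂ n₁ n₂ : ℝ} {a b : ι → ℝ → ℝ → ℂ}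

lemma SG.cmp_add_left {m₁' m₂' : ℝ} {a' : ι → ℝ → ℝ → ℂ}
    (ha : SG γ m₁ m₂ a) (hγ : 0 ≤ γ) (hm : m₁ ≤ -2)
    (ha' : SG γ m₁' m₂' a') (hm' : m₁' ≤ -2) (hb : SG γ n₁ n₂ b)
    (i : ι) {θ : ℝ} (hθ : |θ| ≤ 2) (x ξ : ℝ) :
    cps θ (fun x ξ => a i x ξ + a' i x ξ) (b i) x ξ =
      cps θ (a i) (b i) x ξ + cps θ (a' i) (b i) x ξ := by
  rw [← ha.cmp_add_integral hγ hm hb ha' hm' hb i hθ]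
  unfold cps
  congr 1
  ext z
  have : kern (fun x ξ => a i x ξ + a' i x ξ) x z = kern (a i) x z + kern (a' i) x z := by
    unfold kern
    rw [← mul_add, ← integral_add (ha.integrable_ep_mul hm i x z)
      (ha'.integrable_ep_mul hm' i x z)]
    simp_rw [mul_add]
  rw [this]
  ring

lemma SG.cmp_mul_xi (ha : SG γ m₁ m₂ a) (hγ : 0 ≤ γ) (hγ1 : γ ≤ 1) (hm : m₁ ≤ -3)
    (hb : SG γ n₁ n₂ b) (i : ι) {θ : ℝ} (hθ : |θ| ≤ 2) (x ξ : ℝ) :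
    (1 + Complex.I * ξ) * cps θ (a i) (b i) x ξ =
      cps θ (fun x ξ => (1 + Complex.I * ξ) * a i x ξ) (b i) x ξ -
        θ * cps θ (a i) (_root_.dX (b i)) x ξ := by
  have hm2 : m₁ ≤ -2 := by linarith
  have ha1 : SG γ (m₁ + 1) m₂ (fun i x ξ => Complex.I * ξ * a i x ξ) := by
    have := ((SG.xi (ι := ι)).const_mul Complex.I).mono hγ1 le_rfl le_rfl |>.mul ha
    rwa [zero_add, add_comm 1] at this
  have hm1 : m₁ + 1 ≤ -2 := by linarith
  have e1 : (fun x (ξ : ℝ) => (1 + Complex.I * ξ) * a i x ξ) =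
      fun x ξ => a i x ξ + Complex.I * ξ * a i x ξ := by ext x ξ; ring
  rw [e1, SG.cmp_add_left ha hγ hm2 ha1 hm1 hb i hθ x ξ]
  have I1 := (ha.integrable_cmp_integrand hγ hm2 hb i hθ x ξ).const_mul (Complex.I * ξ)
  have I2 := ha1.integrable_cmp_integrand hγ hm1 hb i hθ x ξ
  have I3 := (ha.integrable_cmp_integrand hγ hm2 hb.dX i hθ x ξ).const_mul (θ : ℂ)
  have key : ∫ z, (kern (fun x ξ => Complex.I * ξ * a i x ξ) x z * ep (-(z * ξ)) *
      b i (x - θ * z) ξ - Complex.I * ξ * (kern (a i) x z * ep (-(z * ξ)) * b i (x - θ * z) ξ) -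
      θ * (kern (a i) x z * ep (-(z * ξ)) * _root_.dX (b i) (x - θ * z) ξ)) = 0 := by
    refine integral_eq_zero_of_hasDerivAt_of_integrable
      (f := fun z => kern (a i) x z * ep (-(z * ξ)) * b i (x - θ * z) ξ) (fun z => ?_)
      ((I2.sub I1).sub I3) (ha.integrable_cmp_integrand hγ hm2 hb i hθ x ξ)
    have h1 := ha.hasDerivAt_kern_z hm i x z
    have h2 := hasDerivAt_ep_mul (-ξ) z
    have h4 : HasDerivAt (fun z : ℝ => x - θ * z) (-θ) z := by
      simpa using ((hasDerivAt_id z).const_mul θ).const_sub x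
    have h3 := (hb.hasDerivAt_x i (x - θ * z) ξ).scomp z h4
    have e : (fun z : ℝ => ep (-ξ * z)) = fun z => ep (-(z * ξ)) := by
      ext z; congr 1; ring
    rw [e] at h2
    refine ((h1.mul h2).mul h3).congr_deriv ?_
    rw [Complex.real_smul, show -ξ * z = -(z * ξ) by ring]
    simp only [Function.comp_apply, Pi.mul_apply]
    push_cast
    ring
  have e2 := integral_sub (I2.sub I1) I3
  simp only [Pi.sub_apply] at e2
  rw [e2, integral_sub I2 I1, integral_const_mul, integral_const_mul] at key
  unfold cps at *
  linear_combination -key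

lemma norm_one_add_I_mul (ξ : ℝ) : ‖1 + Complex.I * ξ‖ = jb ξ := by
  rw [Complex.norm_def, jb, Complex.normSq_apply]
  simp
  ring_nf

lemma SG.cmp_lossy_aux (k : ℕ) (hγ : 0 ≤ γ) (hγ1 : γ ≤ 1) : ∀ {m₁ n₂ : ℝ}
    {a b : ι → ℝ → ℝ → ℂ}, SG γ m₁ m₂ a → m₁ ≤ -2 - k → SG γ n₁ n₂ b →
    ∃ C, 0 ≤ C ∧ ∀ i θ, |θ| ≤ 1 → ∀ x ξ,
      ‖cps θ (a i) (b i) x ξ‖ ≤ C * jb ξ ^ (n₁ - k) * jb x ^ (m₂ + n₂) := by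
  induction k with
  | zero =>
    intro m₁ n₂ a b ha hm hb
    obtain ⟨C, hC, h⟩ := ha.cmp_bdd hγ (by simpa using hm) hb
    exact ⟨C, hC, fun i θ hθ x ξ => by simpa using h i θ (by linarith) x ξ⟩
  | succ k ih =>
    intro m₁ n₂ a b ha hm hb
    push_cast at hm
    obtain ⟨C, hC, h⟩ := ih (ha.mul_one_add_xi hγ1) (by linarith) hb
    obtain ⟨D, hD, h'⟩ := ih ha (by linarith) (hb.dX.le le_rfl (by linarith : n₂ - γ ≤ n₂))
    refine ⟨C + D, by positivity, fun i θ hθ x ξ => ?_⟩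
    have e := ha.cmp_mul_xi hγ hγ1 (by linarith [(Nat.cast_nonneg k : (0:ℝ) ≤ k)]) hb i
      (by linarith : |θ| ≤ 2) x ξ
    have h1 := h i θ hθ x ξ
    have h2 := h' i θ hθ x ξ
    have h3 := norm_sub_le (cps θ (fun x ξ => (1 + Complex.I * ξ) * a i x ξ) (b i) x ξ)
        (θ * cps θ (a i) (_root_.dX (b i)) x ξ)
    rw [← e, norm_mul, norm_mul, norm_one_add_I_mul, Complex.norm_real, Real.norm_eq_abs] at h3
    have h4 : |θ| * ‖cps θ (a i) (_root_.dX (b i)) x ξ‖ ≤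
        1 * ‖cps θ (a i) (_root_.dX (b i)) x ξ‖ := by gcongr
    have h5 : jb ξ * jb ξ ^ (n₁ - (k + 1 : ℕ)) = jb ξ ^ (n₁ - k) := by
      nth_rewrite 1 [← Real.rpow_one (jb ξ)]
      rw [← jb_rpow_add]
      congr 1; push_cast; ring
    refine le_of_mul_le_mul_left ?_ (jb_pos ξ)
    rw [one_mul] at h4
    calc _ ≤ _ := h3.trans (add_le_add h1 (h4.trans h2))
      _ = (C + D) * jb ξ ^ (n₁ - k) * jb x ^ (m₂ + n₂) := by ring
      _ = _ := by rw [← h5]; ring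

lemma SG.cmp_lossy_bdd (ha : SG γ m₁ m₂ a) (hγ : 0 ≤ γ) (hγ1 : γ ≤ 1) (hm : m₁ ≤ -2)
    (hb : SG γ n₁ n₂ b) :
    ∃ C, 0 ≤ C ∧ ∀ i θ, |θ| ≤ 1 → ∀ x ξ,
      ‖cps θ (a i) (b i) x ξ‖ ≤ C * jb ξ ^ (m₁ + n₁ + 3) * jb x ^ (m₂ + n₂) := by
  have h0 : 0 ≤ -2 - m₁ := by linarith
  obtain ⟨C, hC, h⟩ := SG.cmp_lossy_aux ⌊-2 - m₁⌋₊ hγ hγ1 ha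
    (by linarith [Nat.floor_le h0]) hb
  refine ⟨C, hC, fun i θ hθ x ξ => (h i θ hθ x ξ).trans ?_⟩
  have := jb_rpow_pos x (m₂ + n₂)
  have := jb_rpow_mono ξ (show n₁ - ⌊-2 - m₁⌋₊ ≤ m₁ + n₁ + 3 by
    linarith [Nat.lt_floor_add_one (-2 - m₁)])
  gcongr

/-- Composition of symbols with a fixed loss of three orders in `ξ`. -/
theorem SG.cmp_lossy (ha : SG γ m₁ m₂ a) (hγ : 0 ≤ γ) (hγ1 : γ ≤ 1) (hm : m₁ ≤ -2)
    (hb : SG γ n₁ n₂ b) :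
    SG γ (m₁ + n₁ + 3) (m₂ + n₂) (fun i => cps 1 (a i) (b i)) := by
  refine SG.of_class (fun p q d => ∃ m₁ m₂ n₁ n₂ a b, SG γ m₁ m₂ a ∧ SG γ n₁ n₂ b ∧ m₁ ≤ -2 ∧
    p = m₁ + n₁ + 3 ∧ q = m₂ + n₂ ∧ d = fun i => cps 1 (a i) (b i)) ?_ ?_ ?_
    ⟨m₁, m₂, n₁, n₂, a, b, ha, hb, hm, rfl, rfl, rfl⟩
  · rintro p q _ ⟨m₁, m₂, n₁, n₂, a, b, ha, hb, hm, rfl, rfl, rfl⟩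
    obtain ⟨C, hC, h⟩ := ha.cmp_lossy_bdd hγ hγ1 hm hb
    exact ⟨C, hC, fun i => h i 1 (by simp)⟩
  · rintro p q _ ⟨m₁, m₂, n₁, n₂, a, b, ha, hb, hm, rfl, rfl, rfl⟩
    exact ⟨_, _, ⟨_, _, _, _, _, _, ha.dXi, hb, by linarith, by ring, rfl, rfl⟩,
      ⟨_, _, _, _, _, _, ha, hb.dXi, hm, by ring, rfl, rfl⟩,
      fun i x ξ => ha.hasDerivAt_cmp_xi hγ hm hb i (by norm_num) x ξ⟩
  · rintro p q _ ⟨m₁, m₂, n₁, n₂, a, b, ha, hb, hm, rfl, rfl, rfl⟩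
    exact ⟨_, _, ⟨_, _, _, _, _, _, ha.dX, hb, hm, rfl, by ring, rfl⟩,
      ⟨_, _, _, _, _, _, ha, hb.dX, hm, rfl, by ring, rfl⟩,
      fun i x ξ => ha.hasDerivAt_cmp_x hγ hm hb i (by norm_num) x ξ⟩

end cps

/-! ### Asymptotic expansion of the composition -/

/-- The first `N` terms of the asymptotic expansion of a composition. -/
def expn (θ : ℝ) (N : ℕ) (a b : ℝ → ℝ → ℂ) : ℝ → ℝ → ℂ := fun x ξ =>
  ∑ j ∈ Finset.range N, (-Complex.I * θ) ^ j / (j.factorial : ℂ) *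
    (dXi^[j] a x ξ * dX^[j] b x ξ)

section expn

variable {m₁ m₂ n₁ n₂ : ℝ} {a b : ι → ℝ → ℝ → ℂ}

lemma SmoothSym.dXi_iterate_dX {a : ℝ → ℝ → ℂ} (h : SmoothSym a) (n : ℕ) :
    _root_.dXi (_root_.dX^[n] a) = _root_.dX^[n] (_root_.dXi a) := by
  induction n generalizing a with
  | zero => rfl
  | succ n ih => rw [Function.iterate_succ_apply, ih h.dX, ← h.dX_dXi, Function.iterate_succ_apply]

lemma hasDerivAt_expn_x {a b : ℝ → ℝ → ℂ} (ha : SmoothSym a) (hb : SmoothSym b) (θ : ℝ) (N : ℕ)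
    (x ξ : ℝ) : HasDerivAt (fun x => expn θ N a b x ξ)
      (expn θ N (dX a) b x ξ + expn θ N a (dX b) x ξ) x := by
  unfold expn
  rw [← Finset.sum_add_distrib]
  refine HasDerivAt.fun_sum fun j _ => ?_
  refine ((((ha.iterate_dXi j).hasDerivAt_x x ξ).mul
    ((hb.iterate_dX j).hasDerivAt_x x ξ)).const_mul _).congr_deriv ?_
  rw [ha.dX_iterate_dXi, ← Function.iterate_succ_apply' dX, Function.iterate_succ_apply]
  ring

lemma hasDerivAt_expn_xi {a b : ℝ → ℝ → ℂ} (ha : SmoothSym a) (hb : SmoothSym b) (θ : ℝ) (N : ℕ)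
    (x ξ : ℝ) : HasDerivAt (fun ξ => expn θ N a b x ξ)
      (expn θ N (dXi a) b x ξ + expn θ N a (dXi b) x ξ) ξ := by
  unfold expn
  rw [← Finset.sum_add_distrib]
  refine HasDerivAt.fun_sum fun j _ => ?_
  refine ((((ha.iterate_dXi j).hasDerivAt_xi x ξ).mul
    ((hb.iterate_dX j).hasDerivAt_xi x ξ)).const_mul _).congr_deriv ?_
  rw [hb.dXi_iterate_dX, ← Function.iterate_succ_apply' dXi, Function.iterate_succ_apply]
  ring

lemma hasDerivAt_expn_theta (a b : ℝ → ℝ → ℂ) (θ : ℝ) (N : ℕ)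
    (x ξ : ℝ) : HasDerivAt (fun θ => expn θ (N + 1) a b x ξ)
      (-Complex.I * expn θ N (dXi a) (dX b) x ξ) θ := by
  unfold expn
  simp_rw [Finset.sum_range_succ' _ N, Finset.mul_sum]
  simp only [pow_zero]
  refine HasDerivAt.add_const _ (HasDerivAt.fun_sum fun j _ => ?_)
  have h1 : HasDerivAt (fun θ : ℝ => -Complex.I * (θ : ℂ)) (-Complex.I) θ := by
    simpa using (Complex.ofRealCLM.hasDerivAt (x := θ)).const_mul (-Complex.I)
  refine (((h1.pow (j + 1)).div_const _).mul_const _).congr_deriv ?_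
  simp only [Function.iterate_succ_apply, Nat.factorial_succ, Nat.add_sub_cancel]
  have : ((j + 1 : ℕ) : ℂ) ≠ 0 := by exact_mod_cast j.succ_ne_zero
  have h2 : ((j.factorial : ℕ) : ℂ) ≠ 0 := by exact_mod_cast j.factorial_ne_zero
  push_cast at *
  field_simp

lemma expn_zero_theta (a b : ℝ → ℝ → ℂ) (N : ℕ) (x ξ : ℝ) :
    expn 0 (N + 1) a b x ξ = a x ξ * b x ξ := by
  simp [expn, Finset.sum_range_succ']

lemma SG.cmp_sub_expn_bdd (N : ℕ) : ∀ {m₁ n₂ : ℝ} {a b : ι → ℝ → ℝ → ℂ}, SG 1 m₁ m₂ a → m₁ ≤ -2 →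
    SG 1 n₁ n₂ b → ∃ C, 0 ≤ C ∧ ∀ i, ∀ θ ∈ Set.Icc (0:ℝ) 1, ∀ x ξ,
      ‖cps θ (a i) (b i) x ξ - expn θ N (a i) (b i) x ξ‖ ≤
        C * jb ξ ^ (m₁ + n₁ + 3 - N) * jb x ^ (m₂ + n₂ - N) := by
  induction N with
  | zero =>
    intro m₁ n₂ a b ha hm hb
    obtain ⟨C, hC, h⟩ := ha.cmp_lossy_bdd zero_le_one le_rfl hm hb
    refine ⟨C, hC, fun i θ hθ x ξ => ?_⟩
    simpa [expn] using h i θ (abs_le.2 ⟨by linarith [hθ.1], hθ.2⟩) x ξ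
  | succ N ih =>
    intro m₁ n₂ a b ha hm hb
    obtain ⟨C, hC, h⟩ := ih ha.dXi (by linarith) hb.dX
    refine ⟨C, hC, fun i θ hθ x ξ => ?_⟩
    have hd : ∀ s ∈ Set.Icc (0:ℝ) 1, HasDerivWithinAt
        (fun s => cps s (a i) (b i) x ξ - expn s (N + 1) (a i) (b i) x ξ)
        (-Complex.I * (cps s (_root_.dXi (a i)) (_root_.dX (b i)) x ξ -
          expn s N (_root_.dXi (a i)) (_root_.dX (b i)) x ξ)) (Set.Icc 0 1) s := by
      intro s hs
      rw [mul_sub]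
      exact ((ha.hasDerivAt_cmp_theta zero_le_one hm hb i
        (abs_le.2 ⟨by linarith [hs.1], hs.2⟩) x ξ).sub
        (hasDerivAt_expn_theta _ _ s N x ξ)).hasDerivWithinAt
    have := (convex_Icc (0:ℝ) 1).norm_image_sub_le_of_norm_hasDerivWithin_le hd
      (C := C * jb ξ ^ (m₁ - 1 + n₁ + 3 - N) * jb x ^ (m₂ + (n₂ - 1) - N)) (fun s hs => by
        rw [norm_mul, norm_neg, Complex.norm_I, one_mul]; exact h i s hs x ξ)
      (Set.left_mem_Icc.2 zero_le_one) hθ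
    rw [ha.cmp_zero zero_le_one hm, expn_zero_theta, sub_self, sub_zero, sub_zero,
      Real.norm_eq_abs, abs_of_nonneg hθ.1] at this
    have p1 := jb_rpow_pos ξ (m₁ - 1 + n₁ + 3 - N)
    have p2 := jb_rpow_pos x (m₂ + (n₂ - 1) - N)
    refine this.trans ((mul_le_of_le_one_right (by positivity) hθ.2).trans_eq ?_)
    rw [show m₁ - 1 + n₁ + 3 - (N : ℝ) = m₁ + n₁ + 3 - (N + 1 : ℕ) by push_cast; ring,
      show m₂ + (n₂ - 1) - (N : ℝ) = m₂ + n₂ - (N + 1 : ℕ) by push_cast; ring]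

lemma SG.cmp_sub_expn_lossy (ha : SG 1 m₁ m₂ a) (hm : m₁ ≤ -2) (hb : SG 1 n₁ n₂ b) (N : ℕ) :
    SG 1 (m₁ + n₁ + 3 - N) (m₂ + n₂ - N)
      (fun i x ξ => cps 1 (a i) (b i) x ξ - expn 1 N (a i) (b i) x ξ) := by
  refine SG.of_class (fun p q d => ∃ m₁ m₂ n₁ n₂ a b, SG 1 m₁ m₂ a ∧ SG 1 n₁ n₂ b ∧ m₁ ≤ -2 ∧
    p = m₁ + n₁ + 3 - N ∧ q = m₂ + n₂ - N ∧
    d = fun i x ξ => cps 1 (a i) (b i) x ξ - expn 1 N (a i) (b i) x ξ) ?_ ?_ ?_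
    ⟨m₁, m₂, n₁, n₂, a, b, ha, hb, hm, rfl, rfl, rfl⟩
  · rintro p q _ ⟨m₁, m₂, n₁, n₂, a, b, ha, hb, hm, rfl, rfl, rfl⟩
    obtain ⟨C, hC, h⟩ := ha.cmp_sub_expn_bdd N hm hb
    exact ⟨C, hC, fun i => h i 1 (by simp)⟩
  · rintro p q _ ⟨m₁, m₂, n₁, n₂, a, b, ha, hb, hm, rfl, rfl, rfl⟩
    refine ⟨_, _, ⟨_, _, _, _, _, _, ha.dXi, hb, by linarith, by ring, rfl, rfl⟩,
      ⟨_, _, _, _, _, _, ha, hb.dXi, hm, by ring, rfl, rfl⟩, fun i x ξ => ?_⟩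
    exact ((ha.hasDerivAt_cmp_xi zero_le_one hm hb i (by norm_num) x ξ).sub
      (hasDerivAt_expn_xi (ha.smooth i) (hb.smooth i) 1 N x ξ)).congr_deriv (by ring)
  · rintro p q _ ⟨m₁, m₂, n₁, n₂, a, b, ha, hb, hm, rfl, rfl, rfl⟩
    refine ⟨_, _, ⟨_, _, _, _, _, _, ha.dX, hb, hm, rfl, by ring, rfl⟩,
      ⟨_, _, _, _, _, _, ha, hb.dX, hm, rfl, by ring, rfl⟩, fun i x ξ => ?_⟩
    exact ((ha.hasDerivAt_cmp_x zero_le_one hm hb i (by norm_num) x ξ).sub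
      (hasDerivAt_expn_x (ha.smooth i) (hb.smooth i) 1 N x ξ)).congr_deriv (by ring)

lemma SG.expn_term (ha : SG 1 m₁ m₂ a) (hb : SG 1 n₁ n₂ b) (j : ℕ) :
    SG 1 (m₁ + n₁ - j) (m₂ + n₂ - j) (fun i x ξ => _root_.dXi^[j] (a i) x ξ * _root_.dX^[j] (b i) x ξ) := by
  have := (ha.iterate_dXi j).mul (hb.iterate_dX j)
  exact this.le (by linarith) (by linarith)

/-- The asymptotic expansion holds without loss when it holds with a loss of three orders. -/
lemma SG.sub_expn_of_lossy {c : ι → ℝ → ℝ → ℂ} (ha : SG 1 m₁ m₂ a) (hb : SG 1 n₁ n₂ b)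
    (h : ∀ N : ℕ, SG 1 (m₁ + n₁ + 3 - N) (m₂ + n₂ - N)
      (fun i x ξ => c i x ξ - expn 1 N (a i) (b i) x ξ)) (N : ℕ) :
    SG 1 (m₁ + n₁ - N) (m₂ + n₂ - N)
      (fun i x ξ => c i x ξ - expn 1 N (a i) (b i) x ξ) := by
  have h1 := (h (N + 3)).le (m₁' := m₁ + n₁ - N) (m₂' := m₂ + n₂ - N) (by push_cast; linarith)
    (by push_cast; linarith)
  have h2 : ∀ j ≥ N, SG 1 (m₁ + n₁ - N) (m₂ + n₂ - N) (fun i x ξ =>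
      (-Complex.I * (1 : ℝ)) ^ j / (j.factorial : ℂ) *
      (_root_.dXi^[j] (a i) x ξ * _root_.dX^[j] (b i) x ξ)) := fun j hj =>
    ((ha.expn_term hb j).const_mul _).le (by gcongr) (by gcongr)
  refine (((h1.add (h2 N le_rfl)).add (h2 (N + 1) (by omega))).add
    (h2 (N + 2) (by omega))).congr fun i x ξ => ?_
  unfold expn
  rw [Finset.sum_range_succ, Finset.sum_range_succ, Finset.sum_range_succ]
  ring

theorem SG.cmp_sub_expn (ha : SG 1 m₁ m₂ a) (hm : m₁ ≤ -2) (hb : SG 1 n₁ n₂ b) (N : ℕ) :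
    SG 1 (m₁ + n₁ - N) (m₂ + n₂ - N)
      (fun i x ξ => cps 1 (a i) (b i) x ξ - expn 1 N (a i) (b i) x ξ) :=
  SG.sub_expn_of_lossy ha hb (fun N => ha.cmp_sub_expn_lossy hm hb N) N

end expn

/-! ### Operators on Schwartz functions -/

/-- A class of bounded functions closed under differentiation and multiplication by the variable
consists of Schwartz functions. -/
theorem exists_schwartzMap_of_class (P : (ℝ → ℂ) → Prop)
    (hb : ∀ f, P f → ∃ C, ∀ x, ‖f x‖ ≤ C)
    (hd : ∀ f, P f → ∃ g, P g ∧ ∀ x, HasDerivAt f (g x) x)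
    (hm : ∀ f, P f → P (fun x => x * f x)) {f : ℝ → ℂ} (hf : P f) :
    ∃ F : SchwartzMap ℝ ℂ, ∀ x, F x = f x := by
  have hdd : ∀ f, P f → P (deriv f) ∧ Differentiable ℝ f := by
    intro f hf
    obtain ⟨g, hg, h⟩ := hd f hf
    rw [show deriv f = g from funext fun x => (h x).deriv]
    exact ⟨hg, fun x => (h x).differentiableAt⟩
  have hit : ∀ n : ℕ, P (iteratedDeriv n f) := by
    intro n
    induction n with
    | zero => simpa using hf
    | succ n ih => rw [iteratedDeriv_succ]; exact (hdd _ ih).1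
  have hpow : ∀ (k : ℕ) f, P f → P (fun x => x ^ k * f x) := by
    intro k
    induction k with
    | zero => intro f hf; simpa using hf
    | succ k ih =>
      intro f hf
      have := ih _ (hm f hf)
      refine (congrArg P (funext fun x => ?_)).mp this
      ring
  refine ⟨⟨f, contDiff_of_differentiable_iteratedDeriv fun m _ => (hdd _ (hit m)).2,
    fun k n => ?_⟩, fun x => rfl⟩
  obtain ⟨C, hC⟩ := hb _ (hpow k _ (hit n))
  refine ⟨C, fun x => ?_⟩
  have := hC x
  rw [norm_iteratedFDeriv_eq_norm_iteratedDeriv]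
  rwa [norm_mul, norm_pow, Complex.norm_real] at this

/-- Symbols rapidly decaying in `ξ`. -/
def RapidXi (m : ℝ) (c : ι → ℝ → ℝ → ℂ) : Prop := ∀ N : ℕ, SG 0 (-N : ℝ) m c

lemma RapidXi.mul_sg {m m₁ m₂ γ : ℝ} {c a : ι → ℝ → ℝ → ℂ} (hc : RapidXi m c) (ha : SG γ m₁ m₂ a)
    (hγ : 0 ≤ γ) : RapidXi (m₂ + m) (fun i x ξ => a i x ξ * c i x ξ) := by
  intro N
  obtain ⟨k, hk⟩ := exists_nat_ge m₁
  refine ((ha.mono hγ le_rfl le_rfl).mul (hc (N + k))).le ?_ le_rfl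
  push_cast
  linarith

lemma RapidXi.two {m : ℝ} {c : ι → ℝ → ℝ → ℂ} (hc : RapidXi m c) : SG 0 (-2) m c := by
  simpa using hc 2

lemma RapidXi.dX {m : ℝ} {c : ι → ℝ → ℝ → ℂ} (hc : RapidXi m c) :
    RapidXi m (fun i => _root_.dX (c i)) := fun N => by simpa using (hc N).dX

lemma RapidXi.dXi {m : ℝ} {c : ι → ℝ → ℝ → ℂ} (hc : RapidXi m c) :
    RapidXi m (fun i => _root_.dXi (c i)) := fun N => by simpa using (hc N).dXi

lemma RapidXi.hasDerivAt_diag {m : ℝ} {c : ι → ℝ → ℝ → ℂ} (hc : RapidXi m c) (i : ι) (x : ℝ) :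
    HasDerivAt (fun x => kern (c i) x x)
      (kern (fun x ξ => _root_.dX (c i) x ξ + Complex.I * ξ * c i x ξ) x x) x := by
  have h1 : SG 0 (-2) m (fun i x ξ => _root_.dX (c i) x ξ + Complex.I * ξ * c i x ξ) := by
    have h3 := (hc.mul_sg ((SG.xi (ι := ι)).const_mul Complex.I) zero_le_one).two
    rw [zero_add] at h3
    exact hc.dX.two.add h3
  obtain ⟨C, hC0, hC⟩ := hc.two.xi_bound le_rfl
  obtain ⟨D, hD0, hD⟩ := h1.xi_bound le_rfl
  unfold kern
  refine HasDerivAt.const_mul _ (hasDerivAt_integral_of_jb_bound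
    (F := fun x ξ => ep (x * ξ) * c i x ξ)
    (F' := fun x ξ => ep (x * ξ) * (_root_.dX (c i) x ξ + Complex.I * ξ * c i x ξ))
    (C₀ := C * jb x ^ m) (C := D * (4 ^ |m| * jb x ^ m))
    (fun x => (by fun_prop : Continuous fun ξ => ep (x * ξ)).mul (hc.two.continuous_xi i x))
    ((by fun_prop : Continuous fun ξ => ep (x * ξ)).mul (h1.continuous_xi i x))
    (fun ξ => by rw [norm_ep_mul]; exact hC i x ξ) (fun x' hx' ξ => ?_) (fun x ξ => ?_))
  · rw [norm_ep_mul]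
    refine (hD i x' ξ).trans ?_
    have := jb_rpow_pos ξ (-2)
    have := jb_local hx' m
    gcongr
  · have h := hasDerivAt_ep_mul ξ x
    simp only [mul_comm ξ] at h
    exact (h.mul (hc.two.hasDerivAt_x i x ξ)).congr_deriv (by ring)

lemma RapidXi.exists_diag {m : ℝ} {c : ι → ℝ → ℝ → ℂ} (hc : RapidXi m c) (i : ι) :
    ∃ F : SchwartzMap ℝ ℂ, ∀ x, F x = kern (c i) x x := by
  refine exists_schwartzMap_of_class
    (fun f => ∃ (m : ℝ) (c : ι → ℝ → ℝ → ℂ), RapidXi m c ∧ f = fun x => kern (c i) x x) ?_ ?_ ?_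
    ⟨m, c, hc, rfl⟩
  · rintro _ ⟨m, c, hc, rfl⟩
    obtain ⟨C, -, hC⟩ := hc.two.kern_decay_rpow le_rfl le_rfl (-m)
    refine ⟨C, fun x => (hC i x x).trans_eq ?_⟩
    rw [mul_assoc, ← jb_rpow_add]; simp
  · rintro _ ⟨m, c, hc, rfl⟩
    refine ⟨_, ⟨m, (fun i x ξ => _root_.dX (c i) x ξ + Complex.I * ξ * c i x ξ),
      fun N => ?_, rfl⟩, fun x => hc.hasDerivAt_diag i x⟩
    have h3 := hc.mul_sg ((SG.xi (ι := ι)).const_mul Complex.I) zero_le_one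
    rw [zero_add] at h3
    exact (hc.dX N).add (h3 N)
  · rintro _ ⟨m, c, hc, rfl⟩
    refine ⟨m, (fun i x ξ => Complex.I * _root_.dXi (c i) x ξ), fun N => (hc.dXi N).const_mul _,
      funext fun x => ?_⟩
    rw [hc.two.mul_kern le_rfl le_rfl]
    unfold kern
    rw [mul_left_comm, ← integral_const_mul]
    congr 2
    ext; ring

lemma schwartz_rapidXi (u : SchwartzMap ℝ ℂ) : RapidXi 0 (fun (_ : ι) _ ξ => u ξ) := by
  intro N
  refine SG.of_closed_class (fun p q d => d = (fun _ _ _ => 0) ∨ (p = -N ∧ q = 0 ∧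
    ∃ u : SchwartzMap ℝ ℂ, d = fun _ _ ξ => u ξ)) ?_ ?_ ?_ (Or.inr ⟨rfl, rfl, u, rfl⟩)
  · rintro p q _ (rfl | ⟨rfl, rfl, u, rfl⟩)
    · exact SG.zero.bdd (γ := 0)
    obtain ⟨C, hC⟩ := u.decay 0 0
    obtain ⟨D, hD⟩ := u.decay N 0
    have hC0 := (norm_nonneg _).trans (by simpa using hC.2 0)
    have hD0 : 0 ≤ D := le_trans (by positivity) (hD.2 0)
    refine ⟨2 ^ N * (C + D), by positivity, fun _ _ ξ => ?_⟩
    have h1 := hC.2 ξ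
    have h2 := hD.2 ξ
    simp only [pow_zero, one_mul, norm_iteratedFDeriv_zero] at h1 h2
    have h3 : jb ξ ^ N ≤ 2 ^ N * (1 + |ξ| ^ N) := by
      calc jb ξ ^ N ≤ (1 + |ξ|) ^ N := pow_le_pow_left₀ (jb_pos ξ).le (jb_le ξ) _
        _ ≤ (2 * max 1 |ξ|) ^ N := by
          refine pow_le_pow_left₀ (by positivity) ?_ _
          linarith [le_max_left 1 |ξ|, le_max_right 1 |ξ|]
        _ = 2 ^ N * (max 1 |ξ|) ^ N := mul_pow ..
        _ ≤ _ := by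
          gcongr
          rcases max_choice 1 |ξ| with h | h <;> rw [h]
          · simp
          · simp
    have hj : 0 < jb ξ ^ N := pow_pos (jb_pos ξ) N
    rw [Real.rpow_zero, mul_one, Real.rpow_neg (jb_pos ξ).le, Real.rpow_natCast,
      ← div_eq_mul_inv, le_div_iff₀ hj]
    rw [Real.norm_eq_abs] at h2
    calc ‖u ξ‖ * jb ξ ^ N ≤ ‖u ξ‖ * (2 ^ N * (1 + |ξ| ^ N)) := by gcongr
      _ = 2 ^ N * (‖u ξ‖ + |ξ| ^ N * ‖u ξ‖) := by ring
      _ ≤ _ := by gcongr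
  · rintro p q _ (rfl | ⟨rfl, rfl, u, rfl⟩)
    · exact ⟨_, Or.inl rfl, fun _ _ _ => hasDerivAt_const _ _⟩
    · exact ⟨_, Or.inr ⟨by ring, rfl, SchwartzMap.derivCLM ℂ ℂ u, rfl⟩, fun i x ξ => by
        rw [SchwartzMap.derivCLM_apply]; exact (u.differentiableAt).hasDerivAt⟩
  · rintro p q _ (rfl | ⟨rfl, rfl, u, rfl⟩)
    · exact ⟨_, Or.inl rfl, fun _ _ _ => hasDerivAt_const _ _⟩
    · exact ⟨_, Or.inl rfl, fun _ _ _ => hasDerivAt_const _ _⟩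

lemma exists_schwartz_fourier (u : SchwartzMap ℝ ℂ) :
    ∃ F : SchwartzMap ℝ ℂ, ∀ ξ, F ξ = ∫ y, ep (-(y * ξ)) * u y := by
  have h : RapidXi 0 (fun (_ : Unit) (_ : ℝ) ξ => (2 * π : ℂ) * u (-ξ)) := by
    intro N
    have h1 := schwartz_rapidXi (ι := Unit)
      (SchwartzMap.compCLMOfContinuousLinearEquiv ℂ (ContinuousLinearEquiv.neg ℝ) u) N
    exact (h1.const_mul (2 * π : ℂ)).congr fun _ _ _ => rfl
  obtain ⟨F, hF⟩ := h.exists_diag ()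
  refine ⟨F, fun ξ => ?_⟩
  rw [hF, kern, ← integral_neg_eq_self, ← integral_const_mul]
  congr 1
  ext y
  have : (π : ℂ) ≠ 0 := by exact_mod_cast Real.pi_ne_zero
  rw [neg_neg, show ξ * -y = -(y * ξ) by ring]
  push_cast
  field_simp

/-- The Fourier transform `û(ξ) = ∫ e^{-iyξ} u(y) dy` of a Schwartz function. -/
def hat (u : SchwartzMap ℝ ℂ) : SchwartzMap ℝ ℂ := (exists_schwartz_fourier u).choose

lemma hat_apply (u : SchwartzMap ℝ ℂ) (ξ : ℝ) : hat u ξ = ∫ y, ep (-(y * ξ)) * u y :=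
  (exists_schwartz_fourier u).choose_spec ξ

lemma integrable_ep_mul_schwartz (u : SchwartzMap ℝ ℂ) (ξ : ℝ) :
    Integrable (fun y => ep (-(y * ξ)) * u y) := by
  refine u.integrable.norm.mono' (by have := u.continuous; fun_prop) (Filter.Eventually.of_forall fun y => ?_)
  rw [norm_ep_mul]

lemma hat_add (u v : SchwartzMap ℝ ℂ) (ξ : ℝ) : hat (u + v) ξ = hat u ξ + hat v ξ := by
  simp_rw [hat_apply]
  rw [← integral_add (integrable_ep_mul_schwartz u ξ) (integrable_ep_mul_schwartz v ξ)]
  simp [mul_add]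

lemma hat_smul (c : ℂ) (u : SchwartzMap ℝ ℂ) (ξ : ℝ) : hat (c • u) ξ = c * hat u ξ := by
  simp_rw [hat_apply]
  rw [← integral_const_mul]
  simp [mul_left_comm]

lemma hat_inversion (u : SchwartzMap ℝ ℂ) (x : ℝ) :
    u x = kern (fun _ ξ => hat u ξ) x x := by
  have h1 := (schwartz_rapidXi (ι := Unit) u).two.integral_kern le_rfl le_rfl () 0 x
  rw [← h1, kern, ← integral_neg_eq_self, ← integral_const_mul]
  congr 1
  ext ξ
  rw [hat_apply, kern]
  simp only [neg_mul, neg_neg]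
  rw [mul_comm x, mul_assoc, mul_comm (ep _)]
  congr 3
  ext y
  congr 2
  ring

lemma psdo1_eq (a : ℝ → ℝ → ℂ) (u : SchwartzMap ℝ ℂ) (x : ℝ) :
    psdo1 a (fun y => u y) x = kern (fun x ξ => a x ξ * hat u ξ) x x := by
  unfold psdo1 kern
  congr 2
  ext ξ
  simp only [hat_apply]
  rw [← mul_assoc]
  congr 2
  · rw [ep, Complex.ofReal_mul, mul_assoc, mul_comm Complex.I]
  · ext y; congr 1; rw [ep]; congr 1; push_cast; ring

lemma SG.rapidXi_hat {γ m₁ m₂ : ℝ} {a : ι → ℝ → ℝ → ℂ} (ha : SG γ m₁ m₂ a) (hγ : 0 ≤ γ)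
    (u : SchwartzMap ℝ ℂ) : RapidXi m₂ (fun i x ξ => a i x ξ * hat u ξ) := by
  simpa using (schwartz_rapidXi (ι := ι) (hat u)).mul_sg ha hγ

lemma kern_add {a b : ℝ → ℝ → ℂ} {x z : ℝ} (ha : Integrable fun ξ => ep (z * ξ) * a x ξ)
    (hb : Integrable fun ξ => ep (z * ξ) * b x ξ) :
    kern (fun x ξ => a x ξ + b x ξ) x z = kern a x z + kern b x z := by
  unfold kern
  rw [← mul_add, ← integral_add ha hb]
  simp_rw [mul_add]

lemma kern_const_mul (c : ℂ) (a : ℝ → ℝ → ℂ) (x z : ℝ) :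
    kern (fun x ξ => c * a x ξ) x z = c * kern a x z := by
  unfold kern
  rw [mul_left_comm, ← integral_const_mul c]
  simp only [mul_left_comm c]

open Classical in
/-- The operator with symbol `a` on Schwartz space. -/
def opS (a : ℝ → ℝ → ℂ) : SchwartzMap ℝ ℂ →ₗ[ℂ] SchwartzMap ℝ ℂ :=
  if h : ∃ L : SchwartzMap ℝ ℂ →ₗ[ℂ] SchwartzMap ℝ ℂ, ∀ u x, L u x = psdo1 a (fun y => u y) x
  then h.choose else 0

section opS

variable {γ m₁ m₂ n₁ n₂ : ℝ} {a b : ι → ℝ → ℝ → ℂ}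

theorem SG.opS_apply (ha : SG γ m₁ m₂ a) (hγ : 0 ≤ γ) (i : ι) (u : SchwartzMap ℝ ℂ) (x : ℝ) :
    opS (a i) u x = psdo1 (a i) (fun y => u y) x := by
  have h : ∃ L : SchwartzMap ℝ ℂ →ₗ[ℂ] SchwartzMap ℝ ℂ,
      ∀ u x, L u x = psdo1 (a i) (fun y => u y) x := by
    choose F hF using fun u => (ha.rapidXi_hat hγ u).exists_diag i
    refine ⟨⟨⟨F, fun u v => ?_⟩, fun c u => ?_⟩, fun u x => ?_⟩
    · ext x
      rw [add_apply, hF, hF, hF,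
        ← kern_add ((ha.rapidXi_hat hγ u).two.integrable_ep_mul le_rfl i x x)
          ((ha.rapidXi_hat hγ v).two.integrable_ep_mul le_rfl i x x)]
      simp_rw [hat_add, mul_add]
    · ext x
      simp only [smul_apply, hF, smul_eq_mul, RingHom.id_apply]
      rw [← kern_const_mul]
      simp_rw [hat_smul, mul_left_comm]
    · exact (hF u x).trans (psdo1_eq _ _ _).symm
  rw [opS, dif_pos h]
  exact h.choose_spec u x

lemma SG.opS_kern (ha : SG γ m₁ m₂ a) (hγ : 0 ≤ γ) (i : ι) (u : SchwartzMap ℝ ℂ) (x : ℝ) :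
    opS (a i) u x = kern (fun x ξ => a i x ξ * hat u ξ) x x :=
  (ha.opS_apply hγ i u x).trans (psdo1_eq _ _ _)

lemma SG.opS_add (ha : SG γ m₁ m₂ a) (hγ : 0 ≤ γ) (hb : SG γ n₁ n₂ b) (i : ι) :
    opS (fun x ξ => a i x ξ + b i x ξ) = opS (a i) + opS (b i) := by
  ext u x
  have hab := (ha.le (le_max_left m₁ n₁) (le_max_left m₂ n₂)).add
    (hb.le (le_max_right m₁ n₁) (le_max_right m₂ n₂))
  rw [hab.opS_kern hγ i u x, LinearMap.add_apply, add_apply, ha.opS_kern hγ,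
    hb.opS_kern hγ, ← kern_add ((ha.rapidXi_hat hγ u).two.integrable_ep_mul le_rfl i x x)
      ((hb.rapidXi_hat hγ u).two.integrable_ep_mul le_rfl i x x)]
  simp_rw [add_mul]

lemma SG.opS_const_mul (ha : SG γ m₁ m₂ a) (hγ : 0 ≤ γ) (c : ℂ) (i : ι) :
    opS (fun x ξ => c * a i x ξ) = c • opS (a i) := by
  ext u x
  rw [(ha.const_mul c).opS_kern hγ i u x, LinearMap.smul_apply, smul_apply,
    ha.opS_kern hγ, smul_eq_mul, ← kern_const_mul]
  simp_rw [mul_assoc]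

lemma SG.opS_sub (ha : SG γ m₁ m₂ a) (hγ : 0 ≤ γ) (hb : SG γ n₁ n₂ b) (i : ι) :
    opS (fun x ξ => a i x ξ - b i x ξ) = opS (a i) - opS (b i) := by
  have h1 := ha.opS_add hγ (hb.const_mul (-1)) i
  have h2 := hb.opS_const_mul hγ (-1) i
  rw [sub_eq_add_neg, ← neg_one_smul ℂ, ← h2, ← h1]
  congr 1
  ext
  ring

lemma opS_one : opS (fun _ _ => 1) = LinearMap.id := by
  ext u x
  rw [(SG.const (ι := Unit) (γ := 1) 1).opS_kern zero_le_one () u x, LinearMap.id_apply,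
    hat_inversion u x]
  simp

end opS

section opS_comp

variable {γ m₁ m₂ n₁ n₂ : ℝ} {a b : ι → ℝ → ℝ → ℂ}

theorem SG.integral_kern_mul_opS (ha : SG γ m₁ m₂ a) (hγ : 0 ≤ γ) (hγ1 : γ ≤ 1) (hm : m₁ ≤ -2)
    (hb : SG γ n₁ n₂ b) (i : ι) (u : SchwartzMap ℝ ℂ) (x : ℝ) :
    ∫ z, kern (a i) x z * opS (b i) u (x - z) = opS (cps 1 (a i) (b i)) u x := by
  have hr := hb.rapidXi_hat hγ u
  rw [(ha.cmp_lossy hγ hγ1 hm hb).opS_kern hγ i u x]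
  simp_rw [hb.opS_kern hγ]
  have hr2 := hr.two
  obtain ⟨C, hC0, hC⟩ := hr2.bdd
  obtain ⟨D, hD0, hD⟩ := ha.kern_decay_rpow hγ hm (-2 - |n₂|)
  have hcont : Continuous (fun q : ℝ × ℝ => kern (a i) x q.1 *
      (ep ((x - q.1) * q.2) * (b i (x - q.1) q.2 * hat u q.2))) := by
    have h1 := ha.continuous_kern hm i x
    have h2 := (hb.smooth i).continuous
    have h3 : Continuous fun ξ => hat u ξ := (hat u).continuous
    have h4 : Continuous fun q : ℝ × ℝ => b i (x - q.1) q.2 :=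
      h2.comp (by fun_prop : Continuous fun q : ℝ × ℝ => (x - q.1, q.2))
    have h5 := continuous_ep
    fun_prop
  have hintg : Integrable (fun q : ℝ × ℝ => kern (a i) x q.1 *
      (ep ((x - q.1) * q.2) * (b i (x - q.1) q.2 * hat u q.2))) (volume.prod volume) := by
    refine Integrable.mono' ((integrable_jb_neg_two.mul_prod integrable_jb_neg_two).const_mul
      (D * jb x ^ m₂ * C * (2 ^ |n₂| * jb x ^ |n₂|))) hcont.aestronglyMeasurable
      (Filter.Eventually.of_forall fun q => ?_)
    obtain ⟨z, ξ⟩ := q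
    simp only
    rw [norm_mul, norm_mul, norm_ep, one_mul]
    have h1 := hC i (x - z) ξ
    have h2 := hD i x z
    have h3 : jb (x - z) ^ n₂ ≤ 2 ^ |n₂| * jb x ^ |n₂| * jb z ^ |n₂| := by
      have h4 := peetre n₂ x (-z)
      rw [← sub_eq_add_neg, jb_neg] at h4
      refine h4.trans ?_
      have := jb_rpow_mono x (le_abs_self n₂)
      have := jb_rpow_pos z |n₂|
      gcongr
    have e : jb z ^ (-2 - |n₂|) * jb z ^ |n₂| = jb z ^ (-2 : ℝ) := by
      rw [← jb_rpow_add]; ring_nf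
    have p1 := jb_rpow_pos z (-2 - |n₂|)
    have p2 := jb_rpow_pos x m₂
    have p3 := jb_rpow_pos ξ (-2)
    calc _ ≤ (D * jb x ^ m₂ * jb z ^ (-2 - |n₂|)) * (C * jb ξ ^ (-2 : ℝ) *
          (2 ^ |n₂| * jb x ^ |n₂| * jb z ^ |n₂|)) :=
          mul_le_mul h2 (h1.trans (by gcongr)) (norm_nonneg _) (by positivity)
      _ = D * jb x ^ m₂ * C * (2 ^ |n₂| * jb x ^ |n₂|) *
          ((jb z ^ (-2 - |n₂|) * jb z ^ |n₂|) * jb ξ ^ (-2 : ℝ)) := by ring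
      _ = _ := by rw [e]
  have e1 : ∀ z, kern (a i) x z * kern (fun x ξ => b i x ξ * hat u ξ) (x - z) (x - z) =
      ((2 * π)⁻¹ : ℝ) * ∫ ξ, kern (a i) x z *
        (ep ((x - z) * ξ) * (b i (x - z) ξ * hat u ξ)) := by
    intro z
    rw [integral_const_mul, kern.eq_def (fun x ξ => b i x ξ * hat u ξ)]
    ring
  simp_rw [e1]
  rw [integral_const_mul, integral_integral_swap hintg, kern]
  congr 2
  ext ξ
  rw [cps, ← integral_mul_const, ← integral_const_mul]
  congr 1
  ext z
  rw [show (x - z) * ξ = x * ξ + -(z * ξ) by ring, ep_add, one_mul]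
  ring

lemma SG.opS_eq_integral (ha : SG γ m₁ m₂ a) (hγ : 0 ≤ γ) (hγ1 : γ ≤ 1) (hm : m₁ ≤ -2)
    (i : ι) (u : SchwartzMap ℝ ℂ) (x : ℝ) :
    opS (a i) u x = ∫ z, kern (a i) x z * u (x - z) := by
  have h := ha.integral_kern_mul_opS hγ hγ1 hm (SG.const 1) i u x
  have e : cps 1 (a i) (fun _ _ => 1) = a i := by
    ext x ξ
    simp only [cps, mul_one]
    exact ha.integral_kern hγ hm i x ξ
  rw [e, opS_one] at h
  exact h.symm

theorem SG.opS_comp_cps (ha : SG γ m₁ m₂ a) (hγ : 0 ≤ γ) (hγ1 : γ ≤ 1) (hm : m₁ ≤ -2)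
    (hb : SG γ n₁ n₂ b) (i : ι) (u : SchwartzMap ℝ ℂ) :
    opS (a i) (opS (b i) u) = opS (cps 1 (a i) (b i)) u := by
  ext x
  rw [ha.opS_eq_integral hγ hγ1 hm, ha.integral_kern_mul_opS hγ hγ1 hm hb]

/-- A Fourier multiplier acts on the Fourier side by multiplication. -/
lemma hat_opS {m : ℝ → ℂ} {s : ℝ} (hm : SG γ s 0 (fun (_ : Unit) _ ξ => m ξ)) (hγ : 0 ≤ γ)
    (u : SchwartzMap ℝ ℂ) (ξ : ℝ) : hat (opS (fun _ ξ => m ξ) u) ξ = m ξ * hat u ξ := by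
  have hr := (hm.rapidXi_hat hγ u).two
  have h1 := hr.integral_kern le_rfl le_rfl () 0 ξ
  rw [hat_apply, ← h1]
  congr 1
  ext y
  rw [hm.opS_kern hγ () u y, mul_comm]
  rfl

lemma hasDerivAt_schwartz (u : SchwartzMap ℝ ℂ) (x : ℝ) :
    HasDerivAt u (opS (fun _ ξ => Complex.I * ξ) u x) x := by
  have h1 := (SG.const (ι := Unit) (γ := 1) 1).rapidXi_hat zero_le_one u
  have h2 := h1.hasDerivAt_diag () x
  have e : (fun x => kern (fun _ ξ => 1 * hat u ξ) x x) = u := by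
    ext x
    rw [hat_inversion u x]
    simp
  rw [e] at h2
  refine h2.congr_deriv ?_
  have h3 := (SG.xi (ι := Unit)).const_mul Complex.I
  rw [h3.opS_kern zero_le_one () u x]
  congr 1
  ext x ξ
  simp [_root_.dX]

lemma SG.opS_one_add_xi (hb : SG 1 n₁ n₂ b) (i : ι) (u : SchwartzMap ℝ ℂ) :
    opS (fun _ ξ => 1 + Complex.I * ξ) (opS (b i) u) =
      opS (fun x ξ => (1 + Complex.I * ξ) * b i x ξ + _root_.dX (b i) x ξ) u := by
  have h0 := SG.const (ι := Unit) (γ := 1) 1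
  have h1 := (SG.xi (ι := Unit)).const_mul Complex.I
  have h2 := (h0.le (m₁' := 1) (m₂' := 0) (by norm_num) le_rfl).opS_add zero_le_one h1 ()
  rw [h2, opS_one, LinearMap.add_apply, LinearMap.id_apply]
  ext x
  have hr := hb.rapidXi_hat zero_le_one u
  have h3 := hr.hasDerivAt_diag i x
  have e : (fun x => kern (fun x ξ => b i x ξ * hat u ξ) x x) = opS (b i) u := by
    ext x; rw [hb.opS_kern zero_le_one]
  rw [e] at h3
  have h4 := (hasDerivAt_schwartz (opS (b i) u) x).unique h3
  rw [add_apply, h4, hb.opS_kern zero_le_one]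
  have hb' := (hb.mul_one_add_xi le_rfl).add (hb.dX.le (by linarith : n₁ ≤ n₁ + 1)
    (by linarith : n₂ - 1 ≤ n₂))
  rw [hb'.opS_kern zero_le_one i u x]
  have hi2 : Integrable fun ξ => ep (x * ξ) *
      (_root_.dX (fun x ξ => b i x ξ * hat u ξ) x ξ +
        Complex.I * ξ * (b i x ξ * hat u ξ)) := by
    have h5 : SG 0 (-2) n₂ (fun i x ξ => _root_.dX (fun x ξ => b i x ξ * hat u ξ) x ξ +
        Complex.I * ξ * (b i x ξ * hat u ξ)) := by
      have h3 := (hr.mul_sg ((SG.xi (ι := ι)).const_mul Complex.I) zero_le_one).two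
      rw [zero_add] at h3
      exact hr.dX.two.add h3
    exact h5.integrable_ep_mul le_rfl i x x
  rw [← kern_add (hr.two.integrable_ep_mul le_rfl i x x) hi2]
  congr 1
  ext x ξ
  rw [show _root_.dX (fun x ξ => b i x ξ * hat u ξ) x ξ = _root_.dX (b i) x ξ * hat u ξ from
    ((hb.hasDerivAt_x i x ξ).mul_const _).deriv]
  ring

lemma SG.opS_mul_one_add_xi (ha : SG 1 m₁ m₂ a) (i : ι) (u : SchwartzMap ℝ ℂ) :
    opS (fun x ξ => (1 + Complex.I * ξ) * a i x ξ) u =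
      opS (a i) (opS (fun _ ξ => 1 + Complex.I * ξ) u) := by
  have h : SG 1 1 0 (fun (_ : Unit) (_ : ℝ) (ξ : ℝ) => 1 + Complex.I * (ξ : ℂ)) :=
    ((SG.const 1).le (by norm_num) le_rfl).add (SG.xi.const_mul _)
  ext x
  rw [(ha.mul_one_add_xi le_rfl).opS_kern zero_le_one, ha.opS_kern zero_le_one]
  simp_rw [hat_opS (m := fun ξ => 1 + Complex.I * ξ) h zero_le_one u]
  congr 1
  ext x ξ
  ring

lemma SG.inv_one_add_xi {γ : ℝ} (hγ : γ ≤ 1) :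
    SG γ (-1) 0 (fun (_ : ι) (_ : ℝ) (ξ : ℝ) => (1 + Complex.I * (ξ : ℂ))⁻¹) := by
  have h1 : SG 1 1 0 (fun (_ : ι) (_ : ℝ) (ξ : ℝ) => 1 + (-Complex.I) * (ξ : ℂ)) :=
    ((SG.const 1).le (by norm_num) le_rfl).add (SG.xi.const_mul _)
  have h2 := h1.mul (SG.jb_xi (-2))
  refine (h2.mono hγ (by norm_num) (by norm_num)).congr fun i x ξ => ?_
  have h3 : (1 + Complex.I * (ξ : ℂ)) * (1 + -Complex.I * ξ) = ((jb ξ ^ 2 : ℝ) : ℂ) := by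
    rw [jb_sq]; push_cast; ring_nf; simp
  have h4 : ((jb ξ : ℝ) : ℂ) ≠ 0 := by exact_mod_cast (jb_pos ξ).ne'
  rw [Real.rpow_neg (jb_pos ξ).le, Real.rpow_two]
  have h5 : (1 + Complex.I * (ξ : ℂ)) ≠ 0 := by
    intro h; rw [h, zero_mul] at h3; push_cast at h3; exact pow_ne_zero 2 h4 h3.symm
  rw [eq_comm, ← mul_right_inj' h5, mul_inv_cancel₀ h5, ← mul_assoc, h3]
  push_cast
  field_simp

lemma one_add_xi_ne (ξ : ℝ) : (1 + Complex.I * (ξ : ℂ)) ≠ 0 := by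
  rw [← norm_ne_zero_iff, norm_one_add_I_mul]
  exact (jb_pos ξ).ne'

lemma dXi_iterate_mul_one_add_xi {a : ℝ → ℝ → ℂ} (ha : SmoothSym a) (j : ℕ) :
    dXi^[j] (fun (x ξ : ℝ) => (1 + Complex.I * (ξ : ℂ)) * a x ξ) = fun (x ξ : ℝ) =>
      (1 + Complex.I * (ξ : ℂ)) * dXi^[j] a x ξ + j * Complex.I * dXi^[j - 1] a x ξ := by
  induction j with
  | zero => ext; simp
  | succ j ih =>
    rw [Function.iterate_succ_apply', ih]
    refine hasDerivAt_dXi fun x ξ => ?_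
    have h1 : HasDerivAt (fun ξ : ℝ => 1 + Complex.I * (ξ : ℂ)) Complex.I ξ := by
      simpa using ((Complex.ofRealCLM.hasDerivAt (x := ξ)).const_mul Complex.I).const_add 1
    have h2 := (ha.iterate_dXi j).hasDerivAt_xi x ξ
    have h3 := ((ha.iterate_dXi (j - 1)).hasDerivAt_xi x ξ).const_mul (j * Complex.I)
    refine ((h1.mul h2).add h3).congr_deriv ?_
    rw [← Function.iterate_succ_apply' dXi, ← Function.iterate_succ_apply' dXi]
    rcases j with _ | j
    · simp; ring
    · simp only [Nat.add_sub_cancel, Nat.succ_eq_add_one]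
      push_cast
      ring

lemma dX_iterate_mul_xi {b : ℝ → ℝ → ℂ} (hb : SmoothSym b) (f : ℝ → ℂ) (j : ℕ) :
    dX^[j] (fun x ξ => f ξ * b x ξ + dX b x ξ) = fun x ξ =>
      f ξ * dX^[j] b x ξ + dX^[j + 1] b x ξ := by
  induction j with
  | zero => rfl
  | succ j ih =>
    rw [Function.iterate_succ_apply', ih]
    refine hasDerivAt_dX fun x ξ => ?_
    have h2 := (hb.iterate_dX j).hasDerivAt_x x ξ
    have h3 := (hb.iterate_dX (j + 1)).hasDerivAt_x x ξ
    refine ((h2.const_mul (f ξ)).add h3).congr_deriv ?_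
    rw [← Function.iterate_succ_apply' dX, ← Function.iterate_succ_apply' dX]

lemma expn_mul_one_add_xi {a b : ℝ → ℝ → ℂ} (ha : SmoothSym a) (hb : SmoothSym b) (N : ℕ)
    (x ξ : ℝ) :
    expn 1 (N + 1) a (fun (x ξ : ℝ) => (1 + Complex.I * (ξ : ℂ)) * b x ξ + dX b x ξ) x ξ =
      expn 1 (N + 1) (fun (x ξ : ℝ) => (1 + Complex.I * (ξ : ℂ)) * a x ξ) b x ξ +
        (-Complex.I) ^ N / (N.factorial : ℂ) * (dXi^[N] a x ξ * dX^[N + 1] b x ξ) := by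
  unfold expn
  simp only [dXi_iterate_mul_one_add_xi ha,
    dX_iterate_mul_xi hb (fun ξ : ℝ => 1 + Complex.I * (ξ : ℂ))]
  induction N with
  | zero => simp; ring
  | succ N ih =>
    rw [Finset.sum_range_succ, ih, Finset.sum_range_succ _ (N + 1)]
    have h1 : ((N : ℂ) + 1) ≠ 0 := by exact_mod_cast N.succ_ne_zero
    have h2 : ((N.factorial : ℕ) : ℂ) ≠ 0 := by exact_mod_cast N.factorial_ne_zero
    simp only [Nat.factorial_succ, Nat.add_sub_cancel, Complex.ofReal_one, mul_one]
    push_cast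
    field_simp
    rw [pow_succ (-Complex.I) N]
    ring_nf
    simp only [Complex.I_sq]
    ring

/-- The composition of two operators with `SG` symbols has a symbol with the usual asymptotic
expansion. -/
theorem SG.exists_comp (ha : SG 1 m₁ m₂ a) (hb : SG 1 n₁ n₂ b) :
    ∃ c : ι → ℝ → ℝ → ℂ, (∀ N : ℕ, SG 1 (m₁ + n₁ - N) (m₂ + n₂ - N)
      (fun i x ξ => c i x ξ - expn 1 N (a i) (b i) x ξ)) ∧
      ∀ i u, opS (a i) (opS (b i) u) = opS (c i) u := by
  obtain ⟨k, hk⟩ := exists_nat_ge (m₁ + 2)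
  replace hk : m₁ ≤ -2 + k := by linarith
  induction k generalizing m₁ n₁ a b with
  | zero =>
    have hm : m₁ ≤ -2 := by simpa using hk
    exact ⟨_, fun N => ha.cmp_sub_expn hm hb N,
      fun i u => ha.opS_comp_cps zero_le_one le_rfl hm hb i u⟩
  | succ k ih =>
    have ha' := (SG.inv_one_add_xi (ι := ι) le_rfl).mul ha
    rw [zero_add] at ha'
    have hb' := (hb.mul_one_add_xi le_rfl).add (hb.dX.le (by linarith : n₁ ≤ n₁ + 1)
      (by linarith : n₂ - 1 ≤ n₂))
    obtain ⟨c, hc, hop⟩ := ih ha' hb' (by push_cast at hk; linarith)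
    have ea : ∀ i, (fun (x ξ : ℝ) => (1 + Complex.I * (ξ : ℂ)) *
        ((1 + Complex.I * (ξ : ℂ))⁻¹ * a i x ξ)) = a i := by
      intro i; ext x ξ; rw [mul_inv_cancel_left₀ (one_add_xi_ne ξ)]
    have h1 : ∀ N : ℕ, SG 1 (m₁ + n₁ - (N + 1 : ℕ)) (m₂ + n₂ - (N + 1 : ℕ))
        (fun i x ξ => c i x ξ - expn 1 (N + 1) (a i) (b i) x ξ) := by
      intro N
      have h2 := (((ha'.iterate_dXi N).mul (hb.iterate_dX (N + 1))).const_mul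
        ((-Complex.I) ^ N / (N.factorial : ℂ))).le
        (m₁' := m₁ + n₁ - (N + 1 : ℕ)) (m₂' := m₂ + n₂ - (N + 1 : ℕ))
        (by push_cast; linarith) (by push_cast; linarith)
      refine (((hc (N + 1)).le (by linarith) (by linarith)).add h2).congr fun i x ξ => ?_
      rw [expn_mul_one_add_xi (ha'.smooth i) (hb.smooth i) N x ξ, ea]
      ring
    refine ⟨c, fun N => ?_, fun i u => ?_⟩
    · have h3 := ((ha.expn_term hb N).const_mul
        ((-Complex.I * (1 : ℝ)) ^ N / (N.factorial : ℂ)))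
      refine (((h1 N).le (by push_cast; linarith) (by push_cast; linarith)).add h3).congr
        fun i x ξ => ?_
      unfold expn
      rw [Finset.sum_range_succ]
      ring
    · rw [← hop, ← hb.opS_one_add_xi, ← ha'.opS_mul_one_add_xi, ea]

end opS_comp

/-! ### Symbols with a logarithmic loss and symbols of exponential type -/

/-- Symbols of order `m₁, m₂` up to an arbitrarily small loss in `x`. -/
def SGp (m₁ m₂ : ℝ) (a : ι → ℝ → ℝ → ℂ) : Prop := ∀ ε > 0, SG 1 m₁ (m₂ + ε) a

section SGp

variable {m₁ m₂ n₁ n₂ : ℝ} {a b : ι → ℝ → ℝ → ℂ}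

lemma SG.sgp (ha : SG 1 m₁ m₂ a) : SGp m₁ m₂ a := fun ε hε => ha.le le_rfl (by linarith)

lemma SGp.sg (ha : SGp m₁ m₂ a) (h : m₂ < n₂) : SG 1 m₁ n₂ a := by
  simpa using ha (n₂ - m₂) (by linarith)

lemma SGp.smooth (ha : SGp m₁ m₂ a) (i : ι) : SmoothSym (a i) := (ha 1 one_pos).smooth i

lemma SGp.le (ha : SGp m₁ m₂ a) (h₁ : m₁ ≤ n₁) (h₂ : m₂ ≤ n₂) : SGp n₁ n₂ a :=
  fun ε hε => (ha ε hε).le h₁ (by linarith)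

lemma SGp.congr (ha : SGp m₁ m₂ a) (h : ∀ i x ξ, b i x ξ = a i x ξ) : SGp m₁ m₂ b :=
  fun ε hε => (ha ε hε).congr h

lemma SGp.add (ha : SGp m₁ m₂ a) (hb : SGp m₁ m₂ b) : SGp m₁ m₂ (fun i x ξ => a i x ξ + b i x ξ) :=
  fun ε hε => (ha ε hε).add (hb ε hε)

lemma SGp.sub (ha : SGp m₁ m₂ a) (hb : SGp m₁ m₂ b) : SGp m₁ m₂ (fun i x ξ => a i x ξ - b i x ξ) :=
  fun ε hε => (ha ε hε).sub (hb ε hε)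

lemma SGp.const_mul (ha : SGp m₁ m₂ a) (c : ℂ) : SGp m₁ m₂ (fun i x ξ => c * a i x ξ) :=
  fun ε hε => (ha ε hε).const_mul c

lemma SGp.neg (ha : SGp m₁ m₂ a) : SGp m₁ m₂ (fun i x ξ => -a i x ξ) :=
  fun ε hε => (ha ε hε).neg

lemma SGp.mul (ha : SGp m₁ m₂ a) (hb : SGp n₁ n₂ b) :
    SGp (m₁ + n₁) (m₂ + n₂) (fun i x ξ => a i x ξ * b i x ξ) := fun ε hε =>
  ((ha (ε / 2) (by linarith)).mul (hb (ε / 2) (by linarith))).le le_rfl (by linarith)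

lemma SGp.dX (ha : SGp m₁ m₂ a) : SGp m₁ (m₂ - 1) (fun i => _root_.dX (a i)) :=
  fun ε hε => (ha ε hε).dX.le le_rfl (by linarith)

lemma SGp.dXi (ha : SGp m₁ m₂ a) : SGp (m₁ - 1) m₂ (fun i => _root_.dXi (a i)) :=
  fun ε hε => (ha ε hε).dXi.le le_rfl (by linarith)

lemma SGp.reindex {κ : Type} (ha : SGp m₁ m₂ a) (f : κ → ι) : SGp m₁ m₂ (fun j => a (f j)) :=
  fun ε hε => (ha ε hε).reindex f

end SGp

/-- Phase functions of logarithmic growth. -/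
structure Phase (φ : ι → ℝ → ℝ → ℂ) : Prop where
  smooth : ∀ i, SmoothSym (φ i)
  dx : SGp 0 (-1) (fun i => dX (φ i))
  dxi : SGp (-1) 0 (fun i => dXi (φ i))
  exp_le : ∃ M C : ℝ, 0 ≤ C ∧ ∀ i x ξ, ‖Complex.exp (φ i x ξ)‖ ≤ C * jb x ^ M ∧
    ‖Complex.exp (-φ i x ξ)‖ ≤ C * jb x ^ M

section Phase

variable {m₁ m₂ n₁ n₂ : ℝ} {a b f g : ι → ℝ → ℝ → ℂ} {φ χ : ι → ℝ → ℝ → ℂ}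

lemma dX_neg (a : ℝ → ℝ → ℂ) : dX (fun x ξ => -a x ξ) = fun x ξ => -dX a x ξ := by
  ext x ξ; exact deriv.fun_neg

lemma dXi_neg (a : ℝ → ℝ → ℂ) : dXi (fun x ξ => -a x ξ) = fun x ξ => -dXi a x ξ := by
  ext x ξ; exact deriv.fun_neg

lemma SmoothSym.dX_add {a b : ℝ → ℝ → ℂ} (ha : SmoothSym a) (hb : SmoothSym b) :
    _root_.dX (fun x ξ => a x ξ + b x ξ) = fun x ξ => _root_.dX a x ξ + _root_.dX b x ξ :=
  hasDerivAt_dX fun x ξ => (ha.hasDerivAt_x x ξ).add (hb.hasDerivAt_x x ξ)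

lemma SmoothSym.dXi_add {a b : ℝ → ℝ → ℂ} (ha : SmoothSym a) (hb : SmoothSym b) :
    _root_.dXi (fun x ξ => a x ξ + b x ξ) = fun x ξ => _root_.dXi a x ξ + _root_.dXi b x ξ :=
  hasDerivAt_dXi fun x ξ => (ha.hasDerivAt_xi x ξ).add (hb.hasDerivAt_xi x ξ)

lemma SmoothSym.dX_exp {a : ℝ → ℝ → ℂ} (ha : SmoothSym a) :
    _root_.dX (fun x ξ => Complex.exp (a x ξ)) = fun x ξ => Complex.exp (a x ξ) * _root_.dX a x ξ :=
  hasDerivAt_dX fun x ξ => (ha.hasDerivAt_x x ξ).cexp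

lemma SmoothSym.dXi_exp {a : ℝ → ℝ → ℂ} (ha : SmoothSym a) :
    _root_.dXi (fun x ξ => Complex.exp (a x ξ)) =
      fun x ξ => Complex.exp (a x ξ) * _root_.dXi a x ξ :=
  hasDerivAt_dXi fun x ξ => (ha.hasDerivAt_xi x ξ).cexp

lemma Phase.neg (hφ : Phase φ) : Phase (fun i x ξ => -φ i x ξ) where
  smooth i := ContDiff.neg (hφ.smooth i)
  dx := by simpa only [dX_neg] using hφ.dx.neg
  dxi := by simpa only [dXi_neg] using hφ.dxi.neg
  exp_le := by
    obtain ⟨M, C, hC, h⟩ := hφ.exp_le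
    exact ⟨M, C, hC, fun i x ξ => by simpa using (h i x ξ).symm⟩

lemma Phase.zero : Phase (fun (_ : ι) _ _ => 0) where
  smooth i := contDiff_const
  dx := by
    have : dX (fun _ _ => (0 : ℂ)) = fun _ _ => 0 := by ext; simp [dX]
    rw [this]; exact SG.zero.sgp
  dxi := by
    have : dXi (fun _ _ => (0 : ℂ)) = fun _ _ => 0 := by ext; simp [dXi]
    rw [this]; exact SG.zero.sgp
  exp_le := ⟨0, 1, zero_le_one, by simp⟩

lemma Phase.add (hφ : Phase φ) (hχ : Phase χ) : Phase (fun i x ξ => φ i x ξ + χ i x ξ) where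
  smooth i := ContDiff.add (hφ.smooth i) (hχ.smooth i)
  dx := by
    have : (fun i => dX fun x ξ => φ i x ξ + χ i x ξ) =
      fun i x ξ => dX (φ i) x ξ + dX (χ i) x ξ := by
        ext1 i; exact (hφ.smooth i).dX_add (hχ.smooth i)
    rw [this]; exact hφ.dx.add hχ.dx
  dxi := by
    have : (fun i => dXi fun x ξ => φ i x ξ + χ i x ξ) =
      fun i x ξ => dXi (φ i) x ξ + dXi (χ i) x ξ := by
        ext1 i; exact (hφ.smooth i).dXi_add (hχ.smooth i)
    rw [this]; exact hφ.dxi.add hχ.dxi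
  exp_le := by
    obtain ⟨M, C, hC, h⟩ := hφ.exp_le
    obtain ⟨M', C', hC', h'⟩ := hχ.exp_le
    refine ⟨M + M', C * C', by positivity, fun i x ξ => ?_⟩
    have := jb_rpow_pos x M
    rw [neg_add, Complex.exp_add, Complex.exp_add, norm_mul, norm_mul, jb_rpow_add,
      show C * C' * (jb x ^ M * jb x ^ M') = C * jb x ^ M * (C' * jb x ^ M') by ring]
    exact ⟨mul_le_mul (h i x ξ).1 (h' i x ξ).1 (norm_nonneg _) (by positivity),
      mul_le_mul (h i x ξ).2 (h' i x ξ).2 (norm_nonneg _) (by positivity)⟩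

lemma Phase.reindex {κ : Type} (hφ : Phase φ) (f : κ → ι) : Phase (fun j => φ (f j)) where
  smooth j := hφ.smooth (f j)
  dx := hφ.dx.reindex f
  dxi := hφ.dxi.reindex f
  exp_le := by
    obtain ⟨M, C, hC, h⟩ := hφ.exp_le
    exact ⟨M, C, hC, fun i => h (f i)⟩

theorem Phase.exp_mul (hφ : Phase φ) : ∃ M : ℝ, ∀ {m₁ m₂ : ℝ} {g : ι → ℝ → ℝ → ℂ}, SGp m₁ m₂ g →
    SG 1 m₁ (m₂ + M) (fun i x ξ => Complex.exp (φ i x ξ) * g i x ξ) := by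
  obtain ⟨M, C, hC, h⟩ := hφ.exp_le
  refine ⟨M + 1, fun {m₁ m₂ g} hg => ?_⟩
  refine SG.of_closed_class (fun p q d => ∃ g, SGp p (q - (M + 1)) g ∧
    d = fun i x ξ => Complex.exp (φ i x ξ) * g i x ξ) ?_ ?_ ?_ ⟨g, by simpa using hg, rfl⟩
  · rintro p q _ ⟨g, hg, rfl⟩
    obtain ⟨D, hD, hb⟩ := (hg 1 one_pos).bdd
    refine ⟨C * D, by positivity, fun i x ξ => ?_⟩
    have := jb_rpow_pos x M
    rw [norm_mul]
    refine (mul_le_mul (h i x ξ).1 (hb i x ξ) (norm_nonneg _) (by positivity)).trans_eq ?_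
    have e : jb x ^ q = jb x ^ M * jb x ^ (q - (M + 1) + 1) := by rw [← jb_rpow_add]; ring_nf
    rw [e]
    ring
  · rintro p q _ ⟨g, hg, rfl⟩
    refine ⟨_, ⟨_, (hg.dXi.add ((hφ.dxi.mul hg).le (n₁ := p - 1) (n₂ := q - (M + 1))
      (by linarith) (by linarith))), rfl⟩, fun i x ξ => ?_⟩
    exact ((((hφ.smooth i).hasDerivAt_xi x ξ).cexp).mul
      ((hg.smooth i).hasDerivAt_xi x ξ)).congr_deriv (by ring)
  · rintro p q _ ⟨g, hg, rfl⟩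
    refine ⟨_, ⟨_, ((hg.dX.le (n₁ := p) (n₂ := q - 1 - (M + 1)) le_rfl (by linarith)).add
      ((hφ.dx.mul hg).le (n₁ := p) (n₂ := q - 1 - (M + 1))
      (by linarith) (by linarith))), rfl⟩, fun i x ξ => ?_⟩
    exact ((((hφ.smooth i).hasDerivAt_x x ξ).cexp).mul
      ((hg.smooth i).hasDerivAt_x x ξ)).congr_deriv (by ring)

/-- Products of `e^φ` with a symbol of order `m₁, m₂`. -/
def ExpSG (φ : ι → ℝ → ℝ → ℂ) (m₁ m₂ : ℝ) (f : ι → ℝ → ℝ → ℂ) : Prop :=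
  ∃ g, SGp m₁ m₂ g ∧ f = fun i x ξ => Complex.exp (φ i x ξ) * g i x ξ

lemma ExpSG.exists_sg (hφ : Phase φ) (hf : ExpSG φ m₁ m₂ f) : ∃ n, SG 1 m₁ n f := by
  obtain ⟨M, hM⟩ := hφ.exp_mul
  obtain ⟨g, hg, rfl⟩ := hf
  exact ⟨_, hM hg⟩

lemma ExpSG.le (hf : ExpSG φ m₁ m₂ f) (h₁ : m₁ ≤ n₁) (h₂ : m₂ ≤ n₂) : ExpSG φ n₁ n₂ f := by
  obtain ⟨g, hg, rfl⟩ := hf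
  exact ⟨g, hg.le h₁ h₂, rfl⟩

lemma ExpSG.congr (hf : ExpSG φ m₁ m₂ f) (h : ∀ i x ξ, g i x ξ = f i x ξ) : ExpSG φ m₁ m₂ g := by
  rwa [show g = f from by funext i x ξ; exact h i x ξ]

lemma SGp.expSG (ha : SGp m₁ m₂ a) : ExpSG (fun _ _ _ => 0) m₁ m₂ a := ⟨a, ha, by simp⟩

lemma ExpSG.sgp (ha : ExpSG (fun _ _ _ => 0) m₁ m₂ a) : SGp m₁ m₂ a := by
  obtain ⟨g, hg, rfl⟩ := ha
  simpa using hg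

lemma ExpSG.exp : ExpSG φ 0 0 (fun i x ξ => Complex.exp (φ i x ξ)) :=
  ⟨_, (SG.const 1).sgp, by simp⟩

lemma ExpSG.add (hf : ExpSG φ m₁ m₂ f) (hg : ExpSG φ m₁ m₂ g) :
    ExpSG φ m₁ m₂ (fun i x ξ => f i x ξ + g i x ξ) := by
  obtain ⟨f, hf, rfl⟩ := hf
  obtain ⟨g, hg, rfl⟩ := hg
  exact ⟨_, hf.add hg, by funext i x ξ; ring⟩

lemma ExpSG.const_mul (hf : ExpSG φ m₁ m₂ f) (c : ℂ) :
    ExpSG φ m₁ m₂ (fun i x ξ => c * f i x ξ) := by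
  obtain ⟨f, hf, rfl⟩ := hf
  exact ⟨_, hf.const_mul c, by funext i x ξ; ring⟩

lemma ExpSG.sub (hf : ExpSG φ m₁ m₂ f) (hg : ExpSG φ m₁ m₂ g) :
    ExpSG φ m₁ m₂ (fun i x ξ => f i x ξ - g i x ξ) :=
  (hf.add (hg.const_mul (-1))).congr fun i x ξ => by ring

lemma ExpSG.mul (hf : ExpSG φ m₁ m₂ f) (hg : ExpSG χ n₁ n₂ g) :
    ExpSG (fun i x ξ => φ i x ξ + χ i x ξ) (m₁ + n₁) (m₂ + n₂)
      (fun i x ξ => f i x ξ * g i x ξ) := by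
  obtain ⟨f, hf, rfl⟩ := hf
  obtain ⟨g, hg, rfl⟩ := hg
  exact ⟨_, hf.mul hg, by funext i x ξ; rw [Complex.exp_add]; ring⟩

lemma ExpSG.dX (hφ : Phase φ) (hf : ExpSG φ m₁ m₂ f) :
    ExpSG φ m₁ (m₂ - 1) (fun i => _root_.dX (f i)) := by
  obtain ⟨g, hg, rfl⟩ := hf
  refine ⟨_, hg.dX.add ((hφ.dx.mul hg).le (n₁ := m₁) (n₂ := m₂ - 1) (by linarith) (by linarith)),
    ?_⟩
  funext i
  refine hasDerivAt_dX fun x ξ => ((((hφ.smooth i).hasDerivAt_x x ξ).cexp).mul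
      ((hg.smooth i).hasDerivAt_x x ξ)).congr_deriv (by ring)

lemma ExpSG.dXi (hφ : Phase φ) (hf : ExpSG φ m₁ m₂ f) :
    ExpSG φ (m₁ - 1) m₂ (fun i => _root_.dXi (f i)) := by
  obtain ⟨g, hg, rfl⟩ := hf
  refine ⟨_, hg.dXi.add ((hφ.dxi.mul hg).le (n₁ := m₁ - 1) (n₂ := m₂) (by linarith) (by linarith)),
    ?_⟩
  funext i
  refine hasDerivAt_dXi fun x ξ => ((((hφ.smooth i).hasDerivAt_xi x ξ).cexp).mul
      ((hg.smooth i).hasDerivAt_xi x ξ)).congr_deriv (by ring)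

lemma ExpSG.iterate_dX (hφ : Phase φ) (hf : ExpSG φ m₁ m₂ f) (n : ℕ) :
    ExpSG φ m₁ (m₂ - n) (fun i => _root_.dX^[n] (f i)) := by
  induction n generalizing m₂ f with
  | zero => simpa using hf
  | succ n ih => exact (ih (hf.dX hφ)).le le_rfl (by push_cast; linarith)

lemma ExpSG.iterate_dXi (hφ : Phase φ) (hf : ExpSG φ m₁ m₂ f) (n : ℕ) :
    ExpSG φ (m₁ - n) m₂ (fun i => _root_.dXi^[n] (f i)) := by
  induction n generalizing m₁ f with
  | zero => simpa using hf
  | succ n ih => exact (ih (hf.dXi hφ)).le (by push_cast; linarith) le_rfl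

lemma Phase.expSG_of_sg (hφ : Phase φ) : ∃ M : ℝ, ∀ {m₁ m₂ : ℝ} {f : ι → ℝ → ℝ → ℂ},
    SG 1 m₁ (m₂ - M) f → ExpSG φ m₁ m₂ f := by
  obtain ⟨M, hM⟩ := hφ.neg.exp_mul
  refine ⟨M, fun {m₁ m₂ f} hf => ⟨_, (hM hf.sgp).sgp.le le_rfl (by linarith), ?_⟩⟩
  funext i x ξ
  rw [← mul_assoc, ← Complex.exp_add, add_neg_cancel, Complex.exp_zero, one_mul]

/-- Composition of operators whose symbols are of exponential type. -/
theorem ExpSG.exists_comp (hφ : Phase φ) (hχ : Phase χ) (hf : ExpSG φ m₁ m₂ f)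
    (hg : ExpSG χ n₁ n₂ g) :
    ∃ c : ι → ℝ → ℝ → ℂ, (∀ N : ℕ,
      ExpSG (fun i x ξ => φ i x ξ + χ i x ξ) (m₁ + n₁ - N) (m₂ + n₂ - N)
        (fun i x ξ => c i x ξ - expn 1 N (f i) (g i) x ξ)) ∧
      ∀ i u, opS (f i) (opS (g i) u) = opS (c i) u := by
  obtain ⟨k₁, hf'⟩ := hf.exists_sg hφ
  obtain ⟨k₂, hg'⟩ := hg.exists_sg hχ
  obtain ⟨c, hc, hop⟩ := hf'.exists_comp hg'
  obtain ⟨M, hM⟩ := (hφ.add hχ).expSG_of_sg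
  refine ⟨c, fun N => ?_, hop⟩
  obtain ⟨d, hd⟩ := exists_nat_ge (M + k₁ + k₂ - m₂ - n₂)
  have key : ∀ d : ℕ, ExpSG (fun i x ξ => φ i x ξ + χ i x ξ) (m₁ + n₁ - N) (m₂ + n₂ - N)
      (fun i x ξ => c i x ξ - expn 1 (N + d) (f i) (g i) x ξ) →
      ExpSG (fun i x ξ => φ i x ξ + χ i x ξ) (m₁ + n₁ - N) (m₂ + n₂ - N)
        (fun i x ξ => c i x ξ - expn 1 N (f i) (g i) x ξ) := by
    intro d
    induction d with
    | zero => exact id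
    | succ d ih =>
      intro h
      refine ih ?_
      have h3 := ((((hf.iterate_dXi hφ (N + d)).mul (hg.iterate_dX hχ (N + d))).const_mul
        ((-Complex.I * (1 : ℝ)) ^ (N + d) / ((N + d).factorial : ℂ))).le
        (n₁ := m₁ + n₁ - N) (n₂ := m₂ + n₂ - N) (by push_cast; linarith) (by push_cast; linarith))
      refine (h.add h3).congr fun i x ξ => ?_
      unfold expn
      rw [← add_assoc N d 1, Finset.sum_range_succ]
      ring
  exact key d (hM ((hc (N + d)).le (by push_cast; linarith) (by push_cast; linarith)))

end Phase

/-! ### Parametrices with small remainder -/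

section height

variable {m₁ m₂ : ℝ} {a : ι → ℝ → ℝ → ℂ} {H : ι → ℝ}

lemma SG.height_mul (ha : SG 1 m₁ m₂ a) (hH : ∀ i, 0 ≤ H i)
    (hv : ∀ i x ξ, |ξ| < H i → a i x ξ = 0) :
    SG 1 (m₁ + 1) m₂ (fun i x ξ => (H i : ℂ) * a i x ξ) := by
  refine SG.of_closed_class (fun p q d => ∃ b, SG 1 (p - 1) q b ∧
    (∀ i x ξ, |ξ| < H i → b i x ξ = 0) ∧ d = fun i x ξ => (H i : ℂ) * b i x ξ) ?_ ?_ ?_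
    ⟨a, by simpa using ha, hv, rfl⟩
  · rintro p q _ ⟨b, hb, hv, rfl⟩
    obtain ⟨C, hC, h⟩ := hb.bdd
    refine ⟨C, hC, fun i x ξ => ?_⟩
    have hξ := jb_rpow_pos ξ (p - 1)
    have hx := jb_rpow_pos x q
    beta_reduce
    rcases lt_or_ge |ξ| (H i) with hlt | hge
    · rw [hv i x ξ hlt, mul_zero, norm_zero]
      have := jb_rpow_pos ξ p
      positivity
    · rw [norm_mul, Complex.norm_real, Real.norm_of_nonneg (hH i)]
      have e : jb ξ ^ p = jb ξ * jb ξ ^ (p - 1) := by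
        simpa using jb_rpow_add ξ 1 (p - 1)
      rw [e]
      calc H i * ‖b i x ξ‖ ≤ jb ξ * (C * jb ξ ^ (p - 1) * jb x ^ q) :=
            mul_le_mul (hge.trans (abs_le_jb ξ)) (h i x ξ) (norm_nonneg _) (jb_pos ξ).le
        _ = _ := by ring
  · rintro p q _ ⟨b, hb, hv, rfl⟩
    refine ⟨_, ⟨_, by simpa [sub_right_comm] using hb.dXi, fun i x ξ hξ => ?_, rfl⟩,
      fun i x ξ => (hb.hasDerivAt_xi i x ξ).const_mul _⟩
    have : (fun ξ' => b i x ξ') =ᶠ[nhds ξ] fun _ => 0 := by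
      filter_upwards [(isOpen_lt continuous_abs continuous_const).mem_nhds hξ] with η hη
      exact hv i x η hη
    simp [_root_.dXi, this.deriv_eq]
  · rintro p q _ ⟨b, hb, hv, rfl⟩
    refine ⟨_, ⟨_, hb.dX, fun i x ξ hξ => ?_, rfl⟩,
      fun i x ξ => (hb.hasDerivAt_x i x ξ).const_mul _⟩
    have : (fun x' => b i x' ξ) = fun _ => 0 := funext fun x' => hv i x' ξ hξ
    simp [_root_.dX, this]

lemma SGp.height_mul (ha : SGp m₁ m₂ a) (hH : ∀ i, 0 ≤ H i)
    (hv : ∀ i x ξ, |ξ| < H i → a i x ξ = 0) :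
    SGp (m₁ + 1) m₂ (fun i x ξ => (H i : ℂ) * a i x ξ) :=
  fun ε hε => (ha ε hε).height_mul hH hv

lemma SGp.div_height (ha : SGp m₁ m₂ a) (hH : ∀ i, 1 ≤ H i) :
    SGp m₁ m₂ (fun i x ξ => (H i : ℂ)⁻¹ * a i x ξ) := by
  intro ε hε
  have h : SG 1 0 0 (fun (i : ι) (_ _ : ℝ) => (H i : ℂ)⁻¹) := SG.bddConst (C := 1) fun i => by
    rw [norm_inv, Complex.norm_real, Real.norm_of_nonneg (zero_le_one.trans (hH i))]
    exact inv_le_one_of_one_le₀ (hH i)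
  simpa using h.mul (ha ε hε)

end height

lemma dX_iterate_succ_eq_zero {b : ℝ → ℝ → ℂ} {c : ℂ} {ξ : ℝ} (hb : ∀ x, b x ξ = c) (j : ℕ)
    (x : ℝ) : dX^[j + 1] b x ξ = 0 := by
  induction j generalizing b c with
  | zero => simp [dX, hb]
  | succ j ih =>
    rw [Function.iterate_succ_apply]
    exact ih (b := dX b) (c := 0) fun x => by simp [dX, hb]

lemma dXi_iterate_succ_mul_sub_one (c : ℂ) (a : ℝ → ℝ → ℂ) (j : ℕ) :
    dXi^[j + 1] (fun x ξ => c * (a x ξ - 1)) = fun x ξ => c * dXi^[j + 1] a x ξ := by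
  have h : ∀ b : ℝ → ℝ → ℂ, dXi (fun x ξ => c * b x ξ) = fun x ξ => c * dXi b x ξ := by
    intro b
    funext x ξ
    exact deriv_const_mul_field c
  induction j with
  | zero =>
    funext x ξ
    simp only [zero_add, Function.iterate_one, dXi]
    rw [deriv_const_mul_field, deriv_sub_const]
  | succ j ih =>
    rw [Function.iterate_succ_apply', ih, h]
    funext x ξ
    rw [Function.iterate_succ_apply' _ (j + 1)]

/-- The operators `e^{-φ}(x,D)` and `e^{φ}(x,D)` are inverse to each other up to an operator of
order `-1, -1` which is small for large `H` if `φ` vanishes for `|ξ| < H`. -/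
theorem Phase.exists_parametrix {φ : ι → ℝ → ℝ → ℂ} (hφ : Phase φ) {H : ι → ℝ}
    (hH : ∀ i, 1 ≤ H i) (hv : ∀ i x ξ, |ξ| < H i → φ i x ξ = 0) :
    ∃ r : ι → ℝ → ℝ → ℂ, SGp (-1) (-1) r ∧ SGp 0 (-1) (fun i x ξ => (H i : ℂ) * r i x ξ) ∧
      ∀ i u, opS (fun x ξ => Complex.exp (-φ i x ξ)) (opS (fun x ξ => Complex.exp (φ i x ξ)) u) =
        u - opS (r i) u := by
  have hH0 : ∀ i, 0 ≤ H i := fun i => zero_le_one.trans (hH i)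
  have hHne : ∀ i, (H i : ℂ) ≠ 0 := fun i =>
    Complex.ofReal_ne_zero.2 (zero_lt_one.trans_le (hH i)).ne'
  obtain ⟨k₁, hf⟩ := (ExpSG.exp (φ := fun i x ξ => -φ i x ξ)).exists_sg hφ.neg
  obtain ⟨k₂, hg⟩ := (ExpSG.exp (φ := φ)).exists_sg hφ
  have hf1 : SG 1 0 (max k₁ 0) (fun i x ξ => Complex.exp (-φ i x ξ) - 1) :=
    (hf.le le_rfl (le_max_left _ _)).sub ((SG.const 1).le le_rfl (le_max_right _ _))
  have hf2 := hf1.height_mul hH0 fun i x ξ hξ => by simp [hv i x ξ hξ]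
  obtain ⟨c, hc, hop⟩ := hf2.exists_comp hg
  obtain ⟨K', hK⟩ := exists_nat_ge (max k₁ 0 + k₂ + 1)
  set S : ℕ → ι → ℝ → ℝ → ℂ := fun n i x ξ => ∑ j ∈ Finset.range n,
    (-Complex.I * (1 : ℝ)) ^ (j + 1) / ((j + 1).factorial : ℂ) *
      (dXi^[j + 1] (fun x ξ => Complex.exp (-φ i x ξ)) x ξ *
        dX^[j + 1] (fun x ξ => Complex.exp (φ i x ξ)) x ξ) with hS
  have hSv : ∀ n i x ξ, |ξ| < H i → S n i x ξ = 0 := fun n i x ξ hξ =>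
    Finset.sum_eq_zero fun j _ => by
      rw [dX_iterate_succ_eq_zero (c := 1) fun x => by simp [hv i x ξ hξ]]
      simp
  have hSs : ∀ n, SGp (-1) (-1) (S n) := by
    intro n
    induction n with
    | zero => exact fun ε _ => SG.zero.congr fun i x ξ => by simp [hS]
    | succ n ih =>
      have h := ((((ExpSG.exp (φ := fun i x ξ => -φ i x ξ)).iterate_dXi hφ.neg (n + 1)).mul
        ((ExpSG.exp (φ := φ)).iterate_dX hφ (n + 1))).const_mul
        ((-Complex.I * (1 : ℝ)) ^ (n + 1) / ((n + 1).factorial : ℂ))).le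
        (n₁ := -1) (n₂ := -1) (by push_cast; linarith [n.cast_nonneg (α := ℝ)])
        (by push_cast; linarith [n.cast_nonneg (α := ℝ)])
      have h' := ih.add (ExpSG.sgp (by simpa only [neg_add_cancel] using h))
      exact h'.congr fun i x ξ => by simp only [hS, Finset.sum_range_succ]
  have hexp : ∀ n i x ξ, expn 1 (n + 1) (fun x ξ => (H i : ℂ) * (Complex.exp (-φ i x ξ) - 1))
      (fun x ξ => Complex.exp (φ i x ξ)) x ξ =
      (H i : ℂ) * (Complex.exp (-φ i x ξ) - 1) * Complex.exp (φ i x ξ) + H i * S n i x ξ := by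
    intro n i x ξ
    unfold expn
    rw [Finset.sum_range_succ']
    simp only [dXi_iterate_succ_mul_sub_one, hS, Finset.mul_sum]
    rw [add_comm]
    congr 1
    · simp
    · exact Finset.sum_congr rfl fun j _ => by ring
  set d : ι → ℝ → ℝ → ℂ := fun i x ξ =>
    c i x ξ - (H i : ℂ) * (Complex.exp (-φ i x ξ) - 1) * Complex.exp (φ i x ξ) -
      H i * S (K' + 1) i x ξ with hd
  have hds : SGp (-1) (-1) d := by
    have h := (hc (K' + 1 + 1)).le (m₁' := -1) (m₂' := -1)
      (by push_cast; linarith [K'.cast_nonneg (α := ℝ)]) (by push_cast; linarith)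
    refine h.sgp.congr fun i x ξ => ?_
    rw [hexp, hd]
    ring
  refine ⟨fun i x ξ => -((H i : ℂ)⁻¹ * d i x ξ + S (K' + 1) i x ξ),
    ((hds.div_height hH).add (hSs _)).neg, ?_, fun i u => ?_⟩
  · have h := ((hds.le (n₁ := 0) (n₂ := -1) (by norm_num) le_rfl).add
      (((hSs (K' + 1)).height_mul hH0 (hSv _)).le (n₁ := 0) (n₂ := -1) (by norm_num) le_rfl)).neg
    exact h.congr fun i x ξ => by field_simp [hHne i]
  · have hcs : SG 1 1 (max k₁ 0 + k₂) c := by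
      have := hc 0
      simpa [expn] using this
    have e1 : (fun x ξ => -((H i : ℂ)⁻¹ * d i x ξ + S (K' + 1) i x ξ)) = fun x ξ =>
        (1 + (-1) * Complex.exp (φ i x ξ)) + (-(H i : ℂ)⁻¹) * c i x ξ := by
      funext x ξ
      have := hHne i
      have h2 : Complex.exp (-φ i x ξ) * Complex.exp (φ i x ξ) = 1 := by
        rw [← Complex.exp_add]; simp
      simp only [hd]
      field_simp
      linear_combination (H i : ℂ) * h2
    have e2 : (fun x ξ => Complex.exp (-φ i x ξ)) = fun x ξ =>
        1 + (H i : ℂ)⁻¹ * ((H i : ℂ) * (Complex.exp (-φ i x ξ) - 1)) := by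
      funext x ξ
      have := hHne i
      field_simp
      ring
    have h1 : SG 1 0 0 (fun (_ : ι) _ _ => (1 : ℂ)) := SG.const 1
    beta_reduce
    rw [e1, (((h1.le le_rfl (le_max_left 0 k₂)).add
        ((hg.le le_rfl (le_max_right 0 k₂)).const_mul (-1)))).opS_add zero_le_one
        (hcs.const_mul (-(H i : ℂ)⁻¹)) i, h1.opS_add zero_le_one (hg.const_mul (-1)) i,
      hg.opS_const_mul zero_le_one, hcs.opS_const_mul zero_le_one, e2,
      h1.opS_add zero_le_one (hf2.const_mul _) i, hf2.opS_const_mul zero_le_one, opS_one]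
    simp only [LinearMap.add_apply, LinearMap.smul_apply, LinearMap.id_apply, hop]
    module

/-! ### Neumann series -/

lemma SGp.exists_comp {m₁ m₂ n₁ n₂ : ℝ} {a b : ι → ℝ → ℝ → ℂ} (ha : SGp m₁ m₂ a)
    (hb : SGp n₁ n₂ b) : ∃ c : ι → ℝ → ℝ → ℂ, SGp (m₁ + n₁) (m₂ + n₂) c ∧
      ∀ i u, opS (a i) (opS (b i) u) = opS (c i) u := by
  obtain ⟨c, hc, h⟩ := ha.expSG.exists_comp Phase.zero Phase.zero hb.expSG
  refine ⟨c, ?_, h⟩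
  have := hc 0
  simp only [add_zero, Nat.cast_zero, sub_zero, expn, Finset.range_zero, Finset.sum_empty] at this
  exact this.sgp

lemma SGn.pred {γ m₁ m₂ : ℝ} {n : ℕ} {a : ι → ℝ → ℝ → ℂ} (h : SGn γ (n + 1) m₁ m₂ a) :
    SGn γ n m₁ m₂ a := by
  induction n generalizing m₁ m₂ a with
  | zero => exact h.1
  | succ n ih => exact ⟨h.1, ih h.2.1, ih h.2.2⟩

lemma SGn.add {γ m₁ m₂ : ℝ} {n : ℕ} {a b : ι → ℝ → ℝ → ℂ} (ha : SGn γ n m₁ m₂ a)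
    (hb : SGn γ n m₁ m₂ b) (sa : ∀ i, SmoothSym (a i)) (sb : ∀ i, SmoothSym (b i)) :
    SGn γ n m₁ m₂ (fun i x ξ => a i x ξ + b i x ξ) := by
  induction n generalizing m₁ m₂ a b with
  | zero => exact BddW.add ha hb
  | succ n ih =>
    refine ⟨BddW.add ha.1 hb.1, ?_, ?_⟩
    · simp_rw [fun i => (sa i).dXi_add (sb i)]
      exact ih ha.2.1 hb.2.1 (fun i => (sa i).dXi) fun i => (sb i).dXi
    · simp_rw [fun i => (sa i).dX_add (sb i)]
      exact ih ha.2.2 hb.2.2 (fun i => (sa i).dX) fun i => (sb i).dX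

lemma SGn.const_mul {γ m₁ m₂ : ℝ} {n : ℕ} {a : ι → ℝ → ℝ → ℂ} (ha : SGn γ n m₁ m₂ a) (c : ℂ) :
    SGn γ n m₁ m₂ (fun i x ξ => c * a i x ξ) := by
  have hb : ∀ {m₁ m₂ : ℝ} {a : ι → ℝ → ℝ → ℂ}, BddW m₁ m₂ a →
      BddW m₁ m₂ (fun i x ξ => c * a i x ξ) := by
    rintro m₁ m₂ a ⟨C, hC, h⟩
    refine ⟨‖c‖ * C, by positivity, fun i x ξ => ?_⟩
    rw [norm_mul, mul_assoc ‖c‖, mul_assoc ‖c‖]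
    exact mul_le_mul_of_nonneg_left (h i x ξ) (norm_nonneg c)
  induction n generalizing m₁ m₂ a with
  | zero => exact hb ha
  | succ n ih =>
    refine ⟨hb ha.1, ?_, ?_⟩
    · have e : (fun i => dXi (fun x ξ => c * a i x ξ)) = fun i x ξ => c * dXi (a i) x ξ := by
        funext i x ξ
        exact deriv_const_mul_field c
      rw [e]
      exact ih ha.2.1
    · have e : (fun i => dX (fun x ξ => c * a i x ξ)) = fun i x ξ => c * dX (a i) x ξ := by
        funext i x ξ
        exact deriv_const_mul_field c
      rw [e]
      exact ih ha.2.2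

lemma SGn.le {γ m₁ m₂ n₁ n₂ : ℝ} {n : ℕ} {a : ι → ℝ → ℝ → ℂ} (h : SGn γ n m₁ m₂ a)
    (h₁ : m₁ ≤ n₁) (h₂ : m₂ ≤ n₂) : SGn γ n n₁ n₂ a := by
  induction n generalizing m₁ m₂ n₁ n₂ a with
  | zero => exact BddW.mono h h₁ h₂
  | succ n ih =>
    exact ⟨h.1.mono h₁ h₂, ih h.2.1 (by linarith) h₂, ih h.2.2 h₁ (by linarith)⟩

lemma SGn.gain {m₁ m₂ : ℝ} {n : ℕ} {a : ι → ℝ → ℝ → ℂ} (h : SGn 0 n (m₁ - n) (m₂ - n) a) :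
    SGn 1 n m₁ m₂ a := by
  induction n generalizing m₁ m₂ a with
  | zero => simpa [SGn] using h
  | succ n ih =>
    have h0 : BddW m₁ m₂ a := h.1.mono (by push_cast; linarith [n.cast_nonneg (α := ℝ)])
      (by push_cast; linarith [n.cast_nonneg (α := ℝ)])
    refine ⟨h0, ih ?_, ih ?_⟩
    · exact h.2.1.le (by push_cast; linarith) (by push_cast; linarith)
    · exact h.2.2.le (by push_cast; linarith) (by push_cast; linarith)

section single

variable {ρ : ℝ → ℝ → ℂ}

lemma SG.cmp_add_right {γ m₁ m₂ n₁ n₂ n₁' n₂' : ℝ} {a b b' : ι → ℝ → ℝ → ℂ} (ha : SG γ m₁ m₂ a)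
    (hγ : 0 ≤ γ) (hm : m₁ ≤ -2) (hb : SG γ n₁ n₂ b) (hb' : SG γ n₁' n₂' b') (i : ι) (x ξ : ℝ) :
    cps 1 (a i) (fun x ξ => b i x ξ + b' i x ξ) x ξ =
      cps 1 (a i) (b i) x ξ + cps 1 (a i) (b' i) x ξ := by
  have h1 := ha.integrable_cmp_integrand hγ hm hb i (θ := 1) (by norm_num) x ξ
  have h2 := ha.integrable_cmp_integrand hγ hm hb' i (θ := 1) (by norm_num) x ξ
  unfold cps
  rw [← integral_add h1 h2]
  simp_rw [mul_add]

lemma SG.dXi_cmp {γ m₁ m₂ n₁ n₂ : ℝ} {a b : ι → ℝ → ℝ → ℂ} (ha : SG γ m₁ m₂ a)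
    (hγ : 0 ≤ γ) (hm : m₁ ≤ -2) (hb : SG γ n₁ n₂ b) (i : ι) :
    _root_.dXi (cps 1 (a i) (b i)) = fun x ξ =>
      cps 1 (_root_.dXi (a i)) (b i) x ξ + cps 1 (a i) (_root_.dXi (b i)) x ξ :=
  hasDerivAt_dXi fun x ξ => ha.hasDerivAt_cmp_xi hγ hm hb i (by norm_num) x ξ

lemma SG.dX_cmp {γ m₁ m₂ n₁ n₂ : ℝ} {a b : ι → ℝ → ℝ → ℂ} (ha : SG γ m₁ m₂ a)
    (hγ : 0 ≤ γ) (hm : m₁ ≤ -2) (hb : SG γ n₁ n₂ b) (i : ι) :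
    _root_.dX (cps 1 (a i) (b i)) = fun x ξ =>
      cps 1 (_root_.dX (a i)) (b i) x ξ + cps 1 (a i) (_root_.dX (b i)) x ξ :=
  hasDerivAt_dX fun x ξ => ha.hasDerivAt_cmp_x hγ hm hb i (by norm_num) x ξ

lemma SG.cmp_smooth {m₁ : ℝ} (hρ : SG 0 m₁ 0 (fun _ : Unit => ρ)) (hm : m₁ ≤ -3) {b : ℝ → ℝ → ℂ}
    (hb : SG 0 0 0 (fun _ : Unit => b)) : SG 0 0 0 (fun _ : Unit => cps 1 ρ b) :=
  (hρ.cmp_lossy le_rfl zero_le_one (by linarith) hb).le (by linarith) (by simp)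

/-- The composition with a fixed symbol is bounded on families with finitely many bounded
derivatives. -/
lemma SGn.cmp {n : ℕ} {v : ι → ℝ → ℝ → ℂ} (hρ : SG 0 (-3) 0 (fun _ : Unit => ρ))
    (hv : ∀ i, SG 0 0 0 (fun _ : Unit => v i)) (h : SGn 0 n 0 0 v) :
    SGn 0 n 0 0 (fun i => cps 1 ρ (v i)) := by
  have hb : ∀ {ρ : ℝ → ℝ → ℂ} {v : ι → ℝ → ℝ → ℂ}, SG 0 (-3) 0 (fun _ : Unit => ρ) →
      BddW 0 0 v → BddW 0 0 (fun i => cps 1 ρ (v i)) := by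
    rintro ρ v hρ ⟨C, hC, h⟩
    obtain ⟨D, hD, h'⟩ := hρ.kern_decay_rpow le_rfl (by norm_num) (-2)
    refine ⟨D * C * ∫ x, jb x ^ (-2 : ℝ), mul_nonneg (by positivity) jb_int_nonneg,
      fun i x ξ => ?_⟩
    have := norm_integral_le_of_jb_bound (C := D * C)
      (f := fun z => kern ρ x z * ep (-(z * ξ)) * v i (x - 1 * z) ξ) fun z => by
        have h1 := h' () x z
        have h2 := h i (x - 1 * z) ξ
        simp only [Real.rpow_zero, mul_one] at h1 h2
        rw [norm_mul, norm_mul, norm_ep, mul_one]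
        calc _ ≤ (D * jb z ^ (-2 : ℝ)) * C := by simpa using mul_le_mul h1 h2 (norm_nonneg _) (mul_nonneg hD (jb_rpow_pos _ _).le)
          _ = _ := by ring
    simpa [cps] using this
  induction n generalizing ρ v with
  | zero => exact hb hρ h
  | succ n ih =>
    have h0 := h.pred
    simp only [SGn, sub_zero] at h ⊢
    refine ⟨hb hρ h.1, ?_, ?_⟩
    · simp_rw [fun i => hρ.dXi_cmp le_rfl (by norm_num) (hv i) ()]
      have hd := hρ.dXi
      have hdv : ∀ i, SG 0 0 0 (fun _ : Unit => dXi (v i)) := fun i => by simpa using (hv i).dXi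
      rw [sub_zero] at hd
      exact (ih hd hv h0).add (ih hρ hdv h.2.1) (fun i => (hd.cmp_smooth le_rfl (hv i)).smooth ())
        fun i => (hρ.cmp_smooth le_rfl (hdv i)).smooth ()
    · simp_rw [fun i => hρ.dX_cmp le_rfl (by norm_num) (hv i) ()]
      have hd := hρ.dX
      have hdv : ∀ i, SG 0 0 0 (fun _ : Unit => dX (v i)) := fun i => by simpa using (hv i).dX
      rw [sub_zero] at hd
      exact (ih hd hv h0).add (ih hρ hdv h.2.2) (fun i => (hd.cmp_smooth le_rfl (hv i)).smooth ())
        fun i => (hρ.cmp_smooth le_rfl (hdv i)).smooth ()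

lemma norm_cps_le {δ C : ℝ} {b : ℝ → ℝ → ℂ} (hρ : ∀ x z, ‖kern ρ x z‖ ≤ δ * jb z ^ (-2 : ℝ))
    (hδ : δ * ∫ x, jb x ^ (-2 : ℝ) ≤ 1 / 4) (hC : 0 ≤ C) (hb : ∀ x ξ, ‖b x ξ‖ ≤ C) (x ξ : ℝ) :
    ‖cps 1 ρ b x ξ‖ ≤ C / 4 := by
  have := norm_integral_le_of_jb_bound (C := δ * C)
    (f := fun z => kern ρ x z * ep (-(z * ξ)) * b (x - 1 * z) ξ) fun z => by
      rw [norm_mul, norm_mul, norm_ep, mul_one]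
      calc _ ≤ (δ * jb z ^ (-2 : ℝ)) * C := mul_le_mul (hρ x z) (hb _ _) (norm_nonneg _)
            ((norm_nonneg _).trans (hρ x z))
        _ = _ := by ring
  refine this.trans ?_
  nlinarith

lemma neumann_bdd {n : ℕ} {δ : ℝ} (hρ : SG 0 (-3) 0 (fun _ : Unit => ρ))
    (hk : ∀ x z, ‖kern ρ x z‖ ≤ δ * jb z ^ (-2 : ℝ)) (hδ : δ * ∫ x, jb x ^ (-2 : ℝ) ≤ 1 / 4)
    {v w : ℕ → ℝ → ℝ → ℂ} (hv : ∀ j, SG 0 0 0 (fun _ : Unit => v j))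
    (hw : ∀ j, SG 0 0 0 (fun _ : Unit => w j)) (hwn : SGn 0 n 0 0 w)
    (hvw : ∀ j, v (j + 1) = fun x ξ => w j x ξ + 2 * cps 1 ρ (v j) x ξ) : SGn 0 n 0 0 v := by
  have hb : ∀ {v w : ℕ → ℝ → ℝ → ℂ}, SG 0 0 0 (fun _ : Unit => v 0) → BddW 0 0 w →
      (∀ j, v (j + 1) = fun x ξ => w j x ξ + 2 * cps 1 ρ (v j) x ξ) → BddW 0 0 v := by
    rintro v w h0 ⟨C, hC, h⟩ hvw
    obtain ⟨D, hD, h'⟩ := h0.bdd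
    refine ⟨D + 2 * C, by positivity, fun j => ?_⟩
    simp only [Real.rpow_zero, mul_one] at h h' ⊢
    induction j with
    | zero => exact fun x ξ => (h' () x ξ).trans (by linarith)
    | succ j ih =>
      intro x ξ
      rw [hvw]
      have := norm_cps_le hk hδ (by positivity) ih x ξ
      calc _ ≤ ‖w j x ξ‖ + ‖2 * cps 1 ρ (v j) x ξ‖ := norm_add_le _ _
        _ ≤ C + 2 * ((D + 2 * C) / 4) := by
          rw [norm_mul, Complex.norm_ofNat]
          exact add_le_add (h j x ξ) (by linarith)
        _ ≤ _ := by linarith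
  induction n generalizing v w with
  | zero => exact hb (hv 0) hwn hvw
  | succ n ih =>
    have hvn := ih hv hw hwn.pred hvw
    simp only [SGn, sub_zero] at hwn ⊢
    have hs : ∀ j, SmoothSym (cps 1 ρ (v j)) := fun j => (hρ.cmp_smooth le_rfl (hv j)).smooth ()
    have h2 : ∀ j, SmoothSym (fun x ξ => 2 * cps 1 ρ (v j) x ξ) := fun j =>
      ((hρ.cmp_smooth le_rfl (hv j)).const_mul 2).smooth ()
    refine ⟨hb (hv 0) hwn.1 hvw, ?_, ?_⟩
    · have hd := hρ.dXi
      have hdv : ∀ i, SG 0 0 0 (fun _ : Unit => dXi (v i)) := fun i => by simpa using (hv i).dXi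
      have hdw : ∀ i, SG 0 0 0 (fun _ : Unit => dXi (w i)) := fun i => by simpa using (hw i).dXi
      rw [sub_zero] at hd
      have hq : ∀ i, SG 0 0 0 (fun _ : Unit => fun x ξ => 2 * cps 1 (dXi ρ) (v i) x ξ) := fun i =>
        (hd.cmp_smooth le_rfl (hv i)).const_mul 2
      refine ih (w := fun j x ξ => dXi (w j) x ξ + 2 * cps 1 (dXi ρ) (v j) x ξ) hdv
        (fun j => (hdw j).add (hq j)) (hwn.2.1.add ((SGn.cmp hd hv hvn).const_mul 2)
          (fun i => (hdw i).smooth ()) fun i => (hq i).smooth ()) fun j => ?_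
      rw [hvw, ((hw j).smooth ()).dXi_add (h2 j)]
      have e : dXi (fun x ξ => 2 * cps 1 ρ (v j) x ξ) = fun x ξ => 2 * dXi (cps 1 ρ (v j)) x ξ := by
        funext x ξ
        exact deriv_const_mul_field _
      rw [e, hρ.dXi_cmp le_rfl (by norm_num) (hv j) ()]
      funext x ξ
      ring
    · have hd := hρ.dX
      have hdv : ∀ i, SG 0 0 0 (fun _ : Unit => dX (v i)) := fun i => by simpa using (hv i).dX
      have hdw : ∀ i, SG 0 0 0 (fun _ : Unit => dX (w i)) := fun i => by simpa using (hw i).dX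
      rw [sub_zero] at hd
      have hq : ∀ i, SG 0 0 0 (fun _ : Unit => fun x ξ => 2 * cps 1 (dX ρ) (v i) x ξ) := fun i =>
        (hd.cmp_smooth le_rfl (hv i)).const_mul 2
      refine ih (w := fun j x ξ => dX (w j) x ξ + 2 * cps 1 (dX ρ) (v j) x ξ) hdv
        (fun j => (hdw j).add (hq j)) (hwn.2.2.add ((SGn.cmp hd hv hvn).const_mul 2)
          (fun i => (hdw i).smooth ()) fun i => (hq i).smooth ()) fun j => ?_
      rw [hvw, ((hw j).smooth ()).dX_add (h2 j)]
      have e : dX (fun x ξ => 2 * cps 1 ρ (v j) x ξ) = fun x ξ => 2 * dX (cps 1 ρ (v j)) x ξ := by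
        funext x ξ
        exact deriv_const_mul_field _
      rw [e, hρ.dX_cmp le_rfl (by norm_num) (hv j) ()]
      funext x ξ
      ring

end single

lemma SG.geometric_sum {v : ℕ → ℝ → ℝ → ℂ} (hv : SG 0 0 0 v) :
    SG 0 0 0 (fun (_ : Unit) x ξ => ∑' j, (1 / 2 : ℂ) ^ j * v j x ξ) := by
  have hb : ∀ {v : ℕ → ℝ → ℝ → ℂ}, SG 0 0 0 v → ∃ C, 0 ≤ C ∧ ∀ j x ξ,
      ‖(1 / 2 : ℂ) ^ j * v j x ξ‖ ≤ C * (1 / 2) ^ j := by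
    intro v hv
    obtain ⟨C, hC, h⟩ := hv.bdd
    refine ⟨C, hC, fun j x ξ => ?_⟩
    have := h j x ξ
    simp only [Real.rpow_zero, mul_one] at this
    rw [norm_mul, norm_pow, mul_comm]
    norm_num
    exact this
  have hs : ∀ C : ℝ, Summable fun j : ℕ => C * (1 / 2 : ℝ) ^ j := fun C =>
    (summable_geometric_of_lt_one (by norm_num) (by norm_num)).mul_left C
  refine SG.of_closed_class (fun p q d => p = 0 ∧ q = 0 ∧ ∃ v : ℕ → ℝ → ℝ → ℂ, SG 0 0 0 v ∧
    d = fun (_ : Unit) x ξ => ∑' j, (1 / 2 : ℂ) ^ j * v j x ξ) ?_ ?_ ?_ ⟨rfl, rfl, v, hv, rfl⟩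
  · rintro p q _ ⟨rfl, rfl, v, hv, rfl⟩
    obtain ⟨C, hC, h⟩ := hb hv
    refine ⟨∑' j : ℕ, C * (1 / 2 : ℝ) ^ j, tsum_nonneg fun j => by positivity, fun _ x ξ => ?_⟩
    simp only [Real.rpow_zero, mul_one]
    exact tsum_of_norm_bounded (hs C).hasSum fun j => h j x ξ
  · rintro p q _ ⟨rfl, rfl, v, hv, rfl⟩
    have hd := hv.dXi
    rw [sub_zero] at hd
    obtain ⟨C, hC, h⟩ := hb hd
    obtain ⟨D, hD, h'⟩ := hb hv
    exact ⟨_, ⟨by simp, rfl, _, hd, rfl⟩, fun _ x ξ => hasDerivAt_tsum (hs C)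
      (fun j y => (hv.hasDerivAt_xi j x y).const_mul _) (fun j y => h j x y)
      (Summable.of_norm_bounded (hs D) fun j => h' j x 0) ξ⟩
  · rintro p q _ ⟨rfl, rfl, v, hv, rfl⟩
    have hd := hv.dX
    rw [sub_zero] at hd
    obtain ⟨C, hC, h⟩ := hb hd
    obtain ⟨D, hD, h'⟩ := hb hv
    exact ⟨_, ⟨rfl, by simp, _, hd, rfl⟩, fun _ x ξ => hasDerivAt_tsum (hs C)
      (fun j y => (hv.hasDerivAt_x j y ξ).const_mul _) (fun j y => h j y ξ)
      (Summable.of_norm_bounded (hs D) fun j => h' j 0 ξ) x⟩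

section single

variable {ρ : ℝ → ℝ → ℂ} {δ : ℝ}

lemma exists_neumann (hρ : SG 0 (-3) 0 (fun _ : Unit => ρ))
    (hk : ∀ x z, ‖kern ρ x z‖ ≤ δ * jb z ^ (-2 : ℝ)) (hδ : δ * ∫ x, jb x ^ (-2 : ℝ) ≤ 1 / 4) :
    ∃ s, SG 0 0 0 (fun _ : Unit => s) ∧ ∀ x ξ, s x ξ = 1 + cps 1 ρ s x ξ := by
  set v : ℕ → ℝ → ℝ → ℂ := fun j => (fun b x ξ => 2 * cps 1 ρ b x ξ)^[j] (fun _ _ => 1) with hv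
  have hsucc : ∀ j, v (j + 1) = fun x ξ => 2 * cps 1 ρ (v j) x ξ := fun j => by
    simp only [hv, Function.iterate_succ_apply']
  have hvs : ∀ j, SG 0 0 0 (fun _ : Unit => v j) := by
    intro j
    induction j with
    | zero => exact SG.const 1
    | succ j ih =>
      rw [hsucc]
      exact (hρ.cmp_smooth le_rfl ih).const_mul 2
  have hw : SG 0 0 0 (fun (_ : ℕ) (_ _ : ℝ) => (0 : ℂ)) := SG.zero
  have hvu : SG 0 0 0 v := ⟨fun j => (hvs j).smooth (), fun n =>
    neumann_bdd hρ hk hδ hvs (fun j => hw.reindex fun _ => j) (hw.2 n) fun j => by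
      simpa using hsucc j⟩
  have hgs := hvu.geometric_sum
  refine ⟨_, hgs, fun x ξ => ?_⟩
  obtain ⟨C, hC, hb⟩ := hvu.bdd
  simp only [Real.rpow_zero, mul_one] at hb
  obtain ⟨D, hD, hD'⟩ := hρ.kern_decay_rpow le_rfl (by norm_num) (-2)
  simp only [Real.rpow_zero, mul_one] at hD'
  have hb2 : ∀ j x ξ, ‖(1 / 2 : ℂ) ^ j * v j x ξ‖ ≤ C * (1 / 2) ^ j := by
    intro j x ξ
    rw [norm_mul, norm_pow, mul_comm]
    norm_num
    exact hb j x ξ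
  have hs : Summable fun j : ℕ => C * (1 / 2 : ℝ) ^ j :=
    (summable_geometric_of_lt_one (by norm_num) (by norm_num)).mul_left C
  have hsum : ∀ x ξ, Summable fun j => (1 / 2 : ℂ) ^ j * v j x ξ := fun x ξ =>
    Summable.of_norm_bounded hs fun j => hb2 j x ξ
  have hF : ∀ j, ∀ z, ‖kern ρ x z * ep (-(z * ξ)) * ((1 / 2 : ℂ) ^ j * v j (x - 1 * z) ξ)‖ ≤
      (C * (1 / 2) ^ j * D) * jb z ^ (-2 : ℝ) := by
    intro j z
    rw [norm_mul, norm_mul, norm_ep, mul_one]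
    calc _ ≤ (D * jb z ^ (-2 : ℝ)) * (C * (1 / 2) ^ j) :=
          mul_le_mul (hD' () x z) (hb2 j _ _) (norm_nonneg _)
            (mul_nonneg hD (jb_rpow_pos _ _).le)
      _ = _ := by ring
  have hintg : ∀ j, Integrable fun z =>
      kern ρ x z * ep (-(z * ξ)) * ((1 / 2 : ℂ) ^ j * v j (x - 1 * z) ξ) := by
    intro j
    have := ((hρ.integrable_cmp_integrand le_rfl (by norm_num) (hvs j) () (θ := 1) (by norm_num)
      x ξ).const_mul ((1 / 2 : ℂ) ^ j))
    exact this.congr (Filter.Eventually.of_forall fun z => by beta_reduce; ring)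
  have hsn : Summable fun j => ∫ z,
      ‖kern ρ x z * ep (-(z * ξ)) * ((1 / 2 : ℂ) ^ j * v j (x - 1 * z) ξ)‖ := by
    refine Summable.of_nonneg_of_le (fun j => integral_nonneg fun z => norm_nonneg _) (fun j => ?_)
      (hs.mul_right (D * ∫ x, jb x ^ (-2 : ℝ)))
    rw [← mul_assoc, ← integral_const_mul]
    exact integral_mono (hintg j).norm (integrable_jb_neg_two.const_mul _) (hF j)
  have key : cps 1 ρ (fun x ξ => ∑' j, (1 / 2 : ℂ) ^ j * v j x ξ) x ξ =
      ∑' j, (1 / 2 : ℂ) ^ j * cps 1 ρ (v j) x ξ := by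
    unfold cps
    simp_rw [← tsum_mul_left]
    rw [← integral_tsum_of_summable_integral_norm hintg hsn]
    refine tsum_congr fun j => ?_
    rw [← integral_const_mul]
    exact integral_congr_ae (Filter.Eventually.of_forall fun z => by beta_reduce; ring)
  rw [key, (hsum x ξ).tsum_eq_zero_add]
  congr 1
  · simp [hv]
  · refine tsum_congr fun j => ?_
    rw [hsucc, pow_succ]
    ring

lemma SG.of_neumann (hρ : SG 1 (-4) (-4) (fun _ : Unit => ρ)) {s : ℝ → ℝ → ℂ}
    (hs : SG 0 0 0 (fun _ : Unit => s)) (h : ∀ x ξ, s x ξ = 1 + cps 1 ρ s x ξ) :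
    SG 1 0 0 (fun _ : Unit => s) := by
  have hρ0 := hρ.mono zero_le_one le_rfl le_rfl
  refine ⟨hs.1, fun n => ?_⟩
  have key : ∀ n : ℕ, ∃ a b, SG 1 0 0 (fun _ : Unit => a) ∧ SG 0 (-n) (-n) (fun _ : Unit => b) ∧
      s = fun x ξ => a x ξ + b x ξ := by
    intro n
    induction n with
    | zero => exact ⟨_, _, SG.zero, by simpa using hs, by simp⟩
    | succ n ih =>
      obtain ⟨a, b, ha, hb, hab⟩ := ih
      refine ⟨fun x ξ => 1 + cps 1 ρ a x ξ, cps 1 ρ b, (SG.const 1).add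
        ((hρ.cmp_lossy zero_le_one le_rfl (by norm_num) ha).le (by norm_num) (by norm_num)),
        (hρ0.cmp_lossy le_rfl zero_le_one (by norm_num) hb).le (by push_cast; linarith)
          (by push_cast; linarith), ?_⟩
      funext x ξ
      rw [h, hab, hρ0.cmp_add_right le_rfl (by norm_num) (ha.mono zero_le_one le_rfl le_rfl) hb (),
        add_assoc]
  obtain ⟨a, b, ha, hb, rfl⟩ := key n
  refine (ha.2 n).add (SGn.gain ?_) ha.1 hb.1
  simpa using hb.2 n

lemma opS_injective_of_kern (hρ : SG 1 (-4) (-4) (fun _ : Unit => ρ))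
    (hk : ∀ x z, ‖kern ρ x z‖ ≤ δ * jb z ^ (-2 : ℝ)) (hδ : δ * ∫ x, jb x ^ (-2 : ℝ) ≤ 1 / 4)
    {u : SchwartzMap ℝ ℂ} (hu : u = opS ρ u) : u = 0 := by
  obtain ⟨K, hK, hKu⟩ : ∃ K : ℝ, 0 ≤ K ∧ ∀ x, ‖u x‖ ≤ K :=
    ⟨_, norm_nonneg _, u.toBoundedContinuousFunction.norm_coe_le_norm⟩
  have hb : ∀ n : ℕ, ∀ x, ‖u x‖ ≤ K * (1 / 4) ^ n := by
    intro n
    induction n with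
    | zero => exact fun x => by simpa using hKu x
    | succ n ih =>
      intro x
      rw [hu, hρ.opS_eq_integral zero_le_one le_rfl (by norm_num) ()]
      have := norm_cps_le hk hδ (by positivity) (b := fun x _ => u x) (fun x _ => ih x) x 0
      refine (le_of_eq ?_).trans (this.trans_eq (by ring))
      simp [cps, ep_zero]
  ext x
  have h0 : Filter.Tendsto (fun n : ℕ => K * (1 / 4 : ℝ) ^ n)
      Filter.atTop (nhds (K * 0)) :=
    (tendsto_pow_atTop_nhds_zero_of_lt_one (by norm_num) (by norm_num)).const_mul _
  rw [mul_zero] at h0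
  exact norm_le_zero_iff.1 (ge_of_tendsto' h0 fun n => hb n x)

/-- `1 - ρ(x,D)` is invertible if the kernel of `ρ(x,D)` is small. -/
theorem exists_inverse_one_sub (hρ : SG 1 (-4) (-4) (fun _ : Unit => ρ))
    (hk : ∀ x z, ‖kern ρ x z‖ ≤ δ * jb z ^ (-2 : ℝ)) (hδ : δ * ∫ x, jb x ^ (-2 : ℝ) ≤ 1 / 4) :
    ∃ s, SG 1 (-1) (-1) (fun (_ : Unit) x ξ => s x ξ - 1) ∧
      (∀ u, opS s u - opS ρ (opS s u) = u) ∧ ∀ u, opS s (u - opS ρ u) = u := by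
  have hρ0 : SG 0 (-3) 0 (fun _ : Unit => ρ) := hρ.mono zero_le_one (by norm_num) (by norm_num)
  obtain ⟨s, hs, h⟩ := exists_neumann hρ0 hk hδ
  have hs1 := SG.of_neumann hρ hs h
  have hr : ∀ u, opS s u - opS ρ (opS s u) = u := by
    intro u
    have hc := hρ.cmp_lossy zero_le_one le_rfl (by norm_num) hs1
    rw [hρ.opS_comp_cps zero_le_one le_rfl (by norm_num) hs1 ()]
    have e : s = fun x ξ => 1 + cps 1 ρ s x ξ := by funext x ξ; exact h x ξ
    have := (SG.const (γ := 1) 1).opS_add zero_le_one hc ()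
    rw [← e, opS_one] at this
    rw [this]
    simp
  refine ⟨s, ?_, hr, fun u => ?_⟩
  · refine ((hρ.cmp_lossy zero_le_one le_rfl (by norm_num) hs1).le (by norm_num)
      (by norm_num)).congr fun _ x ξ => ?_
    rw [h]
    ring
  · have := hr (u - opS ρ u)
    refine sub_eq_zero.1 (opS_injective_of_kern hρ hk hδ ?_)
    rw [map_sub (opS ρ) (opS s (u - opS ρ u)) u]
    rw [sub_eq_iff_eq_add] at this
    nth_rewrite 1 [this]
    abel

end single

/-! ### Inverses of operators of exponential type -/

lemma exists_inverse_one_sub_of_height {r : ι → ℝ → ℝ → ℂ} {H : ι → ℝ} (hH : ∀ i, 1 ≤ H i)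
    (hr : SGp (-1) (-1) r) (hHr : SGp 0 (-1) (fun i x ξ => (H i : ℂ) * r i x ξ)) :
    ∃ C : ℝ, ∀ i, C ≤ H i → ∃ q : ℝ → ℝ → ℂ,
      SGp (-1) (-1) (fun (_ : Unit) x ξ => q x ξ - 1) ∧
      (∀ u, opS q u - opS (r i) (opS q u) = u) ∧ ∀ u, opS q (u - opS (r i) u) = u := by
  obtain ⟨r₂, hr₂, h₂⟩ := hr.exists_comp hr
  obtain ⟨r₃, hr₃, h₃⟩ := hr₂.exists_comp hr
  obtain ⟨r₄, hr₄, h₄⟩ := hr₃.exists_comp hr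
  obtain ⟨ρ, hρ, h₅⟩ := hHr.exists_comp hr₄
  have hρ' : SG 1 (-4) (-4) ρ := (hρ.sg (n₂ := -4) (by norm_num)).le (by norm_num) le_rfl
  obtain ⟨D, hD, hk⟩ := hρ'.kern_decay_rpow zero_le_one (by norm_num) (-2)
  refine ⟨4 * (D * ∫ x, jb x ^ (-2 : ℝ)), fun i hi => ?_⟩
  have hHi : 0 < H i := zero_lt_one.trans_le (hH i)
  have hHne : (H i : ℂ) ≠ 0 := Complex.ofReal_ne_zero.2 hHi.ne'
  have hρi : SG 1 (-4) (-4) (fun _ : Unit => fun x ξ => (H i : ℂ)⁻¹ * ρ i x ξ) :=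
    (hρ'.reindex fun _ : Unit => i).const_mul _
  obtain ⟨s, hs, hs1, hs2⟩ := exists_inverse_one_sub (δ := D / H i) hρi (fun x z => by
      rw [kern_const_mul, norm_mul, norm_inv, Complex.norm_real, Real.norm_of_nonneg hHi.le]
      rw [div_mul_eq_mul_div, div_eq_inv_mul]
      refine mul_le_mul_of_nonneg_left ((hk i x z).trans ?_) (by positivity)
      exact mul_le_mul_of_nonneg_right
        (mul_le_of_le_one_right hD (jb_rpow_le_one x (by norm_num))) (jb_rpow_pos _ _).le)
    (by rw [div_mul_eq_mul_div, div_le_iff₀ hHi]; linarith)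
  have hR : ∀ u, opS (fun x ξ => (H i : ℂ)⁻¹ * ρ i x ξ) u =
      opS (r i) (opS (r i) (opS (r i) (opS (r i) (opS (r i) u)))) := by
    intro u
    rw [hρ'.opS_const_mul zero_le_one, LinearMap.smul_apply, ← h₅, ← h₄, ← h₃, ← h₂,
      (hr.sg (n₂ := 0) (by norm_num)).opS_const_mul zero_le_one, LinearMap.smul_apply, smul_smul,
      inv_mul_cancel₀ hHne, one_smul]
  set t : ℝ → ℝ → ℂ := fun x ξ => 1 + (r i x ξ + (r₂ i x ξ + (r₃ i x ξ + r₄ i x ξ))) with ht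
  have g1 : SGp (-1) (-1) (fun _ : Unit => r i) := hr.reindex _
  have g2 : SGp (-1) (-1) (fun _ : Unit => r₂ i) :=
    (hr₂.reindex fun _ : Unit => i).le (by norm_num) (by norm_num)
  have g3 : SGp (-1) (-1) (fun _ : Unit => r₃ i) :=
    (hr₃.reindex fun _ : Unit => i).le (by norm_num) (by norm_num)
  have g4 : SGp (-1) (-1) (fun _ : Unit => r₄ i) :=
    (hr₄.reindex fun _ : Unit => i).le (by norm_num) (by norm_num)
  have ht1 : SGp (-1) (-1) (fun (_ : Unit) x ξ => t x ξ - 1) :=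
    (g1.add (g2.add (g3.add g4))).congr fun _ x ξ => by simp [ht]
  have hlt : (-1 : ℝ) < 0 := by norm_num
  have hT : ∀ u, opS t u = u + (opS (r i) u + (opS (r i) (opS (r i) u) +
      (opS (r i) (opS (r i) (opS (r i) u)) + opS (r i) (opS (r i) (opS (r i) (opS (r i) u)))))) := by
    intro u
    rw [ht, (SG.const (ι := Unit) (γ := 1) 1).opS_add zero_le_one
        ((g1.add (g2.add (g3.add g4))).sg hlt) (),
      (g1.sg hlt).opS_add zero_le_one ((g2.add (g3.add g4)).sg hlt) (),
      (g2.sg hlt).opS_add zero_le_one ((g3.add g4).sg hlt) (),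
      (g3.sg hlt).opS_add zero_le_one (g4.sg hlt) (), opS_one]
    simp only [LinearMap.add_apply, LinearMap.id_apply, ← h₄, ← h₃, ← h₂]
  have ht0 : SGp 0 0 (fun _ : Unit => t) := by
    refine ((ht1.le (n₁ := 0) (n₂ := 0) (by norm_num) (by norm_num)).add
      (SG.const 1).sgp).congr fun _ x ξ => by simp
  obtain ⟨c, hc, hop⟩ := hs.sgp.exists_comp ht0
  have hq : ∀ u, opS (fun x ξ => c () x ξ + t x ξ) u = opS s (opS t u) := by
    intro u
    have e : s = fun x ξ => (s x ξ - 1) + 1 := by simp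
    have hcs : SG 1 0 1 c := (hc.sg (n₂ := 1) (by norm_num)).le (by norm_num) le_rfl
    rw [hcs.opS_add zero_le_one (ht0 1 one_pos) (), LinearMap.add_apply, ← hop ()]
    nth_rewrite 2 [e]
    rw [hs.opS_add zero_le_one (SG.const 1) (), opS_one]
    rfl
  have left : ∀ u, opS (fun x ξ => c () x ξ + t x ξ) (u - opS (r i) u) = u := by
    intro u
    rw [hq, hT]
    refine Eq.trans (congrArg _ ?_) (hs2 u)
    rw [hR]
    simp only [map_sub]
    abel
  refine ⟨fun x ξ => c () x ξ + t x ξ, ?_, fun u => ?_, left⟩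
  · have hc' : SGp (-1) (-1) c := hc.le (by norm_num) (by norm_num)
    exact (hc'.add ht1).congr fun _ x ξ => by ring
  · have hu : opS t (opS s u) - opS (r i) (opS t (opS s u)) = u := by
      have := hs1 u
      rw [hR] at this
      refine Eq.trans ?_ this
      rw [hT]
      simp only [map_add]
      abel
    have := left (opS t (opS s u))
    rw [hu] at this
    rw [this, hu]

/-- Operators `e^φ(x,D)` are invertible if `φ` vanishes for `|ξ| < H` with `H` large. -/
theorem Phase.exists_inverse {φ : ι → ℝ → ℝ → ℂ} (hφ : Phase φ) {H : ι → ℝ}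
    (hH : ∀ i, 1 ≤ H i) (hv : ∀ i x ξ, |ξ| < H i → φ i x ξ = 0) :
    ∃ C : ℝ, ∀ i, C ≤ H i → ∃ (E : SchwartzMap ℝ ℂ ≃ₗ[ℂ] SchwartzMap ℝ ℂ) (g : ℝ → ℝ → ℂ),
      (∀ u, E u = opS (fun x ξ => Complex.exp (φ i x ξ)) u) ∧ (∀ u, E.symm u = opS g u) ∧
      ExpSG (fun (_ : Unit) x ξ => -φ i x ξ) (-1) (-1)
        (fun _ x ξ => g x ξ - Complex.exp (-φ i x ξ)) := by
  obtain ⟨r, hr, hHr, h⟩ := hφ.exists_parametrix hH hv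
  obtain ⟨r', hr', hHr', h'⟩ := hφ.neg.exists_parametrix hH fun i x ξ hξ => by simp [hv i x ξ hξ]
  simp only [neg_neg] at h'
  obtain ⟨C, hC⟩ := exists_inverse_one_sub_of_height hH hr hHr
  obtain ⟨C', hC'⟩ := exists_inverse_one_sub_of_height hH hr' hHr'
  refine ⟨max C C', fun i hi => ?_⟩
  obtain ⟨q, hq, -, hq2⟩ := hC i ((le_max_left _ _).trans hi)
  obtain ⟨q', -, hq1', -⟩ := hC' i ((le_max_right _ _).trans hi)
  have hφi : Phase (fun _ : Unit => φ i) := hφ.reindex _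
  obtain ⟨c, hc, hop⟩ := hq.expSG.exists_comp Phase.zero hφi.neg ExpSG.exp
  have hc0 := hc 0
  simp only [zero_add, add_zero, Nat.cast_zero, sub_zero, expn, Finset.range_zero,
    Finset.sum_empty] at hc0
  obtain ⟨n₁, hcs⟩ := hc0.exists_sg hφi.neg
  obtain ⟨n₂, hes⟩ := (ExpSG.exp (φ := fun (_ : Unit) x ξ => -φ i x ξ)).exists_sg hφi.neg
  have hg : ∀ u, opS (fun x ξ => c () x ξ + Complex.exp (-φ i x ξ)) u =
      opS q (opS (fun x ξ => Complex.exp (-φ i x ξ)) u) := by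
    intro u
    have e : q = fun x ξ => (q x ξ - 1) + 1 := by simp
    rw [hcs.opS_add zero_le_one hes (), LinearMap.add_apply, ← hop ()]
    nth_rewrite 2 [e]
    rw [(hq 1 one_pos).opS_add zero_le_one (SG.const 1) (), opS_one]
    rfl
  have left : ∀ u, opS (fun x ξ => c () x ξ + Complex.exp (-φ i x ξ))
      (opS (fun x ξ => Complex.exp (φ i x ξ)) u) = u := fun u => by rw [hg, h, hq2]
  have right : ∀ u, opS (fun x ξ => Complex.exp (φ i x ξ))
      (opS (fun x ξ => c () x ξ + Complex.exp (-φ i x ξ)) u) = u := by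
    intro u
    have h1 : opS (fun x ξ => Complex.exp (φ i x ξ)) (opS (fun x ξ => Complex.exp (-φ i x ξ))
        (opS q' u)) = u := by rw [h', hq1']
    have h2 := left (opS (fun x ξ => Complex.exp (-φ i x ξ)) (opS q' u))
    rw [h1] at h2
    rw [h2, h1]
  refine ⟨LinearEquiv.ofLinearMap (opS fun x ξ => Complex.exp (φ i x ξ))
    (opS fun x ξ => c () x ξ + Complex.exp (-φ i x ξ)) (LinearMap.ext right) (LinearMap.ext left),
    _, fun u => rfl, fun u => rfl, ?_⟩
  exact hc0.congr fun _ x ξ => by simp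

/-! ### Conjugation -/

lemma ExpSG.reindex {κ : Type} {φ f : ι → ℝ → ℝ → ℂ} {m₁ m₂ : ℝ} (hf : ExpSG φ m₁ m₂ f)
    (k : κ → ι) : ExpSG (fun j => φ (k j)) m₁ m₂ (fun j => f (k j)) := by
  obtain ⟨g, hg, rfl⟩ := hf
  exact ⟨_, hg.reindex k, rfl⟩

lemma ExpSG.congr_phase {φ χ f : ι → ℝ → ℝ → ℂ} {m₁ m₂ : ℝ} (hf : ExpSG φ m₁ m₂ f)
    (h : ∀ i x ξ, χ i x ξ = φ i x ξ) : ExpSG χ m₁ m₂ f := by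
  rwa [show χ = φ from by funext i x ξ; exact h i x ξ]

/-- Conjugation by `e^φ(x,D)` changes the symbol by a Poisson bracket to leading order. -/
theorem exists_conj {m₁ m₂ : ℝ} {φ g : ℝ → ℝ → ℂ} (hφ : Phase (fun _ : Unit => φ))
    {E : SchwartzMap ℝ ℂ ≃ₗ[ℂ] SchwartzMap ℝ ℂ}
    (hE : ∀ u, E u = opS (fun x ξ => Complex.exp (φ x ξ)) u) (hEs : ∀ u, E.symm u = opS g u)
    (hg : ExpSG (fun (_ : Unit) x ξ => -φ x ξ) (-1) (-1)
      (fun _ x ξ => g x ξ - Complex.exp (-φ x ξ)))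
    {b : ι → ℝ → ℝ → ℂ} (hb : SGp m₁ m₂ b) :
    ∃ b' : ι → ℝ → ℝ → ℂ, SGp (m₁ - 2) (m₂ - 2) (fun i x ξ => b' i x ξ - b i x ξ +
        Complex.I * (dXi (b i) x ξ * dX φ x ξ - dXi φ x ξ * dX (b i) x ξ)) ∧
      ∀ i u, E.symm (opS (b i) (E u)) = opS (b' i) u := by
  have hφ' : Phase (fun _ : ι => φ) := hφ.reindex fun _ => ()
  have hg' := hg.reindex (fun _ : ι => ())
  have hn := hφ'.neg
  have hexp : ExpSG (fun _ : ι => φ) 0 0 (fun _ x ξ => Complex.exp (φ x ξ)) := ExpSG.exp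
  have hexpn : ExpSG (fun (_ : ι) x ξ => -φ x ξ) 0 0 (fun _ x ξ => Complex.exp (-φ x ξ)) :=
    ExpSG.exp
  have hgg : ExpSG (fun (_ : ι) x ξ => -φ x ξ) 0 0 (fun _ x ξ => g x ξ) :=
    ((hg'.le (by norm_num) (by norm_num)).add hexpn).congr fun _ x ξ => by ring
  obtain ⟨c₁, hc₁, hop₁⟩ := hb.expSG.exists_comp Phase.zero hφ' hexp
  obtain ⟨c₂, hc₂, hop₂⟩ := hexp.exists_comp hφ' Phase.zero hb.expSG
  set w : ι → ℝ → ℝ → ℂ := fun i x ξ =>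
    -Complex.I * (dXi (b i) x ξ * dX φ x ξ - dXi φ x ξ * dX (b i) x ξ) with hw
  have hws : SGp (m₁ - 1) (m₂ - 1) w := by
    refine SGp.const_mul (SGp.sub ?_ ?_) _
    · exact (hb.dXi.mul hφ'.dx).le (by linarith) (by linarith)
    · exact (hφ'.dxi.mul hb.dX).le (by linarith) (by linarith)
  have d₁ := (hc₁ 2).congr_phase (χ := fun _ => φ) fun _ x ξ => by simp
  have d₂ := (hc₂ 2).congr_phase (χ := fun _ => φ) fun _ x ξ => by simp
  have hd : ExpSG (fun _ : ι => φ) (m₁ - 2) (m₂ - 2)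
      (fun i x ξ => c₁ i x ξ - c₂ i x ξ - Complex.exp (φ x ξ) * w i x ξ) := by
    refine ((d₁.le (by norm_num) (by norm_num)).sub
      (d₂.le (by norm_num) (by norm_num))).congr fun i x ξ => ?_
    have e1 := congrFun₂ (SmoothSym.dX_exp (hφ.smooth ())) x ξ
    have e2 := congrFun₂ (SmoothSym.dXi_exp (hφ.smooth ())) x ξ
    simp only [expn, Finset.sum_range_succ, Finset.range_zero, Finset.sum_empty,
      Function.iterate_succ, Function.iterate_zero, id_eq, Function.comp_apply, e1, e2, hw]
    simp
    ring
  have hd1 : ExpSG (fun _ : ι => φ) (m₁ - 1) (m₂ - 1) (fun i x ξ => c₁ i x ξ - c₂ i x ξ) :=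
    ((hd.le (by linarith) (by linarith)).add ⟨w, hws, rfl⟩).congr fun i x ξ => by ring
  obtain ⟨c₃, hc₃, hop₃⟩ := hgg.exists_comp hn hφ' hd1
  have h3 := ((hc₃ 1).congr_phase (χ := fun _ _ _ => 0) fun _ x ξ => by simp).sgp
  have h4 := (((hg'.mul hd1).congr_phase (χ := fun _ _ _ => 0) fun _ x ξ => by simp).sgp)
  have h5 := (((hexpn.mul hd).congr_phase (χ := fun _ _ _ => 0) fun _ x ξ => by simp).sgp)
  have h6 : SGp (m₁ - 2) (m₂ - 2) (fun i x ξ => c₃ i x ξ - w i x ξ) := by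
    refine (((h3.le (by norm_num; linarith) (by norm_num; linarith)).add
      (h4.le (by linarith) (by linarith))).add (h5.le (by linarith) (by linarith))).congr
        fun i x ξ => ?_
    have e : Complex.exp (-φ x ξ) * Complex.exp (φ x ξ) = 1 := by
      rw [← Complex.exp_add]; simp
    simp only [expn, Finset.sum_range_succ, Finset.range_zero, Finset.sum_empty,
      Function.iterate_zero, id_eq, pow_zero, Nat.factorial_zero, Nat.cast_one, div_one, one_mul,
      zero_add]
    linear_combination w i x ξ * e
  have h7 : SGp (m₁ - 1) (m₂ - 1) c₃ :=
    ((h6.le (by linarith) (by linarith)).add hws).congr fun i x ξ => by ring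
  refine ⟨fun i x ξ => b i x ξ + c₃ i x ξ, h6.congr fun i x ξ => by simp only [hw]; ring,
    fun i u => ?_⟩
  obtain ⟨n₁, hs₁⟩ := ((hc₁ 0).exists_sg (Phase.zero.add hφ'))
  obtain ⟨n₂, hs₂⟩ := ((hc₂ 0).exists_sg (hφ'.add Phase.zero))
  simp only [Nat.cast_zero, sub_zero, expn, Finset.range_zero, Finset.sum_empty] at hs₁ hs₂
  rw [(hb 1 one_pos).opS_add zero_le_one (h7 1 one_pos) i, LinearMap.add_apply, ← hop₃, ← hEs]
  have e : opS (fun x ξ => c₁ i x ξ - c₂ i x ξ) u = opS (b i) (E u) - E (opS (b i) u) := by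
    rw [hs₁.opS_sub zero_le_one hs₂ i, LinearMap.sub_apply, ← hop₁, ← hop₂, hE, hE]
  rw [e, map_sub, LinearEquiv.symm_apply_apply]
  abel

/-! ### The phase functions -/

/-- Smooth functions vanishing outside the interval `[-ρ, ρ]`. -/
def CutOff (ρ : ℝ) (χ : ℝ → ℝ) : Prop :=
  ContDiff ℝ (⊤ : ℕ∞) χ ∧ ∀ y, ρ < |y| → χ y = 0

lemma CutOff.bdd {ρ : ℝ} {χ : ℝ → ℝ} (h : CutOff ρ χ) : ∃ B, 0 ≤ B ∧ ∀ y, |χ y| ≤ B := by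
  obtain ⟨B, hB⟩ := (isCompact_Icc (a := -ρ) (b := ρ)).exists_bound_of_continuousOn
    h.1.continuous.continuousOn
  refine ⟨max B 0, le_max_right _ _, fun y => ?_⟩
  by_cases hy : |y| ≤ ρ
  · exact (hB y (abs_le.1 hy)).trans (le_max_left _ _)
  · rw [h.2 y (not_le.1 hy)]; simp

lemma deriv_eq_zero_of_vanish {ρ : ℝ} {χ : ℝ → ℝ} (h : ∀ y, ρ < |y| → χ y = 0) {y : ℝ}
    (hy : ρ < |y|) : deriv χ y = 0 := by
  have : χ =ᶠ[nhds y] fun _ => 0 := by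
    filter_upwards [(isOpen_lt continuous_const continuous_abs).mem_nhds hy] with z hz
    exact h z hz
  rw [this.deriv_eq, deriv_const]

lemma contDiff_deriv_top {χ : ℝ → ℝ} (h : ContDiff ℝ (⊤ : ℕ∞) χ) :
    ContDiff ℝ (⊤ : ℕ∞) (deriv χ) := ((contDiff_succ_iff_deriv (n := (⊤ : ℕ∞))).1 h).2.2

lemma CutOff.mul_deriv {ρ : ℝ} {χ f : ℝ → ℝ} (h : CutOff ρ χ) (hf : ContDiff ℝ (⊤ : ℕ∞) f) :
    CutOff ρ (fun y => f y * deriv χ y) :=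
  ⟨hf.mul (contDiff_deriv_top h.1), fun y hy => by simp [deriv_eq_zero_of_vanish h.2 hy]⟩

lemma CutOff.hasDerivAt {ρ : ℝ} {χ : ℝ → ℝ} (h : CutOff ρ χ) (y : ℝ) :
    HasDerivAt χ (deriv χ y) y := (h.1.differentiable (by simp) y).hasDerivAt

lemma contDiff_jb : ContDiff ℝ (⊤ : ℕ∞) jb :=
  ContDiff.sqrt (by fun_prop) fun x => by positivity

lemma hasDerivAt_jb_rpow (s x : ℝ) : HasDerivAt (fun x => jb x ^ s) (s * x * jb x ^ (s - 2)) x := by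
  simpa [jbh_one] using hasDerivAt_jbh_rpow (h := 1) le_rfl s x

lemma jbh_eq_mul_jb {h : ℝ} (hh : 1 ≤ h) (ξ : ℝ) : jbh h ξ = h * jb (ξ / h) := by
  have : 0 < h := by linarith
  rw [jbh, jb, ← Real.sqrt_sq this.le, ← Real.sqrt_mul (by positivity), Real.sqrt_sq this.le]
  congr 1
  field_simp

/-- Rescaled functions which are constant near infinity are symbols, uniformly in the scale. -/
lemma SG.scaled {H : ι → ℝ} (hH : ∀ i, 1 ≤ H i) {ρ : ℝ} {χ : ℝ → ℝ} (hs : ContDiff ℝ (⊤ : ℕ∞) χ)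
    (hb : ∃ B, ∀ y, |χ y| ≤ B) (hd : ∀ y, ρ < |y| → deriv χ y = 0) :
    SG 1 0 0 (fun i _ ξ => (χ (ξ / H i) : ℂ)) := by
  refine SG.of_class (fun m n a => ∃ (c : ι → ℝ → ℝ → ℂ) (χ : ℝ → ℝ), SG 1 m n c ∧
    ContDiff ℝ (⊤ : ℕ∞) χ ∧ (∃ B, ∀ y, |χ y| ≤ B) ∧ (∀ y, ρ < |y| → deriv χ y = 0) ∧
    a = fun i x ξ => c i x ξ * (χ (ξ / H i) : ℂ)) ?_ ?_ ?_
    ⟨_, χ, SG.const 1, hs, hb, hd, by simp⟩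
  · rintro m n a ⟨c, χ, hc, -, ⟨B, hB⟩, -, rfl⟩
    obtain ⟨C, hC, h⟩ := hc.bdd
    have hB0 : 0 ≤ B := (abs_nonneg _).trans (hB 0)
    refine ⟨C * B, by positivity, fun i x ξ => ?_⟩
    rw [norm_mul, Complex.norm_real, Real.norm_eq_abs]
    calc _ ≤ (C * jb ξ ^ m * jb x ^ n) * B :=
          mul_le_mul (h i x ξ) (hB _) (abs_nonneg _) ((norm_nonneg _).trans (h i x ξ))
      _ = _ := by ring
  · rintro m n a ⟨c, χ, hc, hs, hb, hd, rfl⟩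
    have hcut : CutOff ρ (fun y => jb y * deriv χ y) :=
      ⟨contDiff_jb.mul (contDiff_deriv_top hs), fun y hy => by simp [hd y hy]⟩
    have hj := SG.pow_mul_jbh_rpow hH 0 (-1) (Or.inl (by norm_num))
    refine ⟨_, _, ⟨_, χ, hc.dXi, hs, hb, hd, rfl⟩, ⟨_, fun y => jb y * deriv χ y,
      (hc.mul hj).le (by norm_num) (by norm_num), hcut.1, ?_,
      fun y hy => deriv_eq_zero_of_vanish hcut.2 hy, rfl⟩, fun i x ξ => ?_⟩
    · obtain ⟨B, -, hB⟩ := hcut.bdd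
      exact ⟨B, hB⟩
    · have hi : 0 < H i := by linarith [hH i]
      have h1 := ((hs.differentiable (by simp) (ξ / H i)).hasDerivAt).comp ξ
        ((hasDerivAt_id ξ).div_const (H i))
      refine ((hc.hasDerivAt_xi i x ξ).mul h1.ofReal_comp).congr_deriv ?_
      simp only [Function.comp_apply, id]
      rw [jbh_eq_mul_jb (hH i), Real.rpow_neg_one]
      have := (jb_pos (ξ / H i)).ne'
      have e : ((H i * jb (ξ / H i) : ℝ)⁻¹ * (jb (ξ / H i) * deriv χ (ξ / H i)) : ℝ) =
        deriv χ (ξ / H i) * (1 / H i) := by field_simp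
      rw [← e]
      push_cast
      ring
  · rintro m n a ⟨c, χ, hc, hs, hb, hd, rfl⟩
    refine ⟨_, _, ⟨_, χ, hc.dX, hs, hb, hd, rfl⟩, ⟨_, χ, SG.zero, hs, hb, hd, rfl⟩,
      fun i x ξ => ?_⟩
    refine ((hc.hasDerivAt_x i x ξ).mul_const _).congr_deriv ?_
    simp

lemma jb_rpow_mul_cutOff_le {θ q h x ξ B : ℝ} {χ : ℝ → ℝ} (hθ : 0 ≤ θ) (hh : 1 ≤ h)
    (hv : ∀ y, 1 < |y| → χ y = 0) (hB : ∀ y, |χ y| ≤ B) :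
    |jbh h ξ ^ (-(q * θ)) * jb x ^ θ * χ (jb x * jbh h ξ ^ (-q))| ≤ B := by
  have h0 : 0 ≤ B := (abs_nonneg _).trans (hB 0)
  have hj := jbh_pos hh ξ
  by_cases hy : |jb x * jbh h ξ ^ (-q)| ≤ 1
  · have hp : 0 ≤ jb x * jbh h ξ ^ (-q) := mul_nonneg (jb_pos x).le (Real.rpow_pos_of_pos hj _).le
    have e : jbh h ξ ^ (-(q * θ)) * jb x ^ θ = (jb x * jbh h ξ ^ (-q)) ^ θ := by
      rw [Real.mul_rpow (jb_pos x).le (Real.rpow_pos_of_pos hj _).le, ← Real.rpow_mul hj.le]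
      ring_nf
    rw [e, abs_mul, abs_of_nonneg (Real.rpow_nonneg hp _)]
    rw [abs_of_nonneg hp] at hy
    calc _ ≤ 1 * B := mul_le_mul (Real.rpow_le_one hp hy hθ) (hB _) (abs_nonneg _) zero_le_one
      _ = B := one_mul B
  · rw [hv _ (not_le.1 hy)]; simpa

lemma hasDerivAt_cutOff_xi {q h : ℝ} {χ : ℝ → ℝ} (hh : 1 ≤ h) (hχ : CutOff 1 χ) (x ξ : ℝ) :
    HasDerivAt (fun ξ => χ (jb x * jbh h ξ ^ (-q))) (-q * (ξ ^ 1 * jbh h ξ ^ (-2 : ℝ)) *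
      (jb x * jbh h ξ ^ (-q) * deriv χ (jb x * jbh h ξ ^ (-q)))) ξ := by
  have h1 := ((hχ.hasDerivAt _).comp ξ ((hasDerivAt_jbh_rpow hh (-q) ξ).const_mul (jb x)))
  refine h1.congr_deriv ?_
  rw [show -q - 2 = -q + -2 by ring, Real.rpow_add (jbh_pos hh ξ)]
  ring

lemma SG.cutOff {H : ι → ℝ} (hH : ∀ i, 1 ≤ H i) {θ q : ℝ} (hθ : 0 ≤ θ)
    {χ : ℝ → ℝ} (hχ : CutOff 1 χ) :
    SG 1 0 0 (fun i x ξ => ((jbh (H i) ξ ^ (-(q * θ)) * jb x ^ θ *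
      χ (jb x * jbh (H i) ξ ^ (-q)) : ℝ) : ℂ)) := by
  refine SG.of_class (fun m n a => ∃ (c : ι → ℝ → ℝ → ℂ) (χ : ℝ → ℝ), SG 1 m n c ∧
    CutOff 1 χ ∧ a = fun i x ξ => c i x ξ * ((jbh (H i) ξ ^ (-(q * θ)) * jb x ^ θ *
      χ (jb x * jbh (H i) ξ ^ (-q)) : ℝ) : ℂ)) ?_ ?_ ?_
    ⟨_, χ, SG.const 1, hχ, by simp⟩
  · rintro m n a ⟨c, χ, hc, hχ, rfl⟩
    obtain ⟨C, hC, h⟩ := hc.bdd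
    obtain ⟨B, hB0, hB⟩ := hχ.bdd
    refine ⟨C * B, by positivity, fun i x ξ => ?_⟩
    rw [norm_mul, Complex.norm_real, Real.norm_eq_abs]
    calc _ ≤ (C * jb ξ ^ m * jb x ^ n) * B :=
          mul_le_mul (h i x ξ) (jb_rpow_mul_cutOff_le hθ (hH i) hχ.2 hB) (abs_nonneg _)
            ((norm_nonneg _).trans (h i x ξ))
      _ = _ := by ring
  · rintro m n a ⟨c, χ, hc, hχ, rfl⟩
    have hj := SG.pow_mul_jbh_rpow hH 1 (-2) (Or.inl (by norm_num))
    refine ⟨_, _, ⟨_, χ, (hc.dXi).add (((hc.mul hj).const_mul (-(q * θ : ℝ))).le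
      (by norm_num) (by norm_num)), hχ, rfl⟩, ⟨_, _, ((hc.mul hj).const_mul (-q : ℝ)).le
      (by norm_num) (by norm_num), hχ.mul_deriv contDiff_id, rfl⟩, fun i x ξ => ?_⟩
    have h1 := ((hasDerivAt_jbh_rpow (hH i) (-(q * θ)) ξ).mul_const (jb x ^ θ)).mul
      (hasDerivAt_cutOff_xi (q := q) (hH i) hχ x ξ)
    refine ((hc.hasDerivAt_xi i x ξ).mul h1.ofReal_comp).congr_deriv ?_
    rw [show -(q * θ) - 2 = -(q * θ) + -2 by ring, Real.rpow_add (jbh_pos (hH i) ξ)]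
    simp only [Pi.mul_apply, id]
    push_cast
    ring
  · rintro m n a ⟨c, χ, hc, hχ, rfl⟩
    have hj := (SG.pow_mul_jbh_rpow (ι := ι) (H := fun _ => 1) (fun _ => le_rfl) 1 (-2)
      (Or.inl (by norm_num))).swap
    simp only [jbh_one] at hj
    refine ⟨_, _, ⟨_, χ, (hc.dX).add (((hc.mul hj).const_mul (θ : ℝ)).le
      (by norm_num) (by norm_num)), hχ, rfl⟩, ⟨_, _, (hc.mul hj).le
      (by norm_num) (by norm_num), hχ.mul_deriv contDiff_id, rfl⟩, fun i x ξ => ?_⟩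
    have h2 := (hasDerivAt_jb_rpow 1 x).mul_const (jbh (H i) ξ ^ (-q))
    simp only [Real.rpow_one] at h2
    have h1 := ((hasDerivAt_jb_rpow θ x).const_mul (jbh (H i) ξ ^ (-(q * θ)))).mul
      ((hχ.hasDerivAt _).comp x h2)
    refine ((hc.hasDerivAt_x i x ξ).mul h1.ofReal_comp).congr_deriv ?_
    rw [show θ - 2 = θ + -2 by ring, jb_rpow_add, show (1 : ℝ) - 2 = 1 + -2 by ring, jb_rpow_add]
    simp only [Pi.mul_apply, Function.comp_apply, id, Real.rpow_one]
    push_cast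
    ring

/-- The integral entering the phase functions. -/
def cutInt (q δ h : ℝ) (χ : ℝ → ℝ) (x ξ : ℝ) : ℝ :=
  ∫ y in (0 : ℝ)..x, jb y ^ (δ - 1) * χ (jb y * jbh h ξ ^ (-q))

lemma continuous_cutInt_integrand {q δ h : ℝ} {χ : ℝ → ℝ} (hχ : Continuous χ) (ξ : ℝ) :
    Continuous fun y => jb y ^ (δ - 1) * χ (jb y * jbh h ξ ^ (-q)) :=
  (continuous_jb_rpow _).mul (hχ.comp (continuous_jb.mul continuous_const))

lemma abs_cutInt_le {q δ h B : ℝ} {χ : ℝ → ℝ} (hh : 1 ≤ h) (hχ : CutOff 1 χ)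
    (hB : ∀ y, |χ y| ≤ B) (hδ : 0 < δ) (hδ1 : δ ≤ 1) (x ξ : ℝ) :
    |cutInt q δ h χ x ξ| ≤ B * (jbh h ξ ^ (q * δ) / δ) := by
  have hB0 : 0 ≤ B := (abs_nonneg _).trans (hB 0)
  have hj := jbh_pos hh ξ
  set Y := jbh h ξ ^ q with hY
  have hY0 : 0 < Y := Real.rpow_pos_of_pos hj _
  have hYi : jbh h ξ ^ (-q) = Y⁻¹ := Real.rpow_neg hj.le _
  have hYδ : jbh h ξ ^ (q * δ) = Y ^ δ := Real.rpow_mul hj.le _ _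
  rw [hYδ]
  have hc := continuous_cutInt_integrand (q := q) (δ := δ) (h := h) hχ.1.continuous ξ
  have small : ∀ x, 0 ≤ x → x ≤ Y → |cutInt q δ h χ x ξ| ≤ B * (Y ^ δ / δ) := by
    intro x hx hxY
    have h1 : ‖cutInt q δ h χ x ξ‖ ≤ ∫ y in (0 : ℝ)..x, B * y ^ (δ - 1) := by
      refine intervalIntegral.norm_integral_le_of_norm_le hx (Filter.Eventually.of_forall
        fun y hy => ?_) ((intervalIntegral.intervalIntegrable_rpow' (by linarith)).const_mul _)
      rw [norm_mul, mul_comm, Real.norm_of_nonneg (jb_rpow_pos _ _).le]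
      refine mul_le_mul (hB _) ?_ (jb_rpow_pos _ _).le hB0
      exact Real.rpow_le_rpow_of_nonpos hy.1 ((le_abs_self y).trans (abs_le_jb y)) (by linarith)
    refine h1.trans ?_
    rw [intervalIntegral.integral_const_mul, integral_rpow (Or.inl (by linarith))]
    rw [sub_add_cancel, Real.zero_rpow hδ.ne', sub_zero]
    gcongr
  have pos : ∀ x, 0 ≤ x → |cutInt q δ h χ x ξ| ≤ B * (Y ^ δ / δ) := by
    intro x hx
    rcases le_or_gt x Y with hxY | hxY
    · exact small x hx hxY
    have e : cutInt q δ h χ x ξ = cutInt q δ h χ Y ξ := by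
      unfold cutInt
      rw [← intervalIntegral.integral_add_adjacent_intervals (hc.intervalIntegrable 0 Y)
        (hc.intervalIntegrable Y x), add_eq_left]
      refine (intervalIntegral.integral_congr_ae (Filter.Eventually.of_forall fun y hy => ?_)).trans
        intervalIntegral.integral_zero
      rw [Set.uIoc_of_le hxY.le] at hy
      rw [hχ.2, mul_zero]
      have : Y < jb y := hy.1.trans_le ((le_abs_self y).trans (abs_le_jb y))
      rw [hYi, abs_of_pos (mul_pos (jb_pos y) (inv_pos.2 hY0)), ← div_eq_mul_inv, one_lt_div hY0]
      exact this
    rw [e]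
    exact small Y hY0.le le_rfl
  rcases le_total 0 x with hx | hx
  · exact pos x hx
  have e : cutInt q δ h χ x ξ = -cutInt q δ h χ (-x) ξ := by
    unfold cutInt
    rw [← intervalIntegral.integral_symm]
    have := intervalIntegral.integral_comp_neg
      (f := fun y => jb y ^ (δ - 1) * χ (jb y * jbh h ξ ^ (-q))) (a := 0) (b := x)
    simp only [neg_zero, jb_neg] at this
    exact this
  rw [e, abs_neg]
  exact pos (-x) (by linarith)

lemma hasDerivAt_cutInt_x {q δ h : ℝ} {χ : ℝ → ℝ} (hχ : Continuous χ) (x ξ : ℝ) :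
    HasDerivAt (fun x => cutInt q δ h χ x ξ)
      (jb x ^ (δ - 1) * χ (jb x * jbh h ξ ^ (-q))) x := by
  have hc := continuous_cutInt_integrand (q := q) (δ := δ) (h := h) hχ ξ
  exact intervalIntegral.integral_hasDerivAt_right (hc.intervalIntegrable 0 x)
    (hc.stronglyMeasurableAtFilter _ _) hc.continuousAt

lemma hasDerivAt_cutInt_xi {q δ h : ℝ} {χ : ℝ → ℝ} (hh : 1 ≤ h) (hχ : CutOff 1 χ) (hδ1 : δ ≤ 1)
    (x ξ : ℝ) : HasDerivAt (fun ξ => cutInt q δ h χ x ξ)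
      (-q * (ξ ^ 1 * jbh h ξ ^ (-2 : ℝ)) * cutInt q δ h (fun y => y * deriv χ y) x ξ) ξ := by
  have hχ' : CutOff 1 (fun y => y * deriv χ y) := hχ.mul_deriv contDiff_id
  obtain ⟨B, hB0, hB⟩ := hχ'.bdd
  have hc := fun ξ => continuous_cutInt_integrand (q := q) (δ := δ) (h := h) hχ.1.continuous ξ
  have hc' := fun ξ => continuous_cutInt_integrand (q := q) (δ := δ) (h := h) hχ'.1.continuous ξ
  have key := intervalIntegral.hasDerivAt_integral_of_dominated_loc_of_deriv_le
    (F := fun ξ y => jb y ^ (δ - 1) * χ (jb y * jbh h ξ ^ (-q)))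
    (F' := fun ξ y => -q * (ξ ^ 1 * jbh h ξ ^ (-2 : ℝ)) * (jb y ^ (δ - 1) *
      (jb y * jbh h ξ ^ (-q) * deriv χ (jb y * jbh h ξ ^ (-q)))))
    (bound := fun _ => |q| * B) (a := 0) (b := x) (x₀ := ξ) (μ := volume)
    (s := Set.univ) Filter.univ_mem
    (Filter.Eventually.of_forall fun ξ => (hc ξ).aestronglyMeasurable)
    ((hc ξ).intervalIntegrable 0 x)
    ((continuous_const.mul (hc' ξ)).aestronglyMeasurable)
    (Filter.Eventually.of_forall fun y _ ξ _ => ?_)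
    intervalIntegrable_const
    (Filter.Eventually.of_forall fun y _ ξ _ => ?_)
  · refine key.2.congr_deriv ?_
    rw [intervalIntegral.integral_const_mul]
    rfl
  · rw [norm_mul, norm_mul (-q), norm_mul (jb y ^ (δ - 1)), norm_neg]
    have h1 : ‖ξ ^ 1 * jbh h ξ ^ (-2 : ℝ)‖ ≤ 1 := by
      refine (jbh_bound hh 1 (-2) ξ).trans ?_
      exact Real.rpow_le_one_of_one_le_of_nonpos (hh.trans (le_jbh h ξ)) (by norm_num)
    have h2 : ‖jb y ^ (δ - 1)‖ ≤ 1 := by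
      rw [Real.norm_of_nonneg (jb_rpow_pos _ _).le]
      exact jb_rpow_le_one y (by linarith)
    calc _ ≤ ‖q‖ * 1 * (1 * B) :=
          mul_le_mul (mul_le_mul_of_nonneg_left h1 (norm_nonneg _))
            (mul_le_mul h2 (hB _) (abs_nonneg _) zero_le_one) (by positivity) (by positivity)
      _ = |q| * B := by rw [Real.norm_eq_abs]; ring
  · refine ((hasDerivAt_cutOff_xi (q := q) hh hχ y ξ).const_mul (jb y ^ (δ - 1))).congr_deriv ?_
    ring

lemma SG.cutInt {H : ι → ℝ} (hH : ∀ i, 1 ≤ H i) {δ q : ℝ} (hδ : 0 < δ) (hδ1 : δ ≤ 1)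
    {χ : ℝ → ℝ} (hχ : CutOff 1 χ) :
    SG 1 0 0 (fun i x ξ => ((jbh (H i) ξ ^ (-(q * δ)) * cutInt q δ (H i) χ x ξ : ℝ) : ℂ)) := by
  refine SG.of_class (fun m n a => SG 1 m n a ∨ (0 ≤ n ∧ ∃ (c : ι → ℝ → ℝ → ℂ) (χ : ℝ → ℝ),
    SG 1 m 0 c ∧ (∀ i x ξ, c i x ξ = c i 0 ξ) ∧ CutOff 1 χ ∧
    a = fun i x ξ => c i x ξ * ((jbh (H i) ξ ^ (-(q * δ)) * _root_.cutInt q δ (H i) χ x ξ : ℝ) : ℂ)))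
    ?_ ?_ ?_ (Or.inr ⟨le_rfl, _, χ, SG.const 1, fun _ _ _ => rfl, hχ, by simp⟩)
  · rintro m n a (ha | ⟨hn, c, χ, hc, -, hχ, rfl⟩)
    · exact ha.bdd
    obtain ⟨C, hC, h⟩ := hc.bdd
    obtain ⟨B, hB0, hB⟩ := hχ.bdd
    refine BddW.mono ?_ le_rfl hn
    refine ⟨C * (B / δ), by positivity, fun i x ξ => ?_⟩
    rw [norm_mul, Complex.norm_real, Real.norm_eq_abs, abs_mul,
      abs_of_pos (Real.rpow_pos_of_pos (jbh_pos (hH i) ξ) _)]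
    have h2 : jbh (H i) ξ ^ (-(q * δ)) * |_root_.cutInt q δ (H i) χ x ξ| ≤ B / δ := by
      refine (mul_le_mul_of_nonneg_left (abs_cutInt_le (hH i) hχ hB hδ hδ1 x ξ)
        (Real.rpow_pos_of_pos (jbh_pos (hH i) ξ) _).le).trans_eq ?_
      have := (Real.rpow_pos_of_pos (jbh_pos (hH i) ξ) (q * δ)).ne'
      rw [Real.rpow_neg (jbh_pos (hH i) ξ).le]
      field_simp
    calc _ ≤ (C * jb ξ ^ m * jb x ^ (0 : ℝ)) * (B / δ) :=
          mul_le_mul (h i x ξ) h2 (mul_nonneg (Real.rpow_pos_of_pos (jbh_pos (hH i) ξ) _).le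
            (abs_nonneg _)) ((norm_nonneg _).trans (h i x ξ))
      _ = _ := by ring
  · rintro m n a (ha | ⟨hn, c, χ, hc, hcx, hχ, rfl⟩)
    · exact ⟨_, _, Or.inl ha.dXi, Or.inl SG.zero, fun i x ξ => by
        simpa using ha.hasDerivAt_xi i x ξ⟩
    have hj := SG.pow_mul_jbh_rpow hH 1 (-2) (Or.inl (by norm_num))
    have hcx' : ∀ i x ξ, _root_.dXi (c i) x ξ = _root_.dXi (c i) 0 ξ := by
      intro i x ξ
      unfold _root_.dXi
      congr 1
      funext ξ'
      exact hcx i x ξ'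
    refine ⟨_, _, Or.inr ⟨hn, _, χ, (hc.dXi).add (((hc.mul hj).const_mul (-(q * δ : ℝ))).le
      (by norm_num) (by norm_num)), ?_, hχ, rfl⟩,
      Or.inr ⟨hn, _, _, ((hc.mul hj).const_mul (-q : ℝ)).le
      (by norm_num) (by norm_num), ?_, hχ.mul_deriv contDiff_id, rfl⟩, fun i x ξ => ?_⟩
    · intro i x ξ
      rw [hcx i x ξ, hcx' i x ξ]
    · intro i x ξ
      rw [hcx i x ξ]
    have h1 := ((hasDerivAt_jbh_rpow (hH i) (-(q * δ)) ξ).mul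
      (hasDerivAt_cutInt_xi (q := q) (δ := δ) (hH i) hχ hδ1 x ξ))
    refine ((hc.hasDerivAt_xi i x ξ).mul h1.ofReal_comp).congr_deriv ?_
    rw [show -(q * δ) - 2 = -(q * δ) + -2 by ring, Real.rpow_add (jbh_pos (hH i) ξ)]
    simp only [Pi.mul_apply, id]
    push_cast
    ring
  · rintro m n a (ha | ⟨hn, c, χ, hc, hcx, hχ, rfl⟩)
    · exact ⟨_, _, Or.inl ha.dX, Or.inl SG.zero, fun i x ξ => by
        simpa using ha.hasDerivAt_x i x ξ⟩
    have hW := (hc.mul (SG.jb_x (-1))).mul (SG.cutOff hH (q := q) hδ.le hχ)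
    refine ⟨_, _, Or.inl (hW.le (by linarith) (by linarith)), Or.inl SG.zero, fun i x ξ => ?_⟩
    have h0 : _root_.dX (c i) x ξ = 0 := by
      unfold _root_.dX
      rw [show (fun x' => c i x' ξ) = fun _ => c i 0 ξ from funext fun x' => hcx i x' ξ,
        deriv_const]
    have h1 := ((hasDerivAt_cutInt_x (q := q) (δ := δ) (h := H i) hχ.1.continuous x ξ).const_mul
      (jbh (H i) ξ ^ (-(q * δ))))
    refine ((hc.hasDerivAt_x i x ξ).mul h1.ofReal_comp).congr_deriv ?_
    rw [h0, show δ - 1 = -1 + δ by ring, jb_rpow_add]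
    push_cast
    ring

lemma Phase.of_sgp {φ : ι → ℝ → ℝ → ℂ} (h : SGp 0 0 φ) {M C : ℝ} (hC : 0 ≤ C)
    (he : ∀ i x ξ, Real.exp ‖φ i x ξ‖ ≤ C * jb x ^ M) : Phase φ where
  smooth := h.smooth
  dx := h.dX.le le_rfl (by norm_num)
  dxi := h.dXi.le (by norm_num) le_rfl
  exp_le := ⟨M, C, hC, fun i x ξ => ⟨(Complex.norm_exp_le_exp_norm _).trans (he i x ξ),
    (Complex.norm_exp_le_exp_norm _).trans (by rw [norm_neg]; exact he i x ξ)⟩⟩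

lemma Phase.of_sg {φ : ι → ℝ → ℝ → ℂ} (h : SG 1 0 0 φ) : Phase φ := by
  obtain ⟨C, hC, hb⟩ := h.bdd
  refine Phase.of_sgp h.sgp (M := 0) (C := Real.exp C) (Real.exp_pos _).le fun i x ξ => ?_
  have := hb i x ξ
  simp only [Real.rpow_zero, mul_one] at this ⊢
  exact Real.exp_le_exp.2 this

lemma hasDerivAt_arsinh_jb (x : ℝ) : HasDerivAt Real.arsinh (jb x ^ (-1 : ℝ)) x := by
  rw [Real.rpow_neg_one]; exact Real.hasDerivAt_arsinh x

lemma integral_inv_jb (x : ℝ) : ∫ y in (0 : ℝ)..x, (jb y)⁻¹ = Real.arsinh x := by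
  rw [intervalIntegral.integral_eq_sub_of_hasDerivAt
    (f := Real.arsinh) (f' := fun y => (jb y)⁻¹) (fun y _ => Real.hasDerivAt_arsinh y)
    ((continuous_jb.inv₀ fun y => (jb_pos y).ne').intervalIntegrable _ _), Real.arsinh_zero,
    sub_zero]

lemma exp_abs_arsinh_le (x : ℝ) : Real.exp |Real.arsinh x| ≤ 2 * jb x := by
  have h : ∀ y, Real.exp (Real.arsinh y) ≤ 2 * jb y := fun y => by
    rw [Real.exp_arsinh, two_mul]
    exact add_le_add ((le_abs_self y).trans (abs_le_jb y)) le_rfl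
  rcases abs_choice (Real.arsinh x) with e | e <;> rw [e]
  · exact h x
  · rw [← Real.arsinh_neg]; simpa [jb_neg] using h (-x)

lemma sgp_arsinh : SGp 0 0 (fun (_ : ι) x _ => (Real.arsinh x : ℂ)) := by
  intro ε hε
  refine SG.of_partials ⟨2 ^ ε / ε, by positivity, fun i x ξ => ?_⟩ SG.zero
    (fun _ _ _ => hasDerivAt_const _ _) ((SG.jb_x (-1)).le le_rfl (by linarith))
    (fun i x ξ => (hasDerivAt_arsinh_jb x).ofReal_comp)
  rw [Complex.norm_real, Real.norm_eq_abs, Real.rpow_zero, mul_one, zero_add]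
  have h1 : ε * |Real.arsinh x| ≤ (2 * jb x) ^ ε := by
    refine (le_trans (by linarith [Real.add_one_le_exp (ε * |Real.arsinh x|)]) le_rfl :
      ε * |Real.arsinh x| ≤ Real.exp (ε * |Real.arsinh x|)).trans ?_
    rw [mul_comm, Real.exp_mul]
    exact Real.rpow_le_rpow (Real.exp_pos _).le (exp_abs_arsinh_le x) hε.le
  rw [Real.mul_rpow two_pos.le (jb_pos x).le] at h1
  rw [div_mul_eq_mul_div, le_div_iff₀ hε]
  linarith

section lamSym

variable {p : ℕ} {Mc : ℕ → ℝ} {ω ψ : ℝ → ℝ} {ρ : ℝ}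

lemma lamSym_one (h x ξ : ℝ) :
    lamSym p Mc ω ψ h 1 x ξ = Mc 1 * ω (ξ / h) * Real.arsinh x := by
  simp [lamSym, integral_inv_jb]

lemma lamSym_two_le {k : ℕ} (hk : 2 ≤ k) (hkp : k ≤ p - 1) {h : ℝ} (hh : 1 ≤ h) (x ξ : ℝ) :
    lamSym p Mc ω ψ h k x ξ = Mc k * ω (ξ / h) *
      (jbh h ξ ^ (-(((p : ℝ) - 1) * (((k : ℝ) - 1) / ((p : ℝ) - 1)))) *
        cutInt ((p : ℝ) - 1) (((k : ℝ) - 1) / ((p : ℝ) - 1)) h ψ x ξ) := by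
  have hp : (0 : ℝ) < (p : ℝ) - 1 := by
    have : (2 : ℝ) ≤ p := by exact_mod_cast (by omega : 2 ≤ p)
    linarith
  rw [lamSym, if_neg (by omega), cutInt, ← mul_assoc]
  congr 1
  · congr 2
    field_simp
    ring
  · refine intervalIntegral.integral_congr fun y _ => ?_
    rw [Real.rpow_neg (jbh_pos hh ξ).le, ← div_eq_mul_inv]
    congr 2
    field_simp
    ring

lemma phase_lamSym (hω : ContDiff ℝ (⊤ : ℕ∞) ω) (hω1 : ∀ ξ, |ω ξ| ≤ 1)
    (hωd : ∀ y, ρ < |y| → deriv ω y = 0) (hψ : CutOff 1 ψ)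
    {H : ι → ℝ} (hH : ∀ i, 1 ≤ H i) {k : ℕ} (hk : 1 ≤ k) (hkp : k ≤ p - 1) :
    Phase (fun i x ξ => (lamSym p Mc ω ψ (H i) k x ξ : ℂ)) := by
  have hωs : SG 1 0 0 (fun i (_ : ℝ) ξ => (ω (ξ / H i) : ℂ)) := SG.scaled hH hω ⟨1, hω1⟩ hωd
  rcases hk.eq_or_lt with rfl | hk2
  · refine Phase.of_sgp (M := |Mc 1|) (C := 2 ^ |Mc 1|) ?_ (by positivity) fun i x ξ => ?_
    · refine ((((hωs.sgp.mul sgp_arsinh).const_mul (Mc 1 : ℂ)).le (by simp) (by simp))).congr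
        fun i x ξ => ?_
      rw [lamSym_one]
      push_cast
      ring
    · rw [lamSym_one, Complex.norm_real, Real.norm_eq_abs, abs_mul, abs_mul,
        ← Real.mul_rpow two_pos.le (jb_pos x).le]
      calc _ ≤ Real.exp (|Real.arsinh x| * |Mc 1|) := Real.exp_le_exp.2 (by
            have := mul_le_mul_of_nonneg_right (mul_le_of_le_one_right (abs_nonneg (Mc 1))
              (hω1 (ξ / H i))) (abs_nonneg (Real.arsinh x))
            linarith)
        _ ≤ _ := by
            rw [Real.exp_mul]
            exact Real.rpow_le_rpow (Real.exp_pos _).le (exp_abs_arsinh_le x) (abs_nonneg _)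
  · have hk2' : (2 : ℝ) ≤ k := by exact_mod_cast hk2
    have hkp' : (k : ℝ) + 1 ≤ p := by exact_mod_cast (by omega : k + 1 ≤ p)
    have hc := SG.cutInt hH (δ := ((k : ℝ) - 1) / ((p : ℝ) - 1)) (q := (p : ℝ) - 1)
      (div_pos (by linarith) (by linarith)) ((div_le_one (by linarith)).2 (by linarith)) hψ
    refine Phase.of_sg ((((hωs.mul hc).const_mul (Mc k : ℂ)).le (by simp) (by simp)).congr
      fun i x ξ => ?_)
    rw [lamSym_two_le hk2 hkp (hH i)]
    push_cast
    ring

lemma dX_lamSym_one (h x ξ : ℝ) : dX (fun x ξ => (lamSym p Mc ω ψ h 1 x ξ : ℂ)) x ξ =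
    ((Mc 1 * ω (ξ / h) * jb x ^ (-1 : ℝ) : ℝ) : ℂ) := by
  simp only [lamSym_one]
  exact (((hasDerivAt_arsinh_jb x).const_mul (Mc 1 * ω (ξ / h))).ofReal_comp).deriv

lemma sg_dX_lamSym (hω : ContDiff ℝ (⊤ : ℕ∞) ω) (hω1 : ∀ ξ, |ω ξ| ≤ 1)
    (hωd : ∀ y, ρ < |y| → deriv ω y = 0) (hψ : CutOff 1 ψ)
    {h : ℝ} (hh : 1 ≤ h) {k : ℕ} (hk : 2 ≤ k) (hkp : k ≤ p - 1) :
    SG 1 (1 - k) (-(((p : ℝ) - k) / ((p : ℝ) - 1)))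
      (fun _ : Unit => dX (fun x ξ => (lamSym p Mc ω ψ h k x ξ : ℂ))) := by
  have hk2' : (2 : ℝ) ≤ k := by exact_mod_cast hk
  have hkp' : (k : ℝ) + 1 ≤ p := by exact_mod_cast (by omega : k + 1 ≤ p)
  have hH : ∀ _ : Unit, 1 ≤ h := fun _ => hh
  have hωs : SG 1 0 0 (fun (_ : Unit) (_ : ℝ) ξ => (ω (ξ / h) : ℂ)) :=
    SG.scaled hH hω ⟨1, hω1⟩ hωd
  have hj := SG.pow_mul_jbh_rpow hH 0 (1 - k) (Or.inl (by norm_num; linarith))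
  have hW := SG.cutOff hH (q := (p : ℝ) - 1) le_rfl hψ
  have hx := SG.jb_x (ι := Unit) (((k : ℝ) - 1) / ((p : ℝ) - 1) - 1)
  refine ((((((hωs.mul hj).mul hx).mul hW)).const_mul (Mc k : ℂ)).le (by simp) ?_).congr
    fun _ x ξ => ?_
  · apply le_of_eq
    have : (p : ℝ) - 1 ≠ 0 := by linarith
    field_simp
    ring
  · simp only [lamSym_two_le hk hkp hh]
    refine (((hasDerivAt_cutInt_x hψ.1.continuous x ξ).const_mul _).const_mul
      (Mc k * ω (ξ / h))).ofReal_comp.deriv.trans ?_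
    have : (p : ℝ) - 1 ≠ 0 := by linarith
    rw [mul_div_cancel₀ _ this, show (1 - (k : ℝ)) = -(k - 1) by ring]
    simp only [mul_zero, neg_zero, Real.rpow_zero, pow_zero]
    push_cast
    ring

end lamSym

/-- The embedding of the Schwartz space in `L²`. -/
def toL2 : SchwartzMap ℝ ℂ →L[ℂ] Lp ℂ 2 (volume : Measure ℝ) :=
  SchwartzMap.toLpCLM ℂ ℂ 2 volume

lemma toL2_ae (u : SchwartzMap ℝ ℂ) : toL2 u =ᵐ[volume] u := u.coeFn_toLp 2 volume

lemma inner_toL2 (u v : SchwartzMap ℝ ℂ) :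
    inner ℂ (toL2 u) (toL2 v) = ∫ x, (starRingEnd ℂ) (u x) * v x := by
  rw [L2.inner_def]
  refine integral_congr_ae ?_
  filter_upwards [toL2_ae u, toL2_ae v] with x h1 h2
  rw [h1, h2, RCLike.inner_apply, mul_comm]

lemma norm_toL2_sq (u : SchwartzMap ℝ ℂ) : ‖toL2 u‖ ^ 2 = ∫ x, ‖u x‖ ^ 2 := by
  have h := congrArg Complex.re (inner_toL2 u u)
  have h2 : inner ℂ (toL2 u) (toL2 u) = ((‖toL2 u‖ ^ 2 : ℝ) : ℂ) := by
    rw [inner_self_eq_norm_sq_to_K]; push_cast; rfl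
  rw [h2, Complex.ofReal_re] at h
  rw [h]
  have : ∀ x, (starRingEnd ℂ) (u x) * u x = ((‖u x‖ ^ 2 : ℝ) : ℂ) := fun x => by
    rw [Complex.conj_mul']; push_cast; rfl
  simp_rw [this]
  rw [integral_complex_ofReal, Complex.ofReal_re]

lemma integrable_norm_sq (u : SchwartzMap ℝ ℂ) : Integrable (fun x => ‖u x‖ ^ 2) :=
  ((u.memLp 2 volume).integrable_norm_pow (by norm_num)).congr (by simp)

lemma lintegral_norm_sq (u : SchwartzMap ℝ ℂ) :
    ∫⁻ x, ENNReal.ofReal (‖u x‖ ^ 2) = ENNReal.ofReal (‖toL2 u‖ ^ 2) := by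
  rw [norm_toL2_sq, ofReal_integral_eq_lintegral_ofReal (integrable_norm_sq u)
    (Filter.Eventually.of_forall fun x => by positivity)]

lemma norm_toL2_le_of_le {u v : SchwartzMap ℝ ℂ} {C : ℝ} (hC : 0 ≤ C)
    (h : ∀ x, ‖u x‖ ≤ C * ‖v x‖) : ‖toL2 u‖ ≤ C * ‖toL2 v‖ := by
  refine le_of_sq_le_sq ?_ (by positivity)
  rw [mul_pow, norm_toL2_sq, norm_toL2_sq, ← integral_const_mul]
  refine integral_mono (integrable_norm_sq u) ((integrable_norm_sq v).const_mul _) fun x => ?_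
  have := pow_le_pow_left₀ (norm_nonneg _) (h x) 2
  rwa [mul_pow] at this

lemma hat_eq_fourier (u : SchwartzMap ℝ ℂ) (ξ : ℝ) :
    hat u ξ = FourierTransform.fourier u (ξ / (2 * π)) := by
  rw [hat_apply, SchwartzMap.fourier_coe, Real.fourier_real_eq_integral_exp_smul]
  congr 1
  ext y
  rw [ep, smul_eq_mul]
  congr 2
  push_cast
  field_simp

lemma inner_hat (u v : SchwartzMap ℝ ℂ) :
    inner ℂ (toL2 (hat u)) (toL2 (hat v)) = (2 * π : ℝ) * inner ℂ (toL2 u) (toL2 v) := by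
  have h := SchwartzMap.integral_inner_fourier_fourier u v
  rw [inner_toL2, inner_toL2]
  simp_rw [RCLike.inner_apply, mul_comm _ ((starRingEnd ℂ) _)] at h
  rw [← h]
  simp_rw [hat_eq_fourier]
  have := Measure.integral_comp_div (fun ξ => (starRingEnd ℂ) (FourierTransform.fourier u ξ) *
    FourierTransform.fourier v ξ) (2 * π)
  rw [this, abs_of_pos (by positivity), Complex.real_smul]

lemma norm_hat_sq (u : SchwartzMap ℝ ℂ) : ‖toL2 (hat u)‖ ^ 2 = 2 * π * ‖toL2 u‖ ^ 2 := by
  have h := inner_hat u u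
  rw [inner_self_eq_norm_sq_to_K, inner_self_eq_norm_sq_to_K] at h
  have h2 : ((‖toL2 (hat u)‖ ^ 2 : ℝ) : ℂ) = ((2 * π * ‖toL2 u‖ ^ 2 : ℝ) : ℂ) := by
    push_cast; push_cast at h; exact h
  exact_mod_cast h2

lemma norm_hat (u : SchwartzMap ℝ ℂ) : ‖toL2 (hat u)‖ = √(2 * π) * ‖toL2 u‖ := by
  rw [← Real.sqrt_sq (norm_nonneg (toL2 (hat u))), norm_hat_sq, Real.sqrt_mul (by positivity),
    Real.sqrt_sq (norm_nonneg _)]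

lemma norm_opS_xi_le {m : ℝ → ℂ} {γ s : ℝ} (hm : SG γ s 0 (fun (_ : Unit) _ ξ => m ξ))
    (hγ : 0 ≤ γ) {C : ℝ} (hC : 0 ≤ C) (h : ∀ ξ, ‖m ξ‖ ≤ C) (u : SchwartzMap ℝ ℂ) :
    ‖toL2 (opS (fun _ ξ => m ξ) u)‖ ≤ C * ‖toL2 u‖ := by
  have h1 := norm_toL2_le_of_le (u := hat (opS (fun _ ξ => m ξ) u)) (v := hat u) hC fun ξ => by
    rw [hat_opS hm hγ, norm_mul]
    exact mul_le_mul_of_nonneg_right (h ξ) (norm_nonneg _)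
  rw [norm_hat, norm_hat, mul_left_comm] at h1
  exact le_of_mul_le_mul_left h1 (by positivity)

lemma opS_x {m : ℝ → ℂ} {γ s : ℝ} (hm : SG γ 0 s (fun (_ : Unit) x _ => m x)) (hγ : 0 ≤ γ)
    (u : SchwartzMap ℝ ℂ) (x : ℝ) : opS (fun x _ => m x) u x = m x * u x := by
  rw [hm.opS_kern hγ () u x, hat_inversion u x]
  exact kern_const_mul (m x) (fun _ ξ => hat u ξ) x x

lemma hasDerivAt_hat (v : SchwartzMap ℝ ℂ) {w : SchwartzMap ℝ ℂ} (hw : ∀ x, w x = x * v x)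
    (ξ : ℝ) : HasDerivAt (hat v) (-Complex.I * hat w ξ) ξ := by
  obtain ⟨C, hC0, hC⟩ := (schwartz_rapidXi (ι := Unit) v).two.bdd
  obtain ⟨D, hD0, hD⟩ := (schwartz_rapidXi (ι := Unit) w).two.bdd
  have := hasDerivAt_integral_of_jb_bound (F := fun ξ y => ep (-(y * ξ)) * v y)
    (F' := fun ξ y => -Complex.I * (ep (-(y * ξ)) * w y)) (x₀ := ξ) (C₀ := C) (C := D)
    (fun ξ => by have := v.continuous; fun_prop) (by have := w.continuous; fun_prop)
    (fun z => by simpa [norm_ep] using hC () 0 z)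
    (fun ξ _ z => by simpa [norm_ep] using hD () 0 z)
    (fun ξ z => by
      have := (hasDerivAt_ep_mul (-z) ξ).mul_const (v z)
      simp only [neg_mul] at this
      refine this.congr_deriv ?_
      rw [hw]; push_cast; ring)
  rw [integral_const_mul, ← hat_apply] at this
  exact this.congr_of_eventuallyEq (Filter.Eventually.of_forall fun ξ => hat_apply v ξ)

/-- Freezing the space variable of a family of symbols. -/
lemma SG.freeze {γ m : ℝ} {a : ι → ℝ → ℝ → ℂ} (h : SG γ m 0 a) :
    SG γ m 0 (fun (q : ι × ℝ) (_ ξ : ℝ) => a q.1 q.2 ξ) := by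
  refine SG.of_closed_class (fun p q d => d = (fun _ _ _ => 0) ∨ (q = 0 ∧ ∃ a : ι → ℝ → ℝ → ℂ,
    SG γ p 0 a ∧ d = fun (q : ι × ℝ) (_ ξ : ℝ) => a q.1 q.2 ξ)) ?_ ?_ ?_ (Or.inr ⟨rfl, a, h, rfl⟩)
  · rintro p q _ (rfl | ⟨rfl, a, ha, rfl⟩)
    · exact SG.zero (γ := 0).bdd
    · obtain ⟨C, hC0, hC⟩ := ha.bdd
      exact ⟨C, hC0, fun i x ξ => by simpa using hC i.1 i.2 ξ⟩
  · rintro p q _ (rfl | ⟨rfl, a, ha, rfl⟩)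
    · exact ⟨_, Or.inl rfl, fun _ _ _ => hasDerivAt_const _ _⟩
    · exact ⟨_, Or.inr ⟨rfl, _, ha.dXi, rfl⟩, fun i x ξ => ha.hasDerivAt_xi _ _ _⟩
  · rintro p q _ (rfl | ⟨rfl, a, ha, rfl⟩)
    · exact ⟨_, Or.inl rfl, fun _ _ _ => hasDerivAt_const _ _⟩
    · exact ⟨_, Or.inl rfl, fun i x ξ => hasDerivAt_const _ _⟩

/-- The localising weight `(1 + i(x - s))⁻¹`. -/
def resW (s x : ℝ) : ℂ := (1 + Complex.I * ((x - s : ℝ) : ℂ))⁻¹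

lemma resW_ne (s x : ℝ) : (1 + Complex.I * ((x - s : ℝ) : ℂ)) ≠ 0 := fun h => by
  have := congrArg Complex.re h
  simp at this

lemma norm_resW_sq (s x : ℝ) : ‖resW s x‖ ^ 2 = jb (x - s) ^ (-2 : ℝ) := by
  rw [resW, norm_inv, inv_pow, ← Complex.normSq_eq_norm_sq, Complex.normSq_apply,
    Real.rpow_neg (jb_pos _).le]
  congr 1
  have := jb_sq (x - s)
  norm_cast
  rw [this]
  simp
  ring

lemma norm_resW_le_one (s x : ℝ) : ‖resW s x‖ ≤ 1 := by
  have h := norm_resW_sq s x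
  have := jb_rpow_le_one (x - s) (s := -2) (by norm_num)
  exact (sq_le_one_iff₀ (norm_nonneg _)).1 (h ▸ this)

lemma resW_self (x : ℝ) : resW x x = 1 := by simp [resW]

lemma hasDerivAt_resW_x (s x : ℝ) :
    HasDerivAt (resW s) (-Complex.I * resW s x ^ 2) x := by
  have h1 : HasDerivAt (fun x : ℝ => 1 + Complex.I * ((x - s : ℝ) : ℂ)) Complex.I x := by
    simpa using (((hasDerivAt_id x).sub_const s).ofReal_comp.const_mul Complex.I).const_add 1
  refine (h1.inv (resW_ne s x)).congr_deriv ?_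
  rw [resW, inv_pow, div_eq_mul_inv]

lemma hasDerivAt_resW_s (s x : ℝ) :
    HasDerivAt (fun s => resW s x) (Complex.I * resW s x ^ 2) s := by
  have h1 : HasDerivAt (fun s : ℝ => 1 + Complex.I * ((x - s : ℝ) : ℂ)) (-Complex.I) s := by
    simpa using (((hasDerivAt_id s).const_sub x).ofReal_comp.const_mul Complex.I).const_add 1
  refine (h1.inv (resW_ne s x)).congr_deriv ?_
  rw [resW, inv_pow, div_eq_mul_inv, neg_neg]

lemma sg_resW : SG 0 0 0 (fun (s : ℝ) (x _ : ℝ) => resW s x) := by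
  refine SG.of_closed_class (fun p q d => p = 0 ∧ q = 0 ∧ (d = (fun _ _ _ => 0) ∨
    ∃ (c : ℂ) (k : ℕ), d = fun s x _ => c * resW s x ^ k)) ?_ ?_ ?_
    ⟨rfl, rfl, Or.inr ⟨1, 1, by simp⟩⟩
  · rintro p q _ ⟨rfl, rfl, rfl | ⟨c, k, rfl⟩⟩
    · exact SG.zero (γ := 0).bdd
    · refine ⟨‖c‖, norm_nonneg _, fun s x ξ => ?_⟩
      rw [norm_mul, norm_pow]
      simpa using mul_le_of_le_one_right (norm_nonneg c)
        (pow_le_one₀ (norm_nonneg _) (norm_resW_le_one s x))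
  · rintro p q _ ⟨rfl, rfl, rfl | ⟨c, k, rfl⟩⟩
    · exact ⟨_, ⟨by simp, rfl, Or.inl rfl⟩, fun _ _ _ => hasDerivAt_const _ _⟩
    · exact ⟨_, ⟨by simp, rfl, Or.inl rfl⟩, fun _ _ _ => hasDerivAt_const _ _⟩
  · rintro p q _ ⟨rfl, rfl, rfl | ⟨c, k, rfl⟩⟩
    · exact ⟨_, ⟨rfl, by simp, Or.inl rfl⟩, fun _ _ _ => hasDerivAt_const _ _⟩
    · refine ⟨fun s x _ => (-Complex.I * c * k) * resW s x ^ (k + 1),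
        ⟨rfl, by simp, Or.inr ⟨_, k + 1, rfl⟩⟩, fun s x _ => ?_⟩
      refine (((hasDerivAt_resW_x s x).pow k).const_mul c).congr_deriv ?_
      rcases k with _ | k
      · simp
      · simp only [Nat.add_sub_cancel]; ring

lemma opS_resW (s : ℝ) (u : SchwartzMap ℝ ℂ) (x : ℝ) :
    opS (fun x _ => resW s x) u x = resW s x * u x :=
  opS_x (m := resW s) (sg_resW.reindex (fun _ : Unit => s)) le_rfl u x

lemma norm_opS_resW_le (s : ℝ) (u : SchwartzMap ℝ ℂ) :
    ‖toL2 (opS (fun x _ => resW s x) u)‖ ≤ ‖toL2 u‖ := by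
  have := norm_toL2_le_of_le (u := opS (fun x _ => resW s x) u) (v := u) zero_le_one fun x => by
    rw [opS_resW, norm_mul]
    exact mul_le_mul_of_nonneg_right (norm_resW_le_one s x) (norm_nonneg _)
  simpa using this

lemma opS_xi_eq_of_resW {m : ℝ → ℂ} {γ : ℝ} (hm : SG γ 0 0 (fun (_ : Unit) _ ξ => m ξ))
    (hγ : 0 ≤ γ) (s : ℝ) (u : SchwartzMap ℝ ℂ) :
    opS (fun x _ => resW s x) (opS (fun _ ξ => m ξ) u) =
      opS (fun _ ξ => m ξ) (opS (fun x _ => resW s x) u) +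
      opS (fun x _ => resW s x) (opS (fun _ ξ => deriv m ξ) (opS (fun x _ => resW s x) u)) := by
  set v := opS (fun x _ => resW s x) u with hv
  set w := opS (fun x _ => (x : ℂ)) v with hw
  have hw' : ∀ x, w x = x * v x := opS_x (m := fun x => (x : ℂ)) SG.id_x zero_le_one v
  have hu : u = (1 - Complex.I * s) • v + Complex.I • w := by
    ext x
    rw [add_apply, smul_apply, smul_apply, hw', hv, opS_resW, resW]
    have := resW_ne s x
    simp only [smul_eq_mul]
    field_simp
    push_cast
    ring
  have hm' : SG γ (0 - γ) 0 (fun (_ : Unit) _ ξ => deriv m ξ) := hm.dXi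
  have key : ∀ x, Complex.I * opS (fun _ ξ => m ξ) w x =
      Complex.I * x * opS (fun _ ξ => m ξ) v x + opS (fun _ ξ => deriv m ξ) v x := fun x => by
    have r1 := (hm.rapidXi_hat hγ v).two
    have r2 := (hm'.rapidXi_hat hγ v).two
    have r3 := (hm.rapidXi_hat hγ w).two
    have h1 := r1.mul_kern le_rfl le_rfl () x x
    have h2 : dXi (fun (_ ξ : ℝ) => m ξ * hat v ξ) =
        fun (_ ξ : ℝ) => deriv m ξ * hat v ξ + -Complex.I * (m ξ * hat w ξ) :=
      hasDerivAt_dXi fun x ξ => ((hm.hasDerivAt_xi () x ξ).mul (hasDerivAt_hat v hw' ξ)).congr_deriv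
        (by simp only [dXi]; ring)
    rw [h2, kern_add (r2.integrable_ep_mul le_rfl () x x)
      (((r3.integrable_ep_mul le_rfl () x x).const_mul (-Complex.I)).congr
        (Filter.Eventually.of_forall fun ξ => by ring)), kern_const_mul] at h1
    rw [hm.opS_kern hγ () v, hm.opS_kern hγ () w, hm'.opS_kern hγ () v]
    linear_combination -Complex.I * h1 +
      (Complex.I * kern (fun x ξ => m ξ * hat w ξ) x x -
        kern (fun x ξ => deriv m ξ * hat v ξ) x x) * Complex.I_sq
  ext x
  rw [add_apply, opS_resW, opS_resW]
  nth_rw 1 [hu]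
  rw [map_add, map_smul, map_smul, add_apply, smul_apply, smul_apply, smul_eq_mul, smul_eq_mul, key,
    resW]
  have := resW_ne s x
  field_simp
  push_cast
  ring

lemma norm_resW_opS_xi_le {m : ℝ → ℂ} {γ : ℝ} (hm : SG γ 0 0 (fun (_ : Unit) _ ξ => m ξ))
    (hγ : 0 ≤ γ) {A B : ℝ} (hA0 : 0 ≤ A) (hB0 : 0 ≤ B) (hA : ∀ ξ, ‖m ξ‖ ≤ A)
    (hB : ∀ ξ, ‖deriv m ξ‖ ≤ B) (s : ℝ) (u : SchwartzMap ℝ ℂ) :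
    ‖toL2 (opS (fun x _ => resW s x) (opS (fun _ ξ => m ξ) u))‖ ≤
      (A + B) * ‖toL2 (opS (fun x _ => resW s x) u)‖ := by
  rw [opS_xi_eq_of_resW hm hγ, map_add, add_mul]
  exact (norm_add_le _ _).trans (add_le_add (norm_opS_xi_le hm hγ hA0 hA _)
    ((norm_opS_resW_le _ _).trans (norm_opS_xi_le (s := 0 - γ) hm.dXi hγ hB0 hB _)))

lemma sq_norm_le_integral {f f' : ℝ → ℂ} (hd : ∀ s, HasDerivAt f (f' s) s) (hf' : Continuous f')
    (h1 : Integrable fun s => ‖f s‖ ^ 2) (h2 : Integrable fun s => ‖f' s‖ ^ 2) (x : ℝ) :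
    ‖f x‖ ^ 2 ≤ ∫ s, (‖f s‖ ^ 2 + ‖f' s‖ ^ 2) := by
  have hf : Continuous f := continuous_iff_continuousAt.2 fun s => (hd s).continuousAt
  have hg : ∀ s, HasDerivAt (fun s => ‖f s‖ ^ 2) (2 * inner ℝ (f s) (f' s)) s :=
    fun s => (hd s).norm_sq
  have hb : ∀ s, ‖2 * inner ℝ (f s) (f' s)‖ ≤ ‖f s‖ ^ 2 + ‖f' s‖ ^ 2 := fun s => by
    have := norm_inner_le_norm (𝕜 := ℝ) (f s) (f' s)
    rw [norm_mul, Real.norm_of_nonneg (by norm_num : (0:ℝ) ≤ 2)]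
    nlinarith [sq_nonneg (‖f s‖ - ‖f' s‖)]
  have hi : Integrable fun s => 2 * inner ℝ (f s) (f' s) :=
    (h1.add h2).mono' (by fun_prop) (Filter.Eventually.of_forall hb)
  have ht := tendsto_zero_of_hasDerivAt_of_integrableOn_Iic (a := x) (fun s _ => hg s)
    hi.integrableOn h1.integrableOn
  have e := integral_Iic_of_hasDerivAt_of_tendsto' (a := x) (fun s _ => hg s) hi.integrableOn ht
  rw [sub_zero] at e
  rw [← e]
  refine (integral_mono hi.integrableOn (h1.add h2).integrableOn
    fun s => (le_abs_self _).trans (hb s)).trans ?_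
  exact setIntegral_le_integral (h1.add h2) (Filter.Eventually.of_forall fun s => by
    simp only [Pi.add_apply]; positivity)

lemma SG.continuous_kern_two {γ : ℝ} {r : ι → ℝ → ℝ → ℂ} (h : SG γ (-2) 0 r) (i : ι) :
    Continuous fun q : ℝ × ℝ => kern (r i) q.1 q.2 := by
  obtain ⟨C, -, hC⟩ := h.bdd
  refine continuous_const.mul (continuous_of_dominated
    (bound := fun ξ => C * jb ξ ^ (-2 : ℝ)) (fun q => ?_) (fun q => ?_) ?_ ?_)
  · exact (h.integrable_ep_mul le_rfl i q.1 q.2).aestronglyMeasurable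
  · refine Filter.Eventually.of_forall fun ξ => ?_
    rw [norm_ep_mul]
    simpa using hC i q.1 ξ
  · exact integrable_jb_neg_two.const_mul C
  · refine Filter.Eventually.of_forall fun ξ => ?_
    have h1 := (h.1 i).continuous
    have h2 : Continuous fun q : ℝ × ℝ => r i q.1 ξ :=
      h1.comp (by fun_prop : Continuous fun q : ℝ × ℝ => (q.1, ξ))
    fun_prop

lemma continuous_resW : Continuous fun q : ℝ × ℝ => resW q.1 q.2 := by
  unfold resW
  exact Continuous.inv₀ (by fun_prop) fun q => resW_ne q.1 q.2

lemma continuous_resW_left (x : ℝ) : Continuous fun s => resW s x := by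
  unfold resW
  exact Continuous.inv₀ (by fun_prop) fun s => resW_ne s x

lemma integrable_resW_sq (x c : ℝ) : Integrable fun s => ‖resW s x‖ ^ 2 * c := by
  simp_rw [norm_resW_sq]
  exact (integrable_jb_neg_two.comp_sub_left x).mul_const c

lemma norm_sq_le_lintegral_resW {F F' : ℝ → ℂ} (cF : Continuous F) (cF' : Continuous F')
    (dF : ∀ s, HasDerivAt F (F' s) s) {C D : ℝ} (hC : ∀ s, ‖F s‖ ≤ C) (hD : ∀ s, ‖F' s‖ ≤ D)
    (x : ℝ) : ENNReal.ofReal (‖F x‖ ^ 2) ≤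
      ∫⁻ s, ENNReal.ofReal (3 * ‖resW s x * F s‖ ^ 2 + 2 * ‖resW s x * F' s‖ ^ 2) := by
  have cw := continuous_resW_left x
  have dG : ∀ s, HasDerivAt (fun s => resW s x * F s)
      (Complex.I * resW s x ^ 2 * F s + resW s x * F' s) s :=
    fun s => (hasDerivAt_resW_s s x).fun_mul (dF s)
  have hw : ∀ s, ‖resW s x‖ ≤ 1 := fun s => norm_resW_le_one s x
  have b1 : ∀ s, ‖resW s x * F s‖ ^ 2 ≤ ‖resW s x‖ ^ 2 * C ^ 2 := fun s => by
    rw [norm_mul, mul_pow]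
    exact mul_le_mul_of_nonneg_left (pow_le_pow_left₀ (norm_nonneg _) (hC s) 2) (by positivity)
  have b2 : ∀ s, ‖resW s x * F' s‖ ^ 2 ≤ ‖resW s x‖ ^ 2 * D ^ 2 := fun s => by
    rw [norm_mul, mul_pow]
    exact mul_le_mul_of_nonneg_left (pow_le_pow_left₀ (norm_nonneg _) (hD s) 2) (by positivity)
  have b3 : ∀ s, ‖Complex.I * resW s x ^ 2 * F s + resW s x * F' s‖ ^ 2 ≤
      2 * ‖resW s x * F s‖ ^ 2 + 2 * ‖resW s x * F' s‖ ^ 2 := fun s => by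
    have h1 : ‖Complex.I * resW s x ^ 2 * F s‖ ≤ ‖resW s x * F s‖ := by
      rw [norm_mul, norm_mul, norm_mul, norm_pow, Complex.norm_I, one_mul]
      refine mul_le_mul_of_nonneg_right ?_ (norm_nonneg _)
      nlinarith [hw s, norm_nonneg (resW s x)]
    have h2 := (norm_add_le (Complex.I * resW s x ^ 2 * F s) (resW s x * F' s)).trans
      (add_le_add_left h1 _)
    have h3 := pow_le_pow_left₀ (norm_nonneg _) h2 2
    nlinarith [sq_nonneg (‖resW s x * F s‖ - ‖resW s x * F' s‖)]
  have i1 : Integrable fun s => ‖resW s x * F s‖ ^ 2 :=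
    (integrable_resW_sq x (C ^ 2)).mono' (by fun_prop) (Filter.Eventually.of_forall fun s => by
      rw [Real.norm_of_nonneg (by positivity)]; exact b1 s)
  have i2 : Integrable fun s => ‖resW s x * F' s‖ ^ 2 :=
    (integrable_resW_sq x (D ^ 2)).mono' (by fun_prop) (Filter.Eventually.of_forall fun s => by
      rw [Real.norm_of_nonneg (by positivity)]; exact b2 s)
  have i3 : Integrable fun s => ‖Complex.I * resW s x ^ 2 * F s + resW s x * F' s‖ ^ 2 :=
    ((i1.const_mul 2).add (i2.const_mul 2)).mono' (by fun_prop)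
      (Filter.Eventually.of_forall fun s => by
        rw [Real.norm_of_nonneg (by positivity)]; exact b3 s)
  have key := sq_norm_le_integral dG (by fun_prop) i1 i3 x
  rw [resW_self, one_mul] at key
  have i4 : Integrable fun s => 3 * ‖resW s x * F s‖ ^ 2 + 2 * ‖resW s x * F' s‖ ^ 2 :=
    (i1.const_mul 3).add (i2.const_mul 2)
  rw [← ofReal_integral_eq_lintegral_ofReal i4
    (Filter.Eventually.of_forall fun s => by simp only [Pi.zero_apply]; positivity)]
  refine ENNReal.ofReal_le_ofReal (key.trans (integral_mono (i1.add i3) i4 fun s => ?_))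
  have := b3 s
  beta_reduce
  linarith

lemma SG.norm_sq_opS_le {a : ι → ℝ → ℝ → ℂ} (ha : SG 1 0 0 a) (i : ι) (u : SchwartzMap ℝ ℂ)
    (x : ℝ) : ENNReal.ofReal (‖opS (a i) u x‖ ^ 2) ≤
      ∫⁻ s, ENNReal.ofReal
        (3 * ‖resW s x * kern (fun s ξ => a i s ξ * hat u ξ) s x‖ ^ 2 +
          2 * ‖resW s x * kern (fun s ξ => _root_.dX (a i) s ξ * hat u ξ) s x‖ ^ 2) := by
  have r1 := (ha.rapidXi_hat zero_le_one u).two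
  have hax : SG 1 0 0 (fun i => _root_.dX (a i)) := ha.dX.le le_rfl (by norm_num)
  have r2 := (hax.rapidXi_hat zero_le_one u).two
  have c1 := r1.continuous_kern_two i
  have c2 := r2.continuous_kern_two i
  obtain ⟨C, hC0, hC⟩ := r1.kern_bdd le_rfl
  obtain ⟨D, hD0, hD⟩ := r2.kern_bdd le_rfl
  simp only [Real.rpow_zero, mul_one] at hC hD
  have dF : ∀ s, HasDerivAt (fun s => kern (fun s ξ => a i s ξ * hat u ξ) s x)
      (kern (fun s ξ => _root_.dX (a i) s ξ * hat u ξ) s x) s := fun s => by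
    have := r1.hasDerivAt_kern le_rfl i s x
    have e : _root_.dX (fun s ξ => a i s ξ * hat u ξ) = fun s ξ => _root_.dX (a i) s ξ * hat u ξ :=
      hasDerivAt_dX fun s ξ => (ha.hasDerivAt_x i s ξ).mul_const _
    rw [e] at this
    exact this
  rw [ha.opS_kern zero_le_one]
  have cx : Continuous fun s : ℝ => (s, x) := by fun_prop
  exact norm_sq_le_lintegral_resW (c1.comp cx) (c2.comp cx) dF (fun s => hC i s x)
    (fun s => hD i s x) x

lemma SG.norm_resW_kern_le {a : ι → ℝ → ℝ → ℂ} (ha : SG 1 0 0 a) : ∃ C, 0 ≤ C ∧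
    ∀ i (u : SchwartzMap ℝ ℂ) s,
      ∫⁻ x, ENNReal.ofReal (‖resW s x * kern (fun s ξ => a i s ξ * hat u ξ) s x‖ ^ 2) ≤
        ENNReal.ofReal (C * ‖toL2 (opS (fun x _ => resW s x) u)‖ ^ 2) := by
  obtain ⟨A, hA0, hA⟩ := ha.bdd
  have hax : SG 1 0 0 (fun i => _root_.dXi (a i)) := ha.dXi.le (by norm_num) le_rfl
  obtain ⟨B, hB0, hB⟩ := hax.bdd
  simp only [Real.rpow_zero, mul_one] at hA hB
  refine ⟨(A + B) ^ 2, by positivity, fun i u s => ?_⟩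
  have hm : SG 1 0 0 (fun (_ : Unit) (_ ξ : ℝ) => a i s ξ) := ha.freeze.reindex fun _ => (i, s)
  have h := norm_resW_opS_xi_le hm zero_le_one hA0 hB0 (hA i s) (hB i s) s u
  have e : ∀ x, resW s x * kern (fun s ξ => a i s ξ * hat u ξ) s x =
      opS (fun x _ => resW s x) (opS (fun _ ξ => a i s ξ) u) x := fun x => by
    rw [opS_resW, hm.opS_kern zero_le_one ()]; rfl
  simp_rw [e]
  rw [lintegral_norm_sq, ← mul_pow]
  exact ENNReal.ofReal_le_ofReal (pow_le_pow_left₀ (norm_nonneg _) h 2)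

/-- Uniform `L²` boundedness of operators of order zero. -/
theorem SG.exists_norm_opS_le {a : ι → ℝ → ℝ → ℂ} (ha : SG 1 0 0 a) : ∃ K, 0 ≤ K ∧
    ∀ i (u : SchwartzMap ℝ ℂ), ‖toL2 (opS (a i) u)‖ ≤ K * ‖toL2 u‖ := by
  have hax : SG 1 0 0 (fun i => _root_.dX (a i)) := ha.dX.le le_rfl (by norm_num)
  obtain ⟨C, hC0, hC⟩ := ha.norm_resW_kern_le
  obtain ⟨D, hD0, hD⟩ := hax.norm_resW_kern_le
  have hW0 := jb_int_nonneg
  set W := ∫ x, jb x ^ (-2 : ℝ) with hW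
  refine ⟨√((3 * C + 2 * D) * W), Real.sqrt_nonneg _, fun i u => ?_⟩
  refine le_of_sq_le_sq ?_ (by positivity)
  rw [mul_pow, Real.sq_sqrt (by positivity)]
  refine (ENNReal.ofReal_le_ofReal_iff (by positivity)).1 ?_
  rw [← lintegral_norm_sq]
  have r1 := (ha.rapidXi_hat zero_le_one u).two
  have r2 := (hax.rapidXi_hat zero_le_one u).two
  have c1 := r1.continuous_kern_two i
  have c2 := r2.continuous_kern_two i
  have cw := continuous_resW
  refine (lintegral_mono fun x => ha.norm_sq_opS_le i u x).trans ?_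
  rw [lintegral_lintegral_swap]
  swap
  · refine (Continuous.measurable ?_).aemeasurable
    refine ENNReal.continuous_ofReal.comp ?_
    have c1' := c1.comp continuous_swap
    have c2' := c2.comp continuous_swap
    have cw' := cw.comp continuous_swap
    exact ((((cw'.mul c1').norm.pow 2).const_mul 3)).add (((cw'.mul c2').norm.pow 2).const_mul 2)
  have h1 : ∀ s, ∫⁻ x, ENNReal.ofReal
        (3 * ‖resW s x * kern (fun s ξ => a i s ξ * hat u ξ) s x‖ ^ 2 +
          2 * ‖resW s x * kern (fun s ξ => _root_.dX (a i) s ξ * hat u ξ) s x‖ ^ 2) ≤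
      ∫⁻ x, ENNReal.ofReal (3 * C + 2 * D) * ENNReal.ofReal (‖resW s x‖ ^ 2 * ‖u x‖ ^ 2) := fun s => by
    have cx : Continuous fun x : ℝ => (s, x) := by fun_prop
    have k1 := (cw.comp cx).mul (c1.comp cx)
    have k2 := (cw.comp cx).mul (c2.comp cx)
    simp only [Function.comp_def] at k1 k2
    have m1 : Measurable fun x => ENNReal.ofReal
        (‖resW s x * kern (fun s ξ => a i s ξ * hat u ξ) s x‖ ^ 2) :=
      (ENNReal.continuous_ofReal.comp (k1.norm.pow 2)).measurable
    have m2 : Measurable fun x => ENNReal.ofReal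
        (‖resW s x * kern (fun s ξ => _root_.dX (a i) s ξ * hat u ξ) s x‖ ^ 2) :=
      (ENNReal.continuous_ofReal.comp (k2.norm.pow 2)).measurable
    have e2 : ∀ x, ‖resW s x‖ ^ 2 * ‖u x‖ ^ 2 = ‖opS (fun x _ => resW s x) u x‖ ^ 2 := fun x => by
      rw [opS_resW, norm_mul, mul_pow]
    simp_rw [e2]
    rw [lintegral_const_mul' _ _ ENNReal.ofReal_ne_top, lintegral_norm_sq]
    have e : ∀ p q : ℂ, ENNReal.ofReal (3 * ‖p‖ ^ 2 + 2 * ‖q‖ ^ 2) =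
        ENNReal.ofReal 3 * ENNReal.ofReal (‖p‖ ^ 2) +
          ENNReal.ofReal 2 * ENNReal.ofReal (‖q‖ ^ 2) := fun p q => by
      rw [ENNReal.ofReal_add (by positivity) (by positivity), ENNReal.ofReal_mul (by norm_num),
        ENNReal.ofReal_mul (by norm_num)]
    simp_rw [e]
    rw [lintegral_add_left (m1.const_mul _), lintegral_const_mul _ m1, lintegral_const_mul _ m2,
      ← ENNReal.ofReal_mul (by positivity)]
    refine (add_le_add (mul_le_mul_right (hC i u s) _) (mul_le_mul_right (hD i u s) _)).trans ?_
    rw [← ENNReal.ofReal_mul (by norm_num),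
      ← ENNReal.ofReal_mul (by norm_num), ← ENNReal.ofReal_add (by positivity) (by positivity)]
    refine ENNReal.ofReal_le_ofReal (le_of_eq (by ring))
  refine (lintegral_mono h1).trans ?_
  rw [lintegral_lintegral_swap]
  swap
  · refine (Continuous.measurable ?_).aemeasurable
    refine (ENNReal.continuous_const_mul ENNReal.ofReal_ne_top).comp
      (ENNReal.continuous_ofReal.comp ?_)
    exact (cw.norm.pow 2).mul ((u.continuous.comp continuous_snd).norm.pow 2)
  have h2 : ∀ x, ∫⁻ s, ENNReal.ofReal (3 * C + 2 * D) * ENNReal.ofReal (‖resW s x‖ ^ 2 * ‖u x‖ ^ 2) =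
      ENNReal.ofReal ((3 * C + 2 * D) * W) * ENNReal.ofReal (‖u x‖ ^ 2) := fun x => by
    rw [lintegral_const_mul' _ _ ENNReal.ofReal_ne_top,
      ← ofReal_integral_eq_lintegral_ofReal (integrable_resW_sq x _)
        (Filter.Eventually.of_forall fun s => by simp only [Pi.zero_apply]; positivity),
      integral_mul_const]
    simp_rw [norm_resW_sq]
    rw [integral_sub_left_eq_self (fun s => jb s ^ (-2 : ℝ)) volume x,
      ← ENNReal.ofReal_mul (by positivity), ← ENNReal.ofReal_mul (by positivity), mul_assoc]
  simp_rw [h2]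
  rw [lintegral_const_mul' _ _ ENNReal.ofReal_ne_top, lintegral_norm_sq,
    ← ENNReal.ofReal_mul (by positivity)]

lemma SG.exists_comp_zero {a b : ι → ℝ → ℝ → ℂ} {m₁ m₂ n₁ n₂ : ℝ} (ha : SG 1 m₁ m₂ a)
    (hb : SG 1 n₁ n₂ b) : ∃ c, SG 1 (m₁ + n₁) (m₂ + n₂) c ∧
      ∀ i u, opS (a i) (opS (b i) u) = opS (c i) u := by
  obtain ⟨c, hc, h⟩ := ha.exists_comp hb
  refine ⟨c, ?_, h⟩
  have := hc 0
  simpa only [Nat.cast_zero, sub_zero, expn, Finset.range_zero, Finset.sum_empty] using this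

lemma SG.exists_comp_one {a b : ι → ℝ → ℝ → ℂ} {m₁ m₂ n₁ n₂ : ℝ} (ha : SG 1 m₁ m₂ a)
    (hb : SG 1 n₁ n₂ b) : ∃ c, SG 1 (m₁ + n₁) (m₂ + n₂) c ∧
      SG 1 (m₁ + n₁ - 1) (m₂ + n₂ - 1) (fun i x ξ => c i x ξ - a i x ξ * b i x ξ) ∧
      ∀ i u, opS (a i) (opS (b i) u) = opS (c i) u := by
  obtain ⟨c, hc, h⟩ := ha.exists_comp hb
  have h0 := hc 0
  have h1 := hc 1
  simp only [Nat.cast_zero, sub_zero, expn, Finset.range_zero, Finset.sum_empty] at h0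
  simp [expn] at h1
  exact ⟨c, h0, h1, h⟩

/-- Multiplication by `⟨x⟩^μ`. -/
def opX (μ : ℝ) : SchwartzMap ℝ ℂ →ₗ[ℂ] SchwartzMap ℝ ℂ := opS (fun x _ => ((jb x ^ μ : ℝ) : ℂ))

/-- The Fourier multiplier `⟨D⟩^m`. -/
def opD (m : ℝ) : SchwartzMap ℝ ℂ →ₗ[ℂ] SchwartzMap ℝ ℂ := opS (fun _ ξ => ((jb ξ ^ m : ℝ) : ℂ))

lemma opX_apply (μ : ℝ) (u : SchwartzMap ℝ ℂ) (x : ℝ) :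
    opX μ u x = ((jb x ^ μ : ℝ) : ℂ) * u x :=
  opS_x (m := fun x => ((jb x ^ μ : ℝ) : ℂ)) (SG.jb_x μ) zero_le_one u x

lemma hat_opD (m : ℝ) (u : SchwartzMap ℝ ℂ) (ξ : ℝ) :
    hat (opD m u) ξ = ((jb ξ ^ m : ℝ) : ℂ) * hat u ξ :=
  hat_opS (m := fun ξ => ((jb ξ ^ m : ℝ) : ℂ)) (SG.jb_xi m) zero_le_one u ξ

lemma hat_injective {u v : SchwartzMap ℝ ℂ} (h : ∀ ξ, hat u ξ = hat v ξ) : u = v := by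
  ext x
  rw [hat_inversion u, hat_inversion v]
  simp_rw [h]

lemma opX_neg_opX (μ : ℝ) (u : SchwartzMap ℝ ℂ) : opX (-μ) (opX μ u) = u := by
  ext x
  rw [opX_apply, opX_apply, ← mul_assoc, ← Complex.ofReal_mul, ← jb_rpow_add]
  simp

lemma opD_neg_opD (m : ℝ) (u : SchwartzMap ℝ ℂ) : opD (-m) (opD m u) = u := by
  refine hat_injective fun ξ => ?_
  rw [hat_opD, hat_opD, ← mul_assoc, ← Complex.ofReal_mul, ← jb_rpow_add]
  simp

lemma inner_opX (μ : ℝ) (u v : SchwartzMap ℝ ℂ) :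
    inner ℂ (toL2 u) (toL2 (opX μ v)) = inner ℂ (toL2 (opX μ u)) (toL2 v) := by
  rw [inner_toL2, inner_toL2]
  congr 1
  ext x
  rw [opX_apply, opX_apply, map_mul, Complex.conj_ofReal]
  ring

lemma inner_opD (m : ℝ) (u v : SchwartzMap ℝ ℂ) :
    inner ℂ (toL2 u) (toL2 (opD m v)) = inner ℂ (toL2 (opD m u)) (toL2 v) := by
  have h1 := inner_hat u (opD m v)
  have h2 := inner_hat (opD m u) v
  have : inner ℂ (toL2 (hat u)) (toL2 (hat (opD m v))) =
      inner ℂ (toL2 (hat (opD m u))) (toL2 (hat v)) := by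
    rw [inner_toL2, inner_toL2]
    congr 1
    ext x
    rw [hat_opD, hat_opD, map_mul, Complex.conj_ofReal]
    ring
  rw [h1, h2] at this
  exact mul_left_cancel₀ (by norm_cast; positivity) this

/-- The weighted norms `‖⟨x⟩^{-rτ}⟨D⟩^r u‖`. -/
def wnorm (τ r : ℝ) (u : SchwartzMap ℝ ℂ) : ℝ := ‖toL2 (opX (-(r * τ)) (opD r u))‖

lemma wnorm_zero (τ : ℝ) (u : SchwartzMap ℝ ℂ) : wnorm τ 0 u = ‖toL2 u‖ := by
  rw [wnorm]
  congr 2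
  have h := opX_neg_opX 0 (opD 0 u)
  have h2 := opD_neg_opD 0 u
  have e1 : opX 0 (opD 0 u) = opD 0 u := by ext x; simp [opX_apply]
  have e2 : opD 0 u = u := hat_injective fun ξ => by simp [hat_opD]
  rw [zero_mul, neg_zero, e1, e2]

lemma SG.exists_inner_opS_le {q : ι → ℝ → ℝ → ℂ} {τ r r' : ℝ}
    (hq : SG 1 (r + r') (-((r + r') * τ)) q) : ∃ K, 0 ≤ K ∧ ∀ i u,
      ‖inner ℂ (toL2 u) (toL2 (opS (q i) u))‖ ≤ K * (wnorm τ r u * wnorm τ r' u) := by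
  obtain ⟨c1, h1, e1⟩ := (SG.jb_xi (ι := ι) (-r)).exists_comp_zero (SG.jb_x (r * τ))
  obtain ⟨c2, h2, e2⟩ := hq.exists_comp_zero h1
  obtain ⟨c3, h3, e3⟩ := (SG.jb_xi (ι := ι) (-r')).exists_comp_zero h2
  obtain ⟨c4, h4, e4⟩ := (SG.jb_x (ι := ι) (r' * τ)).exists_comp_zero h3
  have h4' : SG 1 0 0 c4 := h4.le (by linarith) (by linarith)
  obtain ⟨K, hK0, hK⟩ := h4'.exists_norm_opS_le
  refine ⟨K, hK0, fun i u => ?_⟩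
  set w := opX (-(r * τ)) (opD r u) with hw
  have hS : opS (c4 i) w = opX (r' * τ) (opD (-r') (opS (q i) u)) := by
    rw [← e4, ← e3, ← e2, ← e1]
    have a1 := opX_neg_opX (-(r * τ)) (opD r u)
    rw [neg_neg] at a1
    have a2 := opD_neg_opD r u
    change opX _ (opD _ (opS (q i) (opD _ (opX _ _)))) = _
    rw [hw, a1, a2]
  have e : inner ℂ (toL2 u) (toL2 (opS (q i) u)) =
      inner ℂ (toL2 (opX (-(r' * τ)) (opD r' u))) (toL2 (opS (c4 i) w)) := by
    rw [hS, ← inner_opX, opX_neg_opX, ← inner_opD]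
    have := opD_neg_opD (-r') (opS (q i) u)
    rw [neg_neg] at this
    rw [this]
  rw [e]
  refine (norm_inner_le_norm _ _).trans ?_
  have := mul_le_mul_of_nonneg_left (hK i w) (norm_nonneg (toL2 (opX (-(r' * τ)) (opD r' u))))
  refine this.trans (le_of_eq ?_)
  rw [wnorm, wnorm, ← hw]
  ring

lemma exists_wnorm_interp (τ r s : ℝ) : ∃ K, 0 ≤ K ∧ ∀ u,
    wnorm τ r u ^ 2 ≤ K * (wnorm τ (r + s) u * wnorm τ (r - s) u) := by
  obtain ⟨c1, h1, e1⟩ := (SG.jb_x (ι := Unit) (-(r * τ))).exists_comp_zero (SG.jb_xi r)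
  obtain ⟨c2, h2, e2⟩ := (SG.jb_x (ι := Unit) (-(r * τ))).exists_comp_zero h1
  obtain ⟨c3, h3, e3⟩ := (SG.jb_xi (ι := Unit) r).exists_comp_zero h2
  have h3' : SG 1 ((r + s) + (r - s)) (-(((r + s) + (r - s)) * τ)) c3 :=
    h3.le (by linarith) (by linarith)
  obtain ⟨K, hK0, hK⟩ := h3'.exists_inner_opS_le
  refine ⟨K, hK0, fun u => ?_⟩
  have e : inner ℂ (toL2 u) (toL2 (opS (c3 ()) u)) = ((wnorm τ r u ^ 2 : ℝ) : ℂ) := by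
    rw [← e3, ← e2, ← e1]
    change inner ℂ (toL2 u) (toL2 (opD _ (opX _ (opX _ (opD _ u))))) = _
    rw [inner_opD, inner_opX, inner_self_eq_norm_sq_to_K, wnorm]
    push_cast
    rfl
  have := hK () u
  rw [e, Complex.norm_real, Real.norm_of_nonneg (by positivity)] at this
  exact this

lemma exists_interp_step (K : ℕ → ℝ) (P j : ℕ) : ∀ ε > 0, ∃ C, 0 ≤ C ∧ ∀ n : ℕ → ℝ,
    (∀ j, 1 ≤ j → j < P → n j ^ 2 ≤ K j * (n (j + 1) * n (j - 1))) → j < P →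
      n j ^ 2 ≤ ε * n (j + 1) ^ 2 + C * n 0 ^ 2 := by
  induction j with
  | zero => exact fun ε hε => ⟨1, zero_le_one, fun n _ _ => by nlinarith [sq_nonneg (n 1)]⟩
  | succ j ih =>
    intro ε hε
    obtain ⟨C, hC, h⟩ := ih (ε / (2 * (K (j + 1) ^ 2 + 1))) (by positivity)
    refine ⟨2 * (K (j + 1) ^ 2 / (2 * ε) * C), by positivity, fun n hn hj => ?_⟩
    have h1 := h n hn (by omega)
    have h2 := hn (j + 1) (by omega) hj
    simp only [Nat.add_sub_cancel] at h2
    set k := K (j + 1)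
    have h3 : k * (n (j + 1 + 1) * n j) ≤ ε / 2 * n (j + 1 + 1) ^ 2 + k ^ 2 / (2 * ε) * n j ^ 2 := by
      have : ε / 2 * n (j + 1 + 1) ^ 2 + k ^ 2 / (2 * ε) * n j ^ 2 - k * (n (j + 1 + 1) * n j) =
          (ε * n (j + 1 + 1) - k * n j) ^ 2 / (2 * ε) := by field_simp; ring
      have h0 : 0 ≤ (ε * n (j + 1 + 1) - k * n j) ^ 2 / (2 * ε) := by positivity
      linarith
    have h4 : k ^ 2 / (2 * ε) * n j ^ 2 ≤
        1 / 2 * n (j + 1) ^ 2 + k ^ 2 / (2 * ε) * C * n 0 ^ 2 := by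
      have h5 := mul_le_mul_of_nonneg_left h1 (by positivity : 0 ≤ k ^ 2 / (2 * ε))
      have h6 : k ^ 2 / (2 * ε) * (ε / (2 * (k ^ 2 + 1))) ≤ 1 / 2 := by
        rw [div_mul_div_comm, div_le_div_iff₀ (by positivity) (by positivity)]
        nlinarith [sq_nonneg k]
      nlinarith [mul_le_mul_of_nonneg_right h6 (sq_nonneg (n (j + 1)))]
    nlinarith

lemma exists_interp (K : ℕ → ℝ) (P d : ℕ) : ∀ j, j + d + 1 = P → ∀ ε > 0, ∃ C, 0 ≤ C ∧
    ∀ n : ℕ → ℝ, (∀ j, 1 ≤ j → j < P → n j ^ 2 ≤ K j * (n (j + 1) * n (j - 1))) →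
      n j ^ 2 ≤ ε * n P ^ 2 + C * n 0 ^ 2 := by
  induction d with
  | zero =>
    intro j hj ε hε
    obtain ⟨C, hC, h⟩ := exists_interp_step K P j ε hε
    refine ⟨C, hC, fun n hn => ?_⟩
    have := h n hn (by omega)
    rwa [show j + 1 = P by omega] at this
  | succ d ih =>
    intro j hj ε hε
    obtain ⟨C, hC, h⟩ := exists_interp_step K P j 1 one_pos
    obtain ⟨D, hD, h'⟩ := ih (j + 1) (by omega) ε hε
    refine ⟨C + D, by positivity, fun n hn => ?_⟩
    have h1 := h n hn (by omega)
    have h2 := h' n hn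
    linarith

lemma exists_wnorm_sq_le (τ : ℝ) {P j : ℕ} (hj : j < P) {ε : ℝ} (hε : 0 < ε) : ∃ C, 0 ≤ C ∧ ∀ u,
    wnorm τ (j / 2) u ^ 2 ≤ ε * wnorm τ (P / 2) u ^ 2 + C * ‖toL2 u‖ ^ 2 := by
  choose K hK0 hK using fun j : ℕ => exists_wnorm_interp τ (j / 2) (1 / 2)
  obtain ⟨C, hC, h⟩ := exists_interp K P (P - 1 - j) j (by omega) ε hε
  refine ⟨C, hC, fun u => ?_⟩
  have := h (fun j => wnorm τ (j / 2) u) fun j h1 _ => by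
    have := hK j u
    rcases j with _ | j
    · omega
    · rw [show ((j + 1 : ℕ) : ℝ) / 2 + 1 / 2 = ((j + 1 + 1 : ℕ) : ℝ) / 2 by push_cast; ring,
        show ((j + 1 : ℕ) : ℝ) / 2 - 1 / 2 = (j : ℝ) / 2 by push_cast; ring] at this
      simpa only [Nat.add_sub_cancel] using this
  simpa only [Nat.cast_zero, zero_div, wnorm_zero] using this

/-- Sums of symbols of class `SG^{j,-jτ}` with `j < P`. -/
inductive LowSG (τ : ℝ) (P : ℕ) : (ι → ℝ → ℝ → ℂ) → Prop
  | of_sg {f : ι → ℝ → ℝ → ℂ} (j : ℕ) (hj : j < P) (hf : SG 1 j (-(j * τ)) f) : LowSG τ P f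
  | add {f g : ι → ℝ → ℝ → ℂ} (hf : LowSG τ P f) (hg : LowSG τ P g) :
      LowSG τ P (fun i x ξ => f i x ξ + g i x ξ)

lemma LowSG.sg {τ : ℝ} (hτ : 0 ≤ τ) {P : ℕ} {f : ι → ℝ → ℝ → ℂ} (h : LowSG τ P f) :
    SG 1 (P - 1) 0 f := by
  induction h with
  | of_sg j hj hf =>
    have : (j : ℝ) + 1 ≤ P := by exact_mod_cast hj
    exact hf.le (by linarith) (by rw [neg_nonpos]; positivity)
  | add hf hg h1 h2 => exact h1.add h2

lemma LowSG.const_mul {τ : ℝ} {P : ℕ} {f : ι → ℝ → ℝ → ℂ} (h : LowSG τ P f) (c : ℂ) :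
    LowSG τ P (fun i x ξ => c * f i x ξ) := by
  induction h with
  | of_sg j hj hf => exact .of_sg j hj (hf.const_mul c)
  | add hf hg h1 h2 =>
    simp only [mul_add]
    exact h1.add h2

lemma LowSG.exists_inner_le {τ : ℝ} (hτ : 0 ≤ τ) {P : ℕ} {f : ι → ℝ → ℝ → ℂ} (h : LowSG τ P f) :
    ∀ ε > 0, ∃ C, 0 ≤ C ∧ ∀ i u, ‖inner ℂ (toL2 u) (toL2 (opS (f i) u))‖ ≤
      ε * wnorm τ (P / 2) u ^ 2 + C * ‖toL2 u‖ ^ 2 := by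
  induction h with
  | @of_sg f j hj hf =>
    intro ε hε
    have hf' : SG 1 ((j : ℝ) / 2 + j / 2) (-(((j : ℝ) / 2 + j / 2) * τ)) f := by
      rwa [add_halves]
    obtain ⟨K, hK0, hK⟩ := hf'.exists_inner_opS_le
    obtain ⟨C, hC0, hC⟩ := exists_wnorm_sq_le τ hj (ε := ε / (K + 1)) (by positivity)
    refine ⟨K * C, by positivity, fun i u => (hK i u).trans ?_⟩
    rw [← sq]
    refine (mul_le_mul_of_nonneg_left (hC u) hK0).trans ?_
    have h1 : K * (ε / (K + 1)) ≤ ε := by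
      rw [mul_div_assoc', div_le_iff₀ (by positivity)]
      nlinarith
    nlinarith [mul_le_mul_of_nonneg_right h1 (sq_nonneg (wnorm τ (P / 2) u))]
  | @add f g hf hg h1 h2 =>
    intro ε hε
    obtain ⟨C, hC0, hC⟩ := h1 (ε / 2) (by positivity)
    obtain ⟨D, hD0, hD⟩ := h2 (ε / 2) (by positivity)
    refine ⟨C + D, by positivity, fun i u => ?_⟩
    rw [(hf.sg hτ).opS_add zero_le_one (hg.sg hτ) i, LinearMap.add_apply, map_add, inner_add_right]
    refine (norm_add_le _ _).trans ?_
    linarith [hC i u, hD i u]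

lemma re_inner_opS_xi_nonneg {m : ℝ → ℝ} {s : ℝ}
    (hm : SG 1 s 0 (fun (_ : Unit) (_ ξ : ℝ) => ((m ξ : ℝ) : ℂ))) (h : ∀ ξ, 0 ≤ m ξ)
    (u : SchwartzMap ℝ ℂ) :
    0 ≤ (inner ℂ (toL2 u) (toL2 (opS (fun _ ξ => ((m ξ : ℝ) : ℂ)) u))).re := by
  have h1 := inner_hat u (opS (fun _ ξ => ((m ξ : ℝ) : ℂ)) u)
  have h2 : inner ℂ (toL2 (hat u)) (toL2 (hat (opS (fun _ ξ => ((m ξ : ℝ) : ℂ)) u))) =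
      ((∫ ξ, m ξ * ‖hat u ξ‖ ^ 2 : ℝ) : ℂ) := by
    rw [inner_toL2, ← integral_complex_ofReal]
    congr 1
    ext ξ
    rw [hat_opS (m := fun ξ => ((m ξ : ℝ) : ℂ)) hm zero_le_one, mul_left_comm, Complex.conj_mul']
    push_cast
    rfl
  have h3 := congrArg Complex.re (h1.symm.trans h2)
  rw [Complex.re_ofReal_mul, Complex.ofReal_re] at h3
  have h4 : 0 ≤ ∫ ξ, m ξ * ‖hat u ξ‖ ^ 2 :=
    integral_nonneg fun ξ => mul_nonneg (h ξ) (by positivity)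
  rw [← h3] at h4
  exact nonneg_of_mul_nonneg_right h4 (by positivity)

lemma opD_opD (m n : ℝ) (u : SchwartzMap ℝ ℂ) : opD m (opD n u) = opD (m + n) u := by
  refine hat_injective fun ξ => ?_
  rw [hat_opD, hat_opD, hat_opD, ← mul_assoc, ← Complex.ofReal_mul, ← jb_rpow_add]

lemma re_inner_opS_xi_ge {m : ℝ → ℝ} (hm : SG 1 0 0 (fun (_ : Unit) (_ ξ : ℝ) => ((m ξ : ℝ) : ℂ)))
    {c C s : ℝ} (hs : 0 ≤ s) (h : ∀ ξ, c ≤ m ξ + C * jb ξ ^ (-(2 * s))) (u : SchwartzMap ℝ ℂ) :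
    c * ‖toL2 u‖ ^ 2 - C * ‖toL2 (opD (-s) u)‖ ^ 2 ≤
      (inner ℂ (toL2 u) (toL2 (opS (fun _ ξ => ((m ξ : ℝ) : ℂ)) u))).re := by
  have hD : SG 1 0 0 (fun (_ : Unit) (_ ξ : ℝ) => (C : ℂ) * ((jb ξ ^ (-(2 * s)) : ℝ) : ℂ)) :=
    ((SG.jb_xi (-(2 * s))).const_mul _).le (by linarith) le_rfl
  have hc : SG 1 0 0 (fun (_ : Unit) (_ _ : ℝ) => (-c : ℂ) * 1) := (SG.const 1).const_mul _
  have hs1 := (hm.add hD).add hc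
  have h1 := re_inner_opS_xi_nonneg (m := fun ξ => m ξ + C * jb ξ ^ (-(2 * s)) + -c * 1) (s := 0)
    (hs1.congr fun _ _ _ => by push_cast; rfl) (fun ξ => by linarith [h ξ]) u
  have e : opS (fun _ ξ => ((m ξ + C * jb ξ ^ (-(2 * s)) + -c * 1 : ℝ) : ℂ)) u =
      opS (fun _ ξ => ((m ξ : ℝ) : ℂ)) u + (C : ℂ) • opD (-(2 * s)) u + (-c : ℂ) • u := by
    have e1 := (hm.add hD).opS_add zero_le_one hc ()
    have e2 := hm.opS_add zero_le_one hD ()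
    have e3 := (SG.jb_xi (ι := Unit) (-(2 * s))).opS_const_mul zero_le_one C ()
    have e4 := (SG.const (ι := Unit) (γ := 1) (1 : ℂ)).opS_const_mul zero_le_one (-c : ℂ) ()
    rw [opS_one] at e4
    rw [e2, e3, e4] at e1
    have := congrArg (fun L => L u) e1
    simp only [LinearMap.add_apply, LinearMap.smul_apply, LinearMap.id_apply] at this
    rw [opD, ← this]
    push_cast
    rfl
  have e5 : opD (-(2 * s)) u = opD (-s) (opD (-s) u) := by
    rw [opD_opD]; congr 2; ring
  have e6 : inner ℂ (toL2 u) (toL2 (opD (-(2 * s)) u)) = ((‖toL2 (opD (-s) u)‖ ^ 2 : ℝ) : ℂ) := by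
    rw [e5, inner_opD, inner_self_eq_norm_sq_to_K]; push_cast; rfl
  have e7 : inner ℂ (toL2 u) (toL2 u) = ((‖toL2 u‖ ^ 2 : ℝ) : ℂ) := by
    rw [inner_self_eq_norm_sq_to_K]; push_cast; rfl
  rw [e, map_add, map_add, map_smul, map_smul, inner_add_right, inner_add_right, inner_smul_right,
    inner_smul_right, e6, e7, ← Complex.ofReal_neg, ← Complex.ofReal_mul, ← Complex.ofReal_mul,
    Complex.add_re, Complex.add_re, Complex.ofReal_re, Complex.ofReal_re] at h1
  linarith

lemma exists_re_inner_main_ge {P : ℕ} (hP : 1 ≤ P) {b : ι → ℝ → ℝ}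
    (hb : SG 1 P 0 (fun i (_ ξ : ℝ) => ((b i ξ : ℝ) : ℂ))) {c C : ℝ} (hC : 0 ≤ C)
    (h : ∀ i ξ, c * jb ξ ^ (P : ℝ) ≤ b i ξ + C) : ∃ (e : ι → ℝ → ℝ → ℂ) (K : ℝ), 0 ≤ K ∧
      SG 1 (P - 1) (-2) e ∧ ∀ i u, c * wnorm (1 / P) (P / 2) u ^ 2 - K * ‖toL2 u‖ ^ 2 ≤
        (inner ℂ (toL2 u) (toL2 (opS (fun x ξ => ((b i ξ * jb x ^ (-1 : ℝ) : ℝ) : ℂ) + e i x ξ) u))).re := by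
  have hP0 : (P : ℝ) ≠ 0 := by positivity
  set r : ℝ := P / 2 with hr
  have hrt : r * (1 / P) = 1 / 2 := by rw [hr]; field_simp
  have hκ : SG 1 0 0 (fun i (_ ξ : ℝ) => ((b i ξ * jb ξ ^ (-(2 * r)) : ℝ) : ℂ)) :=
    ((hb.mul (SG.jb_xi (-(2 * r)))).le (by rw [hr]; linarith) (by norm_num)).congr
      fun i x ξ => by push_cast; rfl
  have X := SG.jb_x (ι := ι) (-(1 / 2))
  have D := SG.jb_xi (ι := ι) r
  obtain ⟨c1, h1, h1', e1⟩ := X.exists_comp_one D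
  obtain ⟨c2, h2, h2', e2⟩ := hκ.exists_comp_one h1
  obtain ⟨c3, h3, h3', e3⟩ := X.exists_comp_one h2
  obtain ⟨c4, h4, h4', e4⟩ := D.exists_comp_one h3
  obtain ⟨c5, h5, e5⟩ := (SG.jb_xi (ι := ι) (-r)).exists_comp_zero h1
  obtain ⟨K, hK0, hK⟩ := (h5.le (by linarith) (by norm_num) : SG 1 0 0 c5).exists_norm_opS_le
  have he : SG 1 (P - 1) (-2)
      (fun i x ξ => c4 i x ξ - ((b i ξ * jb x ^ (-1 : ℝ) : ℝ) : ℂ)) := by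
    have s1 := hκ.mul h1'
    have s2 := X.mul (h2'.add (s1.le (by norm_num) (by norm_num)))
    have s3 := D.mul (h3'.add (s2.le (by norm_num) (by norm_num)))
    refine ((h4'.add (s3.le (by linarith) (by norm_num))).le (by rw [hr]; linarith)
      (by norm_num)).congr fun i x ξ => ?_
    have q1 : (b i ξ * jb x ^ (-1 : ℝ) : ℝ) = jb ξ ^ r * (jb x ^ (-(1 / 2) : ℝ) *
        ((b i ξ * jb ξ ^ (-(2 * r))) * (jb x ^ (-(1 / 2) : ℝ) * jb ξ ^ r))) := by
      have a1 : jb x ^ (-1 : ℝ) = jb x ^ (-(1 / 2) : ℝ) * jb x ^ (-(1 / 2) : ℝ) := by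
        rw [← jb_rpow_add]; norm_num
      have a2 : jb ξ ^ r * jb ξ ^ (-(2 * r)) * jb ξ ^ r = 1 := by
        rw [← jb_rpow_add, ← jb_rpow_add]
        ring_nf
        exact Real.rpow_zero _
      rw [a1]
      linear_combination (-(b i ξ * (jb x ^ (-(1 / 2) : ℝ)) * (jb x ^ (-(1 / 2) : ℝ)))) * a2
    rw [q1]
    push_cast
    ring
  refine ⟨_, C * K ^ 2, by positivity, he, fun i u => ?_⟩
  have e : (fun x ξ => ((b i ξ * jb x ^ (-1 : ℝ) : ℝ) : ℂ) +
      (c4 i x ξ - ((b i ξ * jb x ^ (-1 : ℝ) : ℝ) : ℂ))) = c4 i := by ext; ring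
  rw [e, ← e4, ← e3, ← e2, ← e1]
  change _ ≤ (inner ℂ (toL2 u) (toL2 (opD r (opX (-(1 / 2)) (opS _ (opX (-(1 / 2)) (opD r u))))))).re
  rw [inner_opD, inner_opX]
  have hb' := h5
  have k1 := hK i u
  rw [← e5, ← e1] at k1
  change ‖toL2 (opD (-r) (opX (-(1 / 2)) (opD r u)))‖ ≤ _ at k1
  rw [wnorm, hrt]
  set w := opX (-(1 / 2)) (opD r u)
  have g := re_inner_opS_xi_ge (m := fun ξ => b i ξ * jb ξ ^ (-(2 * r)))
    (hκ.reindex fun _ : Unit => i) (c := c) (C := C) (s := r) (by positivity) (fun ξ => by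
      have := mul_le_mul_of_nonneg_right (h i ξ) (jb_rpow_pos ξ (-(2 * r))).le
      have a : jb ξ ^ (P : ℝ) * jb ξ ^ (-(2 * r)) = 1 := by
        rw [← jb_rpow_add, hr]; ring_nf; exact Real.rpow_zero _
      rw [mul_assoc, a, add_mul] at this
      linarith) w
  have k2 := pow_le_pow_left₀ (norm_nonneg _) k1 2
  nlinarith [mul_le_mul_of_nonneg_left k2 hC]

theorem exists_re_inner_ge {P : ℕ} (hP : 1 ≤ P) {b : ι → ℝ → ℝ}
    (hb : SG 1 P 0 (fun i (_ ξ : ℝ) => ((b i ξ : ℝ) : ℂ))) {c C M K : ℝ} (hC : 0 ≤ C)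
    (hM : 0 ≤ M) (h : ∀ i ξ, c * jb ξ ^ (P : ℝ) ≤ b i ξ + C) (hMc : K + 1 ≤ M * c)
    {a f : ι → ℝ → ℝ → ℂ} (ha : SG 1 P (-1) a) (hf : LowSG (1 / P) P f)
    (hK : ∀ i u, ‖inner ℂ (toL2 u) (toL2 (opS (a i) u))‖ ≤ K * wnorm (1 / P) (P / 2) u ^ 2) :
    ∃ L, 0 ≤ L ∧ ∀ i u, -L * ‖toL2 u‖ ^ 2 ≤ (inner ℂ (toL2 u) (toL2 (opS (fun x ξ =>
      ((M * (b i ξ * jb x ^ (-1 : ℝ)) : ℝ) : ℂ) + a i x ξ + f i x ξ) u))).re := by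
  have hP0 : (P : ℝ) ≠ 0 := by positivity
  have hP1 : (1 : ℝ) ≤ P := by exact_mod_cast hP
  have hτ : (0 : ℝ) ≤ 1 / P := by positivity
  obtain ⟨e, Q, hQ0, he, hQ⟩ := exists_re_inner_main_ge hP hb hC h
  have hel : LowSG (1 / P : ℝ) P e := by
    refine .of_sg (P - 1) (by omega) ?_
    rw [Nat.cast_sub hP, Nat.cast_one]
    refine he.le le_rfl ?_
    have : ((P : ℝ) - 1) * (1 / P) ≤ 1 := by
      rw [mul_one_div, div_le_one (by positivity)]; linarith
    linarith
  have hg := (hel.const_mul (-M : ℂ)).add hf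
  obtain ⟨N, hN0, hN⟩ := hg.exists_inner_le hτ 1 one_pos
  refine ⟨M * Q + N, by positivity, fun i u => ?_⟩
  have hmain : SG 1 P (-1) (fun i x ξ => ((b i ξ * jb x ^ (-1 : ℝ) : ℝ) : ℂ)) :=
    ((hb.mul (SG.jb_x (-1))).le (by norm_num) (by norm_num)).congr fun i x ξ => by push_cast; rfl
  have hme := hmain.opS_const_mul zero_le_one
  have s1 : SG 1 P 0 (fun i x ξ => ((b i ξ * jb x ^ (-1 : ℝ) : ℝ) : ℂ) + e i x ξ) :=
    (hmain.le le_rfl (by norm_num)).add (he.le (by linarith) (by norm_num))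
  have s2 := s1.const_mul (M : ℂ)
  have s3 : SG 1 P 0 a := ha.le le_rfl (by norm_num)
  have s4 := hg.sg hτ
  have E : opS (fun x ξ => ((M * (b i ξ * jb x ^ (-1 : ℝ)) : ℝ) : ℂ) + a i x ξ + f i x ξ) u =
      (M : ℂ) • opS (fun x ξ => ((b i ξ * jb x ^ (-1 : ℝ) : ℝ) : ℂ) + e i x ξ) u + opS (a i) u +
        opS (fun x ξ => (-M : ℂ) * e i x ξ + f i x ξ) u := by
    have r1 := (s2.add s3).opS_add zero_le_one s4 i
    have r2 := s2.opS_add zero_le_one s3 i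
    have r3 := s1.opS_const_mul zero_le_one (M : ℂ) i
    rw [r2, r3] at r1
    have := congrArg (fun L => L u) r1
    simp only [LinearMap.add_apply, LinearMap.smul_apply] at this
    rw [← this]
    congr 2
    ext x ξ
    push_cast
    ring
  rw [E, map_add, map_add, map_smul, inner_add_right, inner_add_right, inner_smul_right,
    Complex.add_re, Complex.add_re, Complex.re_ofReal_mul]
  have t1 := mul_le_mul_of_nonneg_left (hQ i u) hM
  have t2 := (abs_le.1 ((Complex.abs_re_le_norm _).trans (hK i u))).1
  have t3 := (abs_le.1 ((Complex.abs_re_le_norm _).trans (hN i u))).1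
  have t4 := mul_le_mul_of_nonneg_right hMc (sq_nonneg (wnorm (1 / P) (P / 2) u))
  linarith

lemma dX_eq_zero_of_forall_eq {a : ℝ → ℝ → ℂ} (h : ∀ x ξ, a x ξ = a 0 ξ) (x ξ : ℝ) :
    dX a x ξ = 0 := by
  have e : (fun x' => a x' ξ) = fun _ => a 0 ξ := funext fun x' => h x' ξ
  simp [dX, e]

/-- Conjugation of `a + r`, with `a = a(ξ)` of order `n + 2`, modulo symbols of order `n`. -/
lemma exists_conj_add {n : ℕ} {φ g : ℝ → ℝ → ℂ} (hφ : Phase (fun _ : Unit => φ))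
    {E : SchwartzMap ℝ ℂ ≃ₗ[ℂ] SchwartzMap ℝ ℂ}
    (hE : ∀ u, E u = opS (fun x ξ => Complex.exp (φ x ξ)) u) (hEs : ∀ u, E.symm u = opS g u)
    (hg : ExpSG (fun (_ : Unit) x ξ => -φ x ξ) (-1) (-1)
      (fun _ x ξ => g x ξ - Complex.exp (-φ x ξ)))
    {a r : ι → ℝ → ℝ → ℂ} (ha : SG 1 (n + 2) 0 a) (hax : ∀ i x ξ, a i x ξ = a i 0 ξ)
    (hr : SG 1 (n + 1) 0 r) :
    ∃ f : ι → ℝ → ℝ → ℂ, SG 1 n (-(n * (1 / ((n + 1 : ℕ) : ℝ)))) f ∧ ∀ i u,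
      E.symm (opS (fun x ξ => a i x ξ + r i x ξ) (E u)) = opS (fun x ξ => a i x ξ +
        (r i x ξ - Complex.I * (dXi (a i) x ξ * dX φ x ξ) + f i x ξ)) u := by
  have hb : SG 1 (n + 2) 0 (fun i x ξ => a i x ξ + r i x ξ) :=
    ha.add (hr.le (by linarith) le_rfl)
  obtain ⟨b', h₁, h₂⟩ := exists_conj hφ hE hEs hg hb.sgp
  have hn : (-1 : ℝ) < -(n * (1 / ((n + 1 : ℕ) : ℝ))) := by
    push_cast
    rw [mul_one_div, neg_lt_neg_iff, div_lt_one (by positivity)]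
    linarith
  have hφx : SGp 0 (-1) (fun _ : ι => dX φ) := hφ.dx.reindex (fun _ => ())
  have hφξ : SGp (-1) 0 (fun _ : ι => dXi φ) := hφ.dxi.reindex (fun _ => ())
  have h₃ := (h₁.le (n₁ := n) (n₂ := -1) (by linarith) (by norm_num)).sub
    (((((hr.dXi.sgp.mul hφx).le (n₁ := n) (n₂ := -1) (by linarith) (by norm_num)).sub
      ((hφξ.mul hr.dX.sgp).le (n₁ := n) (n₂ := -1) (by linarith) (by norm_num)))).const_mul
      Complex.I)
  refine ⟨fun i x ξ => b' i x ξ - a i x ξ - r i x ξ +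
    Complex.I * (dXi (a i) x ξ * dX φ x ξ), (h₃.sg hn).congr ?_, ?_⟩
  · intro i x ξ
    have e₁ : dXi (fun x ξ => a i x ξ + r i x ξ) x ξ = dXi (a i) x ξ + dXi (r i) x ξ :=
      ((ha.hasDerivAt_xi i x ξ).add (hr.hasDerivAt_xi i x ξ)).deriv
    have e₂ : dX (fun x ξ => a i x ξ + r i x ξ) x ξ = dX (r i) x ξ := by
      have := ((ha.hasDerivAt_x i x ξ).add (hr.hasDerivAt_x i x ξ)).deriv
      rw [dX_eq_zero_of_forall_eq (hax i), zero_add] at this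
      exact this
    rw [e₁, e₂]
    ring
  · intro i u
    rw [h₂]
    congr 2
    funext x ξ
    ring

/-- Successive conjugations of `a + r`: only the first one contributes at the order `n + 1`
without additional decay. -/
lemma exists_conj_comp {n : ℕ} {E : ℕ → (SchwartzMap ℝ ℂ ≃ₗ[ℂ] SchwartzMap ℝ ℂ)}
    {φ g : ℕ → ℝ → ℝ → ℂ}
    (hφ : ∀ k, 1 ≤ k → k ≤ n + 1 → Phase (fun _ : Unit => φ k))
    (hE : ∀ k, 1 ≤ k → k ≤ n + 1 → ∀ u,
      E k u = opS (fun x ξ => Complex.exp (φ k x ξ)) u)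
    (hEs : ∀ k, 1 ≤ k → k ≤ n + 1 → ∀ u, (E k).symm u = opS (g k) u)
    (hg : ∀ k, 1 ≤ k → k ≤ n + 1 → ExpSG (fun (_ : Unit) x ξ => -φ k x ξ) (-1) (-1)
      (fun _ x ξ => g k x ξ - Complex.exp (-φ k x ξ)))
    (hφx : ∀ k : ℕ, 2 ≤ k → k ≤ n + 1 →
      SG 1 (1 - k) (-((n + 2 - k : ℝ) * (1 / ((n + 1 : ℕ) : ℝ)))) (fun _ : Unit => dX (φ k)))
    {a r : ι → ℝ → ℝ → ℂ} (ha : SG 1 (n + 2) 0 a) (hax : ∀ i x ξ, a i x ξ = a i 0 ξ)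
    (hr : SG 1 (n + 1) 0 r)
    (h₁ : SG 1 (n + 1) 0 (fun i x ξ => Complex.I * (dXi (a i) x ξ * dX (φ 1) x ξ)))
    (k : ℕ) (hk : k ≤ n) :
    ∃ f : ι → ℝ → ℝ → ℂ, LowSG (1 / ((n + 1 : ℕ) : ℝ)) (n + 1) f ∧ ∀ i u,
      compBwd (fun k => ⇑(E k).symm) (k + 1) (opS (fun x ξ => a i x ξ + r i x ξ)
        (compFwd (fun k => ⇑(E k)) (k + 1) u)) = opS (fun x ξ => a i x ξ +
        (r i x ξ - Complex.I * (dXi (a i) x ξ * dX (φ 1) x ξ) + f i x ξ)) u := by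
  induction k with
  | zero =>
    obtain ⟨f, hf, h⟩ := exists_conj_add (hφ 1 le_rfl (by omega)) (hE 1 le_rfl (by omega))
      (hEs 1 le_rfl (by omega)) (hg 1 le_rfl (by omega)) ha hax hr
    exact ⟨f, .of_sg n (by omega) hf, h⟩
  | succ k ih =>
    obtain ⟨f, hf, h⟩ := ih (by omega)
    have hl : 1 ≤ k + 1 + 1 := by omega
    have hu : k + 1 + 1 ≤ n + 1 := by omega
    have hfs : SG 1 (n + 1) 0 f := (hf.sg (by positivity)).le (by push_cast; linarith) le_rfl
    obtain ⟨f', hf', h'⟩ := exists_conj_add (hφ _ hl hu) (hE _ hl hu) (hEs _ hl hu)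
      (hg _ hl hu) ha hax ((hr.sub h₁).add hfs)
    have hd : LowSG (1 / ((n + 1 : ℕ) : ℝ)) (n + 1)
        (fun i x ξ => -Complex.I * (dXi (a i) x ξ * dX (φ (k + 1 + 1)) x ξ)) := by
      refine .of_sg (n - k) (by omega) ?_
      have hs := (hφx (k + 1 + 1) (by omega) hu).reindex (fun _ : ι => ())
      refine ((ha.dXi.mul hs).const_mul (-Complex.I)).le (le_of_eq ?_) (le_of_eq ?_)
      · rw [Nat.cast_sub (by omega)]; push_cast; ring
      · rw [Nat.cast_sub (by omega)]; push_cast; ring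
    refine ⟨_, (hf.add hd).add (.of_sg n (by omega) hf'), fun i u => ?_⟩
    change (E (k + 1 + 1)).symm (compBwd (fun k => ⇑(E k).symm) (k + 1)
      (opS (fun x ξ => a i x ξ + r i x ξ)
        (compFwd (fun k => ⇑(E k)) (k + 1) (E (k + 1 + 1) u)))) = _
    rw [h, h']
    congr 2
    funext x ξ
    ring

lemma iteratedDeriv_ofReal {f : ℝ → ℝ} (hf : ContDiff ℝ (⊤ : ℕ∞) f) (n : ℕ) :
    iteratedDeriv n (fun x => (f x : ℂ)) = fun x => ((iteratedDeriv n f x : ℝ) : ℂ) := by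
  induction n with
  | zero => simp
  | succ n ih =>
    rw [iteratedDeriv_succ, ih, iteratedDeriv_succ]
    funext x
    have hd : DifferentiableAt ℝ (iteratedDeriv n f) x :=
      (hf.differentiable_iteratedDeriv n (by exact_mod_cast WithTop.coe_lt_top n)) x
    exact hd.hasDerivAt.ofReal_comp.deriv

lemma SG.of_xi {m : ℝ} {f : ι → ℝ → ℝ} (hf : ∀ i, ContDiff ℝ (⊤ : ℕ∞) (f i))
    (hb : ∀ α : ℕ, ∃ C > 0, ∀ i ξ, |iteratedDeriv α (f i) ξ| ≤ C * jb ξ ^ (m - α)) :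
    SG 1 m 0 (fun i (_ ξ : ℝ) => ((f i ξ : ℝ) : ℂ)) := by
  refine SG.of_iteratedDeriv (fun i => ?_) (fun α β => ?_)
  · exact Complex.ofRealCLM.contDiff.comp ((hf i).comp contDiff_snd)
  · obtain ⟨C, hC, h⟩ := hb α
    refine ⟨C, hC, fun i x ξ => ?_⟩
    rcases Nat.eq_zero_or_pos β with rfl | hβ
    · simp only [iteratedDeriv_zero, iteratedDeriv_ofReal (hf i), Complex.norm_real,
        Real.norm_eq_abs, mul_one, Nat.cast_zero, sub_zero, Real.rpow_zero]
      exact h i ξ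
    · have e : (fun ξ' : ℝ => iteratedDeriv β (fun _ : ℝ => ((f i ξ' : ℝ) : ℂ)) x) =
          fun _ => 0 := by
        funext ξ'
        rw [iteratedDeriv_const, if_neg hβ.ne']
      rw [e, iteratedDeriv_const]
      have h₁ := jb_rpow_pos ξ (m - α * 1)
      have h₂ := jb_rpow_pos x (0 - β * 1)
      rw [ite_self, norm_zero]
      positivity

lemma sign_eq_of_isPreconnected {f : ℝ → ℝ} (hf : Continuous f) {s : Set ℝ}
    (hs : IsPreconnected s) (h0 : ∀ x ∈ s, f x ≠ 0) {x y : ℝ} (hx : x ∈ s) (hy : y ∈ s) :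
    Real.sign (f x) = Real.sign (f y) := by
  have key : ∀ x ∈ s, ∀ y ∈ s, f x < 0 → 0 < f y → False := fun x hx y hy h₁ h₂ => by
    obtain ⟨z, hz, e⟩ := hs.intermediate_value hx hy hf.continuousOn ⟨h₁.le, h₂.le⟩
    exact h0 z hz e
  rcases lt_or_gt_of_ne (h0 x hx) with h₁ | h₁ <;> rcases lt_or_gt_of_ne (h0 y hy) with h₂ | h₂
  · rw [Real.sign_of_neg h₁, Real.sign_of_neg h₂]
  · exact (key x hx y hy h₁ h₂).elim
  · exact (key y hy x hx h₂ h₁).elim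
  · rw [Real.sign_of_pos h₁, Real.sign_of_pos h₂]

lemma abs_real_sign_le (x : ℝ) : |Real.sign x| ≤ 1 := by
  rcases Real.sign_apply_eq x with h | h | h <;> simp [h]

lemma exists_sign_cutoff [Nonempty ι] {d : ι → ℝ → ℝ} {R : ℝ} (hR : 1 < R)
    (hd : ∀ i, Continuous (d i)) (h0 : ∀ i ξ, R ≤ |ξ| → d i ξ ≠ 0)
    (hs : ∀ i j ξ, R ≤ |ξ| → Real.sign (d i ξ) = Real.sign (d j ξ)) :
    ∃ ω : ℝ → ℝ, ContDiff ℝ (⊤ : ℕ∞) ω ∧ (∀ ξ, |ω ξ| ≤ 1) ∧ (∀ ξ, |ξ| ≤ 1 → ω ξ = 0) ∧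
      (∀ i ξ, R ≤ |ξ| → ω ξ = Real.sign (d i ξ)) ∧ (∀ y, R < |y| → deriv ω y = 0) ∧
      ∀ i h ξ, 1 ≤ h → h * R ≤ |ξ| → ω (ξ / h) * d i ξ = |d i ξ| := by
  obtain ⟨i₀⟩ := ‹Nonempty ι›
  have hR1 : 0 < R - 1 := by linarith
  set S : ℝ → ℝ := fun ξ => Real.smoothTransition ((ξ - 1) / (R - 1)) with hSdef
  have hS : ContDiff ℝ (⊤ : ℕ∞) S :=
    Real.smoothTransition.contDiff.comp ((contDiff_id.sub contDiff_const).div_const _)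
  have hS0 : ∀ ξ, ξ ≤ 1 → S ξ = 0 := fun ξ h =>
    Real.smoothTransition.zero_of_nonpos (div_nonpos_of_nonpos_of_nonneg (by linarith) hR1.le)
  have hS1 : ∀ ξ, R ≤ ξ → S ξ = 1 := fun ξ h =>
    Real.smoothTransition.one_of_one_le ((one_le_div hR1).2 (by linarith))
  have hSb : ∀ ξ, |S ξ| ≤ 1 := fun ξ => by
    rw [abs_of_nonneg (Real.smoothTransition.nonneg _)]
    exact Real.smoothTransition.le_one _
  set s₁ := Real.sign (d i₀ R) with hs₁
  set s₂ := Real.sign (d i₀ (-R)) with hs₂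
  have hpos : ∀ i ξ, R ≤ ξ → Real.sign (d i ξ) = s₁ := fun i ξ h => by
    rw [hs i i₀ ξ (h.trans (le_abs_self ξ))]
    exact sign_eq_of_isPreconnected (hd i₀) (s := Set.Ici R) isPreconnected_Ici
      (fun x hx => h0 i₀ x (le_trans hx (le_abs_self x))) h Set.self_mem_Ici
  have hneg : ∀ i ξ, ξ ≤ -R → Real.sign (d i ξ) = s₂ := fun i ξ h => by
    rw [hs i i₀ ξ (by rw [le_abs]; right; linarith)]
    exact sign_eq_of_isPreconnected (hd i₀) (s := Set.Iic (-R)) isPreconnected_Iic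
      (fun x hx => h0 i₀ x (by rw [le_abs]; right; linarith [Set.mem_Iic.1 hx])) h
      Set.self_mem_Iic
  set ω : ℝ → ℝ := fun ξ => s₁ * S ξ + s₂ * S (-ξ) with hω
  have hω₁ : ∀ ξ, R ≤ ξ → ω ξ = s₁ := fun ξ h => by
    simp [hω, hS1 ξ h, hS0 (-ξ) (by linarith)]
  have hω₂ : ∀ ξ, ξ ≤ -R → ω ξ = s₂ := fun ξ h => by
    simp [hω, hS1 (-ξ) (by linarith), hS0 ξ (by linarith)]
  have hsgn : ∀ i ξ, R ≤ |ξ| → ω ξ = Real.sign (d i ξ) := fun i ξ h => by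
    rcases le_abs.1 h with h | h
    · rw [hω₁ ξ h, hpos i ξ h]
    · rw [hω₂ ξ (by linarith), hneg i ξ (by linarith)]
  refine ⟨ω, (contDiff_const.mul hS).add (contDiff_const.mul (hS.comp contDiff_neg)), ?_, ?_,
    hsgn, ?_, ?_⟩
  · intro ξ
    rcases le_total ξ 1 with h | h
    · have e : ω ξ = s₂ * S (-ξ) := by simp [hω, hS0 ξ h]
      rw [e, abs_mul]
      exact mul_le_one₀ (abs_real_sign_le _) (abs_nonneg _) (hSb _)
    · have e : ω ξ = s₁ * S ξ := by simp [hω, hS0 (-ξ) (by linarith)]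
      rw [e, abs_mul]
      exact mul_le_one₀ (abs_real_sign_le _) (abs_nonneg _) (hSb _)
  · intro ξ h
    obtain ⟨h₁, h₂⟩ := abs_le.1 h
    simp [hω, hS0 ξ h₂, hS0 (-ξ) (by linarith)]
  · intro y hy
    rcases lt_abs.1 hy with h | h
    · have e : ω =ᶠ[nhds y] fun _ => s₁ := by
        filter_upwards [lt_mem_nhds h] with z hz using hω₁ z hz.le
      rw [e.deriv_eq, deriv_const]
    · have e : ω =ᶠ[nhds y] fun _ => s₂ := by
        filter_upwards [gt_mem_nhds (show y < -R by linarith)] with z hz using hω₂ z hz.le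
      rw [e.deriv_eq, deriv_const]
  · intro i h ξ hh hξ
    have hh0 : 0 < h := by linarith
    have hRh : R ≤ h * R := le_mul_of_one_le_left (by linarith) hh
    have key : ω (ξ / h) = Real.sign (d i ξ) := by
      rcases le_abs.1 hξ with h' | h'
      · rw [hω₁ _ ((le_div_iff₀ hh0).2 (by linarith)), hpos i ξ (by linarith)]
      · rw [hω₂ _ ((div_le_iff₀ hh0).2 (by linarith)), hneg i ξ (by linarith)]
    rw [key]
    rcases lt_trichotomy (d i ξ) 0 with h' | h' | h'
    · rw [Real.sign_of_neg h', abs_of_neg h']; ring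
    · simp [h']
    · rw [Real.sign_of_pos h', abs_of_pos h']; ring

lemma exists_plateau : ∃ ψ : ℝ → ℝ, ContDiff ℝ (⊤ : ℕ∞) ψ ∧ HasCompactSupport ψ ∧
    (∀ y, 0 ≤ ψ y ∧ ψ y ≤ 1) ∧ (∀ y, |y| ≤ 1 / 2 → ψ y = 1) ∧ ∀ y, 1 ≤ |y| → ψ y = 0 := by
  let f : ContDiffBump (0 : ℝ) := ⟨1 / 2, 1, by norm_num, by norm_num⟩
  refine ⟨f, f.contDiff, f.hasCompactSupport, fun y => ⟨f.nonneg, f.le_one⟩, fun y hy => ?_,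
    fun y hy => ?_⟩
  · exact f.one_of_mem_closedBall (by simpa [f] using hy)
  · exact f.zero_of_le_dist (by simpa [f] using hy)

/-- The lower bound `c ⟨ξ⟩^P ≤ ω(ξ/h) d(ξ) + C`, with `c` independent of `h`. -/
lemma exists_lower_bound {P : ℕ} {d : ι → ℝ → ℝ} {R Cp A : ℝ} (hR : 1 < R) (hCp : 0 < Cp)
    (hA : 0 ≤ A) (hd : ∀ i ξ, |d i ξ| ≤ A * jb ξ ^ (P : ℝ))
    (hlow : ∀ i ξ, R ≤ |ξ| → Cp * |ξ| ^ P ≤ |d i ξ|) {ω : ℝ → ℝ} (hω : ∀ ξ, |ω ξ| ≤ 1)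
    (hωd : ∀ i h ξ, 1 ≤ h → h * R ≤ |ξ| → ω (ξ / h) * d i ξ = |d i ξ|) {h : ℝ} (hh : 1 ≤ h) :
    ∃ C, 0 ≤ C ∧ ∀ i ξ, Cp * (1 / 2) ^ P * jb ξ ^ (P : ℝ) ≤ ω (ξ / h) * d i ξ + C := by
  set c := Cp * (1 / 2 : ℝ) ^ P with hc
  have hc0 : 0 ≤ c := by positivity
  refine ⟨(A + c) * jb (h * R) ^ (P : ℝ),
    mul_nonneg (by linarith) (jb_rpow_pos _ _).le, fun i ξ => ?_⟩
  have hC := jb_rpow_pos (h * R) P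
  rcases le_or_gt (h * R) |ξ| with h' | h'
  · rw [hωd i h ξ hh h']
    have hRh : R ≤ h * R := le_mul_of_one_le_left (by linarith) hh
    have h₁ := hlow i ξ (hRh.trans h')
    have h₂ : jb ξ ≤ 2 * |ξ| := by
      have := jb_le ξ
      linarith
    have h₃ : jb ξ ^ (P : ℝ) ≤ (2 * |ξ|) ^ P := by
      rw [Real.rpow_natCast]
      exact pow_le_pow_left₀ (jb_pos ξ).le h₂ P
    have h₄ : c * (2 * |ξ|) ^ P = Cp * |ξ| ^ P := by
      rw [hc, mul_assoc, ← mul_pow]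
      congr 2
      ring
    have h₅ := mul_le_mul_of_nonneg_left h₃ hc0
    have h₆ : 0 ≤ (A + c) * jb (h * R) ^ (P : ℝ) := by positivity
    linarith
  · have h₁ : jb ξ ^ (P : ℝ) ≤ jb (h * R) ^ (P : ℝ) := by
      refine Real.rpow_le_rpow (jb_pos ξ).le (Real.sqrt_le_sqrt ?_) (by positivity)
      have := sq_le_sq' (by linarith [abs_nonneg ξ]) h'.le
      rw [sq_abs] at this
      linarith
    have h₂ : |ω (ξ / h) * d i ξ| ≤ A * jb (h * R) ^ (P : ℝ) := by
      rw [abs_mul]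
      calc _ ≤ 1 * |d i ξ| := by gcongr; exact hω _
        _ ≤ A * jb ξ ^ (P : ℝ) := by rw [one_mul]; exact hd i ξ
        _ ≤ _ := by gcongr
    have h₃ := mul_le_mul_of_nonneg_left h₁ hc0
    linarith [neg_abs_le (ω (ξ / h) * d i ξ)]

lemma LowSG.sum_range {τ : ℝ} {P : ℕ} {c : ℕ → ι → ℝ → ℝ → ℂ} {m : ℕ} (hm : m < P + 1)
    (h : ∀ j < P, SG 1 j (-(j * τ)) (c j)) (hP : 0 < P) :
    LowSG τ P (fun i x ξ => ∑ j ∈ Finset.range m, c j i x ξ) := by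
  induction m with
  | zero =>
    refine .of_sg 0 hP ?_
    simpa using SG.const (ι := ι) (γ := 1) 0
  | succ m ih =>
    simp only [Finset.sum_range_succ]
    exact (ih (by omega)).add (.of_sg m (by omega) (h m (by omega)))

lemma opS_sum {κ : Type} [DecidableEq κ] {γ m₁ m₂ : ℝ} (hγ : 0 ≤ γ) (s : Finset κ)
    {c : κ → ι → ℝ → ℝ → ℂ} (h : ∀ j ∈ s, SG γ m₁ m₂ (c j)) (i : ι) :
    opS (fun x ξ => ∑ j ∈ s, c j i x ξ) = ∑ j ∈ s, opS (c j i) := by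
  induction s using Finset.induction_on with
  | empty =>
    have e := (SG.const (ι := ι) (γ := γ) 1).opS_const_mul hγ 0 i
    simpa using e
  | insert j s hj ih =>
    simp only [Finset.sum_insert hj]
    have hs : ∀ j ∈ s, SG γ m₁ m₂ (c j) := fun k hk => h k (Finset.mem_insert_of_mem hk)
    rw [(h j (Finset.mem_insert_self j s)).opS_add hγ (SG.sum s hs) i, ih hs]

/-- Inverses of `e^{λ_{p-k}}(x,D)` for a common value of `h`. -/
lemma exists_inverse_lamSym {p : ℕ} {Mc : ℕ → ℝ} {ω ψ : ℝ → ℝ} {ρ : ℝ}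
    (hω : ContDiff ℝ (⊤ : ℕ∞) ω) (hω1 : ∀ ξ, |ω ξ| ≤ 1) (hω0 : ∀ ξ, |ξ| ≤ 1 → ω ξ = 0)
    (hωd : ∀ y, ρ < |y| → deriv ω y = 0) (hψ : CutOff 1 ψ) :
    ∃ h : ℝ, 1 ≤ h ∧ ∃ (E : ℕ → (SchwartzMap ℝ ℂ ≃ₗ[ℂ] SchwartzMap ℝ ℂ))
      (g : ℕ → ℝ → ℝ → ℂ), ∀ k, 1 ≤ k → k ≤ p - 1 →
      (∀ u, E k u = opS (fun x ξ => Complex.exp (lamSym p Mc ω ψ h k x ξ : ℂ)) u) ∧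
      (∀ u, (E k).symm u = opS (g k) u) ∧
      ExpSG (fun (_ : Unit) x ξ => -(lamSym p Mc ω ψ h k x ξ : ℂ)) (-1) (-1)
        (fun _ x ξ => g k x ξ - Complex.exp (-(lamSym p Mc ω ψ h k x ξ : ℂ))) := by
  have key : ∀ k, ∃ C : ℝ, 1 ≤ k → k ≤ p - 1 → ∀ h : ℝ, 1 ≤ h → C ≤ h →
      ∃ (E : SchwartzMap ℝ ℂ ≃ₗ[ℂ] SchwartzMap ℝ ℂ) (g : ℝ → ℝ → ℂ),
      (∀ u, E u = opS (fun x ξ => Complex.exp (lamSym p Mc ω ψ h k x ξ : ℂ)) u) ∧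
      (∀ u, E.symm u = opS g u) ∧
      ExpSG (fun (_ : Unit) x ξ => -(lamSym p Mc ω ψ h k x ξ : ℂ)) (-1) (-1)
        (fun _ x ξ => g x ξ - Complex.exp (-(lamSym p Mc ω ψ h k x ξ : ℂ))) := by
    intro k
    by_cases hk : 1 ≤ k ∧ k ≤ p - 1
    · have hH : ∀ h : {h : ℝ // 1 ≤ h}, 1 ≤ (h : ℝ) := fun h => h.2
      have hφ := phase_lamSym (Mc := Mc) hω hω1 hωd hψ hH hk.1 hk.2
      obtain ⟨C, hC⟩ := hφ.exists_inverse hH (fun h x ξ hξ => by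
        have hz : ω (ξ / h) = 0 := hω0 _ (by
          rw [abs_div, abs_of_pos (zero_lt_one.trans_le h.2),
            div_le_one (zero_lt_one.trans_le h.2)]
          exact hξ.le)
        simp [lamSym, hz])
      exact ⟨C, fun _ _ h hh hCh => hC ⟨h, hh⟩ hCh⟩
    · exact ⟨0, fun h₁ h₂ => absurd ⟨h₁, h₂⟩ hk⟩
  choose C hC using key
  set h : ℝ := 1 + ∑ k ∈ Finset.range p, |C k| with hh
  have h1 : 1 ≤ h := by
    rw [hh, le_add_iff_nonneg_right]
    exact Finset.sum_nonneg fun k _ => abs_nonneg _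
  have hle : ∀ k, 1 ≤ k → k ≤ p - 1 → C k ≤ h := fun k hk hkp => by
    have := Finset.single_le_sum (f := fun k => |C k|) (fun k _ => abs_nonneg _)
      (Finset.mem_range.2 (show k < p by omega))
    linarith [le_abs_self (C k)]
  refine ⟨h, h1, ?_⟩
  have sel : ∀ k, ∃ Eg : (SchwartzMap ℝ ℂ ≃ₗ[ℂ] SchwartzMap ℝ ℂ) × (ℝ → ℝ → ℂ),
      1 ≤ k → k ≤ p - 1 →
      (∀ u, Eg.1 u = opS (fun x ξ => Complex.exp (lamSym p Mc ω ψ h k x ξ : ℂ)) u) ∧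
      (∀ u, Eg.1.symm u = opS Eg.2 u) ∧
      ExpSG (fun (_ : Unit) x ξ => -(lamSym p Mc ω ψ h k x ξ : ℂ)) (-1) (-1)
        (fun _ x ξ => Eg.2 x ξ - Complex.exp (-(lamSym p Mc ω ψ h k x ξ : ℂ))) := fun k => by
    by_cases hk : 1 ≤ k ∧ k ≤ p - 1
    · obtain ⟨E, g, h⟩ := hC k hk.1 hk.2 h h1 (hle k hk.1 hk.2)
      exact ⟨(E, g), fun _ _ => h⟩
    · exact ⟨(LinearEquiv.refl ℂ _, 0), fun h₁ h₂ => absurd ⟨h₁, h₂⟩ hk⟩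
  choose Eg hEg using sel
  exact ⟨fun k => (Eg k).1, fun k => (Eg k).2, hEg⟩

/-- Conjugation by the operators `e^{λ_{p-k}}(x,D)` makes the lower order terms semibounded. -/
theorem exists_conj_semibounded {n : ℕ} {a : ι → ℝ → ℝ}
    (ha : SG 1 (n + 2) 0 (fun i (_ ξ : ℝ) => ((a i ξ : ℝ) : ℂ)))
    (hda : ∀ i, Differentiable ℝ (a i)) {c₀ : ℝ} (hc₀ : 0 < c₀) {ω ψ : ℝ → ℝ} {ρ : ℝ}
    (hω : ContDiff ℝ (⊤ : ℕ∞) ω) (hω1 : ∀ ξ, |ω ξ| ≤ 1) (hω0 : ∀ ξ, |ξ| ≤ 1 → ω ξ = 0)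
    (hωd : ∀ y, ρ < |y| → deriv ω y = 0) (hψ : CutOff 1 ψ)
    (hlow : ∀ h : ℝ, 1 ≤ h → ∃ C, 0 ≤ C ∧ ∀ i ξ,
      c₀ * jb ξ ^ ((n + 1 : ℕ) : ℝ) ≤ ω (ξ / h) * deriv (a i) ξ + C)
    {c f : ι → ℝ → ℝ → ℂ} (hc : SG 1 ((n + 1 : ℕ) : ℝ) (-1) c)
    (hf : LowSG (1 / ((n + 1 : ℕ) : ℝ)) (n + 1) f) :
    ∃ h : ℝ, 1 ≤ h ∧ ∃ Mc : ℕ → ℝ, (∀ k, 0 < Mc k) ∧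
    ∃ E : ℕ → (SchwartzMap ℝ ℂ ≃ₗ[ℂ] SchwartzMap ℝ ℂ),
      (∀ k, 1 ≤ k → k ≤ n + 1 → ∀ u x, E k u x = psdo1
        (fun x ξ => ((Real.exp (lamSym (n + 2) Mc ω ψ h k x ξ) : ℝ) : ℂ)) (fun y => u y) x) ∧
      ∃ q : ι → ℝ → ℝ → ℂ, SG 1 (n + 1) 0 q ∧
        (∃ L, ∀ i u, -L * ‖toL2 u‖ ^ 2 ≤ (inner ℂ (toL2 u) (toL2 (opS (q i) u))).re) ∧
        ∀ i u, compBwd (fun k => ⇑(E k).symm) (n + 1)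
          (opS (fun x ξ => Complex.I * ((a i ξ : ℝ) : ℂ) + (c i x ξ + f i x ξ))
            (compFwd (fun k => ⇑(E k)) (n + 1) u)) =
          opS (fun x ξ => Complex.I * ((a i ξ : ℝ) : ℂ) + q i x ξ) u := by
  have hP : (0 : ℝ) < ((n + 1 : ℕ) : ℝ) := by positivity
  obtain ⟨K, hK0, hK⟩ := (hc.le (m₁' := ((n + 1 : ℕ) : ℝ) / 2 + ((n + 1 : ℕ) : ℝ) / 2)
    (m₂' := -((((n + 1 : ℕ) : ℝ) / 2 + ((n + 1 : ℕ) : ℝ) / 2) * (1 / ((n + 1 : ℕ) : ℝ))))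
    (by rw [add_halves]) (by rw [add_halves, mul_one_div_cancel hP.ne'])).exists_inner_opS_le
  set M : ℝ := (K + 1) / c₀ with hM
  have hM0 : 0 < M := by positivity
  set Mc : ℕ → ℝ := fun _ => M
  obtain ⟨h, hh, E, g, hEg⟩ :=
    exists_inverse_lamSym (p := n + 2) (Mc := Mc) hω hω1 hω0 hωd hψ
  have hφ : ∀ k, 1 ≤ k → k ≤ n + 1 →
      Phase (fun (_ : Unit) x ξ => (lamSym (n + 2) Mc ω ψ h k x ξ : ℂ)) := fun k hk hkn =>
    phase_lamSym (p := n + 2) (H := fun _ : Unit => h) hω hω1 hωd hψ (fun _ => hh) hk hkn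
  refine ⟨h, hh, Mc, fun _ => hM0, E, fun k hk hkn u x => ?_, ?_⟩
  · obtain ⟨m, hm⟩ := (ExpSG.exp (φ := fun (_ : Unit) x ξ =>
      (lamSym (n + 2) Mc ω ψ h k x ξ : ℂ))).exists_sg (hφ k hk hkn)
    rw [(hEg k hk hkn).1 u]
    simp only [Complex.ofReal_exp]
    exact hm.opS_apply zero_le_one () u x
  have hxi : ∀ i x ξ, dXi (fun (_ ξ : ℝ) => Complex.I * ((a i ξ : ℝ) : ℂ)) x ξ =
      Complex.I * ((deriv (a i) ξ : ℝ) : ℂ) := fun i x ξ =>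
    ((hda i ξ).hasDerivAt.ofReal_comp.const_mul Complex.I).deriv
  have hda' : SG 1 (n + 1) 0 (fun i (_ ξ : ℝ) => ((deriv (a i) ξ : ℝ) : ℂ)) := by
    refine (ha.dXi.le (by linarith) le_rfl).congr fun i x ξ => ?_
    exact (hda i ξ).hasDerivAt.ofReal_comp.deriv.symm
  have hb : SG 1 ((n + 1 : ℕ) : ℝ) 0
      (fun i (_ ξ : ℝ) => ((ω (ξ / h) * deriv (a i) ξ : ℝ) : ℂ)) := by
    refine (((SG.scaled (H := fun _ : ι => h) (fun _ => hh) hω ⟨1, hω1⟩ hωd).mul hda').le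
      (by push_cast; linarith) (by norm_num)).congr fun i x ξ => ?_
    push_cast; ring
  have hone : ∀ i x ξ, Complex.I * (dXi (fun (_ ξ : ℝ) => Complex.I * ((a i ξ : ℝ) : ℂ)) x ξ *
      dX (fun x ξ => (lamSym (n + 2) Mc ω ψ h 1 x ξ : ℂ)) x ξ) =
      -((M * (ω (ξ / h) * deriv (a i) ξ * jb x ^ (-1 : ℝ)) : ℝ) : ℂ) := fun i x ξ => by
    rw [hxi, dX_lamSym_one]
    push_cast
    linear_combination ((M : ℂ) * ω (ξ / h) * ((jb x ^ (-1 : ℝ) : ℝ) : ℂ) *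
      ((deriv (a i) ξ : ℝ) : ℂ)) * Complex.I_mul_I
  have hjx : SG 1 (n + 1) 0 (fun i (x ξ : ℝ) =>
      ((M * (ω (ξ / h) * deriv (a i) ξ * jb x ^ (-1 : ℝ)) : ℝ) : ℂ)) := by
    refine (((hb.mul (SG.jb_x (-1))).const_mul (M : ℂ)).le (by push_cast; linarith)
      (by norm_num)).congr fun i x ξ => ?_
    push_cast; ring
  have hr : SG 1 (n + 1) 0 (fun i x ξ => c i x ξ + f i x ξ) :=
    (hc.le (by push_cast; linarith) (by norm_num)).add
      ((hf.sg (by positivity)).le (by push_cast; linarith) le_rfl)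
  obtain ⟨f', hf', hconj⟩ := exists_conj_comp
    (φ := fun k x ξ => (lamSym (n + 2) Mc ω ψ h k x ξ : ℂ)) (g := g) hφ
    (fun k hk hkn => (hEg k hk hkn).1) (fun k hk hkn => (hEg k hk hkn).2.1)
    (fun k hk hkn => (hEg k hk hkn).2.2) (fun k hk hkn => by
      refine (sg_dX_lamSym (p := n + 2) (Mc := Mc) hω hω1 hωd hψ hh hk hkn).le le_rfl
        (le_of_eq ?_)
      push_cast
      rw [mul_one_div]
      congr 2
      ring)
    (ha.const_mul Complex.I) (fun _ _ _ => rfl) hr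
    (hjx.neg.congr fun i x ξ => hone i x ξ) n le_rfl
  obtain ⟨C, hC0, hC⟩ := hlow h hh
  obtain ⟨L, -, hL⟩ := exists_re_inner_ge (P := n + 1) (by omega) hb hC0 hM0.le hC
    (K := K) (by rw [hM, div_mul_cancel₀ _ hc₀.ne']) hc (hf.add hf')
    (fun i u => by rw [pow_two]; exact hK i u)
  have hq : SG 1 (n + 1) 0 (fun i (x ξ : ℝ) =>
      ((M * (ω (ξ / h) * deriv (a i) ξ * jb x ^ (-1 : ℝ)) : ℝ) : ℂ) + c i x ξ +
        (f i x ξ + f' i x ξ)) :=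
    (hjx.add (hc.le (by push_cast; linarith) (by norm_num))).add
      (((hf.add hf').sg (by positivity)).le (by push_cast; linarith) le_rfl)
  refine ⟨_, hq, ⟨L, hL⟩, fun i u => ?_⟩
  rw [hconj]
  congr 2
  funext x ξ
  rw [hone]
  ring

/-- reduction of a `p`-evolution operator to a form with nonnegative
lower order terms, via conjugation with the invertible operators `e^{λ_{p-k}}(x,D)`. -/
theorem stmt19 (p : ℕ) (hp : 2 ≤ p) (T : ℝ) (hT : 0 < T)
    (ap : ℝ → ℝ → ℝ) (aj : ℕ → ℝ → ℝ → ℝ → ℂ)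
    (hap_cont : ContinuousOn (fun q : ℝ × ℝ => ap q.1 q.2)
      (Set.Icc 0 T ×ˢ (Set.univ : Set ℝ)))
    (hap_smooth : ∀ t ∈ Set.Icc (0:ℝ) T, ContDiff ℝ (⊤ : ℕ∞) (ap t))
    (hap_bd : ∀ α : ℕ, ∃ C > 0, ∀ t ∈ Set.Icc (0:ℝ) T, ∀ ξ : ℝ,
      |iteratedDeriv α (ap t) ξ| ≤ C * jb ξ ^ ((p:ℝ) - α))
    (Cp R : ℝ) (hCp : 0 < Cp) (hR : 1 < R)
    (hap_low : ∀ t ∈ Set.Icc (0:ℝ) T, ∀ ξ : ℝ, R ≤ |ξ| →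
      Cp * |ξ| ^ (p - 1) ≤ |deriv (ap t) ξ|)
    (hap_sign : ∀ t ∈ Set.Icc (0:ℝ) T, ∀ t' ∈ Set.Icc (0:ℝ) T, ∀ ξ : ℝ, R ≤ |ξ| →
      Real.sign (deriv (ap t) ξ) = Real.sign (deriv (ap t') ξ))
    (haj_cont : ∀ j < p, ContinuousOn (fun q : ℝ × ℝ × ℝ => aj j q.1 q.2.1 q.2.2)
      (Set.Icc 0 T ×ˢ (Set.univ : Set (ℝ × ℝ))))
    (haj_smooth : ∀ j < p, ∀ t ∈ Set.Icc (0:ℝ) T,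
      ContDiff ℝ (⊤ : ℕ∞) (fun q : ℝ × ℝ => aj j t q.1 q.2))
    (haj_bd : ∀ j < p, ∀ α β : ℕ, ∃ C > 0, ∀ t ∈ Set.Icc (0:ℝ) T, ∀ x ξ : ℝ,
      ‖iteratedDeriv α (fun ξ' => iteratedDeriv β (fun x' => aj j t x' ξ') x) ξ‖ ≤
        C * jb ξ ^ ((j:ℝ) - α) * jb x ^ (-(j:ℝ) / ((p:ℝ) - 1) - β)) :
    ∃ h : ℝ, 1 ≤ h ∧
    ∃ Mc : ℕ → ℝ, (∀ k : ℕ, 1 ≤ k → k ≤ p - 1 → 0 < Mc k) ∧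
    ∃ ω ψ : ℝ → ℝ,
      ContDiff ℝ (⊤ : ℕ∞) ω ∧ (∀ ξ : ℝ, |ω ξ| ≤ 1) ∧
      (∀ ξ : ℝ, |ξ| ≤ 1 → ω ξ = 0) ∧
      (∀ t ∈ Set.Icc (0:ℝ) T, ∀ ξ : ℝ, R ≤ |ξ| →
        ω ξ = Real.sign (deriv (ap t) ξ)) ∧
      ContDiff ℝ (⊤ : ℕ∞) ψ ∧ HasCompactSupport ψ ∧
      (∀ y : ℝ, 0 ≤ ψ y ∧ ψ y ≤ 1) ∧
      (∀ y : ℝ, |y| ≤ 1 / 2 → ψ y = 1) ∧ (∀ y : ℝ, 1 ≤ |y| → ψ y = 0) ∧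
    ∃ E : ℕ → (SchwartzMap ℝ ℂ ≃ₗ[ℂ] SchwartzMap ℝ ℂ),
      (∀ k : ℕ, 1 ≤ k → k ≤ p - 1 → ∀ u : SchwartzMap ℝ ℂ, ∀ x : ℝ,
        E k u x = psdo1
          (fun x' ξ' => ((Real.exp (lamSym p Mc ω ψ h k x' ξ') : ℝ) : ℂ))
          (fun y => u y) x) ∧
    ∃ Aop : ℝ → (SchwartzMap ℝ ℂ →ₗ[ℂ] SchwartzMap ℝ ℂ),
      (∀ t ∈ Set.Icc (0:ℝ) T, ∀ v : SchwartzMap ℝ ℂ, ∀ x : ℝ,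
        Aop t v x = Complex.I * psdo1 (fun _ ξ => ((ap t ξ : ℝ) : ℂ)) (fun y => v y) x +
          ∑ j ∈ Finset.range p, Complex.I * psdo1 (aj j t) (fun y => v y) x) ∧
    ∃ Q : ℕ → ℝ → ℝ → ℝ → ℂ, ∃ r₀ : ℝ → ℝ → ℝ → ℂ,
      (∀ ℓ : ℕ, 1 ≤ ℓ → ℓ ≤ p - 1 →
        (∀ t ∈ Set.Icc (0:ℝ) T,
          ContDiff ℝ (⊤ : ℕ∞) (fun q : ℝ × ℝ => Q ℓ t q.1 q.2)) ∧
        (∀ α β : ℕ, ∃ C > 0, ∀ t ∈ Set.Icc (0:ℝ) T, ∀ x ξ : ℝ,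
          ‖iteratedDeriv α (fun ξ' => iteratedDeriv β (fun x' => Q ℓ t x' ξ') x) ξ‖ ≤
            C * jb ξ ^ (((p:ℝ) - ℓ) - α) * jb x ^ (-(β:ℝ))) ∧
        (∀ t ∈ Set.Icc (0:ℝ) T, ∀ v : SchwartzMap ℝ ℂ,
          0 ≤ (∫ x : ℝ, psdo1 (Q ℓ t) (fun y => v y) x * (starRingEnd ℂ) (v x)).re)) ∧
      (∀ t ∈ Set.Icc (0:ℝ) T,
        ContDiff ℝ (⊤ : ℕ∞) (fun q : ℝ × ℝ => r₀ t q.1 q.2)) ∧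
      (∀ α β : ℕ, ∃ C > 0, ∀ t ∈ Set.Icc (0:ℝ) T, ∀ x ξ : ℝ,
        ‖iteratedDeriv α (fun ξ' => iteratedDeriv β (fun x' => r₀ t x' ξ') x) ξ‖ ≤
          C * jb ξ ^ (-(α:ℝ))) ∧
      (∀ t ∈ Set.Icc (0:ℝ) T, ∀ v : SchwartzMap ℝ ℂ, ∀ x : ℝ,
        compBwd (fun k => ⇑(E k).symm) (p - 1)
            (Aop t (compFwd (fun k => ⇑(E k)) (p - 1) v)) x =
          Complex.I * psdo1 (fun _ ξ => ((ap t ξ : ℝ) : ℂ)) (fun y => v y) x +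
            (∑ ℓ ∈ Finset.Icc 1 (p - 1), psdo1 (Q ℓ t) (fun y => v y) x) +
            psdo1 (r₀ t) (fun y => v y) x) := by
  obtain ⟨n, rfl⟩ : ∃ n, p = n + 2 := ⟨p - 2, by omega⟩
  have hn1 : ((n + 2 : ℕ) : ℝ) - 1 = ((n + 1 : ℕ) : ℝ) := by push_cast; ring
  let ι : Type := Set.Icc (0 : ℝ) T
  let t₀ : ι := ⟨0, le_rfl, hT.le⟩
  have : Nonempty ι := ⟨t₀⟩
  have hsm : ∀ t : ι, ContDiff ℝ (⊤ : ℕ∞) (ap t) := fun t => hap_smooth t t.2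
  have hda : ∀ t : ι, Differentiable ℝ (ap t) := fun t => (hsm t).differentiable (by simp)
  have ha : SG 1 ((n + 2 : ℕ) : ℝ) 0 (fun (t : ι) (_ ξ : ℝ) => ((ap t ξ : ℝ) : ℂ)) :=
    SG.of_xi hsm fun α => by
      obtain ⟨C, hC, h⟩ := hap_bd α
      exact ⟨C, hC, fun t ξ => h t t.2 ξ⟩
  have ha' : SG 1 (n + 2) 0 (fun (t : ι) (_ ξ : ℝ) => ((ap t ξ : ℝ) : ℂ)) := by
    exact_mod_cast ha
  have hj : ∀ j < n + 2, SG 1 j (-(j * (1 / ((n + 1 : ℕ) : ℝ)))) (fun t : ι => aj j t) :=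
    fun j hjn => SG.of_iteratedDeriv (fun t => haj_smooth j hjn t t.2) fun α β => by
      obtain ⟨C, hC, h⟩ := haj_bd j hjn α β
      refine ⟨C, hC, fun t x ξ => ?_⟩
      have e := h t t.2 x ξ
      rwa [hn1, neg_div, ← mul_one_div, ← mul_one (α : ℝ), ← mul_one (β : ℝ)] at e
  obtain ⟨A, hA, hA'⟩ : ∃ A > 0, ∀ (t : ι) ξ, |deriv (ap t) ξ| ≤ A * jb ξ ^ ((n + 1 : ℕ) : ℝ) := by
    obtain ⟨A, hA, h⟩ := hap_bd 1
    refine ⟨A, hA, fun t ξ => ?_⟩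
    have e := h t t.2 ξ
    rwa [iteratedDeriv_one, Nat.cast_one, hn1] at e
  have hlow : ∀ (t : ι) ξ, R ≤ |ξ| → Cp * |ξ| ^ (n + 1) ≤ |deriv (ap t) ξ| := fun t ξ h =>
    hap_low t t.2 ξ h
  obtain ⟨ω, hω, hω1, hω0, hωs, hωd, hωm⟩ := exists_sign_cutoff (d := fun t : ι => deriv (ap t))
    hR (fun t => (hsm t).continuous_deriv (by simp))
    (fun t ξ h h0 => by
      have h₁ := hlow t ξ h
      rw [h0, abs_zero] at h₁
      have : 0 < Cp * |ξ| ^ (n + 1) := by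
        have : 0 < |ξ| := by linarith
        positivity
      linarith)
    (fun t s ξ h => hap_sign t t.2 s s.2 ξ h)
  obtain ⟨ψ, hψ, hψc, hψ01, hψ1, hψ0⟩ := exists_plateau
  have hcI : SG 1 ((n + 1 : ℕ) : ℝ) (-1)
      (fun (t : ι) x ξ => Complex.I * aj (n + 1) t x ξ) :=
    ((hj (n + 1) (by omega)).const_mul Complex.I).le le_rfl
      (by rw [mul_one_div_cancel (by positivity)])
  have hfI := LowSG.sum_range (c := fun j (t : ι) x ξ => Complex.I * aj j t x ξ)
    (τ := 1 / ((n + 1 : ℕ) : ℝ)) (m := n + 1) (P := n + 1) (by omega)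
    (fun j hjn => (hj j (by omega)).const_mul Complex.I) (by omega)
  obtain ⟨h, hh, Mc, hMc, E, hE, q, hq, ⟨L, hL⟩, hconj⟩ := exists_conj_semibounded ha' hda
    (c₀ := Cp * (1 / 2) ^ (n + 1)) (by positivity) hω hω1 hω0 hωd
    (ψ := ψ) ⟨hψ, fun y hy => hψ0 y hy.le⟩
    (fun h hh => exists_lower_bound hR hCp hA.le hA' hlow hω1 hωm hh) hcI hfI
  refine ⟨h, hh, Mc, fun k _ _ => hMc k, ω, ψ, hω, hω1, hω0,
    fun t ht ξ hξ => hωs ⟨t, ht⟩ ξ hξ, hψ, hψc, hψ01, hψ1, hψ0, E, hE,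
    fun t => Complex.I • opS (fun _ ξ => ((ap t ξ : ℝ) : ℂ)) +
      ∑ j ∈ Finset.range (n + 2), Complex.I • opS (aj j t), ?_, ?_⟩
  · intro t ht v x
    rw [← ha.opS_apply zero_le_one ⟨t, ht⟩ v x]
    simp only [LinearMap.add_apply, LinearMap.smul_apply, LinearMap.sum_apply, add_apply,
      smul_apply, sum_apply, smul_eq_mul]
    congr 1
    refine Finset.sum_congr rfl fun j hjn => ?_
    rw [(hj j (Finset.mem_range.1 hjn)).opS_apply zero_le_one ⟨t, ht⟩ v x]
  have hL' : SG 1 0 0 (fun (_ : ι) (_ _ : ℝ) => (L : ℂ)) := SG.const _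
  have hL'' : SG 1 0 0 (fun (_ : ι) (_ _ : ℝ) => -(L : ℂ)) := SG.const _
  have hQ : SG 1 (n + 1) 0 (fun (t : ι) x ξ => q t x ξ + (L : ℂ)) :=
    hq.add (hL'.le (by positivity) le_rfl)
  have hopL : ∀ c : ℂ, opS (fun _ _ => c) = c • LinearMap.id := fun c => by
    have e := (SG.const (ι := ι) (γ := 1) 1).opS_const_mul zero_le_one c t₀
    simpa only [mul_one, opS_one] using e
  have hopQ : ∀ (t : ι) u, opS (fun x ξ => q t x ξ + (L : ℂ)) u = opS (q t) u + (L : ℂ) • u :=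
    fun t u => by
      rw [hq.opS_add zero_le_one hL' t, hopL]
      rfl
  set Q : ℕ → ℝ → ℝ → ℝ → ℂ := fun ℓ t x ξ =>
    if ht : ℓ = 1 ∧ t ∈ Set.Icc 0 T then q ⟨t, ht.2⟩ x ξ + (L : ℂ) else 0 with hQdef
  have hQ1 : ∀ t : ι, Q 1 t = fun x ξ => q t x ξ + (L : ℂ) := fun t => by
    funext x ξ
    exact dif_pos ⟨rfl, t.2⟩
  have hQ2 : ∀ ℓ t, ℓ ≠ 1 → Q ℓ t = fun _ _ => 0 := fun ℓ t hℓ => by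
    funext x ξ
    exact dif_neg fun h => hℓ h.1
  have hp0 : ∀ (v : SchwartzMap ℝ ℂ) x, psdo1 (fun _ _ => 0) (fun y => v y) x = 0 :=
    fun v x => by simp [psdo1]
  refine ⟨Q, fun _ _ _ => -(L : ℂ), ?_, fun _ _ => contDiff_const, ?_, ?_⟩
  · intro ℓ hℓ hℓn
    rcases eq_or_ne ℓ 1 with rfl | hne
    · refine ⟨fun t ht => ?_, fun α β => ?_, fun t ht v => ?_⟩
      · rw [hQ1 ⟨t, ht⟩]
        exact hQ.smooth ⟨t, ht⟩
      · obtain ⟨C, hC, hb⟩ := hQ.iteratedDeriv_bound α β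
        refine ⟨C, hC, fun t ht x ξ => ?_⟩
        rw [hQ1 ⟨t, ht⟩, Nat.cast_one, hn1]
        have e := hb ⟨t, ht⟩ x ξ
        rwa [mul_one, mul_one, zero_sub, ← Nat.cast_add_one] at e
      · rw [hQ1 ⟨t, ht⟩]
        have e : (∫ x : ℝ, psdo1 (fun x ξ => q ⟨t, ht⟩ x ξ + (L : ℂ)) (fun y => v y) x *
            (starRingEnd ℂ) (v x)) = inner ℂ (toL2 v) (toL2 (opS (q ⟨t, ht⟩) v)) +
              L * inner ℂ (toL2 v) (toL2 v) := by
          rw [← inner_smul_right, ← inner_add_right, ← map_smul, ← map_add, ← hopQ, inner_toL2]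
          refine integral_congr_ae (.of_forall fun x => ?_)
          beta_reduce
          rw [hQ.opS_apply zero_le_one ⟨t, ht⟩ v x, mul_comm]
        have e₂ : (inner ℂ (toL2 v) (toL2 v) : ℂ) = ((‖toL2 v‖ ^ 2 : ℝ) : ℂ) := by
          rw [inner_self_eq_norm_sq_to_K]
          norm_cast
        rw [e, e₂, ← Complex.ofReal_mul, Complex.add_re, Complex.ofReal_re]
        linarith [hL ⟨t, ht⟩ v]
    · refine ⟨fun t ht => ?_, fun α β => ⟨1, one_pos, fun t ht x ξ => ?_⟩, fun t ht v => ?_⟩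
      · rw [hQ2 ℓ t hne]
        exact contDiff_const
      · rw [hQ2 ℓ t hne]
        have h₁ := jb_rpow_pos ξ (((n + 2 : ℕ) : ℝ) - ℓ - α)
        have h₂ := jb_rpow_pos x (-(β : ℝ))
        simp only [iteratedDeriv_const, ite_self, norm_zero]
        positivity
      · rw [hQ2 ℓ t hne]
        simp [hp0]
  · intro α β
    obtain ⟨C, hC, hb⟩ := hL''.iteratedDeriv_bound α β
    refine ⟨C, hC, fun t ht x ξ => (hb ⟨t, ht⟩ x ξ).trans ?_⟩
    rw [mul_one, mul_one, zero_sub, zero_sub]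
    refine mul_le_of_le_one_right ?_ (jb_rpow_le_one x (by simp))
    have := jb_rpow_pos ξ (-(α : ℝ))
    positivity
  · intro t ht v x
    have hr : ∀ j ∈ Finset.range (n + 2), SG 1 (n + 1) 0
        (fun (t : ι) x ξ => Complex.I * aj j t x ξ) := fun j hjn => by
      have hjn := Finset.mem_range.1 hjn
      have hjr : (j : ℝ) ≤ n + 1 := by exact_mod_cast (show j ≤ n + 1 by omega)
      exact ((hj j hjn).const_mul Complex.I).le hjr (neg_nonpos.2 (by positivity))
    have hA : (Complex.I • opS (fun _ ξ => ((ap t ξ : ℝ) : ℂ)) +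
        ∑ j ∈ Finset.range (n + 2), Complex.I • opS (aj j t)) =
        opS (fun x ξ => Complex.I * ((ap t ξ : ℝ) : ℂ) + (Complex.I * aj (n + 1) t x ξ +
          ∑ j ∈ Finset.range (n + 1), Complex.I * aj j t x ξ)) := by
      have e := (ha.const_mul Complex.I).opS_add zero_le_one
        (SG.sum (Finset.range (n + 2)) hr) ⟨t, ht⟩
      rw [ha.opS_const_mul zero_le_one Complex.I ⟨t, ht⟩,
        opS_sum zero_le_one (Finset.range (n + 2)) hr ⟨t, ht⟩] at e
      rw [Finset.sum_congr rfl fun j hjn => ((hj j (Finset.mem_range.1 hjn)).opS_const_mul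
        zero_le_one Complex.I ⟨t, ht⟩).symm]
      refine e.symm.trans (congrArg opS ?_)
      funext x ξ
      rw [Finset.sum_range_succ, add_comm (Complex.I * aj (n + 1) t x ξ)]
    beta_reduce
    rw [hA, show n + 2 - 1 = n + 1 from rfl, hconj ⟨t, ht⟩ v,
      (ha.const_mul Complex.I).opS_add zero_le_one hq ⟨t, ht⟩,
      ha.opS_const_mul zero_le_one Complex.I ⟨t, ht⟩,
      Finset.sum_eq_single_of_mem 1 (Finset.mem_Icc.2 ⟨le_rfl, by omega⟩)
        (fun ℓ _ hne => by rw [hQ2 ℓ t hne]; exact hp0 v x), hQ1 ⟨t, ht⟩,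
      ← hQ.opS_apply zero_le_one ⟨t, ht⟩ v x, hopQ ⟨t, ht⟩,
      ← hL''.opS_apply zero_le_one ⟨t, ht⟩ v x, hopL,
      ← ha.opS_apply zero_le_one ⟨t, ht⟩ v x]
    simp only [LinearMap.add_apply, LinearMap.smul_apply, LinearMap.id_apply, add_apply,
      smul_apply, smul_eq_mul]
    ring
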